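/- Let K be an infinite field, Q a strongly connected quiver, Inv(Q) = Inv(Q,(2,…,2)), and write p ≡ q when p and q are equal in Inv(Q)/((Inv(Q)⁺)²), using the notation tr(a_1⋯a_s) = σ_1(X_{a_s}⋯X_{a_1}), det(a_1⋯a_s) = σ_2(X_{a_s}⋯X_{a_1}), σ_k(a_1⋯a_s) = σ_k(X_{a_s}⋯X_{a_1}) for closed paths a_1⋯a_s. Then the ideal of relations for Inv(Q)/((Inv(Q)⁺)²), i.e. the kernel L(Q) of the natural surjection from A(Q)/((A(Q)⁺)²) onto Inv(Q)/((Inv(Q)⁺)²) where A(Q) is the free commutative K-algebra on symbols σ_k(h) (k ≥ 1, h a closed path in Q), equals the K-span of the following relations: (a) tr(a_1a_2) ≡ tr(a_2a_1) and det(a_1a_2) ≡ det(a_2a_1) for paths a_1, a_2 with a_1a_2 closed; (b) tr(a²) ≡ −2 det(a); (c) tr(a²b) ≡ 0; (d) tr(bac) ≡ −tr(abc) and tr(acb) ≡ −tr(abc); (e) det(ab) ≡ 0; (f) σ_k(a) ≡ 0 for k > 2; where a, b, c are incident closed paths in Q. -/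

import Mathlib

open Classical BigOperators

/-- A quiver (finite oriented graph data): a type of vertices, a type of arrows,
and source (tail `a''`) and target (head `a'`) maps. -/
structure QuiverData where
  V : Type
  A : Type
  src : A → V
  tgt : A → V

namespace QuiverData

variable (Q : QuiverData)

/-- `Q.IsPathFrom u v l` : the list of arrows `l` is a (possibly empty) path
from `u` to `v`, i.e. `l = [a₁, …, a_s]` with `a₁'' = u`, `aᵢ' = a_{i+1}''`, `a_s' = v`. -/
def IsPathFrom : Q.V → Q.V → List Q.A → Prop
  | u, v, [] => u = v
  | u, v, a :: l => Q.src a = u ∧ IsPathFrom (Q.tgt a) v l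

/-- A (non-empty) closed path in the vertex `v`. -/
def IsClosedAt (v : Q.V) (l : List Q.A) : Prop :=
  l ≠ [] ∧ Q.IsPathFrom v v l

/-- A (non-empty) closed path. -/
def IsClosed (l : List Q.A) : Prop := ∃ v, Q.IsClosedAt v l

/-- `deg_w(l)`: the degree of the closed path `l` in the vertex `w`,
i.e. the number of `i` with `aᵢ' = w`. -/
noncomputable def vdeg (l : List Q.A) (w : Q.V) : ℕ :=
  Nat.card {i : Fin l.length // Q.tgt (l.get i) = w}

/-- `deg_b(l)`: the number of occurrences of the arrow `b` in the path `l`. -/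
noncomputable def adeg (l : List Q.A) (b : Q.A) : ℕ :=
  Nat.card {i : Fin l.length // l.get i = b}

/-- The number of occurrences in `l` of arrows from the set `S`. -/
noncomputable def sdeg (l : List Q.A) (S : Set Q.A) : ℕ :=
  Nat.card {i : Fin l.length // l.get i ∈ S}

/-- A primitive closed path in `v`: a closed path without self-intersections,
i.e. `deg_w = 1` for every vertex `w` of the path. -/
def IsPrimitiveAt (v : Q.V) (l : List Q.A) : Prop :=
  Q.IsClosedAt v l ∧ ∀ a ∈ l, Q.vdeg l (Q.tgt a) = 1

/-- A primitive closed path. -/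
def IsPrimitive (l : List Q.A) : Prop := ∃ v, Q.IsPrimitiveAt v l

/-- `m(Q) = m` : `m` is the maximal degree of primitive closed paths in `Q`. -/
def MaxPrimDeg (m : ℕ) : Prop :=
  (∃ l, Q.IsPrimitive l ∧ l.length = m) ∧ ∀ l, Q.IsPrimitive l → l.length ≤ m

/-- `Q` is strongly connected: there is a closed path containing all vertices;
a quiver with one vertex and no arrows is also strongly connected. -/
def StronglyConnected : Prop :=
  (∃ v l, Q.IsClosedAt v l ∧ ∀ w, ∃ a ∈ l, Q.tgt a = w) ∨
    (Subsingleton Q.V ∧ IsEmpty Q.A)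

/-- Formal negation on the set (closed paths with a formal sign) ∪ {0};
`none` is the symbol `0`, and `some (e, l)` is `(-1)^e·l`. -/
def negO : Option (Bool × List Q.A) → Option (Bool × List Q.A)
  | none => none
  | some (e, l) => some (!e, l)

/-- The equivalence `≡` on the set of closed paths of `Q`, enlarged by an additional
symbol `0` (represented by `none`) and formal signs (`some (e, l)` is `(-1)^e·l`).
The parameter `c2` is the proposition "the characteristic of the ground field is 2"
(so that the formal sign `(-1)^σ` is trivial exactly when `c2` holds).
It is the smallest equivalence, compatible with formal negation, such that for paths
`a`, `b` with `ab` a closed path and incident closed paths `a₁, a₂, …`: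
(1) `ab ≡ ba`; (2) `a_{σ(1)}⋯a_{σ(t)} ≡ (-1)^σ a₁⋯a_t` for `t ≥ 2` and `σ ∈ S_t`
(generated here by transpositions of adjacent factors);
(3) `a₁²a₂ ≡ 0`; (4) if `c2` then `a₁² ≡ 0`, while if `¬c2` then `a₁a₂a₃a₄ ≡ 0`. -/
inductive PEquiv (c2 : Prop) : Option (Bool × List Q.A) → Option (Bool × List Q.A) → Prop
  | refl (x) : PEquiv c2 x x
  | symm {x y} : PEquiv c2 x y → PEquiv c2 y x
  | trans {x y z} : PEquiv c2 x y → PEquiv c2 y z → PEquiv c2 x z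
  | neg {x y} : PEquiv c2 x y → PEquiv c2 (Q.negO x) (Q.negO y)
  | cyc (u v : Q.V) (a b : List Q.A) (e : Bool) :
      Q.IsPathFrom u v a → Q.IsPathFrom v u b → a ++ b ≠ [] →
      PEquiv c2 (some (e, a ++ b)) (some (e, b ++ a))
  | swap (v : Q.V) (w₁ c d w₂ : List Q.A) (e : Bool) :
      Q.IsPathFrom v v w₁ → Q.IsClosedAt v c → Q.IsClosedAt v d → Q.IsPathFrom v v w₂ →
      PEquiv c2 (some (e, w₁ ++ c ++ d ++ w₂))
        (some (if c2 then e else !e, w₁ ++ d ++ c ++ w₂))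
  | sq_mul (v : Q.V) (c d : List Q.A) (e : Bool) :
      Q.IsClosedAt v c → Q.IsClosedAt v d →
      PEquiv c2 (some (e, c ++ c ++ d)) none
  | sq (v : Q.V) (c : List Q.A) (e : Bool) :
      c2 → Q.IsClosedAt v c → PEquiv c2 (some (e, c ++ c)) none
  | four (v : Q.V) (c₁ c₂ c₃ c₄ : List Q.A) (e : Bool) :
      ¬c2 → Q.IsClosedAt v c₁ → Q.IsClosedAt v c₂ → Q.IsClosedAt v c₃ → Q.IsClosedAt v c₄ →
      PEquiv c2 (some (e, c₁ ++ c₂ ++ c₃ ++ c₄)) none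
  | sign_triv (e : Bool) (l : List Q.A) :
      c2 → PEquiv c2 (some (e, l)) (some (!e, l))

/-- `l₁ ≡ l₂` for closed paths. -/
def PathEquiv (c2 : Prop) (l₁ l₂ : List Q.A) : Prop :=
  Q.PEquiv c2 (some (false, l₁)) (some (false, l₂))

/-- `l ≡ 0`. -/
def EquivZero (c2 : Prop) (l : List Q.A) : Prop :=
  Q.PEquiv c2 (some (false, l)) none

/-! ### Invariants of quivers for the dimension vector `(2,…,2)` -/

/-- Variables `x_{ij}(a)` of the polynomial ring: for each arrow `a` the entries of the
`2 × 2` generic matrix `X_a`. -/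
def Var : Type := Q.A × Fin 2 × Fin 2

variable (K : Type) [Field K]

/-- The substitution describing the base-change action of the group
`∏_{v} GL₂(K)` (given by a family of invertible matrices `g`) on the variables:
`x_{ij}(a)` is sent to the `(i,j)` entry of `g_{a'} X_a g_{a''}⁻¹`. -/
noncomputable def actVar (g : Q.V → Matrix (Fin 2) (Fin 2) K) (p : Q.Var) :
    MvPolynomial Q.Var K :=
  ∑ k : Fin 2, ∑ l : Fin 2,
    MvPolynomial.C (g (Q.tgt p.1) p.2.1 k * (g (Q.src p.1))⁻¹ l p.2.2) *
      MvPolynomial.X (p.1, k, l)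

/-- `f` belongs to the algebra of invariants `Inv(Q,(2,…,2))`. -/
def IsInvariant (f : MvPolynomial Q.Var K) : Prop :=
  ∀ g : Q.V → Matrix (Fin 2) (Fin 2) K, (∀ v, IsUnit (g v).det) →
    MvPolynomial.aeval (Q.actVar K g) f = f

/-- The space `Inv(Q,(2,…,2))⁺` of invariants without constant term (the span of the
homogeneous invariants of positive degree). -/
def PlusSet : Set (MvPolynomial Q.Var K) :=
  {f | Q.IsInvariant K f ∧ MvPolynomial.constantCoeff f = 0}

/-- `f` is decomposable: it lies in the ideal `(Inv⁺)²`, i.e. in the `K`-span of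
products of two invariants of positive degree. -/
def Decomposable (f : MvPolynomial Q.Var K) : Prop :=
  f ∈ Submodule.span K
    {x : MvPolynomial Q.Var K | ∃ p ∈ Q.PlusSet K, ∃ q ∈ Q.PlusSet K, x = p * q}

/-- The generic `2 × 2` matrix `X_a` of an arrow `a`. -/
noncomputable def genMat (a : Q.A) : Matrix (Fin 2) (Fin 2) (MvPolynomial Q.Var K) :=
  Matrix.of fun i j => MvPolynomial.X (a, i, j)

/-- For a path `l = a₁⋯a_s`, the matrix product `X_{a_s} ⋯ X_{a_1}`. -/
noncomputable def pathMat (l : List Q.A) : Matrix (Fin 2) (Fin 2) (MvPolynomial Q.Var K) :=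
  ((l.map (Q.genMat K)).reverse).prod

/-- `tr(X_{a_s} ⋯ X_{a_1})` for a path `l = a₁⋯a_s`. -/
noncomputable def pathTr (l : List Q.A) : MvPolynomial Q.Var K :=
  Matrix.trace (Q.pathMat K l)

/-- `det(X_{a_s} ⋯ X_{a_1})` for a path `l = a₁⋯a_s`. -/
noncomputable def pathDet (l : List Q.A) : MvPolynomial Q.Var K :=
  Matrix.det (Q.pathMat K l)

/-- `σ_k(X_{a_s} ⋯ X_{a_1})`, the `k`-th coefficient of the characteristic polynomial
of the `2 × 2` matrix `X_{a_s} ⋯ X_{a_1}` (which vanishes for `k > 2`). -/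
noncomputable def pathSigma (k : ℕ) (l : List Q.A) : MvPolynomial Q.Var K :=
  if k = 0 then 1 else if k = 1 then Q.pathTr K l
    else if k = 2 then Q.pathDet K l else 0

/-- `D(Q,(2,…,2))`: the maximal degree of an indecomposable homogeneous invariant,
i.e. the least upper bound for the degrees of elements of a minimal homogeneous
system of generators of `Inv(Q,(2,…,2))`. -/
noncomputable def Dnum : ℕ :=
  sSup {k | ∃ f : MvPolynomial Q.Var K,
    Q.IsInvariant K f ∧ f.IsHomogeneous k ∧ ¬ Q.Decomposable K f}

end QuiverData

/-- `max {D(Q,(2,…,2)) | Q ∈ 𝒬(n,d,m)}` where `𝒬(n,d,m)` is the set of strongly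
connected quivers with `n` vertices (vertex set `Fin n`), `d` arrows (arrow set `Fin d`)
and maximal degree of primitive closed paths equal to `m`. -/
noncomputable def QuiverData.maxD (K : Type) [Field K] (n d m : ℕ) : ℕ :=
  sSup {N | ∃ s t : Fin d → Fin n,
    (QuiverData.mk (Fin n) (Fin d) s t).StronglyConnected ∧
    (QuiverData.mk (Fin n) (Fin d) s t).MaxPrimDeg m ∧
    N = (QuiverData.mk (Fin n) (Fin d) s t).Dnum K}

namespace QuiverData

variable (Q : QuiverData)

/-- Index type of the free generators `σ_k(h)` (`k ≥ 1`, `h` a closed path in `Q`)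
of the free commutative algebra `A(Q)`. -/
def SymIdx : Type := {p : ℕ × List Q.A // 1 ≤ p.1 ∧ Q.IsClosed p.2}

variable (K : Type) [Field K]

/-- The free commutative `K`-algebra `A(Q)` on the symbols `σ_k(h)`. -/
abbrev AQ : Type := MvPolynomial Q.SymIdx K

/-- The generator `σ_k(l)` of `A(Q)`. -/
noncomputable def sym (k : ℕ) (l : List Q.A) (h : 1 ≤ k ∧ Q.IsClosed l) : Q.AQ K :=
  MvPolynomial.X ⟨(k, l), h⟩

/-- The canonical algebra homomorphism `A(Q) → Inv(Q,(2,…,2))`,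
`σ_k(a₁⋯a_s) ↦ σ_k(X_{a_s}⋯X_{a_1})`. -/
noncomputable def toInv : Q.AQ K →ₐ[K] MvPolynomial Q.Var K :=
  MvPolynomial.aeval fun s : Q.SymIdx => Q.pathSigma K s.1.1 s.1.2

/-- The set of relations (a)–(f):
(a) `tr(a₁a₂) - tr(a₂a₁)` and `det(a₁a₂) - det(a₂a₁)` for paths `a₁`, `a₂` such that
`a₁a₂` is a closed path; and, for incident closed paths `a`, `b`, `c`:
(b) `tr(a²) + 2·det(a)`; (c) `tr(a²b)`; (d) `tr(bac) + tr(abc)` and `tr(acb) + tr(abc)`;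
(e) `det(ab)`; (f) `σ_k(a)` for `k > 2`. -/
def RelSet : Set (Q.AQ K) :=
  {x | -- (a)
      (∃ (k : ℕ) (u v : Q.V) (l₁ l₂ : List Q.A)
          (h₁ : 1 ≤ k ∧ Q.IsClosed (l₁ ++ l₂)) (h₂ : 1 ≤ k ∧ Q.IsClosed (l₂ ++ l₁)),
          (k = 1 ∨ k = 2) ∧ l₁ ≠ [] ∧ l₂ ≠ [] ∧
          Q.IsPathFrom u v l₁ ∧ Q.IsPathFrom v u l₂ ∧
          x = Q.sym K k (l₁ ++ l₂) h₁ - Q.sym K k (l₂ ++ l₁) h₂) ∨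
      -- (b)
      (∃ (v : Q.V) (a : List Q.A)
          (h₁ : 1 ≤ 1 ∧ Q.IsClosed (a ++ a)) (h₂ : 1 ≤ 2 ∧ Q.IsClosed a),
          Q.IsClosedAt v a ∧
          x = Q.sym K 1 (a ++ a) h₁ + 2 * Q.sym K 2 a h₂) ∨
      -- (c)
      (∃ (v : Q.V) (a b : List Q.A) (h₁ : 1 ≤ 1 ∧ Q.IsClosed (a ++ a ++ b)),
          Q.IsClosedAt v a ∧ Q.IsClosedAt v b ∧
          x = Q.sym K 1 (a ++ a ++ b) h₁) ∨
      -- (d), first form: tr(bac) + tr(abc)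
      (∃ (v : Q.V) (a b c : List Q.A)
          (h₁ : 1 ≤ 1 ∧ Q.IsClosed (b ++ a ++ c)) (h₂ : 1 ≤ 1 ∧ Q.IsClosed (a ++ b ++ c)),
          Q.IsClosedAt v a ∧ Q.IsClosedAt v b ∧ Q.IsClosedAt v c ∧
          x = Q.sym K 1 (b ++ a ++ c) h₁ + Q.sym K 1 (a ++ b ++ c) h₂) ∨
      -- (d), second form: tr(acb) + tr(abc)
      (∃ (v : Q.V) (a b c : List Q.A)
          (h₁ : 1 ≤ 1 ∧ Q.IsClosed (a ++ c ++ b)) (h₂ : 1 ≤ 1 ∧ Q.IsClosed (a ++ b ++ c)),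
          Q.IsClosedAt v a ∧ Q.IsClosedAt v b ∧ Q.IsClosedAt v c ∧
          x = Q.sym K 1 (a ++ c ++ b) h₁ + Q.sym K 1 (a ++ b ++ c) h₂) ∨
      -- (e)
      (∃ (v : Q.V) (a b : List Q.A) (h₁ : 1 ≤ 2 ∧ Q.IsClosed (a ++ b)),
          Q.IsClosedAt v a ∧ Q.IsClosedAt v b ∧
          x = Q.sym K 2 (a ++ b) h₁) ∨
      -- (f)
      (∃ (k : ℕ) (v : Q.V) (a : List Q.A) (h₁ : 1 ≤ k ∧ Q.IsClosed a),
          2 < k ∧ Q.IsClosedAt v a ∧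
          x = Q.sym K k a h₁)}

/-- The submodule `(A(Q)⁺)²` of `A(Q)`: the span of products of two elements
without constant term. -/
noncomputable def AQplusSq : Submodule K (Q.AQ K) :=
  Submodule.span K {x : Q.AQ K | ∃ p q : Q.AQ K,
    MvPolynomial.constantCoeff p = 0 ∧ MvPolynomial.constantCoeff q = 0 ∧ x = p * q}

end QuiverData


namespace QR

section walk
variable {B C V W : Type*}

/-- walks in the multigraph with letters `B`, source `s`, target `t` -/
def Walk (s t : B → V) : V → V → List B → Prop
  | u, v, [] => u = v
  | u, v, b :: l => s b = u ∧ Walk s t (t b) v l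

theorem isPathFrom_iff (Q : QuiverData) (u v : Q.V) (l : List Q.A) :
    Q.IsPathFrom u v l ↔ Walk Q.src Q.tgt u v l := by
  induction l generalizing u with
  | nil => rfl
  | cons a l ih => simp only [QuiverData.IsPathFrom, Walk, ih]

variable {s t : B → V}

theorem walk_append {u v : V} {l₁ l₂ : List B} :
    Walk s t u v (l₁ ++ l₂) ↔ ∃ w, Walk s t u w l₁ ∧ Walk s t w v l₂ := by
  induction l₁ generalizing u with
  | nil => simp [Walk]
  | cons a l ih => simp [Walk, ih, and_assoc]

theorem walk_unique {u v v' : V} {l : List B} (h : Walk s t u v l) (h' : Walk s t u v' l) :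
    v = v' := by
  induction l generalizing u with
  | nil => exact h.symm.trans h'
  | cons a l ih => exact ih h.2 h'.2

theorem walk_start_unique {u u' v v' : V} {l : List B} (hl : l ≠ []) (h : Walk s t u v l)
    (h' : Walk s t u' v' l) : u = u' := by
  cases l with
  | nil => exact absurd rfl hl
  | cons a l => exact h.1.symm.trans h'.1

theorem walk_snoc {u v : V} {l : List B} {b : B} :
    Walk s t u v (l ++ [b]) ↔ Walk s t u (s b) l ∧ t b = v := by
  rw [walk_append]; simp [Walk]

theorem walk_comp (m : V → W) {u v : V} {l : List B} (h : Walk s t u v l) :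
    Walk (fun b => m (s b)) (fun b => m (t b)) (m u) (m v) l := by
  induction l generalizing u with
  | nil => exact congrArg m h
  | cons a l ih => exact ⟨congrArg m h.1, ih h.2⟩

theorem walk_map (f : C → B) {u v : V} {l : List C} :
    Walk s t u v (l.map f) ↔ Walk (fun c => s (f c)) (fun c => t (f c)) u v l := by
  induction l generalizing u with
  | nil => rfl
  | cons a l ih => simp [Walk, ih]

theorem walk_congr {s' t' : B → V} {u v : V} {l : List B} (hs : ∀ b ∈ l, s' b = s b)
    (ht : ∀ b ∈ l, t' b = t b) (h : Walk s t u v l) : Walk s' t' u v l := by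
  induction l generalizing u with
  | nil => exact h
  | cons a l ih =>
    refine ⟨(hs a (by simp)).trans h.1, ?_⟩
    rw [ht a (by simp)]
    exact ih (fun b hb => hs b (by simp [hb])) (fun b hb => ht b (by simp [hb])) h.2

/-- closed words -/
def Cl (s t : B → V) (l : List B) : Prop := ∃ u, Walk s t u u l

theorem Cl.rot {l₁ l₂ : List B} (h : Cl s t (l₁ ++ l₂)) : Cl s t (l₂ ++ l₁) := by
  obtain ⟨u, hu⟩ := h
  obtain ⟨w, h1, h2⟩ := walk_append.1 hu
  exact ⟨w, walk_append.2 ⟨u, h2, h1⟩⟩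

theorem Cl.rotated {l l' : List B} (h : Cl s t l) (hr : l ~r l') : Cl s t l' := by
  obtain ⟨n, rfl⟩ := hr
  obtain ⟨k, hk⟩ : ∃ k, k = n % l.length := ⟨_, rfl⟩
  rw [← List.rotate_mod, ← hk]
  by_cases hl : l = []
  · subst hl; simpa using h
  have : k ≤ l.length := by
    rw [hk]; exact (Nat.mod_lt _ (List.length_pos_iff.2 hl)).le
  rw [List.rotate_eq_drop_append_take this]
  apply Cl.rot
  rwa [List.take_append_drop]

theorem Cl.comp (m : V → W) {l : List B} (h : Cl s t l) :
    Cl (fun b => m (s b)) (fun b => m (t b)) l := by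
  obtain ⟨u, hu⟩ := h; exact ⟨m u, walk_comp m hu⟩

theorem rotated_append (l₁ l₂ : List B) : (l₁ ++ l₂) ~r (l₂ ++ l₁) :=
  ⟨l₁.length, by simp⟩

/-- rotate so that an element comes last -/
theorem exists_rot_last {x : B} {l : List B} (hx : x ∈ l) : ∃ l', l ~r (l' ++ [x]) := by
  obtain ⟨l1, l2, rfl⟩ := List.append_of_mem hx
  refine ⟨l2 ++ l1, ?_⟩
  have := rotated_append (l1 ++ [x]) l2
  simpa using this

end walk

section rep
variable {B : Type*}

/-- `h` is the (cyclic) word of the permutation `σ`. -/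
def Rep (σ : Equiv.Perm B) (h : List B) : Prop :=
  h.Nodup ∧ h ≠ [] ∧ Cl id σ h ∧ ∀ x, x ∉ h → σ x = x

theorem Rep.rotated {σ : Equiv.Perm B} {h h' : List B} (H : Rep σ h) (hr : h ~r h') :
    Rep σ h' := by
  obtain ⟨h1, h2, h3, h4⟩ := H
  refine ⟨hr.perm.nodup_iff.1 h1, ?_, h3.rotated hr, fun x hx => h4 x ?_⟩
  · rintro rfl; exact h2 (by simpa using hr.perm)
  · rwa [hr.perm.mem_iff]

theorem walk_det {σ : B → B} {u v v' : B} {l l' : List B} (hlen : l.length = l'.length)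
    (h : Walk id σ u v l) (h' : Walk id σ u v' l') : l = l' := by
  induction l generalizing u l' with
  | nil => exact (List.length_eq_zero_iff.1 hlen.symm).symm
  | cons a l ih =>
    cases l' with
    | nil => simp at hlen
    | cons a' l' =>
      obtain ⟨h1, h2⟩ := h
      obtain ⟨h1', h2'⟩ := h'
      simp only [id] at h1 h1'
      subst h1; subst h1'
      rw [ih (by simpa using hlen) h2 h2']

theorem Rep.unique {σ : Equiv.Perm B} {h h' : List B} (H : Rep σ h) (H' : Rep σ h')
    (hp : h.Perm h') : h ~r h' := by
  obtain ⟨x, hx⟩ := List.exists_mem_of_ne_nil _ H.2.1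
  obtain ⟨l, hl⟩ := exists_rot_last hx
  obtain ⟨l', hl'⟩ := exists_rot_last (hp.mem_iff.1 hx)
  have R := H.rotated hl
  have R' := H'.rotated hl'
  obtain ⟨u, hu⟩ := R.2.2.1
  obtain ⟨u', hu'⟩ := R'.2.2.1
  have e := (walk_snoc.1 hu).2
  have e' := (walk_snoc.1 hu').2
  have : u = u' := e.symm.trans e'
  subst this
  have hlen : (l ++ [x]).length = (l' ++ [x]).length := by
    rw [← hl.perm.length_eq, ← hl'.perm.length_eq, hp.length_eq]
  have := walk_det hlen hu hu'
  rw [this] at hl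
  exact hl.trans hl'.symm

theorem walk_last_congr {σ σ' : B → B} {u v : B} {l : List B} {i : B}
    (h : Walk id σ u v (l ++ [i])) (hs : ∀ x ∈ l, σ' x = σ x) :
    Walk id σ' u (σ' i) (l ++ [i]) ∧ σ i = v := by
  obtain ⟨h1, h2⟩ := walk_snoc.1 h
  exact ⟨walk_snoc.2 ⟨walk_congr (fun _ _ => rfl) hs h1, rfl⟩, h2⟩

/-- the 3-cycle `i → j → k → i` -/
noncomputable def cyc3 (i j k : B) : Equiv.Perm B := Equiv.swap i j * Equiv.swap j k

theorem cyc3_apply {i j k : B} (hij : i ≠ j) (hjk : j ≠ k) (hik : i ≠ k) :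
    cyc3 i j k i = j ∧ cyc3 i j k j = k ∧ cyc3 i j k k = i ∧
      ∀ x, x ≠ i → x ≠ j → x ≠ k → cyc3 i j k x = x := by
  unfold cyc3
  refine ⟨?_, ?_, ?_, ?_⟩
  · simp [Equiv.swap_apply_of_ne_of_ne hij hik]
  · simp [Equiv.swap_apply_of_ne_of_ne hik.symm hjk.symm]
  · simp
  · intro x h1 h2 h3
    simp [Equiv.swap_apply_of_ne_of_ne h2 h3, Equiv.swap_apply_of_ne_of_ne h1 h2]

theorem Rep.three {σ : Equiv.Perm B} {X Y Z : List B} {i j k : B}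
    (H : Rep σ ((X ++ [i]) ++ (Y ++ [j]) ++ (Z ++ [k]))) :
    Rep (σ * cyc3 i j k) ((X ++ [i]) ++ (Z ++ [k]) ++ (Y ++ [j])) := by
  obtain ⟨h1, h2, ⟨u, hu⟩, h4⟩ := H
  have hp : ((X ++ [i]) ++ (Y ++ [j]) ++ (Z ++ [k])).Perm
      ((X ++ [i]) ++ (Z ++ [k]) ++ (Y ++ [j])) := by
    rw [List.append_assoc (X ++ [i]), List.append_assoc (X ++ [i])]
    exact List.Perm.append_left _ List.perm_append_comm
  have hn : i ≠ j ∧ j ≠ k ∧ i ≠ k ∧ (∀ x ∈ X, x ≠ i ∧ x ≠ j ∧ x ≠ k) ∧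
      (∀ x ∈ Y, x ≠ i ∧ x ≠ j ∧ x ≠ k) ∧ (∀ x ∈ Z, x ≠ i ∧ x ≠ j ∧ x ≠ k) := by
    simp only [List.nodup_append, List.mem_append, List.mem_singleton] at h1
    obtain ⟨⟨⟨_, _, a1⟩, ⟨_, _, a2⟩, a3⟩, ⟨_, _, a4⟩, a5⟩ := h1
    refine ⟨a3 i (by simp) j (by simp), a5 j (by simp) k (by simp), a5 i (by simp) k (by simp),
      fun x hx => ⟨a1 x hx i rfl, a3 x (by simp [hx]) j (by simp), a5 x (by simp [hx]) k (by simp)⟩,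
      fun x hx => ⟨(a3 i (by simp) x (by simp [hx])).symm, a2 x hx j rfl,
        a5 x (by simp [hx]) k (by simp)⟩,
      fun x hx => ⟨(a5 i (by simp) x (by simp [hx])).symm, (a5 j (by simp) x (by simp [hx])).symm,
        a4 x hx k rfl⟩⟩
  obtain ⟨hij, hjk, hik, hX, hY, hZ⟩ := hn
  obtain ⟨c1, c2, c3, c4⟩ := cyc3_apply hij hjk hik
  obtain ⟨w, hw, hw3⟩ := walk_append.1 hu
  obtain ⟨w', hw1, hw2⟩ := walk_append.1 hw
  have key : ∀ l : List B, (∀ x ∈ l, x ≠ i ∧ x ≠ j ∧ x ≠ k) →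
      ∀ x ∈ l, (σ * cyc3 i j k) x = σ x := by
    intro l hl x hx
    obtain ⟨q1, q2, q3⟩ := hl x hx
    simp [c4 x q1 q2 q3]
  obtain ⟨e1, f1⟩ := walk_last_congr hw1 (key X hX)
  obtain ⟨e2, f2⟩ := walk_last_congr hw2 (key Y hY)
  obtain ⟨e3, f3⟩ := walk_last_congr hw3 (key Z hZ)
  simp only [Equiv.Perm.mul_apply, c1, c2, c3, f1, f2, f3] at e1 e2 e3
  refine ⟨hp.nodup_iff.1 h1, by simp, ⟨u, ?_⟩, ?_⟩
  · exact walk_append.2 ⟨w', walk_append.2 ⟨w, e1, e3⟩, e2⟩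
  · intro x hx
    rw [← hp.mem_iff] at hx
    have hx' := hx
    simp only [List.mem_append, List.mem_singleton, not_or] at hx
    rw [Equiv.Perm.mul_apply, c4 x (by tauto) (by tauto) (by tauto)]
    exact h4 x hx'

theorem walk_closed_set {σ : B → B} {X : Set B} (hX : ∀ x ∈ X, σ x ∈ X) {u v : B} {l : List B}
    (h : Walk id σ u v l) (hu : u ∈ X) : ∀ x ∈ l, x ∈ X := by
  induction l generalizing u with
  | nil => simp
  | cons a l ih =>
    obtain ⟨h1, h2⟩ := h
    simp only [id] at h1
    subst h1
    intro x hx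
    rcases List.mem_cons.1 hx with rfl | hx
    · exact hu
    · exact ih h2 (hX _ hu) x hx

theorem Rep.closed_set {σ : Equiv.Perm B} {h : List B} (H : Rep σ h) {X : Set B}
    (hX : ∀ x ∈ X, σ x ∈ X) {a : B} (ha : a ∈ h) (haX : a ∈ X) : ∀ x ∈ h, x ∈ X := by
  obtain ⟨l, hl⟩ := exists_rot_last ha
  have R := H.rotated hl
  obtain ⟨u, hu⟩ := R.2.2.1
  have e := (walk_snoc.1 hu).2
  have := walk_closed_set hX hu (by rw [← e]; exact hX _ haX)
  intro x hx
  exact this x (hl.perm.mem_iff.1 hx)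

/-- if `σ' i` is the beginning of the segment `X i`, then `σ'` has an invariant set. -/
theorem not_rep_aux {σ σ' : Equiv.Perm B} {u : B} {X : List B} {i : B} {v : B}
    (h : Walk id σ u v (X ++ [i])) (h1 : ∀ x ∈ X, σ' x = σ x) (h2 : σ' i = u) :
    ∀ x ∈ {x | x ∈ X ++ [i]}, σ' x ∈ {x | x ∈ X ++ [i]} := by
  -- successors of elements in a walk
  have key : ∀ (l : List B) (u v : B), Walk id σ u v l → ∀ x ∈ l, σ x = v ∨ σ x ∈ l := by
    intro l
    induction l with
    | nil => simp
    | cons a l ih =>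
      intro u v h x hx
      obtain ⟨h1, h2⟩ := h
      rcases List.mem_cons.1 hx with rfl | hx
      · cases l with
        | nil => left; exact h2
        | cons b l => right; have := h2.1; simp only [id] at this; simp [this]
      · rcases ih _ _ h2 x hx with h | h
        · exact Or.inl h
        · right; simp [h]
  have hu : u ∈ X ++ [i] := by
    cases X with
    | nil => have := h.1; simp only [id] at this; simp [this]
    | cons b l => have := h.1; simp only [id] at this; simp [this]
  intro x hx
  simp only [Set.mem_ofPred_eq] at hx ⊢
  rcases List.mem_append.1 hx with hx | hx
  · rw [h1 x hx]
    rcases key X u _ (walk_snoc.1 h).1 x hx with h | h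
    · simp only [id] at h; simp [h]
    · simp [h]
  · rw [List.mem_singleton.1 hx, h2]; exact hu

theorem Rep.swap_not {σ : Equiv.Perm B} {X Y : List B} {i j : B}
    (H : Rep σ ((X ++ [i]) ++ (Y ++ [j]))) {h : List B} (hi : i ∈ h) (hj : j ∈ h) :
    ¬ Rep (σ * Equiv.swap i j) h := by
  intro R
  obtain ⟨h1, h2, ⟨u, hu⟩, h4⟩ := H
  obtain ⟨w, hw1, hw2⟩ := walk_append.1 hu
  simp only [List.nodup_append, List.mem_append, List.mem_singleton] at h1
  obtain ⟨⟨_, _, a1⟩, ⟨_, _, a2⟩, a3⟩ := h1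
  have := R.closed_set (not_rep_aux hw1 (σ' := σ * Equiv.swap i j) ?_ ?_) hi (by simp) j hj
  · simp only [Set.mem_ofPred_eq, List.mem_append, List.mem_singleton] at this
    exact a3 j this j (Or.inr rfl) rfl
  · intro x hx
    simp [Equiv.swap_apply_of_ne_of_ne (a1 x hx i rfl) (a3 x (Or.inl hx) j (Or.inr rfl))]
  · simp [(walk_snoc.1 hw2).2]

theorem Rep.three_not {σ : Equiv.Perm B} {X Y Z : List B} {i j k : B}
    (H : Rep σ ((X ++ [i]) ++ (Y ++ [j]) ++ (Z ++ [k]))) {h : List B} (hi : i ∈ h) (hj : j ∈ h) :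
    ¬ Rep (σ * cyc3 i k j) h := by
  intro R
  obtain ⟨h1, h2, ⟨u, hu⟩, h4⟩ := H
  obtain ⟨w, hw, hw3⟩ := walk_append.1 hu
  obtain ⟨w', hw1, hw2⟩ := walk_append.1 hw
  simp only [List.nodup_append, List.mem_append, List.mem_singleton] at h1
  obtain ⟨⟨⟨_, _, a1⟩, ⟨_, _, a2⟩, a3⟩, ⟨_, _, a4⟩, a5⟩ := h1
  have hij : i ≠ j := a3 i (by simp) j (by simp)
  have hjk : j ≠ k := a5 j (by simp) k (by simp)
  have hik : i ≠ k := a5 i (by simp) k (by simp)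
  obtain ⟨c1, c2, c3, c4⟩ := cyc3_apply hik hjk.symm hij
  have := R.closed_set (not_rep_aux hw1 (σ' := σ * cyc3 i k j) ?_ ?_) hi (by simp) j hj
  · simp only [Set.mem_ofPred_eq, List.mem_append, List.mem_singleton] at this
    exact a3 j this j (Or.inr rfl) rfl
  · intro x hx
    rw [Equiv.Perm.mul_apply, c4 x (a1 x hx i rfl) (a5 x (by simp [hx]) k (by simp))
      (a3 x (Or.inl hx) j (Or.inr rfl))]
  · simp [c1, (walk_snoc.1 hw3).2]

theorem exists_rep {h : List B} (hn : h.Nodup) (hne : h ≠ []) : ∃ σ, Rep σ h := by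
  refine ⟨h.formPerm, hn, hne, ?_, fun x hx => List.formPerm_apply_of_notMem hx⟩
  have key : ∀ (n : ℕ) (l : List B) (x : B), l.length = n → h = l ++ h.drop n → 
      ∀ hn : n < h.length, Walk id h.formPerm (h[0]'(by omega)) (h[n]'hn) l := by
    intro n
    induction n with
    | zero => intro l x hl _ hn'; rw [List.length_eq_zero_iff.1 hl]; rfl
    | succ n ih =>
      intro l x hl he hn'
      obtain ⟨l', b, rfl⟩ : ∃ l' b, l = l' ++ [b] := by
        rcases List.eq_nil_or_concat l with rfl | ⟨l', b, rfl⟩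
        · simp at hl
        · exact ⟨l', b, by simp⟩
      have hl' : l'.length = n := by simpa using hl
      have hb : h[n] = b := by
        have : h[n]? = some b := by
          rw [he]; simp [hl'] 
        rw [List.getElem?_eq_getElem (by omega)] at this
        exact Option.some.inj this
      refine walk_snoc.2 ⟨?_, ?_⟩
      · have := ih l' x hl' ?_ (by omega)
        · rwa [hb] at this
        · rw [← List.take_append_drop n h]
          congr 1
          · rw [he]; simp [← hl']
          · rw [List.take_append_drop]
      · rw [← hb]; exact List.formPerm_apply_lt_getElem h hn n hn'
  have hpos : 0 < h.length := List.length_pos_iff.2 hne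
  obtain ⟨l, b, hl⟩ : ∃ l b, h = l ++ [b] := by
    rcases List.eq_nil_or_concat h with h0 | ⟨l', b, h0⟩
    · exact absurd h0 hne
    · exact ⟨l', b, by simpa using h0⟩
  have hlen : h.length = l.length + 1 := by rw [hl]; simp
  refine ⟨h[0], ?_⟩
  have h1 := key l.length l b rfl (by conv_lhs => rw [hl]
                                      congr 1; rw [hl]; simp) (by omega)
  have hb : h[l.length]'(by omega) = b := by simp [hl]
  have : Walk id h.formPerm h[0] h[0] (l ++ [b]) := by
    refine walk_snoc.2 ⟨by rwa [hb] at h1, ?_⟩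
    have := List.formPerm_apply_getElem h hn l.length (by omega)
    rw [hb] at this
    rw [this]
    simp [hlen]
  rwa [← hl] at this

end rep
end QR


namespace QR
section s3
variable {B : Type*}

theorem s3_ids {i j k : B} (hij : i ≠ j) (hjk : j ≠ k) (hik : i ≠ k) :
    Equiv.swap j k * Equiv.swap i j = cyc3 i k j ∧
    Equiv.swap i k * Equiv.swap i j = cyc3 i j k ∧
    Equiv.swap i j * Equiv.swap j k = cyc3 i j k ∧
    Equiv.swap i k * Equiv.swap j k = cyc3 i k j ∧
    Equiv.swap i j * Equiv.swap i k = cyc3 i k j ∧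
    Equiv.swap j k * Equiv.swap i k = cyc3 i j k ∧
    Equiv.swap i j * cyc3 i j k = Equiv.swap j k ∧
    Equiv.swap i j * cyc3 i k j = Equiv.swap i k ∧
    Equiv.swap j k * cyc3 i j k = Equiv.swap i k ∧
    Equiv.swap j k * cyc3 i k j = Equiv.swap i j ∧
    Equiv.swap i k * cyc3 i j k = Equiv.swap i j ∧
    Equiv.swap i k * cyc3 i k j = Equiv.swap j k ∧
    cyc3 i j k * Equiv.swap i j = Equiv.swap i k ∧
    cyc3 i j k * Equiv.swap j k = Equiv.swap i j ∧
    cyc3 i j k * Equiv.swap i k = Equiv.swap j k ∧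
    cyc3 i j k * cyc3 i j k = cyc3 i k j ∧
    cyc3 i j k * cyc3 i k j = 1 := by
  obtain ⟨c1, c2, c3, c4⟩ := cyc3_apply hij hjk hik
  obtain ⟨d1, d2, d3, d4⟩ := cyc3_apply hik hjk.symm hij
  have e1 := Equiv.swap_apply_of_ne_of_ne hik.symm hjk.symm
  have e2 := Equiv.swap_apply_of_ne_of_ne hij hik
  have e3 := Equiv.swap_apply_of_ne_of_ne hij.symm hjk
  refine ⟨?_, ?_, ?_, ?_, ?_, ?_, ?_, ?_, ?_, ?_, ?_, ?_, ?_, ?_, ?_, ?_, ?_⟩ <;>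
  · ext x
    by_cases h1 : x = i
    · subst h1; simp [c1, c2, c3, d1, d2, d3, e1, e2, e3]
    by_cases h2 : x = j
    · subst h2; simp [c1, c2, c3, d1, d2, d3, e1, e2, e3]
    by_cases h3 : x = k
    · subst h3; simp [c1, c2, c3, d1, d2, d3, e1, e2, e3]
    simp [c4 x h1 h2 h3, d4 x h1 h3 h2, Equiv.swap_apply_of_ne_of_ne, h1, h2, h3]

variable {A : Type*} [AddCommGroup A]

/-- the antisymmetrizer over three letters -/
noncomputable def asym (F : Equiv.Perm B → A) (σ : Equiv.Perm B) (i j k : B) : A :=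
  F σ - F (σ * Equiv.swap i j) - F (σ * Equiv.swap j k) - F (σ * Equiv.swap i k)
    + F (σ * cyc3 i j k) + F (σ * cyc3 i k j)

theorem asym_shift (F : Equiv.Perm B → A) (σ : Equiv.Perm B) {i j k : B}
    (hij : i ≠ j) (hjk : j ≠ k) (hik : i ≠ k) :
    asym F (σ * Equiv.swap i j) i j k = - asym F σ i j k ∧
    asym F (σ * Equiv.swap j k) i j k = - asym F σ i j k ∧
    asym F (σ * Equiv.swap i k) i j k = - asym F σ i j k ∧
    asym F (σ * cyc3 i j k) i j k = asym F σ i j k ∧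
    asym F (σ * cyc3 i k j) i j k = asym F σ i j k := by
  have key : ∀ σ, asym F (σ * cyc3 i j k) i j k = asym F σ i j k := by
    intro σ
    obtain ⟨h1, h2, h3, h4, h5, h6, h7, h8, h9, h10, h11, h12, h13, h14, h15, h16, h17⟩ :=
      s3_ids hij hjk hik
    simp only [asym, mul_assoc, h13, h14, h15, h16, h17, mul_one]
    abel
  have hc : cyc3 i j k * cyc3 i j k = cyc3 i k j := (s3_ids hij hjk hik).2.2.2.2.2.2.2.2.2.2.2.2.2.2.2.1
  refine ⟨?_, ?_, ?_, key σ, ?_⟩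
  · obtain ⟨h1, h2, h3, h4, h5, h6, h7, h8, h9, h10, h11, h12, h13, h14, h15, h16, h17⟩ :=
      s3_ids hij hjk hik
    simp only [asym, mul_assoc, Equiv.swap_mul_self, mul_one, h3, h5, h7, h8]; abel
  · obtain ⟨h1, h2, h3, h4, h5, h6, h7, h8, h9, h10, h11, h12, h13, h14, h15, h16, h17⟩ :=
      s3_ids hij hjk hik
    simp only [asym, mul_assoc, Equiv.swap_mul_self, mul_one, h1, h6, h9, h10]; abel
  · obtain ⟨h1, h2, h3, h4, h5, h6, h7, h8, h9, h10, h11, h12, h13, h14, h15, h16, h17⟩ :=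
      s3_ids hij hjk hik
    simp only [asym, mul_assoc, Equiv.swap_mul_self, mul_one, h2, h4, h11, h12]; abel
  · rw [← hc, ← mul_assoc, key, key]

end s3

section sft
variable {L : Type*} [Fintype L] {K : Type*} [Field K]

/-- the elementary invariant -/
noncomputable def Th (K : Type*) [Field K] (σ : Equiv.Perm L) :
    (L → Fin 2) × (L → Fin 2) → K :=
  fun x => if x.1 = x.2 ∘ σ then 1 else 0

theorem Th_shift (σ π : Equiv.Perm L) (f g : L → Fin 2) (hf : f ∘ π = f) :
    Th K (σ * π) (f, g) = Th K σ (f, g) := by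
  unfold Th
  have : (f = g ∘ (σ * π : Equiv.Perm L)) ↔ f = g ∘ σ := by
    constructor
    · intro h
      have h' : f ∘ π = (g ∘ σ) ∘ π := by rw [hf]; exact h
      funext x
      have := congrFun h' (π⁻¹ x)
      simpa using this
    · intro h
      rw [← hf, h]; rfl
  simp only [this]

theorem comp_swap {f : L → Fin 2} {i j : L} (h : f i = f j) : f ∘ Equiv.swap i j = f := by
  funext x
  simp only [Function.comp, Equiv.swap_apply_def]
  split_ifs with h1 h2
  · rw [h1, h]
  · rw [h2, h]
  · rfl

theorem asym_Th (σ : Equiv.Perm L) {i j k : L}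
    (hij : i ≠ j) (hjk : j ≠ k) (hik : i ≠ k) : asym (Th K) σ i j k = 0 := by
  funext ⟨f, g⟩
  obtain ⟨h1, h2, h3, h4, h5, h6, h7, h8, h9, h10, h11, h12, h13, h14, h15, h16, h17⟩ :=
    s3_ids hij hjk hik
  have key : f i = f j ∨ f j = f k ∨ f i = f k := by
    generalize f i = a at *; generalize f j = b at *; generalize f k = c at *
    fin_cases a <;> fin_cases b <;> fin_cases c <;> simp
  simp only [asym, Pi.sub_apply, Pi.add_apply, Pi.zero_apply]
  rcases key with h | h | h
  · have e := comp_swap h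
    have a1 := Th_shift (K := K) σ _ f g e
    have a2 := Th_shift (K := K) (σ * Equiv.swap j k) _ f g e
    have a3 := Th_shift (K := K) (σ * Equiv.swap i k) _ f g e
    rw [mul_assoc, h1] at a2
    rw [mul_assoc, h2] at a3
    rw [a1, a2, a3]; ring
  · have e := comp_swap h
    have a1 := Th_shift (K := K) σ _ f g e
    have a2 := Th_shift (K := K) (σ * Equiv.swap i j) _ f g e
    have a3 := Th_shift (K := K) (σ * Equiv.swap i k) _ f g e
    rw [mul_assoc, h3] at a2
    rw [mul_assoc, h4] at a3
    rw [a1, a2, a3]; ring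
  · have e := comp_swap h
    have a1 := Th_shift (K := K) σ _ f g e
    have a2 := Th_shift (K := K) (σ * Equiv.swap i j) _ f g e
    have a3 := Th_shift (K := K) (σ * Equiv.swap j k) _ f g e
    rw [mul_assoc, h5] at a2
    rw [mul_assoc, h6] at a3
    rw [a1, a2, a3]; ring

end sft
end QR

set_option linter.all false

namespace QR
section sft
variable {L : Type*} [Fintype L] {K : Type*} [Field K] {W : Type*}

noncomputable abbrev sw {B : Type*} (i j : B) : Equiv.Perm B := Equiv.swap i j

theorem sw_ne {B : Type*} {i j x : B} (h1 : x ≠ i) (h2 : x ≠ j) : sw i j x = x :=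
  Equiv.swap_apply_of_ne_of_ne h1 h2

theorem bsw_lem {bt : L → W} (i j : L) (h : bt i = bt j) (l : L) : bt (Equiv.swap i j l) = bt l := by
  rw [Equiv.swap_apply_def]; split_ifs with q1 q2
  · rw [q1, h]
  · rw [q2, h]
  · rfl

theorem bcyc_lem {bt : L → W} (i j k : L) (h : bt i = bt j) (h' : bt j = bt k) (l : L) :
    bt (cyc3 i j k l) = bt l := by
  unfold cyc3; rw [Equiv.Perm.mul_apply, bsw_lem _ _ h, bsw_lem _ _ h']

/-- being free of a descending pattern of length three inside a block -/
def Free [LinearOrder L] (bt : L → W) (σ : Equiv.Perm L) : Prop :=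
  ¬ ∃ i j k, i < j ∧ j < k ∧ bt i = bt j ∧ bt j = bt k ∧ σ k < σ j ∧ σ j < σ i

noncomputable def topf [LinearOrder L] (bt : L → W) (σ : Equiv.Perm L) (i : L) : Fin 2 :=
  if ∃ k, i < k ∧ bt i = bt k ∧ σ k < σ i then 1 else 0

theorem free_mono [LinearOrder L] {bt : L → W} {σ : Equiv.Perm L} (hσ : Free bt σ) {i j : L}
    (hb : bt i = bt j) (ht : topf bt σ i = topf bt σ j) (hs : σ j < σ i) : j < i := by
  by_contra hji
  have hne : i ≠ j := by rintro rfl; exact lt_irrefl _ hs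
  have hij : i < j := lt_of_le_of_ne (not_lt.1 hji) hne
  have hi : topf bt σ i = 1 := by
    unfold topf; rw [if_pos ⟨j, hij, hb, hs⟩]
  rw [hi] at ht
  unfold topf at ht
  split_ifs at ht with h
  · obtain ⟨k, hk1, hk2, hk3⟩ := h
    exact hσ ⟨i, j, k, hij, hk1, hb, hk2, hk3, hs⟩
  · exact absurd ht (by decide)

theorem free_lex [LinearOrder L] {bt bs : L → W} {σ τ : Equiv.Perm L} (hσ : Free bt σ)
    (h1 : ∀ l, bs (σ l) = bt l) (h2 : ∀ l, bs (τ l) = bt l)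
    (h : topf bt σ = (topf bt σ ∘ σ.symm) ∘ τ) :
    toLex (σ : L → L) ≤ toLex (τ : L → L) := by
  by_contra hlt
  rw [not_le] at hlt
  obtain ⟨i, hi1, hi2⟩ := hlt
  simp only [ofLex_toLex] at hi1 hi2
  have hi1 : ∀ j < i, τ j = σ j := hi1
  have hi2 : τ i < σ i := hi2
  set j := σ.symm (τ i) with hj
  have hsj : σ j = τ i := by simp [hj]
  have hlt : σ j < σ i := by rw [hsj]; exact hi2
  have hji : j < i := by
    refine free_mono hσ ?_ ?_ hlt
    · rw [← h2 i, ← hsj, h1]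
    · have := congrFun h i
      simpa [hj] using this
  have := hi1 j hji
  rw [hsj] at this
  exact hji.ne (τ.injective this)

theorem sft_aux [LinearOrder L] (bt bs : L → W) (F : Equiv.Perm L → K)
    (hF : ∀ σ : Equiv.Perm L, (∀ l, bs (σ l) = bt l) → ∀ i j k, i ≠ j → j ≠ k → i ≠ k →
      bt i = bt j → bt j = bt k → asym F σ i j k = 0) :
    ∃ T : ((L → Fin 2) × (L → Fin 2) → K) →ₗ[K] K,
      ∀ σ : Equiv.Perm L, (∀ l, bs (σ l) = bt l) → T (Th K σ) = F σ := by
  let I := {σ : Equiv.Perm L // (∀ l, bs (σ l) = bt l) ∧ Free bt σ}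
  have hli : LinearIndependent K (fun σ : I => Th K σ.1) := by
    rw [Fintype.linearIndependent_iff]
    intro c hc
    by_contra hne
    push Not at hne
    obtain ⟨σ, hσ, hmax⟩ := Finset.exists_max_image (Finset.univ.filter fun σ : I => c σ ≠ 0)
      (fun σ => toLex (σ.1 : L → L)) (by obtain ⟨i, hi⟩ := hne; exact ⟨i, by simp [hi]⟩)
    have hσ' : c σ ≠ 0 := by simpa using hσ
    have := congrFun hc (topf bt σ.1, topf bt σ.1 ∘ σ.1.symm)
    rw [Finset.sum_apply, Finset.sum_eq_single σ] at this
    · have e : Th K σ.1 (topf bt σ.1, topf bt σ.1 ∘ σ.1.symm) = 1 := by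
        unfold Th
        rw [if_pos]
        funext x; simp
      simp [e] at this
      exact hσ' this
    · intro τ _ hτ
      by_cases hcτ : c τ = 0
      · simp [hcτ]
      · have hle := hmax τ (by simp [hcτ])
        simp only [Pi.smul_apply, smul_eq_mul, Th]
        rw [if_neg, mul_zero]
        intro h
        have := free_lex σ.2.2 σ.2.1 τ.2.1 h
        have e := le_antisymm hle this
        apply hτ
        apply Subtype.ext
        apply Equiv.ext
        intro x
        exact congrFun (toLex_inj.1 e) x
    · simp
  obtain ⟨T, hT⟩ := LinearMap.exists_extend
    ((Module.Basis.span hli).constr K (fun σ : I => F σ.1))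
  refine ⟨T, ?_⟩
  have hI : ∀ σ : I, T (Th K σ.1) = F σ.1 := by
    intro σ
    have h1 := LinearMap.congr_fun hT (Module.Basis.span hli σ)
    rw [LinearMap.comp_apply, Module.Basis.constr_basis] at h1
    rw [← h1]
    simp [Module.Basis.span_apply]
  have main : ∀ x : Lex (L → L), ∀ σ : Equiv.Perm L, toLex (σ : L → L) = x →
      (∀ l, bs (σ l) = bt l) → T (Th K σ) = F σ := by
    intro x
    induction x using WellFoundedLT.induction with
    | ind x ih =>
    intro σ hx hσ
    subst hx
    by_cases hfree : Free bt σ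
    · exact hI ⟨σ, hσ, hfree⟩
    · unfold Free at hfree
      push Not at hfree
      obtain ⟨i, j, k, hij, hjk, bij, bjk, skj, sji⟩ := hfree
      have hik := hij.trans hjk
      obtain ⟨c1, c2, c3, c4⟩ := cyc3_apply hij.ne hjk.ne hik.ne
      obtain ⟨d1, d2, d3, d4⟩ := cyc3_apply hik.ne hjk.ne' hij.ne
      have e1 := hF σ hσ i j k hij.ne hjk.ne hik.ne bij bjk
      have e2 := congrArg T (asym_Th (K := K) σ hij.ne hjk.ne hik.ne)
      have good : ∀ π : Equiv.Perm L, (∀ l, bt (π l) = bt l) →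
          toLex ((σ * π : Equiv.Perm L) : L → L) < toLex (σ : L → L) →
          T (Th K (σ * π)) = F (σ * π) := by
        intro π hπ hlt
        refine ih _ hlt _ rfl ?_
        intro l
        rw [Equiv.Perm.mul_apply, hσ, hπ]
      have bsw : ∀ i j : L, bt i = bt j → ∀ l, bt (sw i j l) = bt l := fun i j h l => bsw_lem i j h l
      have lexi : ∀ (π : Equiv.Perm L) (q : L), (∀ r < q, π r = r) → σ (π q) < σ q →
          toLex ((σ * π : Equiv.Perm L) : L → L) < toLex (σ : L → L) := by
        intro π q h1 h2
        refine ⟨q, ?_, ?_⟩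
        · intro r hr
          show (σ * π : Equiv.Perm L) r = σ r
          rw [Equiv.Perm.mul_apply, h1 r hr]
        · show (σ * π : Equiv.Perm L) q < σ q
          simpa using h2
      have a1 := good (sw i j) (bsw _ _ bij) (lexi _ i (fun r hr =>
        sw_ne hr.ne (hr.trans hij).ne) (by simpa using sji))
      have a2 := good (sw j k) (bsw _ _ bjk) (lexi _ j (fun r hr =>
        sw_ne hr.ne (hr.trans hjk).ne) (by simpa using skj))
      have a3 := good (sw i k) (bsw _ _ (bij.trans bjk)) (lexi _ i (fun r hr =>
        sw_ne hr.ne (hr.trans hik).ne) (by simpa using skj.trans sji))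
      have a4 := good (cyc3 i j k) (fun l => bcyc_lem _ _ _ bij bjk l)
        (lexi _ i (fun r hr => c4 r hr.ne (hr.trans hij).ne (hr.trans hik).ne) (by
          rw [c1]; exact sji))
      have a5 := good (cyc3 i k j) (fun l => bcyc_lem _ _ _ (bij.trans bjk) bjk.symm l)
        (lexi _ i (fun r hr => d4 r hr.ne (hr.trans hik).ne (hr.trans hij).ne) (by
          rw [d1]; exact skj.trans sji))
      simp only [asym, map_add, map_sub, map_zero, a1, a2, a3, a4, a5] at e1 e2
      linear_combination e2 - e1
  intro σ hσ
  exact main _ σ rfl hσ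

theorem sft (bt bs : L → W) (F : Equiv.Perm L → K)
    (hF : ∀ σ : Equiv.Perm L, (∀ l, bs (σ l) = bt l) → ∀ i j k, i ≠ j → j ≠ k → i ≠ k →
      bt i = bt j → bt j = bt k → asym F σ i j k = 0) :
    ∃ T : ((L → Fin 2) × (L → Fin 2) → K) →ₗ[K] K,
      ∀ σ : Equiv.Perm L, (∀ l, bs (σ l) = bt l) → T (Th K σ) = F σ := by
  letI : LinearOrder L := LinearOrder.lift' (Fintype.equivFin L) (Fintype.equivFin L).injective
  exact sft_aux bt bs F hF

/-- closed words with respect to `bs, bt` that are full -/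
def FullW (bs bt : L → W) (h : List L) : Prop :=
  h.Nodup ∧ (∀ l, l ∈ h) ∧ h ≠ [] ∧ Cl bs bt h

/-- the function on permutations given by a function on words -/
noncomputable def wf (ψ : List L → K) (σ : Equiv.Perm L) : K :=
  if h : ∃ w, Rep σ w ∧ ∀ l, l ∈ w then ψ h.choose else 0

theorem perm_of_full {w w' : List L} (h : w.Nodup) (h' : w'.Nodup) (hf : ∀ l, l ∈ w)
    (hf' : ∀ l, l ∈ w') : w.Perm w' := by
  rw [List.perm_ext_iff_of_nodup h h']
  intro a; simp [hf, hf']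

theorem Rep.cl {bs bt : L → W} {σ : Equiv.Perm L} {w : List L} (H : Rep σ w)
    (hσ : ∀ l, bs (σ l) = bt l) : Cl bs bt w := by
  have := H.2.2.1.comp bs
  simpa only [id, hσ] using this

theorem wf_eq {ψ : List L → K} {bs bt : L → W}
    (hrot : ∀ w w', FullW bs bt w → w ~r w' → ψ w = ψ w')
    {σ : Equiv.Perm L} (hσ : ∀ l, bs (σ l) = bt l) {w : List L} (H : Rep σ w)
    (hf : ∀ l, l ∈ w) : wf ψ σ = ψ w := by
  have hex : ∃ w, Rep σ w ∧ ∀ l, l ∈ w := ⟨w, H, hf⟩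
  unfold wf
  rw [dif_pos hex]
  obtain ⟨h1, h2⟩ := hex.choose_spec
  symm
  refine hrot _ _ ⟨H.1, hf, H.2.1, H.cl hσ⟩ (H.unique h1 (perm_of_full H.1 h1.1 hf h2))

theorem wf_zero {ψ : List L → K} {σ : Equiv.Perm L}
    (H : ∀ w, Rep σ w → (∀ l, l ∈ w) → False) : wf ψ σ = 0 := by
  unfold wf
  rw [dif_neg]
  rintro ⟨w, h1, h2⟩
  exact H w h1 h2

/-- arrangement of three letters in a cyclic word -/
theorem arrange {w : List L} {i j k : L} (hij : i ≠ j) (hjk : j ≠ k) (hik : i ≠ k)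
    (hf : ∀ l, l ∈ w) : ∃ X Y Z, w ~r (X ++ [i]) ++ (Y ++ [j]) ++ (Z ++ [k]) ∨
      w ~r (X ++ [i]) ++ (Y ++ [k]) ++ (Z ++ [j]) := by
  have hsw : ∀ X Y Z : List L, ((X ++ [j]) ++ (Y ++ [i]) ++ (Z ++ [k])) ~r
      (Y ++ [i]) ++ (Z ++ [k]) ++ (X ++ [j]) := fun X Y Z => by
    have := rotated_append (X ++ [j]) ((Y ++ [i]) ++ (Z ++ [k]))
    simpa [List.append_assoc] using this
  obtain ⟨l, hl⟩ := exists_rot_last (hf k)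
  have hi : i ∈ l := by
    have : i ∈ l ++ [k] := hl.perm.mem_iff.1 (hf i)
    simpa [hik] using this
  have hj : j ∈ l := by
    have : j ∈ l ++ [k] := hl.perm.mem_iff.1 (hf j)
    simpa [hjk] using this
  obtain ⟨X, Y, rfl⟩ := List.append_of_mem hi
  rcases List.mem_append.1 hj with hj | hj
  · obtain ⟨X1, X2, rfl⟩ := List.append_of_mem hj
    refine ⟨X2, Y, X1, Or.inr ?_⟩
    refine hl.trans ?_
    have := hsw X1 X2 Y
    simpa [List.append_assoc] using this
  · have hj : j ∈ Y := by simpa [hij.symm] using hj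
    obtain ⟨Y1, Y2, rfl⟩ := List.append_of_mem hj
    refine ⟨X, Y1, Y2, Or.inl ?_⟩
    simpa [List.append_assoc] using hl

theorem asym_wf_full {ψ : List L → K} {bs bt : L → W}
    (hrot : ∀ w w', FullW bs bt w → w ~r w' → ψ w = ψ w')
    (hsw : ∀ (z : W) (A B C : List L), A ≠ [] → B ≠ [] → C ≠ [] →
      Walk bs bt z z A → Walk bs bt z z B → Walk bs bt z z C →
      FullW bs bt (A ++ B ++ C) → ψ (A ++ B ++ C) + ψ (A ++ C ++ B) = 0)
    {σ : Equiv.Perm L} (hσ : ∀ l, bs (σ l) = bt l) {i j k : L} {X Y Z : List L}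
    (hij : i ≠ j) (hjk : j ≠ k) (hik : i ≠ k) (bij : bt i = bt j) (bjk : bt j = bt k)
    (H : Rep σ ((X ++ [i]) ++ (Y ++ [j]) ++ (Z ++ [k])))
    (hf : ∀ l, l ∈ (X ++ [i]) ++ (Y ++ [j]) ++ (Z ++ [k])) : asym (wf ψ) σ i j k = 0 := by
  have bsw : ∀ i j : L, bt i = bt j → ∀ l, bt (Equiv.swap i j l) = bt l := by
    intro i j h l
    rw [Equiv.swap_apply_def]; split_ifs with q1 q2
    · rw [q1, h]
    · rw [q2, h]
    · rfl
  have z1 : wf ψ (σ * Equiv.swap i j) = 0 := wf_zero fun w hw hf' => by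
    have hr : ((X ++ [i]) ++ (Y ++ [j]) ++ (Z ++ [k])) ~r ((Z ++ [k] ++ X) ++ [i]) ++ (Y ++ [j]) := by
      have := rotated_append ((X ++ [i]) ++ (Y ++ [j])) (Z ++ [k])
      simpa [List.append_assoc] using this
    exact (H.rotated hr).swap_not (hf' i) (hf' j) hw
  have z2 : wf ψ (σ * Equiv.swap j k) = 0 := wf_zero fun w hw hf' => by
    have H' : Rep σ (((X ++ [i] ++ Y) ++ [j]) ++ (Z ++ [k])) := by
      simpa [List.append_assoc] using H
    exact H'.swap_not (hf' j) (hf' k) hw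
  have z3 : wf ψ (σ * Equiv.swap i k) = 0 := wf_zero fun w hw hf' => by
    have H' : Rep σ ((X ++ [i]) ++ ((Y ++ [j] ++ Z) ++ [k])) := by
      simpa [List.append_assoc] using H
    exact H'.swap_not (hf' i) (hf' k) hw
  have z4 : wf ψ (σ * cyc3 i k j) = 0 := wf_zero fun w hw hf' => H.three_not (hf' i) (hf' j) hw
  have H3 := H.three
  have hp : ((X ++ [i]) ++ (Y ++ [j]) ++ (Z ++ [k])).Perm
      ((X ++ [i]) ++ (Z ++ [k]) ++ (Y ++ [j])) := by
    rw [List.append_assoc (X ++ [i]), List.append_assoc (X ++ [i])]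
    exact List.Perm.append_left _ List.perm_append_comm
  have hσ3 : ∀ l, bs ((σ * cyc3 i j k) l) = bt l := by
    intro l
    rw [Equiv.Perm.mul_apply, hσ]; unfold cyc3
    rw [Equiv.Perm.mul_apply, bsw _ _ bij, bsw _ _ bjk]
  have w1 := wf_eq hrot hσ H hf
  have w2 := wf_eq hrot hσ3 H3 (fun l => hp.mem_iff.1 (hf l))
  have hcl := H.cl hσ
  unfold asym
  rw [z1, z2, z3, z4, w1, w2]
  obtain ⟨u, hu⟩ := hcl
  obtain ⟨u1, hu1, hu3⟩ := walk_append.1 hu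
  obtain ⟨u2, hu1, hu2⟩ := walk_append.1 hu1
  have t1 : bt i = u2 := (walk_snoc.1 hu1).2
  have t2 : bt j = u1 := (walk_snoc.1 hu2).2
  have t3 : bt k = u := (walk_snoc.1 hu3).2
  have q1 : u2 = u := by rw [← t1, ← t3, bij, bjk]
  have q2 : u1 = u := by rw [← t2, ← t3, bjk]
  subst q1; subst q2
  have := hsw _ (X ++ [i]) (Y ++ [j]) (Z ++ [k]) (by simp) (by simp) (by simp) hu1 hu2 hu3
    ⟨H.1, hf, H.2.1, ⟨_, hu⟩⟩
  simpa using this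

theorem asym_comm (F : Equiv.Perm L → K) (σ : Equiv.Perm L) (i j k : L) :
    asym F σ i j k = asym F σ i k j := by
  unfold asym
  rw [Equiv.swap_comm k j]; ring

theorem asym_wf {ψ : List L → K} {bs bt : L → W}
    (hrot : ∀ w w', FullW bs bt w → w ~r w' → ψ w = ψ w')
    (hsw : ∀ (z : W) (A B C : List L), A ≠ [] → B ≠ [] → C ≠ [] →
      Walk bs bt z z A → Walk bs bt z z B → Walk bs bt z z C →
      FullW bs bt (A ++ B ++ C) → ψ (A ++ B ++ C) + ψ (A ++ C ++ B) = 0)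
    {σ : Equiv.Perm L} (hσ : ∀ l, bs (σ l) = bt l) {i j k : L}
    (hij : i ≠ j) (hjk : j ≠ k) (hik : i ≠ k) (bij : bt i = bt j) (bjk : bt j = bt k) :
    asym (wf ψ) σ i j k = 0 := by
  have bsw : ∀ i j : L, bt i = bt j → ∀ l, bt (Equiv.swap i j l) = bt l := by
    intro i j h l
    rw [Equiv.swap_apply_def]; split_ifs with q1 q2
    · rw [q1, h]
    · rw [q2, h]
    · rfl
  have main : ∀ τ : Equiv.Perm L, (∀ l, bs (τ l) = bt l) → wf ψ τ ≠ 0 →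
      asym (wf ψ) τ i j k = 0 := by
    intro τ hτ hne
    have hex : ∃ w, Rep τ w ∧ ∀ l, l ∈ w := by
      by_contra h
      exact hne (wf_zero fun w h1 h2 => h ⟨w, h1, h2⟩)
    obtain ⟨w, hw, hf⟩ := hex
    obtain ⟨X, Y, Z, h | h⟩ := arrange hij hjk hik hf
    · exact asym_wf_full hrot hsw hτ hij hjk hik bij bjk (hw.rotated h)
        (fun l => h.perm.mem_iff.1 (hf l))
    · rw [asym_comm]
      exact asym_wf_full hrot hsw hτ hik hjk.symm hij (bij.trans bjk) bjk.symm (hw.rotated h)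
        (fun l => h.perm.mem_iff.1 (hf l))
  have main' : ∀ π : Equiv.Perm L, (∀ l, bt (π l) = bt l) → wf ψ (σ * π) ≠ 0 →
      asym (wf ψ) (σ * π) i j k = 0 := fun π hπ h => main _ (fun l => by
        rw [Equiv.Perm.mul_apply, hσ, hπ]) h
  obtain ⟨s1, s2, s3, s4, s5⟩ := asym_shift (wf ψ) σ hij hjk hik
  by_contra hne
  have k0 : wf ψ σ = 0 := by by_contra h; exact hne (main σ hσ h)
  have k1 : wf ψ (σ * Equiv.swap i j) = 0 := by
    by_contra h; have := main' _ (bsw _ _ bij) h; rw [s1, neg_eq_zero] at this; exact hne this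
  have k2 : wf ψ (σ * Equiv.swap j k) = 0 := by
    by_contra h; have := main' _ (bsw _ _ bjk) h; rw [s2, neg_eq_zero] at this; exact hne this
  have k3 : wf ψ (σ * Equiv.swap i k) = 0 := by
    by_contra h; have := main' _ (bsw _ _ (bij.trans bjk)) h
    rw [s3, neg_eq_zero] at this; exact hne this
  have k4 : wf ψ (σ * cyc3 i j k) = 0 := by
    by_contra h; have := main' _ (fun l => by
      unfold cyc3; rw [Equiv.Perm.mul_apply, bsw _ _ bij, bsw _ _ bjk]) h
    rw [s4] at this; exact hne this
  have k5 : wf ψ (σ * cyc3 i k j) = 0 := by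
    by_contra h; have := main' _ (fun l => by
      unfold cyc3; rw [Equiv.Perm.mul_apply, bsw _ _ (bij.trans bjk), bsw _ _ bjk.symm]) h
    rw [s5] at this; exact hne this
  apply hne
  unfold asym
  rw [k0, k1, k2, k3, k4, k5]; ring

end sft
end QR

set_option linter.all false

namespace QR
section fft
variable {E : Type*} {K : Type*} [Field K] {W : Type*}

/-- the elements of `F` in the block `z` -/
noncomputable def blk (b : E → W) (z : W) (F : Finset E) : Finset E := F.filter (fun e => b e = z)

/-- primitive functions -/
structure Prim (b : E → W) (S : Finset E) (k : W → ℕ) (w : Finset E → K) : Prop where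
  supp : ∀ F, w F ≠ 0 → F ⊆ S ∧ ∀ z, (blk b z F).card = k z
  sum : ∀ z, ∀ F0 ⊆ S, (blk b z F0).card < k z →
    ∑ Z ∈ (blk b z S \ F0).powerset, w (F0 ∪ Z) = 0

/-- product of arcs -/
noncomputable def parc (K : Type*) [Field K] : List (E × E) → Finset E → K
  | [], F => if F = ∅ then 1 else 0
  | (i, j) :: m, F => if i ∈ F then (if j ∈ F then 0 else parc K m (F.erase i))
      else (if j ∈ F then - parc K m (F.erase j) else 0)

def verts : List (E × E) → List E
  | [] => []
  | (i, j) :: m => i :: j :: verts m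

/-- number of arcs in a block -/
noncomputable def acount (b : E → W) (z : W) : List (E × E) → ℕ
  | [] => 0
  | (i, _) :: m => (if b i = z then 1 else 0) + acount b z m

def Hom (b : E → W) (m : List (E × E)) : Prop := ∀ p ∈ m, b p.1 = b p.2

theorem parc_notMem {m : List (E × E)} {e : E} (he : e ∉ verts m) {F : Finset E} (hF : e ∈ F) :
    parc K m F = 0 := by
  induction m generalizing F with
  | nil => 
    have : F ≠ ∅ := by rintro rfl; simp at hF
    simp [parc, this]
  | cons p m ih =>
    obtain ⟨i, j⟩ := p
    simp only [verts, List.mem_cons, not_or] at he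
    obtain ⟨h1, h2, h3⟩ := he
    simp only [parc]
    split_ifs
    · rfl
    · exact ih h3 (by simp [hF, h1])
    · rw [ih h3 (by simp [hF, h2]), neg_zero]
    · rfl

theorem blk_erase_eq {b : E → W} {z : W} {F : Finset E} {i : E} (h : b i ≠ z) :
    blk b z (F.erase i) = blk b z F := by
  ext x; simp only [blk, Finset.mem_filter, Finset.mem_erase]
  constructor
  · tauto
  · rintro ⟨h1, h2⟩
    exact ⟨⟨by rintro rfl; exact h h2, h1⟩, h2⟩

theorem blk_erase_card {b : E → W} {z : W} {F : Finset E} {i : E} (h : b i = z) (hi : i ∈ F) :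
    (blk b z (F.erase i)).card + 1 = (blk b z F).card := by
  have : blk b z (F.erase i) = (blk b z F).erase i := by
    ext x; simp only [blk, Finset.mem_filter, Finset.mem_erase]; tauto
  rw [this]
  exact Finset.card_erase_add_one (by simp [blk, h, hi])

theorem parc_supp {b : E → W} {m : List (E × E)} (hb : Hom b m) {F : Finset E}
    (hF : parc K m F ≠ 0) : (∀ e ∈ F, e ∈ verts m) ∧ ∀ z, (blk b z F).card = acount b z m := by
  induction m generalizing F with
  | nil => 
    have : F = ∅ := by by_contra h; simp [parc, h] at hF
    subst this
    simp [blk, acount]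
  | cons p m ih =>
    obtain ⟨i, j⟩ := p
    have hb' : Hom b m := fun p hp => hb p (by simp [hp])
    have hij : b i = b j := hb (i, j) (by simp)
    have key : ∀ q, b q = b i → (q = i ∨ q = j) → q ∈ F → parc K m (F.erase q) ≠ 0 →
       (∀ e ∈ F, e ∈ verts ((i, j) :: m)) ∧ ∀ z, (blk b z F).card = acount b z ((i, j) :: m) := by
      intro q hq hqij hqF hne
      obtain ⟨h1, h2⟩ := ih hb' hne
      refine ⟨?_, ?_⟩
      · intro e he
        simp only [verts, List.mem_cons]
        by_cases heq : e = q
        · subst heq; tauto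
        · exact Or.inr (Or.inr (h1 e (by simp [he, heq])))
      · intro z
        simp only [acount]
        by_cases hz : b i = z
        · rw [if_pos hz, ← h2 z, ← blk_erase_card (hq.trans hz) hqF, add_comm]
        · rw [if_neg hz, ← h2 z, zero_add, blk_erase_eq (by rw [hq]; exact hz)]
    simp only [parc] at hF
    split_ifs at hF with h1 h2 h2
    · exact absurd rfl hF
    · exact key i rfl (Or.inl rfl) h1 hF
    · exact key j hij.symm (Or.inr rfl) h2 (by simpa using hF)
    · exact absurd rfl hF

theorem union_erase {F Z : Finset E} {i : E} (h : i ∉ Z) : (F ∪ Z).erase i = F.erase i ∪ Z := by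
  ext x; simp only [Finset.mem_erase, Finset.mem_union]
  constructor
  · tauto
  · rintro (h1 | h1)
    · tauto
    · exact ⟨by rintro rfl; exact h h1, Or.inr h1⟩

theorem parc_sum {b : E → W} {z : W} {m : List (E × E)} (hb : Hom b m) (hn : (verts m).Nodup)
    {D F : Finset E} (hD : ∀ e ∈ D, b e = z) (hDF : ∀ e ∈ D, e ∉ F)
    (hv : ∀ e ∈ verts m, b e = z → e ∈ F ∨ e ∈ D)
    (hc : (blk b z F).card < acount b z m) : ∑ Z ∈ D.powerset, parc K m (F ∪ Z) = 0 := by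
  induction m generalizing D F with
  | nil => simp [acount] at hc
  | cons p m ih =>
    obtain ⟨i, j⟩ := p
    have hb' : Hom b m := fun p hp => hb p (by simp [hp])
    have hij : b i = b j := hb (i, j) (by simp)
    simp only [verts, List.nodup_cons, List.mem_cons, not_or] at hn
    obtain ⟨⟨n1, n2⟩, n3, n4⟩ := hn
    simp only [verts, List.mem_cons] at hv
    simp only [parc, acount] at hc ⊢
    by_cases hz : b i = z
    · rw [if_pos hz] at hc
      have hz' : b j = z := hij ▸ hz
      -- one of them in `F`, the other in `D`
      have one : ∀ q r, b q = z → q ∈ F → r ∈ D → q ∉ verts m → r ∉ verts m → q ≠ r →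
          ∑ Z ∈ (D.erase r).powerset, parc K m (F.erase q ∪ Z) = 0 := by
        intro q r hq hqF hrD hqm hrm hqr
        refine ih hb' n4 (fun e he => hD e (Finset.mem_of_mem_erase he)) ?_ ?_ ?_
        · intro e he h
          exact hDF e (Finset.mem_of_mem_erase he) (Finset.mem_of_mem_erase h)
        · intro e he hez
          rcases hv e (Or.inr (Or.inr he)) hez with h | h
          · left; simp only [Finset.mem_erase]; exact ⟨by rintro rfl; exact hqm he, h⟩
          · right; simp only [Finset.mem_erase]; exact ⟨by rintro rfl; exact hrm he, h⟩
        · have := blk_erase_card hq hqF; omega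
      rcases hv i (Or.inl rfl) hz with hi | hi <;> rcases hv j (Or.inr (Or.inl rfl)) hz' with hj | hj
      · apply Finset.sum_eq_zero; intro Z hZ; simp [hi, hj]
      · have hjF := hDF j hj
        refine Eq.trans ?_ (one i j hz hi hj n2 n3 n1)
        conv_lhs => rw [← Finset.insert_erase hj]
        rw [Finset.sum_powerset_insert (by simp)]
        rw [add_eq_left.2]
        · apply Finset.sum_congr rfl
          intro Z hZ
          have hZ' := Finset.mem_powerset.1 hZ
          have hjZ : j ∉ Z := fun h => by simpa using hZ' h
          have hiZ : i ∉ Z := fun h => hDF i (Finset.mem_of_mem_erase (hZ' h)) hi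
          rw [if_pos (by simp [hi]), if_neg (by simp [hjF, hjZ]), union_erase hiZ]
        · apply Finset.sum_eq_zero; intro Z hZ; simp [hi]
      · have hiF := hDF i hi
        have e1 := one j i hz' hj hi n3 n2 (Ne.symm n1)
        rw [← neg_eq_zero, ← Finset.sum_neg_distrib] at e1
        refine Eq.trans ?_ e1
        conv_lhs => rw [← Finset.insert_erase hi]
        rw [Finset.sum_powerset_insert (by simp)]
        rw [add_eq_left.2]
        · apply Finset.sum_congr rfl
          intro Z hZ
          have hZ' := Finset.mem_powerset.1 hZ
          have hiZ : i ∉ Z := fun h => by simpa using hZ' h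
          have hjZ : j ∉ Z := fun h => hDF j (Finset.mem_of_mem_erase (hZ' h)) hj
          rw [if_neg (by simp [hiF, hiZ]), if_pos (by simp [hj]), union_erase hjZ]
        · apply Finset.sum_eq_zero; intro Z hZ; simp [hj]
      · have hiF := hDF i hi
        have hjF := hDF j hj
        have hj' : j ∈ D.erase i := by simp [hj, Ne.symm n1]
        rw [← Finset.insert_erase hi, Finset.sum_powerset_insert (by simp),
          ← Finset.insert_erase hj', Finset.sum_powerset_insert (by simp),
          Finset.sum_powerset_insert (by simp)]
        rw [Finset.sum_eq_zero (s := ((D.erase i).erase j).powerset), zero_add]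
        · rw [add_comm (∑ Z ∈ ((D.erase i).erase j).powerset, _) (∑ Z ∈ ((D.erase i).erase j).powerset, _),
            ← add_assoc, ← Finset.sum_add_distrib, ← Finset.sum_add_distrib]
          apply Finset.sum_eq_zero
          intro Z hZ
          have hZ' := Finset.mem_powerset.1 hZ
          have hiZ : i ∉ Z := fun h => by simpa using hZ' h
          have hjZ : j ∉ Z := fun h => by simpa using hZ' h
          have u1 : (F ∪ insert j Z).erase j = F ∪ Z := by
            rw [Finset.union_insert, Finset.erase_insert (by simp [hjF, hjZ])]
          have u2 : (F ∪ insert i Z).erase i = F ∪ Z := by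
            rw [Finset.union_insert, Finset.erase_insert (by simp [hiF, hiZ])]
          simp only [u1, u2]
          simp [hiF, hiZ, hjF, hjZ, n1, Ne.symm n1]
        · intro Z hZ
          have hZ' := Finset.mem_powerset.1 hZ
          have hiZ : i ∉ Z := fun h => by simpa using hZ' h
          have hjZ : j ∉ Z := fun h => by simpa using hZ' h
          simp [hiF, hiZ, hjF, hjZ]
    · rw [if_neg hz, zero_add] at hc
      have hz' : b j ≠ z := hij ▸ hz
      have hiD : ∀ Z ∈ D.powerset, i ∉ Z := fun Z hZ h => hz (hD i (Finset.mem_powerset.1 hZ h))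
      have hjD : ∀ Z ∈ D.powerset, j ∉ Z := fun Z hZ h => hz' (hD j (Finset.mem_powerset.1 hZ h))
      have one : ∀ q, b q ≠ z → q ∉ verts m → ∑ Z ∈ D.powerset, parc K m (F.erase q ∪ Z) = 0 := by
        intro q hq hqm
        refine ih hb' n4 hD (fun e he h => hDF e he (Finset.mem_of_mem_erase h)) ?_ ?_
        · intro e he hez
          rcases hv e (Or.inr (Or.inr he)) hez with h | h
          · left; simp only [Finset.mem_erase]; exact ⟨by rintro rfl; exact hqm he, h⟩
          · right; exact h
        · rwa [blk_erase_eq hq]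
      by_cases hi : i ∈ F <;> by_cases hj : j ∈ F
      · apply Finset.sum_eq_zero; intro Z hZ; simp [hi, hj]
      · refine Eq.trans ?_ (one i hz n2)
        apply Finset.sum_congr rfl
        intro Z hZ
        rw [if_pos (by simp [hi]), if_neg (by simp [hj, hjD Z hZ]), union_erase (hiD Z hZ)]
      · have e1 := one j hz' n3
        rw [← neg_eq_zero, ← Finset.sum_neg_distrib] at e1
        refine Eq.trans ?_ e1
        apply Finset.sum_congr rfl
        intro Z hZ
        rw [if_neg (by simp [hi, hiD Z hZ]), if_pos (by simp [hj]), union_erase (hjD Z hZ)]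
      · apply Finset.sum_eq_zero; intro Z hZ; simp [hi, hj, hiD Z hZ, hjD Z hZ]

theorem parc_prim {b : E → W} {m : List (E × E)} (hb : Hom b m) (hn : (verts m).Nodup)
    {S : Finset E} (hS : ∀ e ∈ verts m, e ∈ S) {k : W → ℕ} (hk : ∀ z, acount b z m = k z) :
    Prim b S k (parc K m) := by
  refine ⟨fun F hF => ?_, fun z F hF hc => ?_⟩
  · obtain ⟨h1, h2⟩ := parc_supp hb hF
    exact ⟨fun e he => hS e (h1 e he), fun z => (h2 z).trans (hk z)⟩
  · refine parc_sum (z := z) hb hn ?_ ?_ ?_ ?_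
    · intro e he; simp only [blk, Finset.mem_sdiff, Finset.mem_filter] at he; exact he.1.2
    · intro e he; simp only [blk, Finset.mem_sdiff, Finset.mem_filter] at he; exact he.2
    · intro e he hez
      by_cases h : e ∈ F
      · exact Or.inl h
      · right; simp only [blk, Finset.mem_sdiff, Finset.mem_filter]; exact ⟨⟨hS e he, hez⟩, h⟩
    · rw [hk]; exact hc

theorem Prim.weight {b : E → W} {S : Finset E} {k : W → ℕ} {w : Finset E → K}
    (hw : Prim b S k w) {F : Finset E} (hF : w F ≠ 0) (z : W) :
    2 * k z ≤ (blk b z S).card := by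
  by_contra hlt
  push Not at hlt
  obtain ⟨hFS, hFk⟩ := hw.supp F hF
  set R := F \ blk b z F with hR
  have hRz : ∀ e ∈ R, b e ≠ z := by
    intro e he; simp only [hR, blk, Finset.mem_sdiff, Finset.mem_filter, not_and] at he
    exact he.2 he.1
  have hRS : R ⊆ S := Finset.sdiff_subset.trans hFS
  -- sums over sets containing A avoiding B
  let s : Finset E → Finset E → K := fun A B => ∑ Z ∈ ((blk b z S \ A) \ B).powerset, w (R ∪ A ∪ Z)
  have s0 : ∀ A ⊆ blk b z S, A.card < k z → s A ∅ = 0 := by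
    intro A hA hc
    have hb : blk b z (R ∪ A) = A := by
      ext x; simp only [blk, Finset.mem_filter, Finset.mem_union]
      constructor
      · rintro ⟨h1 | h1, h2⟩
        · exact absurd h2 (hRz x h1)
        · exact h1
      · intro h; exact ⟨Or.inr h, by have := hA h; simp only [blk, Finset.mem_filter] at this; exact this.2⟩
    have := hw.sum z (R ∪ A) (Finset.union_subset hRS (hA.trans (Finset.filter_subset _ _))) (by rwa [hb])
    have e : blk b z S \ (R ∪ A) = (blk b z S \ A) \ ∅ := by
      ext x; simp only [Finset.mem_sdiff, Finset.mem_union]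
      constructor
      · simp; tauto
      · rintro ⟨⟨h1, h2⟩, _⟩
        refine ⟨h1, ?_⟩
        rintro (h | h)
        · exact hRz x h (by simp only [blk, Finset.mem_filter] at h1; exact h1.2)
        · exact h2 h
    rw [e] at this
    exact this
  have srec : ∀ A B : Finset E, ∀ x ∈ blk b z S, x ∉ A → x ∉ B →
      s A B = s A (insert x B) + s (insert x A) B := by
    intro A B x hx hxA hxB
    have e : (blk b z S \ A) \ B = insert x ((blk b z S \ A) \ insert x B) := by
      ext y; simp only [Finset.mem_sdiff, Finset.mem_insert]
      by_cases hyx : y = x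
      · subst hyx; simp [hx, hxA, hxB]
      · simp [hyx]
    have e' : (blk b z S \ A) \ insert x B = (blk b z S \ insert x A) \ B := by
      ext y; simp only [Finset.mem_sdiff, Finset.mem_insert]; tauto
    show ∑ Z ∈ ((blk b z S \ A) \ B).powerset, w (R ∪ A ∪ Z) = _
    rw [e, Finset.sum_powerset_insert (by simp)]
    congr 1
    show _ = ∑ Z ∈ ((blk b z S \ insert x A) \ B).powerset, w (R ∪ insert x A ∪ Z)
    rw [← e']
    apply Finset.sum_congr rfl
    intro Z _
    congr 1
    ext y; simp only [Finset.mem_union, Finset.mem_insert]; tauto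
  have sB : ∀ B : Finset E, ∀ A : Finset E, A ⊆ blk b z S → B ⊆ blk b z S → Disjoint A B →
      A.card + B.card ≤ k z → s A B = (-1) ^ B.card * s (A ∪ B) ∅ := by
    intro B
    induction B using Finset.induction_on with
    | empty => intro A _ _ _ _; simp
    | insert x B hx ih =>
      intro A hA hB hd hc
      rw [Finset.card_insert_of_notMem hx] at hc ⊢
      have hxA : x ∉ A := fun h => Finset.disjoint_left.1 hd h (Finset.mem_insert_self _ _)
      have hxS := hB (Finset.mem_insert_self x B)
      have hBS : B ⊆ blk b z S := (Finset.subset_insert _ _).trans hB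
      have hdB : Disjoint A B := hd.mono_right (Finset.subset_insert _ _)
      have r := srec A B x hxS hxA hx
      have i1 := ih A hA hBS hdB (by omega)
      rw [s0 (A ∪ B) (Finset.union_subset hA hBS) (by
        rw [Finset.card_union_of_disjoint hdB]; omega), mul_zero] at i1
      have i2 := ih (insert x A) (Finset.insert_subset hxS hA) hBS
        (by rw [Finset.disjoint_insert_left]; exact ⟨hx, hdB⟩)
        (by rw [Finset.card_insert_of_notMem hxA]; omega)
      rw [i1, i2] at r
      have e : insert x A ∪ B = A ∪ insert x B := by
        ext y; simp only [Finset.mem_union, Finset.mem_insert]; tauto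
      rw [e] at r
      rw [pow_succ]
      linear_combination -r
  have hFS' : blk b z F ⊆ blk b z S := Finset.filter_subset_filter _ hFS
  have h1 := sB (blk b z F) ∅ (by simp) hFS' (by simp) (by simp [hFk z])
  have wz : ∀ G, (blk b z G).card ≠ k z → w G = 0 := by
    intro G hG; by_contra h; exact hG ((hw.supp G h).2 z)
  have hbk : ∀ X ⊆ blk b z S, blk b z (R ∪ X) = X := by
    intro A hA
    ext x; simp only [blk, Finset.mem_filter, Finset.mem_union]
    constructor
    · rintro ⟨h1 | h1, h2⟩
      · exact absurd h2 (hRz x h1)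
      · exact h1
    · intro h; exact ⟨Or.inr h, by have := hA h; simp only [blk, Finset.mem_filter] at this; exact this.2⟩
  have h2 : s ∅ (blk b z F) = 0 := by
    apply Finset.sum_eq_zero
    intro Z hZ
    have hZ' := Finset.mem_powerset.1 hZ
    rw [Finset.union_empty]
    apply wz
    rw [hbk Z (hZ'.trans (Finset.sdiff_subset.trans Finset.sdiff_subset))]
    have := Finset.card_le_card hZ'
    rw [Finset.sdiff_empty, Finset.card_sdiff_of_subset hFS', hFk z] at this
    omega
  have h3 : s (∅ ∪ blk b z F) ∅ = w F := by
    rw [Finset.empty_union]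
    show ∑ Z ∈ ((blk b z S \ blk b z F) \ ∅).powerset, w (R ∪ blk b z F ∪ Z) = _
    have hRF : R ∪ blk b z F = F := Finset.sdiff_union_of_subset (Finset.filter_subset _ _)
    rw [hRF, Finset.sum_eq_single ∅]
    · simp
    · intro Z hZ hne
      have hZ' := Finset.mem_powerset.1 hZ
      rw [Finset.sdiff_empty] at hZ'
      apply wz
      have : blk b z (F ∪ Z) = blk b z F ∪ Z := by
        conv_lhs => rw [← hRF, Finset.union_assoc]
        exact hbk _ (Finset.union_subset hFS' (hZ'.trans Finset.sdiff_subset))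
      rw [this, Finset.card_union_of_disjoint, hFk z]
      · have := Finset.card_pos.2 (Finset.nonempty_of_ne_empty hne); omega
      · exact (Finset.subset_sdiff.1 hZ').2.symm
    · intro h; simp at h
  rw [h2, h3] at h1
  have : ((-1 : K) ^ (blk b z F).card) ≠ 0 := pow_ne_zero _ (neg_ne_zero.2 one_ne_zero)
  rcases mul_eq_zero.1 h1.symm with h | h
  · exact this h
  · exact hF h

end fft
end QR

set_option linter.all false

namespace QR
section fft
variable {E : Type*} {K : Type*} [Field K] {W : Type*}

theorem Prim.zero {b : E → W} {S : Finset E} {k : W → ℕ} : Prim b S k (0 : Finset E → K) :=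
  ⟨fun F h => absurd rfl h, fun z F _ _ => by simp⟩

theorem Prim.add {b : E → W} {S : Finset E} {k : W → ℕ} {w w' : Finset E → K}
    (h : Prim b S k w) (h' : Prim b S k w') : Prim b S k (w + w') := by
  refine ⟨fun F hF => ?_, fun z F h1 h2 => ?_⟩
  · by_cases hw : w F = 0
    · exact h'.supp F (by simpa [hw] using hF)
    · exact h.supp F hw
  · simp only [Pi.add_apply, Finset.sum_add_distrib, h.sum z F h1 h2, h'.sum z F h1 h2, add_zero]

theorem Prim.smul {b : E → W} {S : Finset E} {k : W → ℕ} {w : Finset E → K} (c : K)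
    (h : Prim b S k w) : Prim b S k (c • w) := by
  refine ⟨fun F hF => ?_, fun z F h1 h2 => ?_⟩
  · exact h.supp F (by rintro h0; exact hF (by simp [h0]))
  · simp only [Pi.smul_apply, smul_eq_mul, ← Finset.mul_sum, h.sum z F h1 h2, mul_zero]

/-- the set of arc products -/
def arcSet (K : Type*) [Field K] (b : E → W) (S : Finset E) (k : W → ℕ) : Set (Finset E → K) :=
  {f | ∃ m, Hom b m ∧ (verts m).Nodup ∧ (∀ e ∈ verts m, e ∈ S) ∧ (∀ z, acount b z m = k z) ∧
    f = parc K m}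

theorem prim_of_span {b : E → W} {S : Finset E} {k : W → ℕ} {w : Finset E → K}
    (h : w ∈ Submodule.span K (arcSet K b S k)) : Prim b S k w := by
  induction h using Submodule.span_induction with
  | mem x hx => obtain ⟨m, h1, h2, h3, h4, rfl⟩ := hx; exact parc_prim h1 h2 h3 h4
  | zero => exact Prim.zero
  | add x y _ _ hx hy => exact hx.add hy
  | smul c x _ hx => exact hx.smul c

theorem verts_filter {b : E → W} {m : List (E × E)} (hb : Hom b m) (z : W) :
    ((verts m).filter (fun e => b e = z)).length = 2 * acount b z m := by
  induction m with
  | nil => simp [verts, acount]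
  | cons p m ih =>
    obtain ⟨i, j⟩ := p
    have hij : b i = b j := hb (i, j) (by simp)
    have := ih (fun p hp => hb p (by simp [hp]))
    by_cases h : b i = z
    · simp [verts, acount, h, ← hij, this]; omega
    · simp [verts, acount, h, ← hij, this]

theorem Prim.mem_span {b : E → W} (S : Finset E) : ∀ {k : W → ℕ} {w : Finset E → K},
    Prim b S k w → w ∈ Submodule.span K (arcSet K b S k) := by
  induction S using Finset.induction_on with
  | empty =>
    intro k w h
    by_cases h0 : w ∅ = 0
    · have : w = 0 := by
        ext F; by_contra hF
        have := Finset.subset_empty.1 (h.supp F hF).1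
        subst this; exact hF h0
      rw [this]; exact zero_mem _
    · have : w = w ∅ • parc K [] := by
        ext F
        by_cases hF : F = ∅
        · subst hF; simp [parc]
        · simp only [Pi.smul_apply, parc, if_neg hF, smul_zero]
          by_contra h1
          exact hF (Finset.subset_empty.1 (h.supp F h1).1)
      rw [this]
      refine Submodule.smul_mem _ _ (Submodule.subset_span ⟨[], ?_, ?_, ?_, ?_, rfl⟩)
      · intro p hp; simp at hp
      · simp [verts]
      · simp [verts]
      · intro z; rw [← (h.supp ∅ h0).2 z]; simp [acount, blk]
  | insert e S he ih =>
    -- first the case of functions vanishing on sets containing `e`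
    have key : ∀ {k : W → ℕ} {w : Finset E → K}, Prim b (insert e S) k w → 
        (∀ F, e ∈ F → w F = 0) → w ∈ Submodule.span K (arcSet K b (insert e S) k) := by
      intro k w h hv
      have : Prim b S k w := by
        refine ⟨fun F hF => ?_, fun z F h1 h2 => ?_⟩
        · refine ⟨?_, (h.supp F hF).2⟩
          intro x hx
          rcases Finset.mem_insert.1 ((h.supp F hF).1 hx) with rfl | h1
          · exact absurd (hv F hx) hF
          · exact h1
        · rw [← h.sum z F (h1.trans (Finset.subset_insert _ _)) h2]
          apply Finset.sum_subset
          · apply Finset.powerset_mono.2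
            apply Finset.sdiff_subset_sdiff _ (le_refl _)
            exact Finset.filter_subset_filter _ (Finset.subset_insert _ _)
          · intro Z hZ hZ'
            apply hv
            by_contra hn
            apply hZ'
            rw [Finset.mem_powerset] at hZ ⊢
            intro x hx
            have := hZ hx
            simp only [blk, Finset.mem_sdiff, Finset.mem_filter, Finset.mem_insert] at this ⊢
            rcases this with ⟨⟨rfl | h3, h4⟩, h5⟩
            · exact absurd (Finset.mem_union_right _ hx) hn
            · exact ⟨⟨h3, h4⟩, h5⟩
      refine Submodule.span_mono ?_ (ih this)
      rintro f ⟨m, h1, h2, h3, h4, h5⟩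
      exact ⟨m, h1, h2, fun e he => Finset.mem_insert_of_mem (h3 e he), h4, h5⟩
    intro k w h
    by_cases hw' : ∀ F, e ∈ F → w F = 0
    · exact key h hw'
    push Not at hw'
    obtain ⟨F1, heF1, hF1⟩ := hw'
    have hk1 : 1 ≤ k (b e) := by
      rw [← (h.supp F1 hF1).2 (b e)]
      apply Finset.card_pos.2
      exact ⟨e, by simp [blk, heF1]⟩
    have hwt := h.weight hF1 (b e)
    have hbS : (blk b (b e) (insert e S)).card = (blk b (b e) S).card + 1 := by
      have := blk_erase_card (b := b) (z := b e) rfl (Finset.mem_insert_self e S)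
      rw [Finset.erase_insert he] at this
      exact this.symm
    let k' : W → ℕ := fun z => if z = b e then k z - 1 else k z
    let w' : Finset E → K := fun F => if e ∈ F then 0 else w (insert e F)
    have hcard : ∀ (F : Finset E), e ∉ F → ∀ z, (blk b z (insert e F)).card = (blk b z F).card + (if z = b e then 1 else 0) := by
      intro F hF z
      by_cases hz : z = b e
      · have := blk_erase_card (b := b) hz.symm (Finset.mem_insert_self e F)
        rw [Finset.erase_insert hF] at this
        rw [if_pos hz, this]
      · have := blk_erase_eq (b := b) (F := insert e F) (Ne.symm hz)
        rw [Finset.erase_insert hF] at this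
        rw [if_neg hz, this, add_zero]
    have hP : Prim b S k' w' := by
      refine ⟨fun F hF => ?_, fun z F h1 h2 => ?_⟩
      · have hne : e ∉ F := by intro h; simp [w', h] at hF
        simp only [w', if_neg hne] at hF
        obtain ⟨h1, h2⟩ := h.supp _ hF
        refine ⟨fun x hx => ?_, fun z => ?_⟩
        · have := h1 (Finset.mem_insert_of_mem hx)
          exact Finset.mem_of_mem_insert_of_ne this (by rintro rfl; exact hne hx)
        · have := h2 z
          rw [hcard F hne] at this
          simp only [k']
          split_ifs at this ⊢ <;> omega
      · have hne : e ∉ F := fun h => he (h1 h)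
        have := h.sum z (insert e F) (Finset.insert_subset_insert _ h1) (by
          rw [hcard F hne]
          simp only [k'] at h2
          split_ifs at h2 ⊢ <;> omega)
        rw [← this]
        have e1 : blk b z (insert e S) \ insert e F = blk b z S \ F := by
          ext x
          simp only [blk, Finset.mem_sdiff, Finset.mem_filter, Finset.mem_insert, not_or]
          constructor
          · tauto
          · rintro ⟨⟨h3, h4⟩, h5⟩
            exact ⟨⟨Or.inr h3, h4⟩, by rintro rfl; exact he h3, h5⟩
        rw [e1]
        apply Finset.sum_congr rfl
        intro Z hZ
        have : e ∉ F ∪ Z := by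
          intro h
          rcases Finset.mem_union.1 h with h | h
          · exact hne h
          · have := Finset.mem_powerset.1 hZ h
            simp only [blk, Finset.mem_sdiff, Finset.mem_filter] at this
            exact he this.1.1
        simp only [w', if_neg this, Finset.insert_union]
    have hspan := ih hP
    have hex : ∃ w1 ∈ Submodule.span K (arcSet K b (insert e S) k), ∀ F, e ∉ F → w1 (insert e F) = w' F := by
      clear_value w'
      clear hP
      induction hspan using Submodule.span_induction with
      | mem x hx =>
        obtain ⟨m, h1, h2, h3, h4, rfl⟩ := hx
        have hj : ∃ j ∈ blk b (b e) S, j ∉ verts m := by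
          by_contra hcon
          push Not at hcon
          have hsub : blk b (b e) S ⊆ ((verts m).filter (fun x => b x = b e)).toFinset := by
            intro x hx
            rw [List.mem_toFinset, List.mem_filter]
            have hx' := hx
            simp only [blk, Finset.mem_filter] at hx'
            exact ⟨hcon x hx, by simpa using hx'.2⟩
          have c1 := Finset.card_le_card hsub
          have c2 := List.toFinset_card_le ((verts m).filter (fun x => b x = b e))
          have c3 := verts_filter h1 (b e)
          rw [h4 (b e)] at c3
          simp only [k', if_true] at c3
          omega
        obtain ⟨j, hj, hjm⟩ := hj
        simp only [blk, Finset.mem_filter] at hj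
        have hej : e ≠ j := by rintro rfl; exact he hj.1
        refine ⟨parc K ((e, j) :: m), Submodule.subset_span ⟨(e, j) :: m, ?_, ?_, ?_, ?_, rfl⟩, ?_⟩
        · intro p hp
          rcases List.mem_cons.1 hp with rfl | hp
          · exact hj.2.symm
          · exact h1 p hp
        · simp only [verts, List.nodup_cons, List.mem_cons, not_or]
          exact ⟨⟨hej, fun h => he (h3 e h)⟩, hjm, h2⟩
        · intro x hx
          simp only [verts, List.mem_cons] at hx
          rcases hx with rfl | rfl | hx
          · simp
          · simp [hj.1]
          · simp [h3 x hx]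
        · intro z
          simp only [acount, h4 z, k']
          by_cases hz : z = b e
          · rw [if_pos hz.symm, if_pos hz, hz]; omega
          · rw [if_neg (Ne.symm hz), if_neg hz, zero_add]
        · intro F hF
          simp only [parc]
          rw [if_pos (Finset.mem_insert_self _ _)]
          by_cases hjF : j ∈ F
          · rw [if_pos (Finset.mem_insert_of_mem hjF), parc_notMem hjm hjF]
          · rw [if_neg (by simp [hjF, Ne.symm hej]), Finset.erase_insert hF]
      | zero => exact ⟨0, zero_mem _, fun F _ => rfl⟩
      | add x y _ _ hx hy =>
        obtain ⟨a, ha, ha'⟩ := hx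
        obtain ⟨c, hc, hc'⟩ := hy
        exact ⟨a + c, add_mem ha hc, fun F hF => by simp [ha' F hF, hc' F hF]⟩
      | smul c x _ hx =>
        obtain ⟨a, ha, ha'⟩ := hx
        exact ⟨c • a, Submodule.smul_mem _ _ ha, fun F hF => by simp [ha' F hF]⟩
    obtain ⟨w1, hw1, hw1'⟩ := hex
    have h2 := key (w := w + (-1 : K) • w1) (h.add ((prim_of_span hw1).smul _)) (by
      intro F hF
      have := hw1' (F.erase e) (by simp)
      rw [Finset.insert_erase hF] at this
      simp [this, w', Finset.insert_erase hF])
    have e2 : w = (w + (-1 : K) • w1) + w1 := by ext F; simp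
    rw [e2]
    exact add_mem h2 hw1

end fft
end QR

set_option linter.all false

namespace QR
section fft
variable {E : Type*} {K : Type*} [Field K] {W : Type*}

/-- value of an arc -/
noncomputable def av (K : Type*) [Field K] (p q : Prop) : K :=
  if p then (if q then 0 else 1) else (if q then -1 else 0)

theorem mem_verts {m : List (E × E)} {p : E × E} (h : p ∈ m) : p.1 ∈ verts m ∧ p.2 ∈ verts m := by
  induction m with
  | nil => simp at h
  | cons q m ih =>
    rcases List.mem_cons.1 h with rfl | h
    · simp [verts]
    · have := ih h; simp [verts, this]

theorem parc_eq {m : List (E × E)} (hn : (verts m).Nodup) {F : Finset E}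
    (hF : ∀ e ∈ F, e ∈ verts m) :
    parc K m F = (m.map (fun p => av K (p.1 ∈ F) (p.2 ∈ F))).prod := by
  induction m generalizing F with
  | nil =>
    have : F = ∅ := Finset.eq_empty_of_forall_notMem (fun e he => by simpa [verts] using hF e he)
    simp [parc, this]
  | cons p m ih =>
    obtain ⟨i, j⟩ := p
    simp only [verts, List.nodup_cons, List.mem_cons, not_or] at hn hF
    obtain ⟨⟨n1, n2⟩, n3, n4⟩ := hn
    have red : ∀ q, q ∉ verts m → (m.map (fun p => av K (p.1 ∈ F.erase q) (p.2 ∈ F.erase q))) =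
        (m.map (fun p => av K (p.1 ∈ F) (p.2 ∈ F))) := by
      intro q hq
      apply List.map_congr_left
      intro p hp
      have h1 : p.1 ≠ q := by rintro rfl; exact hq (mem_verts hp).1
      have h2 : p.2 ≠ q := by rintro rfl; exact hq (mem_verts hp).2
      simp [h1, h2]
    simp only [parc, List.map_cons, List.prod_cons, av]
    by_cases hi : i ∈ F <;> by_cases hj : j ∈ F
    · simp [hi, hj]
    · simp only [hi, hj, if_true, if_false, one_mul]
      rw [ih n4, red i n2]; · rfl
      intro e he
      have he' := hF e (Finset.mem_of_mem_erase he)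
      rcases he' with rfl | rfl | h
      · simp at he
      · exact absurd (Finset.mem_of_mem_erase he) hj
      · exact h
    · simp only [hi, hj, if_true, if_false]
      rw [ih n4, red j n3]; · simp [av]
      intro e he
      have he' := hF e (Finset.mem_of_mem_erase he)
      rcases he' with rfl | rfl | h
      · exact absurd (Finset.mem_of_mem_erase he) hi
      · simp at he
      · exact h
    · simp [hi, hj]

/-- evaluation of a matching -/
noncomputable def ev (K : Type*) [Field K] (D : Finset E) (m : List (E × E)) (F : Finset E) : K :=
  if F ⊆ D then (m.map (fun p => av K (p.1 ∈ F) (p.2 ∈ F))).prod else 0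

theorem ev_perm {D : Finset E} {m m' : List (E × E)} (h : m.Perm m') : ev K D m = ev K D m' := by
  ext F; simp only [ev, (h.map _).prod_eq]

theorem plucker {D : Finset E} (i j k l : E) (m : List (E × E)) :
    ev K D ((i, j) :: (k, l) :: m) = ev K D ((i, k) :: (j, l) :: m) - ev K D ((i, l) :: (j, k) :: m) := by
  ext F
  simp only [ev, Pi.sub_apply, List.map_cons, List.prod_cons]
  split_ifs with h
  · simp only [← mul_assoc, ← sub_mul]
    congr 1
    simp only [av]
    by_cases h1 : i ∈ F <;> by_cases h2 : j ∈ F <;> by_cases h3 : k ∈ F <;> by_cases h4 : l ∈ F <;>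
      simp [h1, h2, h3, h4]
  · simp

theorem count_le {b : E → W} {z : W} {c : E → Prop} {m : List (E × E)} (hb : Hom b m)
    (h : ∀ p ∈ m, b p.1 = z → c p.1 ∨ c p.2) :
    ((verts m).countP (fun e => b e = z ∧ ¬ c e) ≤ (verts m).countP (fun e => b e = z ∧ c e)) ∧
    ((∃ p ∈ m, b p.1 = z ∧ c p.1 ∧ c p.2) →
      (verts m).countP (fun e => b e = z ∧ ¬ c e) < (verts m).countP (fun e => b e = z ∧ c e)) := by
  induction m with
  | nil => simp [verts]
  | cons p m ih =>
    obtain ⟨i, j⟩ := p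
    have hij : b i = b j := hb (i, j) (by simp)
    obtain ⟨h1, h2⟩ := ih (fun p hp => hb p (by simp [hp])) (fun p hp => h p (by simp [hp]))
    have h3 := h (i, j) (by simp)
    simp only [verts, List.countP_cons, ← hij, List.mem_cons, exists_eq_or_imp, decide_eq_true_eq] at h3 ⊢
    generalize (verts m).countP (fun e => decide (b e = z ∧ ¬ c e)) = A at *
    generalize (verts m).countP (fun e => decide (b e = z ∧ c e)) = B at *
    by_cases hz : b i = z
    · by_cases ci : c i <;> by_cases cj : c j
      · simp [hz, ci, cj]; omega
      · simp [hz, ci, cj]; refine ⟨h1, fun p q hp hz' h4 h5 => h2 ⟨(p, q), hp, hz', h4, h5⟩⟩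
      · simp [hz, ci, cj]; refine ⟨h1, fun p q hp hz' h4 h5 => h2 ⟨(p, q), hp, hz', h4, h5⟩⟩
      · simp [hz, ci, cj] at h3
    · simp [hz]; refine ⟨h1, fun p q hp hz' h4 h5 => h2 ⟨(p, q), hp, hz', h4, h5⟩⟩

theorem exists_perm_cons {α : Type*} {m : List α} {p : α} (h : p ∈ m) : ∃ m', m.Perm (p :: m') := by
  obtain ⟨s, t, rfl⟩ := List.append_of_mem h
  exact ⟨s ++ t, List.perm_middle⟩

theorem verts_perm {m m' : List (E × E)} (h : m.Perm m') : (verts m).Perm (verts m') := by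
  have : ∀ m : List (E × E), verts m = m.flatMap (fun p => [p.1, p.2]) := by
    intro m; induction m with
    | nil => rfl
    | cons p m ih => obtain ⟨i, j⟩ := p; simp [verts, ih]
  rw [this, this]
  exact h.flatMap_right _

variable {L : Type*} [Fintype L]

/-- the arc product of a permutation -/
noncomputable def gS (K : Type*) [Field K] (S : Finset L) (σ : Equiv.Perm L) (F : Finset (L ⊕ L)) : K :=
  if F ⊆ S.disjSum S then ∏ l ∈ S, av K (Sum.inl l ∈ F) (Sum.inr (σ l) ∈ F) else 0

def gSet (K : Type*) [Field K] (bt bs : L → W) (S : Finset L) : Set (Finset (L ⊕ L) → K) :=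
  {f | ∃ σ : Equiv.Perm L, (∀ l, l ∉ S → σ l = l) ∧ (∀ l ∈ S, bs (σ l) = bt l) ∧ f = gS K S σ}

theorem matching_oriented {bt bs : L → W} {S : Finset L} {m : List ((L ⊕ L) × (L ⊕ L))}
    (hb : Hom (Sum.elim bt bs) m) (hn : (verts m).Nodup)
    (hv : ∀ e, e ∈ verts m ↔ e ∈ S.disjSum S)
    (ho : ∀ p ∈ m, (∃ x, p.1 = Sum.inl x) ∧ ∃ y, p.2 = Sum.inr y) :
    ev K (S.disjSum S) m ∈ gSet K bt bs S := by
  have hnp : ∀ p ∈ m, ∀ q ∈ m, (p.1 = q.1 ∨ p.2 = q.2) → p = q := by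
    clear hv hb ho
    induction m with
    | nil => simp
    | cons r m ih =>
      obtain ⟨i, j⟩ := r
      simp only [verts, List.nodup_cons, List.mem_cons, not_or] at hn
      obtain ⟨⟨n1, n2⟩, n3, n4⟩ := hn
      intro p hp q hq h
      rcases List.mem_cons.1 hp with rfl | hp <;> rcases List.mem_cons.1 hq with rfl | hq
      · rfl
      · rcases h with h | h
        · exact absurd (by simp only at h; rw [h]; exact (mem_verts hq).1) n2
        · exact absurd (by simp only at h; rw [h]; exact (mem_verts hq).2) n3
      · rcases h with h | h
        · exact absurd (by simp only at h; rw [← h]; exact (mem_verts hp).1) n2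
        · exact absurd (by simp only at h; rw [← h]; exact (mem_verts hp).2) n3
      · exact ih n4 p hp q hq h
  have hmn : m.Nodup := by
    clear hv hb ho hnp
    induction m with
    | nil => simp
    | cons r m ih =>
      obtain ⟨i, j⟩ := r
      simp only [verts, List.nodup_cons, List.mem_cons, not_or] at hn ⊢
      exact ⟨fun h => hn.1.2 (mem_verts h).1, ih hn.2.2⟩
  have hvm : ∀ e ∈ verts m, ∃ p ∈ m, e = p.1 ∨ e = p.2 := by
    clear hv hb ho hnp hmn hn
    induction m with
    | nil => simp [verts]
    | cons r m ih =>
      obtain ⟨i, j⟩ := r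
      intro e he
      simp only [verts, List.mem_cons] at he
      rcases he with rfl | rfl | he
      · exact ⟨_, List.mem_cons_self, Or.inl rfl⟩
      · exact ⟨_, List.mem_cons_self, Or.inr rfl⟩
      · obtain ⟨p, hp, h⟩ := ih e he
        exact ⟨p, List.mem_cons_of_mem _ hp, h⟩
  have hex : ∀ l : L, ∃ y : L, (l ∈ S → (Sum.inl l, Sum.inr y) ∈ m) ∧ (l ∉ S → y = l) := by
    intro l
    by_cases hl : l ∈ S
    · obtain ⟨p, hp, h⟩ := hvm (Sum.inl l) ((hv _).2 (by simp [hl]))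
      obtain ⟨⟨x, hx⟩, ⟨y, hy⟩⟩ := ho p hp
      rcases h with h | h
      · refine ⟨y, fun _ => ?_, fun h => absurd hl h⟩
        rw [h, ← hy]; exact hp
      · rw [hy] at h; simp at h
    · exact ⟨l, fun h => absurd h hl, fun _ => rfl⟩
  choose f hf1 hf2 using hex
  have hfS : ∀ l ∈ S, f l ∈ S := by
    intro l hl
    have := (hv (Sum.inr (f l))).1 (mem_verts (hf1 l hl)).2
    simpa using this
  have hinj : Function.Injective f := by
    intro x y hxy
    by_cases hx : x ∈ S <;> by_cases hy : y ∈ S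
    · have := hnp _ (hf1 x hx) _ (hf1 y hy) (Or.inr (by simp [hxy]))
      simpa using (Prod.mk.inj this).1
    · have := hfS x hx; rw [hxy, hf2 y hy] at this; exact absurd this hy
    · have := hfS y hy; rw [← hxy, hf2 x hx] at this; exact absurd this hx
    · rw [hf2 x hx, hf2 y hy] at hxy; exact hxy
  refine ⟨Equiv.ofBijective f (Finite.injective_iff_bijective.1 hinj), hf2, ?_, ?_⟩
  · intro l hl
    have := hb _ (hf1 l hl)
    simpa using this.symm
  · ext F
    simp only [ev, gS]
    split_ifs with h
    · rw [← List.prod_toFinset _ hmn]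
      symm
      refine Finset.prod_nbij (fun l => (Sum.inl l, Sum.inr (f l))) ?_ ?_ ?_ ?_
      · intro l hl; simpa using hf1 l hl
      · intro x _ y _ h; simpa using (Prod.mk.inj h).1
      · intro p hp
        have hp' : p ∈ m := by simpa using hp
        obtain ⟨⟨x, hx⟩, ⟨y, hy⟩⟩ := ho p hp'
        have hxS : x ∈ S := by
          have := (hv (Sum.inl x)).1 (hx ▸ (mem_verts hp').1); simpa using this
        refine ⟨x, hxS, ?_⟩
        exact hnp _ (hf1 x hxS) _ hp' (Or.inl hx.symm)
      · intro l hl; rfl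
    · rfl

theorem matching_span {bt bs : L → W} {S : Finset L}
    (hbal : ∀ z, ((S.filter (fun l => bt l = z)).card = (S.filter (fun l => bs l = z)).card))
    (n : ℕ) : ∀ (m : List ((L ⊕ L) × (L ⊕ L))),
    Hom (Sum.elim bt bs) m → (verts m).Nodup → (∀ e, e ∈ verts m ↔ e ∈ S.disjSum S) →
    m.countP (fun p => p.1.isLeft ∧ p.2.isLeft) = n →
    ev K (S.disjSum S) m ∈ Submodule.span K (gSet K bt bs S) := by
  have hcnt : ∀ (m : List ((L ⊕ L) × (L ⊕ L))) (hn : (verts m).Nodup) 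
      (hv : ∀ e, e ∈ verts m ↔ e ∈ S.disjSum S) (z : W),
      (verts m).countP (fun e => Sum.elim bt bs e = z ∧ e.isLeft) = 
      (verts m).countP (fun e => Sum.elim bt bs e = z ∧ ¬ e.isLeft) := by
    intro m hn hv z
    have e1 : (verts m).toFinset = S.disjSum S := by ext e; rw [List.mem_toFinset, hv]
    rw [List.countP_eq_length_filter, List.countP_eq_length_filter,
      ← List.toFinset_card_of_nodup (hn.filter _), ← List.toFinset_card_of_nodup (hn.filter _),
      List.toFinset_filter, List.toFinset_filter, e1]
    have h1 : (Finset.filter (fun e => decide (Sum.elim bt bs e = z ∧ e.isLeft) = true) (S.disjSum S)) =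
        (S.filter (fun l => bt l = z)).map ⟨Sum.inl, Sum.inl_injective⟩ := by
      ext e; cases e <;> simp
    have h2 : (Finset.filter (fun e => decide (Sum.elim bt bs e = z ∧ ¬ e.isLeft) = true) (S.disjSum S)) =
        (S.filter (fun l => bs l = z)).map ⟨Sum.inr, Sum.inr_injective⟩ := by
      ext e; cases e <;> simp
    rw [h1, h2, Finset.card_map, Finset.card_map, hbal]
  induction n with
  | zero =>
    intro m hb hn hv hc
    rw [List.countP_eq_zero] at hc
    have hc' : ∀ p ∈ m, ¬ (p.1.isLeft ∧ p.2.isLeft) := fun p hp => by simpa using hc p hp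
    have hmix : ∀ p ∈ m, (p.1.isLeft ∧ ¬ p.2.isLeft) ∨ (¬ p.1.isLeft ∧ p.2.isLeft) := by
      intro p hp
      by_contra hcon
      have hbb : ¬ p.1.isLeft ∧ ¬ p.2.isLeft := by have := hc' p hp; tauto
      have := (count_le (b := Sum.elim bt bs) (z := Sum.elim bt bs p.1) (c := fun e => ¬ e.isLeft) hb
        (fun q hq _ => by have := hc' q hq; tauto)).2 ⟨p, hp, rfl, hbb.1, hbb.2⟩
      refine (ne_of_lt this) ?_
      refine (List.countP_congr fun x _ => by simp).trans ((hcnt m hn hv (Sum.elim bt bs p.1)).trans (List.countP_congr fun x _ => by simp))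
    let o : (L ⊕ L) × (L ⊕ L) → (L ⊕ L) × (L ⊕ L) := fun p => if p.1.isLeft then p else p.swap
    have hvp : (verts (m.map o)).Perm (verts m) := by
      clear hb hn hv hc hc' hmix
      induction m with
      | nil => exact List.Perm.refl _
      | cons p m ih =>
        obtain ⟨i, j⟩ := p
        simp only [List.map_cons, o]
        split_ifs
        · exact (ih.cons _).cons _
        · exact ((ih.cons _).cons _).trans (List.Perm.swap _ _ _)
    have hmem : ev K (S.disjSum S) (m.map o) ∈ gSet K bt bs S := by
      apply matching_oriented
      · intro p hp
        obtain ⟨q, hq, rfl⟩ := List.mem_map.1 hp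
        simp only [o]; split_ifs
        · exact hb q hq
        · exact (hb q hq).symm
      · exact hvp.nodup_iff.2 hn
      · intro e; rw [hvp.mem_iff, hv]
      · intro p hp
        obtain ⟨q, hq, rfl⟩ := List.mem_map.1 hp
        obtain ⟨i, j⟩ := q
        have := hmix _ hq
        simp only [o]
        cases i <;> cases j <;> simp at this ⊢
    have heq : ev K (S.disjSum S) m = 
        (m.map (fun p => if p.1.isLeft then (1 : K) else -1)).prod • ev K (S.disjSum S) (m.map o) := by
      ext F
      simp only [ev, Pi.smul_apply, smul_eq_mul]
      split_ifs with h
      · rw [List.map_map, ← List.prod_map_mul]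
        congr 1
        apply List.map_congr_left
        rintro ⟨i, j⟩ _
        simp only [Function.comp, o, av]
        split_ifs <;> simp_all
      · simp
    rw [heq]
    exact Submodule.smul_mem _ _ (Submodule.subset_span hmem)
  | succ n ih =>
    intro m hb hn hv hc
    have h1 : ∃ p ∈ m, p.1.isLeft ∧ p.2.isLeft := by
      have : 0 < m.countP (fun p => p.1.isLeft ∧ p.2.isLeft) := by omega
      simpa using List.countP_pos_iff.1 this
    obtain ⟨⟨i, j⟩, hp, hi, hj⟩ := h1
    simp only at hi hj
    have h2 : ∃ q ∈ m, Sum.elim bt bs q.1 = Sum.elim bt bs i ∧ ¬ q.1.isLeft ∧ ¬ q.2.isLeft := by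
      by_contra hcon
      push Not at hcon
      have := (count_le (b := Sum.elim bt bs) (z := Sum.elim bt bs i) (c := fun e => e.isLeft) hb
        (fun q hq hz => by have := hcon q hq hz; tauto)).2 ⟨(i, j), hp, rfl, hi, hj⟩
      refine (ne_of_lt this) ?_
      refine (List.countP_congr fun x _ => by simp).trans ((hcnt m hn hv (Sum.elim bt bs i)).symm.trans (List.countP_congr fun x _ => by simp))
    obtain ⟨⟨k, l⟩, hq, hz, hk, hl⟩ := h2
    simp only at hz hk hl
    have hne : (k, l) ≠ (i, j) := by rintro h; rw [Prod.mk.injEq] at h; rw [h.1] at hk; exact hk hi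
    obtain ⟨m', hm'⟩ : ∃ m', m.Perm ((i, j) :: (k, l) :: m') := by
      obtain ⟨m1, h1⟩ := exists_perm_cons hp
      obtain ⟨m2, h2⟩ := exists_perm_cons (List.mem_of_ne_of_mem hne (h1.mem_iff.1 hq))
      exact ⟨m2, h1.trans (h2.cons _)⟩
    have hvp := verts_perm hm'
    have hij : Sum.elim bt bs i = Sum.elim bt bs j := hb _ hp
    have hkl : Sum.elim bt bs k = Sum.elim bt bs l := hb _ hq
    have hbm' : Hom (Sum.elim bt bs) m' := fun p hp => hb p (hm'.mem_iff.2 (by simp [hp]))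
    rw [hm'.countP_eq] at hc
    have hc' : m'.countP (fun p => p.1.isLeft ∧ p.2.isLeft) = n := by
      simp [List.countP_cons, hi, hj, hk, hl] at hc
      simpa using hc
    rw [ev_perm hm', plucker]
    have go : ∀ k l, Sum.elim bt bs k = Sum.elim bt bs i → Sum.elim bt bs l = Sum.elim bt bs i →
        ¬ k.isLeft → ¬ l.isLeft → (verts m).Perm (verts ((i, k) :: (j, l) :: m')) → 
        ev K (S.disjSum S) ((i, k) :: (j, l) :: m') ∈ Submodule.span K (gSet K bt bs S) := by
      intro k l hk' hl' hk hl hpm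
      apply ih
      · intro p hp
        rcases List.mem_cons.1 hp with rfl | hp
        · exact hk'.symm
        rcases List.mem_cons.1 hp with rfl | hp
        · exact hij.symm.trans hl'.symm
        · exact hbm' p hp
      · exact hpm.nodup_iff.1 hn
      · intro e; rw [← hpm.mem_iff, hv]
      · simp only [List.countP_cons, hi, hj, hk, hl]
        simpa using hc'
    refine sub_mem (go k l hz (hkl.symm.trans hz) hk hl ?_) (go l k (hkl.symm.trans hz) hz hl hk ?_)
    · refine hvp.trans ?_
      simp only [verts]
      exact List.Perm.cons _ (List.Perm.swap _ _ _)
    · refine hvp.trans ?_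
      simp only [verts]
      refine List.Perm.cons _ ?_
      refine (List.Perm.cons _ (List.Perm.swap _ _ _)).trans (List.Perm.swap _ _ _)

theorem fft {bt bs : L → W} {S : Finset L} {w : Finset (L ⊕ L) → K}
    (hs : ∀ F, w F ≠ 0 → F ⊆ S.disjSum S ∧ ∀ z,
      (blk (Sum.elim bt bs) z F).card = (S.filter (fun l => bt l = z)).card ∧
      (blk (Sum.elim bt bs) z F).card = (S.filter (fun l => bs l = z)).card)
    (hU : ∀ z, ∀ F ⊆ S.disjSum S, 
      w F = ∑ Z ∈ (blk (Sum.elim bt bs) z (S.disjSum S) \ F).powerset, w (F ∪ Z)) :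
    w ∈ Submodule.span K (gSet K bt bs S) := by
  by_cases hw : w = 0
  · rw [hw]; exact zero_mem _
  obtain ⟨F1, hF1⟩ : ∃ F, w F ≠ 0 := by
    by_contra h; push Not at h; exact hw (funext h)
  have hbal : ∀ z, ((S.filter (fun l => bt l = z)).card = (S.filter (fun l => bs l = z)).card) :=
    fun z => ((hs F1 hF1).2 z).1.symm.trans ((hs F1 hF1).2 z).2
  have hP : Prim (Sum.elim bt bs) (S.disjSum S) (fun z => (S.filter (fun l => bt l = z)).card) w := by
    refine ⟨fun F hF => ⟨(hs F hF).1, fun z => ((hs F hF).2 z).1⟩, fun z F hF hc => ?_⟩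
    have h0 : w F = 0 := by
      by_contra h
      have := ((hs F h).2 z).1
      omega
    have := hU z F hF
    rw [h0] at this
    convert this.symm
  refine Submodule.span_le.2 ?_ (hP.mem_span)
  rintro f ⟨m, h1, h2, h3, h4, rfl⟩
  have hcov : ∀ e, e ∈ verts m ↔ e ∈ S.disjSum S := by
    intro e
    refine ⟨h3 e, fun he => ?_⟩
    have c1 := verts_filter h1 (Sum.elim bt bs e)
    rw [h4] at c1
    have c2 := List.toFinset_card_of_nodup (h2.filter (fun x => Sum.elim bt bs x = Sum.elim bt bs e))
    have hsub : ((verts m).filter (fun x => Sum.elim bt bs x = Sum.elim bt bs e)).toFinset ⊆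
        blk (Sum.elim bt bs) (Sum.elim bt bs e) (S.disjSum S) := by
      intro x hx
      rw [List.mem_toFinset, List.mem_filter] at hx
      simp only [blk, Finset.mem_filter]
      exact ⟨h3 x hx.1, by simpa using hx.2⟩
    have c3 : (blk (Sum.elim bt bs) (Sum.elim bt bs e) (S.disjSum S)).card = 
        2 * (S.filter (fun l => bt l = Sum.elim bt bs e)).card := by
      rw [two_mul]
      nth_rewrite 2 [hbal]
      rw [← Finset.card_disjSum]
      congr 1
      ext x; cases x <;> simp [blk]
    have := Finset.eq_of_subset_of_card_le hsub (by rw [c3, c2, c1])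
    have he2 : e ∈ ((verts m).filter (fun x => Sum.elim bt bs x = Sum.elim bt bs e)).toFinset := by
      rw [this]; simp only [blk, Finset.mem_filter]; exact ⟨he, trivial⟩
    rw [List.mem_toFinset, List.mem_filter] at he2
    exact he2.1
  have : parc K m = ev K (S.disjSum S) m := by
    ext F
    simp only [ev]
    split_ifs with h
    · exact parc_eq h2 (fun e he => (hcov e).2 (h he))
    · by_contra hne
      apply h
      intro e he
      exact (hcov e).1 ((parc_supp h1 hne).1 e he)
  rw [this]
  exact matching_span hbal _ m h1 h2 hcov rfl

end fft
end QR

set_option linter.all false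

namespace QR
section theta
variable {K : Type} [Field K] {Q : QuiverData} {Λ : Type} [Fintype Λ]

/-- specialization of the generic matrices -/
noncomputable def theta (arr : Λ → Q.A) (Y : Λ → Matrix (Fin 2) (Fin 2) K) :
    MvPolynomial Q.Var K →ₐ[K] MvPolynomial Λ K :=
  MvPolynomial.aeval (fun v : Q.Var => ∑ l : Λ, if arr l = v.1 then
    MvPolynomial.C (Y l v.2.1 v.2.2) * MvPolynomial.X l else 0)

noncomputable def cf (arr : Λ → Q.A) (Y : Λ → Matrix (Fin 2) (Fin 2) K) (m : Λ →₀ ℕ)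
    (p : MvPolynomial Q.Var K) : K := MvPolynomial.coeff m (theta arr Y p)

variable (arr : Λ → Q.A)

theorem cf_C (Y : Λ → Matrix (Fin 2) (Fin 2) K) (m : Λ →₀ ℕ) (c : K) :
    cf arr Y m (MvPolynomial.C c) = if m = 0 then c else 0 := by
  simp only [cf, theta, MvPolynomial.algHom_C, MvPolynomial.algebraMap_eq, MvPolynomial.coeff_C]
  simp [eq_comm]

theorem cf_add (Y : Λ → Matrix (Fin 2) (Fin 2) K) (m : Λ →₀ ℕ) (p q : MvPolynomial Q.Var K) :
    cf arr Y m (p + q) = cf arr Y m p + cf arr Y m q := by simp [cf]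

theorem cf_smul (Y : Λ → Matrix (Fin 2) (Fin 2) K) (m : Λ →₀ ℕ) (c : K) (p : MvPolynomial Q.Var K) :
    cf arr Y m (c • p) = c * cf arr Y m p := by simp [cf]

theorem cf_mul (Y : Λ → Matrix (Fin 2) (Fin 2) K) (m : Λ →₀ ℕ) (p q : MvPolynomial Q.Var K) :
    cf arr Y m (p * q) = ∑ x ∈ Finset.HasAntidiagonal.antidiagonal m, cf arr Y x.1 p * cf arr Y x.2 q := by
  simp only [cf, map_mul, MvPolynomial.coeff_mul]

theorem cf_mul_X (Y : Λ → Matrix (Fin 2) (Fin 2) K) (m : Λ →₀ ℕ) (p : MvPolynomial Q.Var K)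
    (v : Q.Var) : cf arr Y m (p * MvPolynomial.X v) =
      ∑ l : Λ, if arr l = v.1 ∧ m l ≠ 0 then Y l v.2.1 v.2.2 * cf arr Y (m - Finsupp.single l 1) p
        else 0 := by
  simp only [cf, map_mul]
  have : theta arr Y (MvPolynomial.X v) = ∑ l : Λ, if arr l = v.1 then
    MvPolynomial.C (Y l v.2.1 v.2.2) * MvPolynomial.X l else 0 := by simp [theta]
  rw [this, Finset.mul_sum, MvPolynomial.coeff_sum]
  apply Finset.sum_congr rfl
  intro l _
  by_cases h : arr l = v.1
  · rw [if_pos h, mul_left_comm, MvPolynomial.coeff_C_mul, MvPolynomial.coeff_mul_X']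
    by_cases h2 : m l = 0
    · simp [h, h2]
    · simp [h, h2]
  · simp [h]

theorem cf_congr {Y Y' : Λ → Matrix (Fin 2) (Fin 2) K} (p : MvPolynomial Q.Var K) :
    ∀ (m : Λ →₀ ℕ), (∀ l, m l ≠ 0 → Y l = Y' l) → cf arr Y m p = cf arr Y' m p := by
  induction p using MvPolynomial.induction_on with
  | C c => intro m _; rw [cf_C, cf_C]
  | add p q hp hq => intro m h; rw [cf_add, cf_add, hp m h, hq m h]
  | mul_X p v ih =>
    intro m h
    rw [cf_mul_X, cf_mul_X]
    apply Finset.sum_congr rfl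
    intro l _
    split_ifs with hl
    · rw [h l hl.2, ih]
      intro l' hl'
      apply h
      intro h0; apply hl'; simp [h0]
    · rfl

theorem cf_linear (l₀ : Λ) (Y : Λ → Matrix (Fin 2) (Fin 2) K) (A B : Matrix (Fin 2) (Fin 2) K) (r s : K)
    (p : MvPolynomial Q.Var K) : ∀ (m : Λ →₀ ℕ), m l₀ = 1 →
    cf arr (Function.update Y l₀ (r • A + s • B)) m p =
      r * cf arr (Function.update Y l₀ A) m p + s * cf arr (Function.update Y l₀ B) m p := by
  induction p using MvPolynomial.induction_on with
  | C c =>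
    intro m h
    have : m ≠ 0 := by rintro rfl; simp at h
    simp [cf_C, this]
  | add p q hp hq => intro m h; rw [cf_add, cf_add, cf_add, hp m h, hq m h]; ring
  | mul_X p v ih =>
    intro m h
    rw [cf_mul_X, cf_mul_X, cf_mul_X, Finset.mul_sum, Finset.mul_sum, ← Finset.sum_add_distrib]
    apply Finset.sum_congr rfl
    intro l _
    split_ifs with hl
    · by_cases hll : l = l₀
      · subst hll
        have c : ∀ A B, cf arr (Function.update Y l A) (m - Finsupp.single l 1) p =
            cf arr (Function.update Y l B) (m - Finsupp.single l 1) p := by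
          intro A B
          apply cf_congr
          intro l' hl'
          have : l' ≠ l := by rintro rfl; apply hl'; simp [h]
          simp [this]
        simp only [Function.update_self]
        rw [c A (r • A + s • B), c B (r • A + s • B)]
        simp only [Matrix.add_apply, Matrix.smul_apply, smul_eq_mul]
        ring
      · simp only [Function.update_of_ne hll]
        rw [ih _ (by simp [h, Ne.symm hll])]
        ring
    · simp

theorem cf_zero (Y : Λ → Matrix (Fin 2) (Fin 2) K) (p : MvPolynomial Q.Var K) :
    cf arr Y 0 p = MvPolynomial.constantCoeff p := by
  induction p using MvPolynomial.induction_on with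
  | C c => simp [cf_C]
  | add p q hp hq => rw [cf_add, hp, hq, map_add]
  | mul_X p v ih => rw [cf_mul_X]; simp

theorem cf_inv {p : MvPolynomial Q.Var K} (hp : Q.IsInvariant K p)
    (g : Q.V → Matrix (Fin 2) (Fin 2) K) (hg : ∀ v, IsUnit (g v).det)
    (Y : Λ → Matrix (Fin 2) (Fin 2) K) (m : Λ →₀ ℕ) :
    cf arr (fun l => g (Q.tgt (arr l)) * Y l * (g (Q.src (arr l)))⁻¹) m p = cf arr Y m p := by
  have h : theta arr (fun l => g (Q.tgt (arr l)) * Y l * (g (Q.src (arr l)))⁻¹) =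
      (theta arr Y).comp (MvPolynomial.aeval (Q.actVar K g)) := by
    apply MvPolynomial.algHom_ext
    rintro ⟨a, i, j⟩
    have hX : ∀ (Y : Λ → Matrix (Fin 2) (Fin 2) K) (i j : Fin 2), theta arr Y (MvPolynomial.X (σ := Q.Var) (R := K) (a, i, j)) =
      ∑ l : Λ, if arr l = a then MvPolynomial.C (Y l i j) * MvPolynomial.X l else 0 := by
      intro Y i j; exact MvPolynomial.aeval_X _ _
    have hA : (MvPolynomial.aeval (R := K) (Q.actVar K g) : MvPolynomial Q.Var K →ₐ[K] MvPolynomial Q.Var K) (MvPolynomial.X (σ := Q.Var) (R := K) (a, i, j)) =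
       ∑ k : Fin 2, ∑ l : Fin 2, MvPolynomial.C (g (Q.tgt a) i k * (g (Q.src a))⁻¹ l j) *
      MvPolynomial.X (σ := Q.Var) (R := K) (a, k, l) := MvPolynomial.aeval_X _ _
    rw [AlgHom.comp_apply]
    refine (hX _ i j).trans ?_
    refine Eq.trans ?_ (congrArg (theta arr Y) hA).symm
    simp only [map_sum, map_mul, MvPolynomial.algHom_C, MvPolynomial.algebraMap_eq]
    refine Eq.trans ?_ (Finset.sum_congr rfl fun k _ => Finset.sum_congr rfl fun l _ => 
      congrArg (fun x => MvPolynomial.C (g (Q.tgt a) i k) * MvPolynomial.C ((g (Q.src a))⁻¹ l j) * x) (hX Y k l)).symm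
    simp only [Finset.mul_sum]
    have : ∀ f : Fin 2 → Fin 2 → Λ → MvPolynomial Λ K, (∑ i, ∑ j, ∑ l, f i j l) = ∑ l, ∑ i, ∑ j, f i j l := by
      intro f
      rw [Finset.sum_comm' (t' := Finset.univ) (s' := fun _ => Finset.univ)]
      · rw [Finset.sum_congr rfl (fun j _ => Finset.sum_comm), Finset.sum_comm]
        apply Finset.sum_congr rfl; intro l _; rw [Finset.sum_comm]
      · simp
    rw [this]
    apply Finset.sum_congr rfl
    intro l _
    by_cases hl : arr l = a
    · simp only [hl, if_true]
      simp only [Matrix.mul_apply, Fin.sum_univ_two]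
      simp only [map_add, map_mul]
      ring
    · simp [hl]
  conv_rhs => rw [← hp g hg]
  simp only [cf, h, AlgHom.comp_apply]

end theta
end QR

set_option linter.all false

namespace QR
section slots
variable {K : Type} [Field K] {E : Type*} {W : Type*}

/-- `c` is multilinear in slots of `D` and independent of the others -/
structure ML (D : Finset E) (c : (E → Fin 2 → K) → K) : Prop where
  lin : ∀ e ∈ D, ∀ x a b (r s : K), c (Function.update x e (r • a + s • b)) =
    r * c (Function.update x e a) + s * c (Function.update x e b)
  ind : ∀ x y, (∀ e ∈ D, x e = y e) → c x = c y

variable {D : Finset E} {c : (E → Fin 2 → K) → K}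

theorem ML.expand (h : ML D c) (u v : E → Fin 2 → K) : ∀ (D' : Finset E), D' ⊆ D → ∀ x : E → Fin 2 → K,
    c (fun e => if e ∈ D' then u e + v e else x e) =
      ∑ Z ∈ D'.powerset, c (fun e => if e ∈ Z then v e else if e ∈ D' then u e else x e) := by
  intro D'
  induction D' using Finset.induction_on with
  | empty => intro _ x; simp
  | insert e D' he ih =>
    intro hD x
    have hD' : D' ⊆ D := fun y hy => hD (Finset.mem_insert_of_mem hy)
    have heD : e ∈ D := hD (Finset.mem_insert_self _ _)
    have key : ∀ y : Fin 2 → K, c (Function.update (fun e' => if e' ∈ D' then u e' + v e' else x e') e y) =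
      ∑ Z ∈ D'.powerset, c (fun e' => if e' ∈ Z then v e' else if e' ∈ D' then u e' else
        Function.update x e y e') := by
      intro y
      rw [← ih hD']
      congr 1
      funext e'
      by_cases h' : e' = e
      · subst h'; simp [he]
      · simp [h']
    rw [Finset.sum_powerset_insert he]
    have h1 : (fun e' => if e' ∈ insert e D' then u e' + v e' else x e') =
        Function.update (fun e' => if e' ∈ D' then u e' + v e' else x e') e ((1:K) • u e + (1:K) • v e) := by
      funext e'
      by_cases h' : e' = e
      · subst h'; simp
      · simp [h']
    rw [h1, h.lin e heD, key, key, one_mul, one_mul]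
    congr 1
    · apply Finset.sum_congr rfl
      intro Z hZ
      rw [Finset.mem_powerset] at hZ
      congr 1
      funext e'
      by_cases h' : e' = e
      · subst h'; simp [he]
      · simp [h']
    · apply Finset.sum_congr rfl
      intro Z hZ
      rw [Finset.mem_powerset] at hZ
      congr 1
      funext e'
      by_cases h' : e' = e
      · subst h'
        have : e' ∉ Z := fun hh => he (hZ hh)
        simp [he, this]
      · simp [h']

theorem ML.scale (h : ML D c) (r : E → K) (x : E → Fin 2 → K) :
    c (fun e => r e • x e) = (∏ e ∈ D, r e) * c x := by
  have key : ∀ D' ⊆ D, c (fun e => if e ∈ D' then r e • x e else x e) = (∏ e ∈ D', r e) * c x := by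
    intro D'
    induction D' using Finset.induction_on with
    | empty => intro _; simp
    | insert e D' he ih =>
      intro hD
      have hD' : D' ⊆ D := fun y hy => hD (Finset.mem_insert_of_mem hy)
      have heD : e ∈ D := hD (Finset.mem_insert_self _ _)
      rw [Finset.prod_insert he, mul_assoc, ← ih hD']
      have h1 : (fun e' => if e' ∈ insert e D' then r e' • x e' else x e') =
        Function.update (fun e' => if e' ∈ D' then r e' • x e' else x e') e (r e • x e + (0:K) • x e) := by
        funext e'
        by_cases h' : e' = e
        · subst h'; simp
        · simp [h']
      rw [h1, h.lin e heD]
      simp only [zero_mul, add_zero]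
      congr 2
      funext e'
      by_cases h' : e' = e
      · subst h'; simp [he]
      · simp [h']
  rw [← key D (Finset.Subset.refl _)]
  apply h.ind
  intro e he; simp [he]

theorem pow_inj_of_infinite [Infinite K] {A B : ℕ} (h : ∀ t : K, t ≠ 0 → t ^ A = t ^ B) : A = B := by
  have hp : (Polynomial.X ^ (A+1) - Polynomial.X ^ (B+1) : Polynomial K) = 0 := by
    apply Polynomial.funext
    intro t
    by_cases ht : t = 0
    · simp [ht]
    · simp [pow_succ, h t ht]
  have := congrArg (fun p => Polynomial.coeff p (A+1)) hp
  simp only [Polynomial.coeff_sub, Polynomial.coeff_X_pow, Polynomial.coeff_zero] at this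
  by_contra hne
  simp [hne] at this

end slots

section fftinv
variable {K : Type} [Field K] {L : Type} {W : Type*} [Fintype L]

noncomputable def be (K : Type) [Field K] (i : Fin 2) : Fin 2 → K := Pi.single i 1

/-- slot vectors: outside and inside of the set -/
noncomputable def p0 (K : Type) [Field K] : L ⊕ L → Fin 2 → K := Sum.elim (fun _ => be K 1) (fun _ => be K 0)
noncomputable def p1 (K : Type) [Field K] : L ⊕ L → Fin 2 → K := Sum.elim (fun _ => be K 0) (fun _ => - be K 1)

noncomputable def xF (K : Type) [Field K] (F : Finset (L ⊕ L)) : L ⊕ L → Fin 2 → K :=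
  fun e => if e ∈ F then p1 K e else p0 K e

/-- action of `g` at the block `z` -/
noncomputable def actz (bt bs : L → W) (z : W) (g : Matrix (Fin 2) (Fin 2) K) (x : L ⊕ L → Fin 2 → K) :
    L ⊕ L → Fin 2 → K :=
  Sum.elim (fun l => if bt l = z then g.mulVec (x (Sum.inl l)) else x (Sum.inl l))
    (fun l => if bs l = z then (g⁻¹).vecMul (x (Sum.inr l)) else x (Sum.inr l))

variable {bt bs : L → W} {S : Finset L} {c : (L ⊕ L → Fin 2 → K) → K}

/-- the function on sets -/
noncomputable def wset (S : Finset L) (c : (L ⊕ L → Fin 2 → K) → K) (F : Finset (L ⊕ L)) : K :=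
  if F ⊆ S.disjSum S then c (xF K F) else 0

theorem wset_U (h : ML (S.disjSum S) c)
    (heq : ∀ z g x, IsUnit (Matrix.det g) → c (actz bt bs z g x) = c x) (z : W) (F : Finset (L ⊕ L))
    (hF : F ⊆ S.disjSum S) :
    wset S c F = ∑ Z ∈ (blk (Sum.elim bt bs) z (S.disjSum S) \ F).powerset, wset S c (F ∪ Z) := by
  have hginv : (!![1, 1; 0, 1] : Matrix (Fin 2) (Fin 2) K)⁻¹ = !![1, -1; 0, 1] := by
    apply Matrix.inv_eq_right_inv
    ext i j; fin_cases i <;> fin_cases j <;> simp [Matrix.mul_apply, Fin.sum_univ_two]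
  rw [wset, if_pos hF, ← heq z !![1, 1; 0, 1] (xF K F) (by simp)]
  have hsub : (blk (Sum.elim bt bs) z (S.disjSum S) \ F) ⊆ S.disjSum S := by
    intro e he
    simp only [blk, Finset.mem_sdiff, Finset.mem_filter] at he
    exact he.1.1
  have e1 := h.expand (p0 K) (p1 K) _ hsub (xF K F)
  have e2 : c (actz bt bs z !![1, 1; 0, 1] (xF K F)) =
    c (fun e => if e ∈ (blk (Sum.elim bt bs) z (S.disjSum S) \ F) then p0 K e + p1 K e else xF K F e) := by
    apply h.ind
    rintro (l | l) he
    · simp only [actz, Sum.elim_inl, xF]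
      by_cases hz : bt l = z <;> by_cases hl : Sum.inl l ∈ F
      · simp [hz, hl, p1, be]
        funext i; fin_cases i <;> simp [Matrix.mulVec]
      · have : Sum.inl l ∈ (blk (Sum.elim bt bs) z (S.disjSum S) \ F) := by simp [blk, hz, hl]; simpa using he
        simp only [this, hz, hl, if_true, if_false]
        funext i; fin_cases i <;> simp [Matrix.mulVec, p1, p0, be, dotProduct]
      · simp [hz, hl]
      · have : Sum.inl l ∉ (blk (Sum.elim bt bs) z (S.disjSum S) \ F) := by simp [blk, hz, hl]
        simp only [this, hz, hl, if_false]
    · simp only [actz, Sum.elim_inr, xF, hginv]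
      by_cases hz : bs l = z <;> by_cases hl : Sum.inr l ∈ F
      · have : Sum.inr l ∉ (blk (Sum.elim bt bs) z (S.disjSum S) \ F) := by simp [hl]
        simp only [this, hz, hl, if_true, if_false]
        funext i; fin_cases i <;> simp [Matrix.vecMul, p1, p0, be, dotProduct]
      · have : Sum.inr l ∈ (blk (Sum.elim bt bs) z (S.disjSum S) \ F) := by simp [blk, hz, hl]; simpa using he
        simp only [this, hz, hl, if_true, if_false]
        funext i; fin_cases i <;> simp [Matrix.vecMul, p1, p0, be, dotProduct]
      · simp [hz, hl]
      · have : Sum.inr l ∉ (blk (Sum.elim bt bs) z (S.disjSum S) \ F) := by simp [blk, hz, hl]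
        simp only [this, hz, hl, if_false]
  rw [e2]
  refine (Eq.trans (by congr!) e1).trans ?_
  apply Finset.sum_congr rfl
  intro Z hZ
  rw [Finset.mem_powerset] at hZ
  rw [wset, if_pos (Finset.union_subset hF (hZ.trans hsub))]
  congr 1
  funext e
  simp only [xF, Finset.mem_union]
  by_cases h1 : e ∈ Z
  · simp [h1]
  · by_cases h2 : e ∈ F
    · simp [h1, h2]
    · by_cases h3 : e ∈ (blk (Sum.elim bt bs) z (S.disjSum S) \ F)
      · simp only [h1, h2, h3, if_true, if_false, or_false]
      · simp only [h1, h2, h3, if_true, if_false, or_false]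

theorem prod_disj (f : L ⊕ L → K) : ∏ e ∈ S.disjSum S, f e = (∏ l ∈ S, f (Sum.inl l)) * ∏ l ∈ S, f (Sum.inr l) := by
  rw [Finset.prod_disjSum]

theorem wset_supp [Infinite K] (h : ML (S.disjSum S) c)
    (heq : ∀ z g x, IsUnit (Matrix.det g) → c (actz bt bs z g x) = c x) (F : Finset (L ⊕ L))
    (hF : wset S c F ≠ 0) : F ⊆ S.disjSum S ∧ ∀ z,
      (blk (Sum.elim bt bs) z F).card = (S.filter (fun l => bt l = z)).card ∧
      (blk (Sum.elim bt bs) z F).card = (S.filter (fun l => bs l = z)).card := by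
  have hsub : F ⊆ S.disjSum S := by
    by_contra h; simp [wset, h] at hF
  refine ⟨hsub, fun z => ?_⟩
  rw [wset, if_pos hsub] at hF
  have hcard : (blk (Sum.elim bt bs) z F).card =
      (S.filter (fun l => bt l = z ∧ Sum.inl l ∈ F)).card + (S.filter (fun l => bs l = z ∧ Sum.inr l ∈ F)).card := by
    have : blk (Sum.elim bt bs) z F = (S.filter (fun l => bt l = z ∧ Sum.inl l ∈ F)).disjSum
       (S.filter (fun l => bs l = z ∧ Sum.inr l ∈ F)) := by
      ext e
      rcases e with l | l
      · simp only [blk, Finset.mem_filter, Sum.elim_inl, Finset.inl_mem_disjSum]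
        constructor
        · rintro ⟨a, b⟩; have := hsub a; simp at this; exact ⟨this, b, a⟩
        · rintro ⟨a, b, c⟩; exact ⟨c, b⟩
      · simp only [blk, Finset.mem_filter, Sum.elim_inr, Finset.inr_mem_disjSum]
        constructor
        · rintro ⟨a, b⟩; have := hsub a; simp at this; exact ⟨this, b, a⟩
        · rintro ⟨a, b, c⟩; exact ⟨c, b⟩
    rw [this, Finset.card_disjSum]
  have hsplit : ∀ (b : L → W) (P : L → Prop), (S.filter (fun l => b l = z)).card =
      (S.filter (fun l => b l = z ∧ P l)).card + (S.filter (fun l => b l = z ∧ ¬ P l)).card := by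
    intro b P
    rw [← Finset.card_filter_add_card_filter_not (s := S.filter (fun l => b l = z)) P,
      Finset.filter_filter, Finset.filter_filter]
  constructor
  · -- diag(1,t)
    have key : (S.filter (fun l => bt l = z ∧ ¬ Sum.inl l ∈ F)).card =
        (S.filter (fun l => bs l = z ∧ Sum.inr l ∈ F)).card := by
      apply pow_inj_of_infinite (K := K)
      intro t ht
      have hginv : (!![1, 0; 0, t] : Matrix (Fin 2) (Fin 2) K)⁻¹ = !![1, 0; 0, t⁻¹] := by
        apply Matrix.inv_eq_right_inv
        ext i j; fin_cases i <;> fin_cases j <;> simp [Matrix.mul_apply, Fin.sum_univ_two, ht]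
      have e0 := heq z !![1, 0; 0, t] (xF K F) (by simp [ht])
      have e1 : actz bt bs z !![1, 0; 0, t] (xF K F) = fun e => (Sum.elim 
          (fun l => if bt l = z ∧ ¬ Sum.inl l ∈ F then t else 1) 
          (fun l => if bs l = z ∧ Sum.inr l ∈ F then t⁻¹ else 1) e : K) • xF K F e := by
        funext e
        rcases e with l | l
        · simp only [actz, Sum.elim_inl, xF]
          by_cases hz : bt l = z <;> by_cases hl : Sum.inl l ∈ F <;> simp only [hz, hl, if_true, if_false, and_self, not_true, not_false_eq_true, and_false, false_and, one_smul] <;>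
          (funext i; fin_cases i <;> simp [Matrix.mulVec, p1, p0, be, dotProduct])
        · simp only [actz, Sum.elim_inr, xF, hginv]
          by_cases hz : bs l = z <;> by_cases hl : Sum.inr l ∈ F <;> simp only [hz, hl, if_true, if_false, and_self, not_true, not_false_eq_true, and_false, false_and, one_smul] <;>
          (funext i; fin_cases i <;> simp [Matrix.vecMul, p1, p0, be, dotProduct])
      rw [e1, h.scale, prod_disj] at e0
      simp only [Sum.elim_inl, Sum.elim_inr, ← Finset.prod_filter, Finset.prod_const] at e0
      have e2 := mul_right_cancel₀ hF (e0.trans (one_mul _).symm)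
      rw [inv_pow] at e2
      field_simp at e2
      exact e2
    rw [hcard, hsplit bt (fun l => Sum.inl l ∈ F), ← key]
    congr!
  · have key : (S.filter (fun l => bt l = z ∧ Sum.inl l ∈ F)).card =
        (S.filter (fun l => bs l = z ∧ ¬ Sum.inr l ∈ F)).card := by
      apply pow_inj_of_infinite (K := K)
      intro t ht
      have hginv : (!![t, 0; 0, 1] : Matrix (Fin 2) (Fin 2) K)⁻¹ = !![t⁻¹, 0; 0, 1] := by
        apply Matrix.inv_eq_right_inv
        ext i j; fin_cases i <;> fin_cases j <;> simp [Matrix.mul_apply, Fin.sum_univ_two, ht]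
      have e0 := heq z !![t, 0; 0, 1] (xF K F) (by simp [ht])
      have e1 : actz bt bs z !![t, 0; 0, 1] (xF K F) = fun e => (Sum.elim 
          (fun l => if bt l = z ∧ Sum.inl l ∈ F then t else 1) 
          (fun l => if bs l = z ∧ ¬ Sum.inr l ∈ F then t⁻¹ else 1) e : K) • xF K F e := by
        funext e
        rcases e with l | l
        · simp only [actz, Sum.elim_inl, xF]
          by_cases hz : bt l = z <;> by_cases hl : Sum.inl l ∈ F <;> simp only [hz, hl, if_true, if_false, and_self, not_true, not_false_eq_true, and_false, false_and, one_smul] <;>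
          (funext i; fin_cases i <;> simp [Matrix.mulVec, p1, p0, be, dotProduct])
        · simp only [actz, Sum.elim_inr, xF, hginv]
          by_cases hz : bs l = z <;> by_cases hl : Sum.inr l ∈ F <;> simp only [hz, hl, if_true, if_false, and_self, not_true, not_false_eq_true, and_false, false_and, one_smul] <;>
          (funext i; fin_cases i <;> simp [Matrix.vecMul, p1, p0, be, dotProduct])
      rw [e1, h.scale, prod_disj] at e0
      simp only [Sum.elim_inl, Sum.elim_inr, ← Finset.prod_filter, Finset.prod_const] at e0
      have e2 := mul_right_cancel₀ hF (e0.trans (one_mul _).symm)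
      rw [inv_pow] at e2
      field_simp at e2
      exact e2
    rw [hcard, hsplit bs (fun l => Sum.inr l ∈ F), key, add_comm]
    congr!

/-- partial `Th` -/
noncomputable def ThS (K : Type) [Field K] (S : Finset L) (σ : Equiv.Perm L) :
    (L → Fin 2) × (L → Fin 2) → K :=
  fun x => ∏ l ∈ S, if x.1 l = x.2 (σ l) then 1 else 0

noncomputable def Cfun (c : (L ⊕ L → Fin 2 → K) → K) : (L → Fin 2) × (L → Fin 2) → K :=
  fun x => c (Sum.elim (fun l => be K (x.1 l)) (fun l => be K (x.2 l)))

noncomputable def Ffg (S : Finset L) (x : (L → Fin 2) × (L → Fin 2)) : Finset (L ⊕ L) :=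
  (S.filter (fun l => x.1 l = 0)).disjSum (S.filter (fun l => x.2 l = 1))

theorem Ffg_sub (x : (L → Fin 2) × (L → Fin 2)) : Ffg S x ⊆ S.disjSum S := by
  rintro (l | l) he
  · simp only [Ffg, Finset.inl_mem_disjSum, Finset.mem_filter] at he ⊢; exact he.1
  · simp only [Ffg, Finset.inr_mem_disjSum, Finset.mem_filter] at he ⊢; exact he.1

noncomputable def PsiM (K : Type) [Field K] (S : Finset L) :
    (Finset (L ⊕ L) → K) →ₗ[K] ((L → Fin 2) × (L → Fin 2) → K) where
  toFun w := fun x => (∏ l ∈ S, if x.2 l = 1 then -1 else 1) * w (Ffg S x)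
  map_add' a b := by funext x; simp [mul_add]
  map_smul' a b := by funext x; simp; ring

theorem fft_C [Infinite K] (h : ML (S.disjSum S) c)
    (heq : ∀ z g x, IsUnit (Matrix.det g) → c (actz bt bs z g x) = c x) :
    Cfun c ∈ Submodule.span K {f | ∃ σ : Equiv.Perm L, (∀ l, l ∉ S → σ l = l) ∧
      (∀ l ∈ S, bs (σ l) = bt l) ∧ f = ThS K S σ} := by
  have h1 := fft (w := wset S c) (wset_supp h heq) (wset_U h heq)
  have h2 : PsiM K S (wset S c) = Cfun c := by
    funext x
    simp only [PsiM, LinearMap.coe_mk, AddHom.coe_mk, wset, if_pos (Ffg_sub x), Cfun]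
    have := h.scale (Sum.elim (fun l => 1) (fun l => if x.2 l = 1 then -1 else 1)) (xF K (Ffg S x))
    rw [prod_disj] at this
    simp only [Sum.elim_inl, Sum.elim_inr, Finset.prod_const_one, one_mul] at this
    rw [← this]
    apply h.ind
    rintro (l | l) he
    · have hl : l ∈ S := by simpa using he
      simp only [Sum.elim_inl, xF, Ffg, Finset.inl_mem_disjSum, Finset.mem_filter, hl, true_and, one_smul]
      generalize x.1 l = i
      fin_cases i <;> simp [p1, p0]
    · have hl : l ∈ S := by simpa using he
      simp only [Sum.elim_inr, xF, Ffg, Finset.inr_mem_disjSum, Finset.mem_filter, hl, true_and]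
      generalize x.2 l = i
      fin_cases i <;> simp [p1, p0]
  rw [← h2]
  have h3 := Submodule.mem_map_of_mem (f := PsiM K S) h1
  rw [Submodule.map_span] at h3
  refine Submodule.span_mono ?_ h3
  rintro _ ⟨f, ⟨σ, hσ1, hσ2, rfl⟩, rfl⟩
  refine ⟨σ, hσ1, hσ2, ?_⟩
  funext x
  simp only [PsiM, LinearMap.coe_mk, AddHom.coe_mk, gS, if_pos (Ffg_sub x), ThS]
  have hmem : ∀ l, σ l ∈ S ↔ l ∈ S := by
    intro l
    constructor
    · intro h; by_contra hl; rw [hσ1 l hl] at h; exact hl h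
    · intro h; by_contra hl; have := σ.injective (hσ1 _ hl); rw [this] at hl; exact hl h
  have hperm : (∏ l ∈ S, if x.2 l = 1 then (-1:K) else 1) = ∏ l ∈ S, if x.2 (σ l) = 1 then (-1:K) else 1 := by
    symm
    apply Finset.prod_equiv σ
    · intro l; exact (hmem l).symm
    · intro l _; rfl
  rw [hperm, ← Finset.prod_mul_distrib]
  apply Finset.prod_congr rfl
  intro l hl
  simp only [av, Ffg, Finset.inl_mem_disjSum, Finset.inr_mem_disjSum, Finset.mem_filter, hl, hmem, true_and]
  generalize x.1 l = i
  generalize x.2 (σ l) = j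
  fin_cases i <;> fin_cases j <;> simp

end fftinv
end QR

set_option linter.all false

namespace QR
section ell
variable {K : Type} [Field K] {Q : QuiverData} {Fl L : Type} [Fintype Fl] [Fintype L] {W : Type}

noncomputable def Yx (x : L ⊕ L → Fin 2 → K) : Fl ⊕ L → Matrix (Fin 2) (Fin 2) K :=
  Sum.elim (fun _ => 1) (fun l => Matrix.of fun i j => x (Sum.inl l) i * x (Sum.inr l) j)

noncomputable def cs (arr : Fl ⊕ L → Q.A) (m : Fl ⊕ L →₀ ℕ) (p : MvPolynomial Q.Var K)
    (x : L ⊕ L → Fin 2 → K) : K := cf arr (Yx x) m p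

variable (arr : Fl ⊕ L → Q.A)

noncomputable def Sm (m : Fl ⊕ L →₀ ℕ) : Finset L := Finset.univ.filter (fun l => m (Sum.inr l) = 1)

theorem cs_ML (m : Fl ⊕ L →₀ ℕ) (hm : ∀ l, m (Sum.inr l) ≤ 1) (p : MvPolynomial Q.Var K) :
    ML ((Sm m).disjSum (Sm m)) (cs arr m p) := by
  constructor
  · rintro (l | l) he x a b r s
    · have hl : m (Sum.inr l) = 1 := by simpa [Sm] using he
      have key : ∀ (i1 : DecidableEq (L ⊕ L)) (i2 : DecidableEq (Fl ⊕ L)) (v : Fin 2 → K),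
          Yx (Fl := Fl) (@Function.update _ _ i1 x (Sum.inl l) v) = @Function.update _ _ i2 (Yx x) (Sum.inr l)
          (Matrix.of fun i j => v i * x (Sum.inr l) j) := by
        intro i1 i2 v
        funext y
        rcases y with y | y
        · simp [Yx]
        · by_cases hy : y = l
          · subst hy; simp [Yx]
          · have : (Sum.inl y : L ⊕ L) ≠ Sum.inl l := by simpa using hy
            simp [Yx, hy]
      have := cf_linear arr (Sum.inr l) (Yx x) (Matrix.of fun i j => a i * x (Sum.inr l) j)
        (Matrix.of fun i j => b i * x (Sum.inr l) j) r s p m hl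
      simp only [cs]
      rw [key _ (fun a b => Classical.propDecidable (a = b)), key _ (fun a b => Classical.propDecidable (a = b)),
        key _ (fun a b => Classical.propDecidable (a = b)), ← this]
      congr 2
      ext i j
      simp only [Matrix.of_apply, Matrix.add_apply, Matrix.smul_apply, Pi.add_apply, Pi.smul_apply, smul_eq_mul]
      ring
    · have hl : m (Sum.inr l) = 1 := by simpa [Sm] using he
      have key : ∀ (i1 : DecidableEq (L ⊕ L)) (i2 : DecidableEq (Fl ⊕ L)) (v : Fin 2 → K),
          Yx (Fl := Fl) (@Function.update _ _ i1 x (Sum.inr l) v) = @Function.update _ _ i2 (Yx x) (Sum.inr l)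
          (Matrix.of fun i j => x (Sum.inl l) i * v j) := by
        intro i1 i2 v
        funext y
        rcases y with y | y
        · simp [Yx]
        · by_cases hy : y = l
          · subst hy; simp [Yx]
          · have : (Sum.inl y : L ⊕ L) ≠ Sum.inl l := by simpa using hy
            simp [Yx, hy]
      have := cf_linear arr (Sum.inr l) (Yx x) (Matrix.of fun i j => x (Sum.inl l) i * a j)
        (Matrix.of fun i j => x (Sum.inl l) i * b j) r s p m hl
      simp only [cs]
      rw [key _ (fun a b => Classical.propDecidable (a = b)), key _ (fun a b => Classical.propDecidable (a = b)),
        key _ (fun a b => Classical.propDecidable (a = b)), ← this]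
      congr 2
      ext i j
      simp only [Matrix.of_apply, Matrix.add_apply, Matrix.smul_apply, Pi.add_apply, Pi.smul_apply, smul_eq_mul]
      ring
  · intro x y h
    apply cf_congr
    rintro (a | l) hl
    · rfl
    · have : l ∈ Sm m := by
        simp [Sm]; have := hm l; omega
      simp only [Yx, Sum.elim_inr]
      rw [h (Sum.inl l) (by simpa using this), h (Sum.inr l) (by simpa using this)]

theorem cs_act (M : Q.V → W) (m : Fl ⊕ L →₀ ℕ)
    (hM : ∀ a, m (Sum.inl a) ≠ 0 → M (Q.src (arr (Sum.inl a))) = M (Q.tgt (arr (Sum.inl a))))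
    {p : MvPolynomial Q.Var K} (hp : Q.IsInvariant K p) (z : W) (g : Matrix (Fin 2) (Fin 2) K)
    (x : L ⊕ L → Fin 2 → K) (hg : IsUnit g.det) :
    cs arr m p (actz (fun l => M (Q.tgt (arr (Sum.inr l)))) (fun l => M (Q.src (arr (Sum.inr l)))) z g x) =
      cs arr m p x := by
  have h := cf_inv arr hp (fun v => if M v = z then g else 1) (by intro v; by_cases hv : M v = z <;> simp [hv, hg.ne_zero]) (Yx x) m
  simp only [cs]
  rw [← h]
  apply cf_congr
  rintro (a | l) hl
  · simp only [Yx, Sum.elim_inl, hM a hl, mul_one]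
    rw [Matrix.mul_nonsing_inv]
    split_ifs <;> simp [hg.ne_zero]
  · simp only [Yx, Sum.elim_inr, actz, Sum.elim_inl]
    ext i j
    by_cases h1 : M (Q.tgt (arr (Sum.inr l))) = z <;> by_cases h2 : M (Q.src (arr (Sum.inr l))) = z <;>
      simp only [h1, h2, if_true, if_false, Matrix.of_apply, Matrix.mul_apply, Fin.sum_univ_two, Matrix.mulVec,
        Matrix.vecMul, dotProduct, inv_one, Matrix.one_apply] <;> fin_cases i <;> fin_cases j <;> simp <;> ring

theorem fft_p [Infinite K] (M : Q.V → W) (m : Fl ⊕ L →₀ ℕ) (hm : ∀ l, m (Sum.inr l) ≤ 1)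
    (hM : ∀ a, m (Sum.inl a) ≠ 0 → M (Q.src (arr (Sum.inl a))) = M (Q.tgt (arr (Sum.inl a))))
    {p : MvPolynomial Q.Var K} (hp : Q.IsInvariant K p) :
    Cfun (cs arr m p) ∈ Submodule.span K {f | ∃ σ : Equiv.Perm L, (∀ l, l ∉ Sm m → σ l = l) ∧
      (∀ l ∈ Sm m, M (Q.src (arr (Sum.inr (σ l)))) = M (Q.tgt (arr (Sum.inr l)))) ∧ f = ThS K (Sm m) σ} :=
  fft_C (bt := fun l => M (Q.tgt (arr (Sum.inr l)))) (bs := fun l => M (Q.src (arr (Sum.inr l))))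
    (S := Sm m) (c := cs arr m p) (cs_ML arr m hm p) (fun z g x hg => cs_act arr M m hM hp z g x hg)

open Pointwise in
theorem span_mul_zero {A : Type} [CommRing A] [Algebra K A] (T : A →ₗ[K] K) {s t : Set A}
    (h : ∀ a ∈ s, ∀ b ∈ t, T (a * b) = 0) {x y : A} (hx : x ∈ Submodule.span K s)
    (hy : y ∈ Submodule.span K t) : T (x * y) = 0 := by
  have := Submodule.mul_mem_mul hx hy
  rw [Submodule.span_mul_span] at this
  have hle : Submodule.span K (s * t) ≤ LinearMap.ker T := by
    rw [Submodule.span_le]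
    rintro _ ⟨a, ha, b, hb, rfl⟩
    exact h a ha b hb
  exact hle this

theorem ThS_mul {S1 S2 : Finset L} (hd : ∀ l, l ∈ S2 ↔ l ∉ S1) {σ1 σ2 : Equiv.Perm L}
    (h1 : ∀ l, l ∉ S1 → σ1 l = l) (h2 : ∀ l, l ∉ S2 → σ2 l = l) :
    (∀ l ∈ S1, (σ1 * σ2) l = σ1 l) ∧ (∀ l ∈ S2, (σ1 * σ2) l = σ2 l) ∧
    ThS K S1 σ1 * ThS K S2 σ2 = Th K (σ1 * σ2) := by
  have hmem : ∀ l, σ2 l ∈ S2 ↔ l ∈ S2 := by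
    intro l
    constructor
    · intro h; by_contra hl; rw [h2 l hl] at h; exact hl h
    · intro h; by_contra hl; have := σ2.injective (h2 _ hl); rw [this] at hl; exact hl h
  have ha : ∀ l ∈ S1, (σ1 * σ2) l = σ1 l := by
    intro l hl
    rw [Equiv.Perm.mul_apply, h2 l (by rw [hd]; simpa using hl)]
  have hb : ∀ l ∈ S2, (σ1 * σ2) l = σ2 l := by
    intro l hl
    rw [Equiv.Perm.mul_apply, h1]
    rw [← hd, hmem]; exact hl
  refine ⟨ha, hb, ?_⟩
  have hS2 : S2 = Finset.univ \ S1 := by ext l; simp [hd]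
  funext x
  simp only [Pi.mul_apply, ThS, Th]
  rw [Finset.prod_congr rfl (fun l hl => by rw [← ha l hl]),
    Finset.prod_congr (s₁ := S2) rfl (fun l hl => by rw [← hb l hl]), mul_comm, hS2,
    Finset.prod_sdiff (Finset.subset_univ S1)]
  rw [Finset.prod_ite_zero]
  simp only [Finset.mem_univ, true_implies, Finset.prod_const_one, funext_iff, Function.comp_apply]

theorem ThS_univ (σ : Equiv.Perm L) : ThS K Finset.univ σ = Th K σ := by
  funext x
  simp only [ThS, Th]
  rw [Finset.prod_ite_zero]
  simp only [Finset.mem_univ, true_implies, Finset.prod_const_one, funext_iff, Function.comp_apply]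

theorem Cfun_mul (m : Fl ⊕ L →₀ ℕ) (p q : MvPolynomial Q.Var K) :
    Cfun (cs arr m (p * q)) = ∑ x ∈ Finset.HasAntidiagonal.antidiagonal m,
      Cfun (cs arr x.1 p) * Cfun (cs arr x.2 q) := by
  funext y
  simp only [Cfun, cs, cf_mul, Finset.sum_apply, Pi.mul_apply]
  congr!

theorem ell [Infinite K] [Nonempty L] (M : Q.V → W) (m0 : Fl ⊕ L →₀ ℕ) (h0 : ∀ l, m0 (Sum.inr l) = 1)
    (hM : ∀ a, m0 (Sum.inl a) ≠ 0 → M (Q.src (arr (Sum.inl a))) = M (Q.tgt (arr (Sum.inl a))))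
    (ψ : List L → K)
    (hrot : ∀ w w', FullW (fun l => M (Q.src (arr (Sum.inr l)))) (fun l => M (Q.tgt (arr (Sum.inr l)))) w →
      w ~r w' → ψ w = ψ w')
    (hsw : ∀ (z : W) (A B C : List L), A ≠ [] → B ≠ [] → C ≠ [] →
      Walk (fun l => M (Q.src (arr (Sum.inr l)))) (fun l => M (Q.tgt (arr (Sum.inr l)))) z z A → 
      Walk (fun l => M (Q.src (arr (Sum.inr l)))) (fun l => M (Q.tgt (arr (Sum.inr l)))) z z B → 
      Walk (fun l => M (Q.src (arr (Sum.inr l)))) (fun l => M (Q.tgt (arr (Sum.inr l)))) z z C →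
      FullW (fun l => M (Q.src (arr (Sum.inr l)))) (fun l => M (Q.tgt (arr (Sum.inr l)))) (A ++ B ++ C) →
      ψ (A ++ B ++ C) + ψ (A ++ C ++ B) = 0)
    (hR3 : ∀ p ∈ Q.PlusSet K, ∀ m1 m2 : Fl ⊕ L →₀ ℕ, m1 + m2 = m0 → m1 ≠ 0 → (∀ l, m1 (Sum.inr l) = 0) →
      cf arr (fun _ => 1) m1 p ≠ 0 → ∃ (W' : Type) (M' : Q.V → W'),
        (∀ a, m2 (Sum.inl a) ≠ 0 → M' (Q.src (arr (Sum.inl a))) = M' (Q.tgt (arr (Sum.inl a)))) ∧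
        (∀ u v, M' u = M' v → M u = M v) ∧
        ∀ w, FullW (fun l => M' (Q.src (arr (Sum.inr l)))) (fun l => M' (Q.tgt (arr (Sum.inr l)))) w → ψ w = 0) :
    ∃ T : ((L → Fin 2) × (L → Fin 2) → K) →ₗ[K] K,
      (∀ p ∈ Q.PlusSet K, ∀ q ∈ Q.PlusSet K, T (Cfun (cs arr m0 (p * q))) = 0) ∧
      ∀ σ : Equiv.Perm L, (∀ l, M (Q.src (arr (Sum.inr (σ l)))) = M (Q.tgt (arr (Sum.inr l)))) →
        T (Th K σ) = wf ψ σ := by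
  obtain ⟨T, hT⟩ := sft (K := K) (fun l => M (Q.tgt (arr (Sum.inr l)))) (fun l => M (Q.src (arr (Sum.inr l))))
    (wf ψ) (fun σ hσ i j k hij hjk hik h1 h2 => asym_wf hrot hsw hσ hij hjk hik h1 h2)
  refine ⟨T, ?_, hT⟩
  -- the case where the first factor has no L-letters
  have caseA : ∀ p ∈ Q.PlusSet K, ∀ q ∈ Q.PlusSet K, ∀ m1 m2 : Fl ⊕ L →₀ ℕ, m1 + m2 = m0 → (∀ l, m1 (Sum.inr l) = 0) →
      T (Cfun (cs arr m1 p) * Cfun (cs arr m2 q)) = 0 := by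
    intro p hp q hq m1 m2 hm hz
    have hc : Cfun (cs arr m1 p) = fun _ => cf arr (fun _ => 1) m1 p := by
      funext y
      simp only [Cfun, cs]
      apply cf_congr
      rintro (a | l) hl
      · rfl
      · exact absurd (hz l) hl
    have hc2 : Cfun (cs arr m1 p) * Cfun (cs arr m2 q) = cf arr (fun _ => 1) m1 p • Cfun (cs arr m2 q) := by
      rw [hc]; rfl
    rw [hc2, map_smul]
    by_cases h1 : m1 = 0
    · rw [h1, cf_zero, hp.2, zero_smul]
    by_cases h2 : cf arr (fun _ => (1 : Matrix (Fin 2) (Fin 2) K)) m1 p = 0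
    · rw [h2, zero_smul]
    obtain ⟨W', M', hM1, hM2, hM3⟩ := hR3 p hp m1 m2 hm h1 hz h2
    have hm2 : ∀ l, m2 (Sum.inr l) = 1 := by
      intro l
      have := DFunLike.congr_fun hm (Sum.inr l)
      rw [Finsupp.add_apply, hz, h0, zero_add] at this
      exact this
    have hS : Sm m2 = Finset.univ := by ext l; simp [Sm, hm2]
    have := fft_p arr M' m2 (fun l => (hm2 l).le) hM1 hq.1
    have hle : Submodule.span K {f | ∃ σ : Equiv.Perm L, (∀ l, l ∉ Sm m2 → σ l = l) ∧
      (∀ l ∈ Sm m2, M' (Q.src (arr (Sum.inr (σ l)))) = M' (Q.tgt (arr (Sum.inr l)))) ∧ f = ThS K (Sm m2) σ} ≤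
        LinearMap.ker T := by
      rw [Submodule.span_le]
      rintro _ ⟨σ, -, hσ, rfl⟩
      rw [hS] at hσ ⊢
      simp only [SetLike.mem_coe, LinearMap.mem_ker]
      have hσM : ∀ l, M (Q.src (arr (Sum.inr (σ l)))) = M (Q.tgt (arr (Sum.inr l))) :=
        fun l => hM2 _ _ (hσ l (Finset.mem_univ l))
      rw [ThS_univ, hT σ hσM]
      by_cases hw : ∃ w, Rep σ w ∧ ∀ l, l ∈ w
      · obtain ⟨w, hw1, hw2⟩ := hw
        rw [wf_eq hrot hσM hw1 hw2]
        exact hM3 w ⟨hw1.1, hw2, hw1.2.1, hw1.cl (fun l => hσ l (Finset.mem_univ l))⟩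
      · exact wf_zero (fun w h1 h2 => hw ⟨w, h1, h2⟩)
    rw [LinearMap.mem_ker.1 (hle this), smul_zero]
  intro p hp q hq
  rw [Cfun_mul, map_sum]
  apply Finset.sum_eq_zero
  rintro ⟨m1, m2⟩ hx
  rw [Finset.HasAntidiagonal.mem_antidiagonal] at hx
  simp only at hx ⊢
  by_cases hz1 : ∀ l, m1 (Sum.inr l) = 0
  · exact caseA p hp q hq m1 m2 hx hz1
  by_cases hz2 : ∀ l, m2 (Sum.inr l) = 0
  · rw [mul_comm]; exact caseA q hq p hp m2 m1 (by rw [add_comm]; exact hx) hz2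
  push Not at hz1 hz2
  have hs : ∀ l, m1 (Sum.inr l) + m2 (Sum.inr l) = 1 := by
    intro l; rw [← h0 l, ← hx]; rfl
  obtain ⟨l1, hl1⟩ := hz1
  obtain ⟨l2, hl2⟩ := hz2
  have hMx : ∀ a, m1 (Sum.inl a) + m2 (Sum.inl a) ≠ 0 → M (Q.src (arr (Sum.inl a))) = M (Q.tgt (arr (Sum.inl a))) := by
    intro a ha; apply hM; rw [← hx]; exact ha
  have f1 := fft_p arr M m1 (fun l => by have := hs l; omega) (fun a ha => hMx a (by omega)) hp.1
  have f2 := fft_p arr M m2 (fun l => by have := hs l; omega) (fun a ha => hMx a (by omega)) hq.1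
  refine span_mul_zero T ?_ f1 f2
  rintro _ ⟨σ1, a1, a2, rfl⟩ _ ⟨σ2, b1, b2, rfl⟩
  have hd : ∀ l, l ∈ Sm m2 ↔ l ∉ Sm m1 := by
    intro l; simp [Sm]; have := hs l; omega
  obtain ⟨e1, e2, e3⟩ := ThS_mul (K := K) hd a1 b1
  rw [e3, hT]
  · apply wf_zero
    intro w hw1 hw2
    have hmem : ∀ l, σ1 l ∈ Sm m1 ↔ l ∈ Sm m1 := by
      intro l
      constructor
      · intro h; by_contra hl; rw [a1 l hl] at h; exact hl h
      · intro h; by_contra hl; have := σ1.injective (a1 _ hl); rw [this] at hl; exact hl h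
    have := hw1.closed_set (X := (Sm m1 : Set L)) (by
      intro x hx
      have hx' : x ∈ Sm m1 := hx
      rw [e1 x hx']; exact (hmem x).2 hx') (hw2 l1) (by simp [Sm]; have := hs l1; omega) l2 (hw2 l2)
    simp [Sm] at this
    have := hs l2; omega
  · intro l
    by_cases hl : l ∈ Sm m1
    · rw [e1 l hl]; exact a2 l hl
    · have := (hd l).2 hl
      rw [e2 l this]; exact b2 l this

end ell
end QR

set_option linter.all false

namespace QR
section wsum
variable {K : Type} [Field K] {Q : QuiverData} {Λ : Type} [Fintype Λ]

/-- sum over all words over `h` -/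
noncomputable def wsum {R A : Type} [AddCommMonoid R] (arr : Λ → A) : List A → (List Λ → R) → R
  | [], G => G []
  | a :: h, G => ∑ l : Λ, if arr l = a then wsum arr h (fun w => G (l :: w)) else 0

theorem wsum_congr {R A : Type} [AddCommMonoid R] (arr : Λ → A) (h : List A) {G G' : List Λ → R}
    (H : ∀ w, w.map arr = h → G w = G' w) : wsum arr h G = wsum arr h G' := by
  induction h generalizing G G' with
  | nil => exact H [] rfl
  | cons a h ih =>
    simp only [wsum]
    apply Finset.sum_congr rfl
    intro l _
    split_ifs with hl
    · apply ih
      intro w hw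
      apply H; simp [hl, hw]
    · rfl

theorem wsum_map {R R' A F : Type} [AddCommMonoid R] [AddCommMonoid R'] [FunLike F R R'] [AddMonoidHomClass F R R']
    (T : F) (arr : Λ → A) (h : List A) (G : List Λ → R) : T (wsum arr h G) = wsum arr h (fun w => T (G w)) := by
  induction h generalizing G with
  | nil => rfl
  | cons a h ih =>
    simp only [wsum, map_sum]
    apply Finset.sum_congr rfl
    intro l _
    split_ifs
    · exact ih _
    · exact map_zero _

theorem wsum_add {R A : Type} [AddCommMonoid R] (arr : Λ → A) (h : List A) (G G' : List Λ → R) :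
    wsum arr h (fun w => G w + G' w) = wsum arr h G + wsum arr h G' := by
  induction h generalizing G G' with
  | nil => rfl
  | cons a h ih =>
    simp only [wsum, ← Finset.sum_add_distrib]
    apply Finset.sum_congr rfl
    intro l _
    split_ifs
    · exact ih _ _
    · simp

theorem wsum_fn {R A I : Type} [AddCommMonoid R] (arr : Λ → A) (h : List A) (G : List Λ → I → R) (i : I) :
    wsum arr h G i = wsum arr h (fun w => G w i) := by
  induction h generalizing G with
  | nil => rfl
  | cons a h ih =>
    simp only [wsum, Finset.sum_apply]
    apply Finset.sum_congr rfl
    intro l _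
    split_ifs
    · exact ih _
    · simp

theorem wsum_zero {R A : Type} [AddCommMonoid R] (arr : Λ → A) (h : List A) {G : List Λ → R}
    (H : ∀ w, w.map arr = h → G w = 0) : wsum arr h G = 0 := by
  induction h generalizing G with
  | nil => exact H [] rfl
  | cons a h ih =>
    simp only [wsum]
    apply Finset.sum_eq_zero
    intro l _
    split_ifs with hl
    · apply ih; intro w hw; apply H; simp [hl, hw]
    · rfl

/-- content of a word -/
noncomputable def cont (w : List Λ) : Λ →₀ ℕ := Multiset.toFinsupp (w : Multiset Λ)

theorem cont_nil : cont ([] : List Λ) = 0 := by simp [cont]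

theorem cont_cons (l : Λ) (w : List Λ) : cont (l :: w) = Finsupp.single l 1 + cont w := by
  unfold cont
  rw [← Multiset.cons_coe, ← Multiset.singleton_add, map_add, Multiset.toFinsupp_singleton]

theorem cont_apply (w : List Λ) (l : Λ) : cont w l = w.count l := by
  simp [cont]

theorem pathMat_cons (a : Q.A) (h : List Q.A) : Q.pathMat K (a :: h) = Q.pathMat K h * Q.genMat K a := by
  simp [QuiverData.pathMat]

theorem cf_pathMat (arr : Λ → Q.A) (Y : Λ → Matrix (Fin 2) (Fin 2) K) (h : List Q.A) :
    ∀ (m : Λ →₀ ℕ) (i j : Fin 2), cf arr Y m (Q.pathMat K h i j) =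
      wsum arr h (fun w => if cont w = m then (w.map Y).reverse.prod i j else 0) := by
  induction h with
  | nil =>
    intro m i j
    have : Q.pathMat K [] i j = MvPolynomial.C (if i = j then 1 else 0) := by
      simp [QuiverData.pathMat, Matrix.one_apply]
    rw [this, cf_C]
    simp only [wsum, cont_nil, List.map_nil, List.reverse_nil, List.prod_nil, Matrix.one_apply]
    simp only [eq_comm]
  | cons a h ih =>
    intro m i j
    have e1 : Q.pathMat K (a :: h) i j = Q.pathMat K h i 0 * MvPolynomial.X ((a, 0, j) : Q.A × Fin 2 × Fin 2) +
        Q.pathMat K h i 1 * MvPolynomial.X ((a, 1, j) : Q.A × Fin 2 × Fin 2) := by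
      rw [pathMat_cons, Matrix.mul_apply, Fin.sum_univ_two]
      rfl
    rw [e1, cf_add]
    refine (congrArg₂ (· + ·) (cf_mul_X arr Y m _ _) (cf_mul_X arr Y m _ _)).trans ?_
    simp only []
    rw [← Finset.sum_add_distrib]
    simp only [wsum]
    apply Finset.sum_congr rfl
    intro l _
    by_cases hl : arr l = a
    · simp only [hl, true_and, if_true]
      by_cases hm : m l = 0
      · simp only [hm, ne_eq, not_true, if_false, add_zero]
        rw [wsum_zero]
        intro w hw
        rw [if_neg]
        rintro rfl
        simp [cont_cons] at hm
      · simp only [hm, ne_eq, not_false_eq_true, if_true, ih]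
        have := wsum_map (AddMonoidHom.mulLeft (Y l 0 j)) arr h (fun w => if cont w = m - Finsupp.single l 1 then (w.map Y).reverse.prod i 0 else 0)
        have h2 := wsum_map (AddMonoidHom.mulLeft (Y l 1 j)) arr h (fun w => if cont w = m - Finsupp.single l 1 then (w.map Y).reverse.prod i 1 else 0)
        simp only [AddMonoidHom.coe_mulLeft] at this h2
        rw [this, h2, ← wsum_add]
        apply wsum_congr
        intro w hw
        have hiff : cont (l :: w) = m ↔ cont w = m - Finsupp.single l 1 := by
          rw [cont_cons]
          constructor
          · rintro rfl; ext x; simp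
          · intro h; rw [h]; ext x
            by_cases hx : x = l
            · subst hx; simp; omega
            · simp [hx, Ne.symm hx]
        simp only [hiff]
        split_ifs
        · simp only [List.map_cons, List.reverse_cons, List.prod_append, List.prod_singleton,
            Matrix.mul_apply, Fin.sum_univ_two]
          ring
        · simp
    · simp [hl]

theorem cf_pathTr (arr : Λ → Q.A) (Y : Λ → Matrix (Fin 2) (Fin 2) K) (h : List Q.A) (m : Λ →₀ ℕ) :
    cf arr Y m (Q.pathTr K h) =
      wsum arr h (fun w => if cont w = m then Matrix.trace (w.map Y).reverse.prod else 0) := by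
  rw [QuiverData.pathTr, Matrix.trace, Fin.sum_univ_two, cf_add]
  simp only [Matrix.diag_apply]
  rw [cf_pathMat, cf_pathMat, ← wsum_add]
  apply wsum_congr
  intro w _
  split_ifs
  · simp [Matrix.trace, Fin.sum_univ_two]
  · simp

theorem cont_total (arr : Λ → Q.A) (w : List Λ) (b : Q.A) :
    ∑ l : Λ, (if arr l = b then cont w l else 0) = (w.map arr).count b := by
  induction w with
  | nil => simp [cont_nil]
  | cons l w ih =>
    rw [List.map_cons, List.count_cons, ← ih]
    have : ∀ x, (if arr x = b then cont (l :: w) x else 0) =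
      (if arr x = b then cont w x else 0) + (if x = l then (if arr l = b then 1 else 0) else 0) := by
      intro x
      rw [cont_cons]
      by_cases hx : x = l
      · subst hx; by_cases hb : arr x = b <;> simp [hb]; try omega
      · simp [hx, Ne.symm hx]
    simp only [this, Finset.sum_add_distrib]
    simp

/-- entries of path matrices have the expected multidegree -/
theorem cf_pathMat_deg (arr : Λ → Q.A) (Y : Λ → Matrix (Fin 2) (Fin 2) K) (h : List Q.A) (m : Λ →₀ ℕ) (i j : Fin 2)
    (hne : cf arr Y m (Q.pathMat K h i j) ≠ 0) (b : Q.A) :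
    ∑ l : Λ, (if arr l = b then m l else 0) = h.count b := by
  by_contra hb
  apply hne
  rw [cf_pathMat]
  apply wsum_zero
  intro w hw
  rw [if_neg]
  rintro rfl
  rw [cont_total, hw] at hb
  exact hb rfl

theorem cf_pathDet_deg (arr : Λ → Q.A) (Y : Λ → Matrix (Fin 2) (Fin 2) K) (h : List Q.A) (m : Λ →₀ ℕ)
    (hne : cf arr Y m (Q.pathDet K h) ≠ 0) (b : Q.A) :
    ∑ l : Λ, (if arr l = b then m l else 0) = 2 * h.count b := by
  have key : ∀ i j i' j', cf arr Y m (Q.pathMat K h i j * Q.pathMat K h i' j') ≠ 0 →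
      ∑ l : Λ, (if arr l = b then m l else 0) = 2 * h.count b := by
    intro i j i' j' h1
    rw [cf_mul] at h1
    obtain ⟨⟨m1, m2⟩, hm, h2⟩ := Finset.exists_ne_zero_of_sum_ne_zero h1
    rw [Finset.HasAntidiagonal.mem_antidiagonal] at hm
    have a1 := cf_pathMat_deg arr Y h m1 i j (left_ne_zero_of_mul h2) b
    have a2 := cf_pathMat_deg arr Y h m2 i' j' (right_ne_zero_of_mul h2) b
    simp only at hm
    rw [two_mul]
    nth_rewrite 1 [← a1]
    rw [← a2, ← Finset.sum_add_distrib]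
    apply Finset.sum_congr rfl
    intro l _
    rw [← hm]
    split_ifs <;> simp
  by_contra hb
  apply hne
  rw [QuiverData.pathDet, Matrix.det_fin_two]
  have e : Q.pathMat K h 0 0 * Q.pathMat K h 1 1 - Q.pathMat K h 0 1 * Q.pathMat K h 1 0 =
    Q.pathMat K h 0 0 * Q.pathMat K h 1 1 + (-1 : K) • (Q.pathMat K h 0 1 * Q.pathMat K h 1 0) := by
    rw [neg_smul, one_smul, sub_eq_add_neg]
  rw [e, cf_add, cf_smul]
  have n1 : cf arr Y m (Q.pathMat K h 0 0 * Q.pathMat K h 1 1) = 0 := by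
    by_contra h1; exact hb (key _ _ _ _ h1)
  have n2 : cf arr Y m (Q.pathMat K h 0 1 * Q.pathMat K h 1 0) = 0 := by
    by_contra h1; exact hb (key _ _ _ _ h1)
  rw [n1, n2]; simp

/-- counting words with given content -/
theorem wsum_count (arr : Λ → Q.A) (h : List Q.A) : ∀ (m : Λ →₀ ℕ),
    (∀ b, ∑ l : Λ, (if arr l = b then m l else 0) = h.count b) →
    wsum arr h (fun w => if cont w = m then 1 else 0) * ∏ l : Λ, (m l).factorial =
      ∏ b ∈ Finset.univ.image arr, (h.count b).factorial := by
  induction h with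
  | nil =>
    intro m hm
    have : m = 0 := by
      ext l
      have := hm (arr l)
      rw [List.count_nil, Finset.sum_eq_zero_iff] at this
      simpa using this l (Finset.mem_univ l)
    subst this
    simp [wsum, cont_nil]
  | cons a h ih =>
    intro m hm
    simp only [wsum]
    rw [Finset.sum_mul]
    have hterm : ∀ l : Λ, (if arr l = a then wsum arr h (fun w => if cont (l :: w) = m then 1 else 0) else 0) *
        ∏ l : Λ, (m l).factorial = (if arr l = a then m l else 0) * ∏ b ∈ Finset.univ.image arr, (h.count b).factorial := by
      intro l
      by_cases hl : arr l = a
      · simp only [hl, if_true]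
        by_cases h0 : m l = 0
        · rw [h0, zero_mul, wsum_zero, zero_mul]
          intro w _
          rw [if_neg]
          rintro rfl
          simp [cont_cons] at h0
        · have hiff : ∀ w : List Λ, cont (l :: w) = m ↔ cont w = m - Finsupp.single l 1 := by
            intro w
            rw [cont_cons]
            constructor
            · rintro rfl; ext x; simp
            · intro h; rw [h]; ext x
              by_cases hx : x = l
              · subst hx; simp; omega
              · simp [hx, Ne.symm hx]
          simp only [hiff]
          rw [← ih (m - Finsupp.single l 1)]
          · have : ∏ x : Λ, (m x).factorial = m l * ∏ x : Λ, ((m - Finsupp.single l 1 : Λ →₀ ℕ) x).factorial := by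
              rw [← Finset.mul_prod_erase Finset.univ _ (Finset.mem_univ l),
                ← Finset.mul_prod_erase Finset.univ (fun x => ((m - Finsupp.single l 1 : Λ →₀ ℕ) x).factorial) (Finset.mem_univ l), ← mul_assoc]
              congr 1
              · simp [Nat.mul_factorial_pred h0]
              · apply Finset.prod_congr rfl
                intro x hx
                have : x ≠ l := Finset.ne_of_mem_erase hx
                simp [this, Ne.symm this]
            rw [this]; ring
          · intro b
            have hb := hm b
            rw [List.count_cons] at hb
            have : ∀ x, (if arr x = b then m x else 0) =
              (if arr x = b then (m - Finsupp.single l 1 : Λ →₀ ℕ) x else 0) + (if x = l then (if arr l = b then 1 else 0) else 0) := by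
              intro x
              by_cases hx : x = l
              · subst hx; by_cases hb : arr x = b <;> simp [hb]; try omega
              · simp [hx, Ne.symm hx]
            simp only [this, Finset.sum_add_distrib] at hb
            simp [hl] at hb
            simpa using hb
      · simp [hl]
    rw [Finset.sum_congr rfl (fun l _ => hterm l), ← Finset.sum_mul, hm a]
    have ha : a ∈ Finset.univ.image arr := by
      have h1 := hm a
      by_contra hn
      rw [Finset.sum_eq_zero] at h1
      · simp at h1
      · intro l _; rw [if_neg]; rintro rfl; exact hn (by simp)
    rw [← Finset.mul_prod_erase _ _ ha, ← Finset.mul_prod_erase (Finset.univ.image arr) (fun b => (List.count b (a :: h)).factorial) ha, ← mul_assoc]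
    congr 1
    · simp [List.count_cons_self, Nat.factorial_succ]
    · apply Finset.prod_congr rfl
      intro b hb
      rw [List.count_cons_of_ne (Ne.symm (Finset.ne_of_mem_erase hb))]

theorem wsum_const (arr : Λ → Q.A) (h : List Q.A) (m : Λ →₀ ℕ) (c : K) :
    wsum arr h (fun w => if cont w = m then c else 0) =
      (wsum arr h (fun w => if cont w = m then 1 else 0) : ℕ) * c := by
  have := wsum_map ((AddMonoidHom.mulRight c).comp (Nat.castAddMonoidHom K)) arr h (fun w => if cont w = m then 1 else 0)
  simp only [AddMonoidHom.comp_apply, AddMonoidHom.coe_mulRight, Nat.coe_castAddMonoidHom] at this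
  rw [this]
  apply wsum_congr
  intro w _; split_ifs <;> simp

end wsum
end QR

set_option linter.all false

namespace QR

theorem Rep.compat {B V : Type*} {σ : Equiv.Perm B} {τ : List B} (H : Rep σ τ) {bs bt : B → V}
    (hc : Cl bs bt τ) {l : B} (hl : l ∈ τ) : bs (σ l) = bt l := by
  obtain ⟨l', hr⟩ := exists_rot_last hl
  obtain ⟨u, hu⟩ := (H.rotated hr).2.2.1
  obtain ⟨z, hz⟩ := hc.rotated hr
  have e1 := (walk_snoc.1 hu).2
  have e2 := (walk_snoc.1 hz).2
  rw [e1, e2]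
  cases l' with
  | nil => rw [← hu.1]; exact hz.1
  | cons x l' => rw [← hu.1]; exact hz.1

section ellt
variable {K : Type} [Field K] {Q : QuiverData} {Fl L : Type} [Fintype Fl] [Fintype L] {W : Type}

/-- keep only the `L`-letters -/
def fil (w : List (Fl ⊕ L)) : List L := w.filterMap Sum.getRight?

@[simp] theorem fil_nil : fil ([] : List (Fl ⊕ L)) = [] := rfl
@[simp] theorem fil_inl (a : Fl) (w : List (Fl ⊕ L)) : fil (Sum.inl a :: w) = fil w := rfl
@[simp] theorem fil_inr (l : L) (w : List (Fl ⊕ L)) : fil (Sum.inr l :: w) = l :: fil w := rfl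
@[simp] theorem fil_append (w w' : List (Fl ⊕ L)) : fil (w ++ w') = fil w ++ fil w' := by
  simp [fil]

theorem mem_of_cont {Λ : Type} [Fintype Λ] {w : List Λ} {x : Λ} : cont w x ≠ 0 ↔ x ∈ w := by
  rw [cont_apply]
  rw [← Nat.pos_iff_ne_zero, List.count_pos_iff]

theorem fil_count (w : List (Fl ⊕ L)) (l : L) : (fil w).count l = cont w (Sum.inr l) := by
  induction w with
  | nil => simp [cont_nil]
  | cons a w ih =>
    rw [cont_cons]
    rcases a with a | a
    · simp [ih, Finsupp.single_apply]
    · simp only [fil_inr, List.count_cons, ih, Finsupp.add_apply, Finsupp.single_apply, Sum.inr.injEq]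
      by_cases h : a = l <;> simp [h, add_comm]

theorem mem_fil {w : List (Fl ⊕ L)} {l : L} : l ∈ fil w ↔ Sum.inr l ∈ w := by
  induction w with
  | nil => simp
  | cons a w ih => rcases a with a | a <;> simp [ih]

theorem fil_walk {V : Type*} {s t : Fl ⊕ L → V} {w : List (Fl ⊕ L)} {u v : V} (h : Walk s t u v w)
    (hF : ∀ a, Sum.inl a ∈ w → s (Sum.inl a) = t (Sum.inl a)) :
    Walk (fun l => s (Sum.inr l)) (fun l => t (Sum.inr l)) u v (fil w) := by
  induction w generalizing u with
  | nil => exact h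
  | cons a w ih =>
    have ih' := ih h.2 (fun a ha => hF a (by simp [ha]))
    rcases a with a | a
    · rw [fil_inl, ← h.1, hF a (by simp)]; exact ih'
    · exact ⟨h.1, ih'⟩

theorem fil_prod (x : L ⊕ L → Fin 2 → K) (w : List (Fl ⊕ L)) :
    (w.map (Yx x)).reverse.prod = ((fil w).map (fun l => Yx (Fl := Fl) x (Sum.inr l))).reverse.prod := by
  induction w with
  | nil => rfl
  | cons a w ih =>
    rcases a with a | a
    · simp only [List.map_cons, List.reverse_cons, List.prod_append, ih, fil_inl]
      simp [Yx]
    · simp only [List.map_cons, List.reverse_cons, List.prod_append, ih, fil_inr]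

theorem cyc_prod (f g : L → Fin 2) {σ : Equiv.Perm L} {u z : L} {τ : List L} (h : Walk id σ u z τ) :
    Matrix.vecMul (be K (g z)) (τ.map (fun l => Matrix.of fun i j => be K (f l) i * be K (g l) j)).reverse.prod =
      (τ.map (fun l => if f l = g (σ l) then (1:K) else 0)).prod • be K (g u) := by
  induction τ generalizing u with
  | nil =>
    have : u = z := h
    subst this; simp
  | cons l τ ih =>
    obtain ⟨h1, h2⟩ := h
    simp only [id] at h1
    subst h1
    simp only [List.map_cons, List.reverse_cons, List.prod_append, List.prod_cons, List.prod_nil, mul_one]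
    rw [← Matrix.vecMul_vecMul, ih h2, Matrix.smul_vecMul, mul_comm, mul_smul]
    congr 1
    funext j
    simp only [Matrix.vecMul, dotProduct, Fin.sum_univ_two, Matrix.of_apply, Pi.smul_apply, smul_eq_mul, be]
    generalize f l = a
    generalize g (σ l) = b
    fin_cases a <;> fin_cases b <;> simp

theorem cyc_trace {f g : L → Fin 2} {σ : Equiv.Perm L} {τ : List L} (H : Rep σ τ) (hf : ∀ l, l ∈ τ) :
    Matrix.trace (τ.map (fun l => Matrix.of fun i j => be K (f l) i * be K (g l) j)).reverse.prod =
      Th K σ (f, g) := by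
  obtain ⟨h1, h2, ⟨u, hu⟩, h4⟩ := H
  cases τ with
  | nil => exact absurd rfl h2
  | cons l τ =>
    obtain ⟨e1, e2⟩ := hu
    simp only [id] at e1
    subst e1
    have e3 := cyc_prod (K := K) f g e2
    simp only [List.map_cons, List.reverse_cons, List.prod_append, List.prod_cons, List.prod_nil, mul_one]
    have e4 : ∀ P : Matrix (Fin 2) (Fin 2) K, Matrix.trace (P * Matrix.of fun i j => be K (f l) i * be K (g l) j) =
      dotProduct (Matrix.vecMul (be K (g l)) P) (be K (f l)) := by
      intro P
      simp only [Matrix.trace, Matrix.diag_apply, Matrix.mul_apply, Matrix.vecMul, dotProduct, Fin.sum_univ_two, Matrix.of_apply]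
      ring
    rw [e4, e3]
    have e5 : (if f l = g (σ l) then (1:K) else 0) = dotProduct (be K (g (σ l))) (be K (f l)) := by
      simp only [dotProduct, Fin.sum_univ_two, be]
      generalize f l = a
      generalize g (σ l) = b
      fin_cases a <;> fin_cases b <;> simp
    rw [smul_dotProduct, ← e5, smul_eq_mul, mul_comm]
    have e6 : ((l :: τ).map (fun l => if f l = g (σ l) then (1:K) else 0)).prod = Th K σ (f, g) := by
      rw [← ThS_univ]
      simp only [ThS]
      rw [← List.prod_toFinset _ h1]
      apply Finset.prod_congr _ (fun _ _ => rfl)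
      ext x; simpa using hf x
    rw [← e6, List.map_cons, List.prod_cons]

variable (arr : Fl ⊕ L → Q.A)

theorem ell_trace [Infinite K] [Nonempty L] (M : Q.V → W) (m0 : Fl ⊕ L →₀ ℕ) (h0 : ∀ l, m0 (Sum.inr l) = 1)
    (hM : ∀ a, m0 (Sum.inl a) ≠ 0 → M (Q.src (arr (Sum.inl a))) = M (Q.tgt (arr (Sum.inl a))))
    (ψ : List L → K)
    (hrot : ∀ w w', FullW (fun l => M (Q.src (arr (Sum.inr l)))) (fun l => M (Q.tgt (arr (Sum.inr l)))) w →
      w ~r w' → ψ w = ψ w')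
    (hsw : ∀ (z : W) (A B C : List L), A ≠ [] → B ≠ [] → C ≠ [] →
      Walk (fun l => M (Q.src (arr (Sum.inr l)))) (fun l => M (Q.tgt (arr (Sum.inr l)))) z z A → 
      Walk (fun l => M (Q.src (arr (Sum.inr l)))) (fun l => M (Q.tgt (arr (Sum.inr l)))) z z B → 
      Walk (fun l => M (Q.src (arr (Sum.inr l)))) (fun l => M (Q.tgt (arr (Sum.inr l)))) z z C →
      FullW (fun l => M (Q.src (arr (Sum.inr l)))) (fun l => M (Q.tgt (arr (Sum.inr l)))) (A ++ B ++ C) →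
      ψ (A ++ B ++ C) + ψ (A ++ C ++ B) = 0)
    (hR3 : ∀ p ∈ Q.PlusSet K, ∀ m1 m2 : Fl ⊕ L →₀ ℕ, m1 + m2 = m0 → m1 ≠ 0 → (∀ l, m1 (Sum.inr l) = 0) →
      cf arr (fun _ => 1) m1 p ≠ 0 → ∃ (W' : Type) (M' : Q.V → W'),
        (∀ a, m2 (Sum.inl a) ≠ 0 → M' (Q.src (arr (Sum.inl a))) = M' (Q.tgt (arr (Sum.inl a)))) ∧
        (∀ u v, M' u = M' v → M u = M v) ∧
        ∀ w, FullW (fun l => M' (Q.src (arr (Sum.inr l)))) (fun l => M' (Q.tgt (arr (Sum.inr l)))) w → ψ w = 0) :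
    ∃ ℓ : MvPolynomial Q.Var K →ₗ[K] K,
      (∀ p ∈ Q.PlusSet K, ∀ q ∈ Q.PlusSet K, ℓ (p * q) = 0) ∧
      (∀ h, Cl Q.src Q.tgt h → ℓ (Q.pathTr K h) = wsum arr h (fun w => if cont w = m0 then ψ (fil w) else 0)) ∧
      (∀ p, (∀ Y, cf arr Y m0 p = 0) → ℓ p = 0) := by
  obtain ⟨T, hT1, hT2⟩ := ell arr M m0 h0 hM ψ hrot hsw hR3
  let Cl' : MvPolynomial Q.Var K →ₗ[K] ((L → Fin 2) × (L → Fin 2) → K) :=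
    { toFun := fun p => Cfun (cs arr m0 p)
      map_add' := by intro p q; funext y; simp [Cfun, cs, cf_add]
      map_smul' := by intro c p; funext y; simp [Cfun, cs, cf_smul] }
  refine ⟨T ∘ₗ Cl', hT1, ?_, ?_⟩
  · intro h hh
    have e1 : Cl' (Q.pathTr K h) = wsum arr h (fun w => if cont w = m0 then (fun y : (L → Fin 2) × (L → Fin 2) => 
       Matrix.trace (w.map (Yx (Sum.elim (fun l => be K (y.1 l)) (fun l => be K (y.2 l))))).reverse.prod) else 0) := by
      funext y
      rw [wsum_fn]
      show cf arr _ m0 (Q.pathTr K h) = _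
      rw [cf_pathTr]
      apply wsum_congr
      intro w _
      split_ifs <;> rfl
    rw [LinearMap.comp_apply, e1, wsum_map]
    apply wsum_congr
    intro w hw
    split_ifs with hc
    · have hcount : ∀ l, (fil w).count l = 1 := by
        intro l; rw [fil_count, hc, h0]
      have hnd : (fil w).Nodup := by
        rw [List.nodup_iff_count_le_one]; intro l; rw [hcount]
      have hfull : ∀ l, l ∈ fil w := by
        intro l; rw [← List.count_pos_iff, hcount]; norm_num
      obtain ⟨l0⟩ := (inferInstance : Nonempty L)
      obtain ⟨σ, hσ⟩ := exists_rep hnd (List.ne_nil_of_mem (hfull l0))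
      have hcl : Cl (fun l => M (Q.src (arr (Sum.inr l)))) (fun l => M (Q.tgt (arr (Sum.inr l)))) (fil w) := by
        obtain ⟨u, hu⟩ := hh
        rw [← hw, walk_map] at hu
        refine ⟨M u, fil_walk (s := fun x => M (Q.src (arr x))) (t := fun x => M (Q.tgt (arr x))) (walk_comp M hu) ?_⟩
        intro a ha
        apply hM
        rw [← hc]
        exact mem_of_cont.2 ha
      have hcomp : ∀ l, M (Q.src (arr (Sum.inr (σ l)))) = M (Q.tgt (arr (Sum.inr l))) :=
        fun l => hσ.compat hcl (hfull l)
      have e2 : (fun y : (L → Fin 2) × (L → Fin 2) => 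
       Matrix.trace (w.map (Yx (Sum.elim (fun l => be K (y.1 l)) (fun l => be K (y.2 l))))).reverse.prod) = Th K σ := by
        funext y
        rw [fil_prod]
        exact cyc_trace hσ hfull
      rw [e2, hT2 σ hcomp, wf_eq hrot hcomp hσ hfull]
    · exact map_zero T
  · intro p hp
    have : Cl' p = 0 := by funext y; exact hp _
    rw [LinearMap.comp_apply, this, map_zero]

end ellt
end QR

set_option linter.all false

namespace QR
section red
variable {K : Type} [Field K] {Q : QuiverData}

theorem pathMat_append (l l' : List Q.A) : Q.pathMat K (l ++ l') = Q.pathMat K l' * Q.pathMat K l := by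
  simp [QuiverData.pathMat]

theorem pathMat_act (g : Q.V → Matrix (Fin 2) (Fin 2) K) (hg : ∀ v, IsUnit (g v).det) {u v : Q.V} {h : List Q.A}
    (hh : Q.IsPathFrom u v h) :
    (Q.pathMat K h).map (MvPolynomial.aeval (Q.actVar K g)) * (g u).map MvPolynomial.C =
      (g v).map MvPolynomial.C * (Q.pathMat K h) := by
  induction h generalizing u with
  | nil =>
    have : u = v := hh
    subst this
    simp [QuiverData.pathMat]
  | cons a h ih =>
    obtain ⟨h1, h2⟩ := hh
    have ih' := ih h2
    rw [pathMat_cons, Matrix.map_mul, Matrix.mul_assoc]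
    have e1 : (Q.genMat K a).map (MvPolynomial.aeval (Q.actVar K g)) =
        (g (Q.tgt a)).map MvPolynomial.C * Q.genMat K a * (g u)⁻¹.map MvPolynomial.C := by
      ext i j : 1
      have e0 : (MvPolynomial.aeval (Q.actVar K g)) (MvPolynomial.X ((a, i, j) : Q.Var) : MvPolynomial Q.Var K) =
        Q.actVar K g (a, i, j) := MvPolynomial.aeval_X _ _
      have e0' : Q.actVar K g (a, i, j) = ∑ k : Fin 2, ∑ l : Fin 2,
        MvPolynomial.C (g (Q.tgt a) i k * (g u)⁻¹ l j) * Q.genMat K a k l := by rw [← h1]; rfl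
      refine (e0.trans e0').trans ?_
      simp only [Matrix.map_apply, Matrix.mul_apply, Fin.sum_univ_two, map_mul]
      ring
    have e2 : ((g u)⁻¹.map MvPolynomial.C : Matrix (Fin 2) (Fin 2) (MvPolynomial Q.Var K)) * (g u).map MvPolynomial.C = 1 := by
      rw [← Matrix.map_mul, Matrix.nonsing_inv_mul _ (hg u)]
      exact Matrix.map_one _ MvPolynomial.C_0 MvPolynomial.C_1
    rw [e1, Matrix.mul_assoc, Matrix.mul_assoc, e2, Matrix.mul_one, ← Matrix.mul_assoc, ih', Matrix.mul_assoc]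

theorem pathMat_act' (g : Q.V → Matrix (Fin 2) (Fin 2) K) (hg : ∀ v, IsUnit (g v).det) {u : Q.V} {h : List Q.A}
    (hh : Q.IsPathFrom u u h) :
    ∃ G G' : Matrix (Fin 2) (Fin 2) (MvPolynomial Q.Var K), G' * G = 1 ∧
    (Q.pathMat K h).map (MvPolynomial.aeval (Q.actVar K g)) = G * Q.pathMat K h * G' := by
  refine ⟨(g u).map MvPolynomial.C, (g u)⁻¹.map MvPolynomial.C, ?_, ?_⟩
  · rw [← Matrix.map_mul, Matrix.nonsing_inv_mul _ (hg u)]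
    exact Matrix.map_one _ MvPolynomial.C_0 MvPolynomial.C_1
  · rw [← pathMat_act g hg hh, Matrix.mul_assoc, ← Matrix.map_mul, Matrix.mul_nonsing_inv _ (hg u), Matrix.map_one _ MvPolynomial.C_0 MvPolynomial.C_1, Matrix.mul_one]

theorem pathMat_cc {h : List Q.A} (hh : h ≠ []) :
    (Q.pathMat K h).map MvPolynomial.constantCoeff = 0 := by
  cases h with
  | nil => exact absurd rfl hh
  | cons a h =>
    rw [pathMat_cons, Matrix.map_mul]
    have : (Q.genMat K a).map (MvPolynomial.constantCoeff : MvPolynomial Q.Var K →+* K) = 0 := by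
      ext i j
      simp only [Matrix.map_apply, QuiverData.genMat, Matrix.of_apply]
      exact MvPolynomial.constantCoeff_X (R := K) (σ := Q.Var) _
    rw [this, Matrix.mul_zero]

theorem tr_plus {h : List Q.A} (hh : Q.IsClosed h) : Q.pathTr K h ∈ Q.PlusSet K := by
  obtain ⟨v, h1, h2⟩ := hh
  constructor
  · intro g hg
    obtain ⟨G, G', e, e'⟩ := pathMat_act' g hg h2
    unfold QuiverData.pathTr
    have : MvPolynomial.aeval (Q.actVar K g) (Matrix.trace (Q.pathMat K h)) =
      Matrix.trace ((Q.pathMat K h).map (MvPolynomial.aeval (Q.actVar K g))) := by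
      simp [Matrix.trace, Fin.sum_univ_two]
    rw [this, e', Matrix.trace_mul_comm, ← Matrix.mul_assoc, e, Matrix.one_mul]
  · have := pathMat_cc (K := K) h1
    unfold QuiverData.pathTr
    have h2 : MvPolynomial.constantCoeff (Matrix.trace (Q.pathMat K h)) =
      Matrix.trace ((Q.pathMat K h).map MvPolynomial.constantCoeff) := by
      simp [Matrix.trace, Fin.sum_univ_two]
    rw [h2, this, Matrix.trace_zero]

theorem det_plus {h : List Q.A} (hh : Q.IsClosed h) : Q.pathDet K h ∈ Q.PlusSet K := by
  obtain ⟨v, h1, h2⟩ := hh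
  constructor
  · intro g hg
    obtain ⟨G, G', e, e'⟩ := pathMat_act' g hg h2
    unfold QuiverData.pathDet
    have : MvPolynomial.aeval (Q.actVar K g) (Matrix.det (Q.pathMat K h)) =
      Matrix.det ((Q.pathMat K h).map (MvPolynomial.aeval (Q.actVar K g))) := by
      simp [Matrix.det_fin_two]
    rw [this, e', Matrix.det_mul, Matrix.det_mul]
    have : G'.det * G.det = 1 := by rw [← Matrix.det_mul, e, Matrix.det_one]
    linear_combination (Q.pathMat K h).det * this
  · have := pathMat_cc (K := K) h1
    unfold QuiverData.pathDet
    have h2 : MvPolynomial.constantCoeff (Matrix.det (Q.pathMat K h)) =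
      Matrix.det ((Q.pathMat K h).map MvPolynomial.constantCoeff) := by
      simp [Matrix.det_fin_two]
    rw [h2, this, Matrix.det_zero]

theorem zero_plus : (0 : MvPolynomial Q.Var K) ∈ Q.PlusSet K := by
  constructor
  · intro g hg; simp
  · simp

theorem sigma_plus {k : ℕ} (hk : 1 ≤ k) {h : List Q.A} (hh : Q.IsClosed h) : Q.pathSigma K k h ∈ Q.PlusSet K := by
  unfold QuiverData.pathSigma
  split_ifs
  · omega
  · exact tr_plus hh
  · exact det_plus hh
  · exact zero_plus

theorem toInv_inv (p : Q.AQ K) : Q.IsInvariant K (Q.toInv K p) := by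
  induction p using MvPolynomial.induction_on with
  | C a => intro g hg; simp [QuiverData.toInv]
  | add p q hp hq => intro g hg; rw [map_add, map_add, hp g hg, hq g hg]
  | mul_X p i hp =>
    intro g hg; rw [map_mul, map_mul, hp g hg]
    congr 1
    simp only [QuiverData.toInv, MvPolynomial.aeval_X]
    exact (sigma_plus i.2.1 i.2.2).1 g hg

theorem toInv_cc (p : Q.AQ K) : MvPolynomial.constantCoeff (Q.toInv K p) = MvPolynomial.constantCoeff p := by
  induction p using MvPolynomial.induction_on with
  | C a => simp [QuiverData.toInv]
  | add p q hp hq => simp [hp, hq]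
  | mul_X p i hp =>
    rw [map_mul, map_mul, map_mul, MvPolynomial.constantCoeff_X, mul_zero]
    have : MvPolynomial.constantCoeff (Q.toInv K (MvPolynomial.X i)) = 0 := by
      simp only [QuiverData.toInv, MvPolynomial.aeval_X]
      exact (sigma_plus i.2.1 i.2.2).2
    rw [this, mul_zero]

theorem toInv_plus {p : Q.AQ K} (hp : MvPolynomial.constantCoeff p = 0) : Q.toInv K p ∈ Q.PlusSet K :=
  ⟨toInv_inv p, by rw [toInv_cc, hp]⟩

noncomputable def DD (K : Type) [Field K] (Q : QuiverData) : Submodule K (MvPolynomial Q.Var K) := Submodule.span K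
    {x : MvPolynomial Q.Var K | ∃ p ∈ Q.PlusSet K, ∃ q ∈ Q.PlusSet K, x = p * q}

theorem mul_DD {p q : MvPolynomial Q.Var K} (hp : p ∈ Q.PlusSet K) (hq : q ∈ Q.PlusSet K) : p * q ∈ DD K Q :=
  Submodule.subset_span ⟨p, hp, q, hq, rfl⟩

theorem plus_mul {p q : MvPolynomial Q.Var K} (hp : p ∈ Q.PlusSet K) (hq : q ∈ Q.PlusSet K) : p * q ∈ Q.PlusSet K :=
  ⟨fun g hg => by rw [map_mul, hp.1 g hg, hq.1 g hg], by rw [map_mul, hp.2, zero_mul]⟩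

theorem closed_append {v : Q.V} {a b : List Q.A} (ha : Q.IsClosedAt v a) (hb : Q.IsClosedAt v b) :
    Q.IsClosedAt v (a ++ b) := by
  refine ⟨by simp [ha.1], ?_⟩
  have h1 := ha.2
  have h2 := hb.2
  rw [isPathFrom_iff] at *
  exact walk_append.2 ⟨v, h1, h2⟩

theorem toInv_sym {k : ℕ} {l : List Q.A} (h) : Q.toInv K (Q.sym K k l h) = Q.pathSigma K k l := by
  exact MvPolynomial.aeval_X _ _

theorem sig1 (l : List Q.A) : Q.pathSigma K 1 l = Q.pathTr K l := by simp [QuiverData.pathSigma]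
theorem sig2 (l : List Q.A) : Q.pathSigma K 2 l = Q.pathDet K l := by simp [QuiverData.pathSigma]

theorem tr3 {v : Q.V} {a b c : List Q.A} (ha : Q.IsClosedAt v a) (hb : Q.IsClosedAt v b) (hc : Q.IsClosedAt v c) :
    Q.pathTr K (a ++ c ++ b) + Q.pathTr K (a ++ b ++ c) ∈ DD K Q := by
  have P := fun {x} (h : Q.IsClosedAt v x) => tr_plus (K := K) ⟨v, h⟩
  have : Q.pathTr K (a ++ c ++ b) + Q.pathTr K (a ++ b ++ c) =
    Q.pathTr K a * Q.pathTr K (b ++ c) + Q.pathTr K b * Q.pathTr K (a ++ c) + Q.pathTr K c * Q.pathTr K (a ++ b)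
    - Q.pathTr K a * Q.pathTr K b * Q.pathTr K c := by
    simp only [QuiverData.pathTr, pathMat_append]
    simp only [Matrix.trace, Fin.sum_univ_two, Matrix.diag_apply, Matrix.mul_apply]
    ring
  rw [this]
  exact sub_mem (add_mem (add_mem (mul_DD (P ha) (P (closed_append hb hc))) (mul_DD (P hb) (P (closed_append ha hc))))
    (mul_DD (P hc) (P (closed_append ha hb)))) (mul_DD (plus_mul (P ha) (P hb)) (P hc))

theorem tr_rot (a b : List Q.A) : Q.pathTr K (a ++ b) = Q.pathTr K (b ++ a) := by
  rw [QuiverData.pathTr, QuiverData.pathTr, pathMat_append, pathMat_append, Matrix.trace_mul_comm]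

theorem rel_DD {x : Q.AQ K} (hx : x ∈ Q.RelSet K) : Q.toInv K x ∈ DD K Q := by
  rcases hx with h | h | h | h | h | h | h
  · obtain ⟨k, u, v, l₁, l₂, h₁, h₂, hk, -, -, -, -, rfl⟩ := h
    rw [map_sub, toInv_sym, toInv_sym]
    have : Q.pathSigma K k (l₁ ++ l₂) = Q.pathSigma K k (l₂ ++ l₁) := by
      rcases hk with rfl | rfl
      · rw [sig1, sig1, tr_rot]
      · simp only [sig2, QuiverData.pathDet, pathMat_append, Matrix.det_mul, mul_comm]
    rw [this, sub_self]; exact zero_mem _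
  · obtain ⟨v, a, h₁, h₂, ha, rfl⟩ := h
    rw [map_add, map_mul, toInv_sym, toInv_sym, sig1, sig2]
    have : Q.pathTr K (a ++ a) + (Q.toInv K) 2 * Q.pathDet K a = Q.pathTr K a * Q.pathTr K a := by
      rw [map_ofNat]
      simp only [QuiverData.pathTr, QuiverData.pathDet, pathMat_append]
      simp only [Matrix.trace, Fin.sum_univ_two, Matrix.diag_apply, Matrix.mul_apply, Matrix.det_fin_two]
      ring
    rw [this]; exact mul_DD (tr_plus ⟨v, ha⟩) (tr_plus ⟨v, ha⟩)
  · obtain ⟨v, a, b, h₁, ha, hb, rfl⟩ := h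
    rw [toInv_sym, sig1]
    have : Q.pathTr K (a ++ a ++ b) = Q.pathTr K a * Q.pathTr K (a ++ b) - Q.pathDet K a * Q.pathTr K b := by
      simp only [QuiverData.pathTr, QuiverData.pathDet, pathMat_append]
      simp only [Matrix.trace, Fin.sum_univ_two, Matrix.diag_apply, Matrix.mul_apply, Matrix.det_fin_two]
      ring
    rw [this]
    exact sub_mem (mul_DD (tr_plus ⟨v, ha⟩) (tr_plus ⟨v, closed_append ha hb⟩)) (mul_DD (det_plus ⟨v, ha⟩) (tr_plus ⟨v, hb⟩))
  · obtain ⟨v, a, b, c, h₁, h₂, ha, hb, hc, rfl⟩ := h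
    rw [map_add, toInv_sym, toInv_sym, sig1, sig1]
    have := tr3 (K := K) hc ha hb
    rw [List.append_assoc, tr_rot, List.append_assoc c a b, tr_rot c] at this
    exact this
  · obtain ⟨v, a, b, c, h₁, h₂, ha, hb, hc, rfl⟩ := h
    rw [map_add, toInv_sym, toInv_sym, sig1, sig1]
    exact tr3 ha hb hc
  · obtain ⟨v, a, b, h₁, ha, hb, rfl⟩ := h
    rw [toInv_sym, sig2]
    have : Q.pathDet K (a ++ b) = Q.pathDet K a * Q.pathDet K b := by
      simp only [QuiverData.pathDet, pathMat_append, Matrix.det_mul, mul_comm]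
    rw [this]
    exact mul_DD (det_plus ⟨v, ha⟩) (det_plus ⟨v, hb⟩)
  · obtain ⟨k, v, a, h₁, hk, ha, rfl⟩ := h
    rw [toInv_sym]
    have : Q.pathSigma K k a = 0 := by
      unfold QuiverData.pathSigma
      rw [if_neg (by omega), if_neg (by omega), if_neg (by omega)]
    rw [this]; exact zero_mem _

theorem easy_dir (q : Q.AQ K) (hq : q ∈ Submodule.span K (Q.RelSet K) ⊔ Q.AQplusSq K) :
    Q.Decomposable K (Q.toInv K q) := by
  have : Submodule.span K (Q.RelSet K) ⊔ Q.AQplusSq K ≤ (DD K Q).comap (Q.toInv K).toLinearMap := by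
    rw [sup_le_iff]
    constructor
    · rw [Submodule.span_le]; intro x hx; exact rel_DD hx
    · unfold QuiverData.AQplusSq
      rw [Submodule.span_le]
      rintro x ⟨p, q, hp, hq, rfl⟩
      show Q.toInv K (p * q) ∈ DD K Q
      rw [map_mul]
      exact mul_DD (toInv_plus hp) (toInv_plus hq)
  exact this hq

/-- the combinatorial data of a linear form on the quotient by the relations -/
structure PD (Q : QuiverData) (K : Type) [Field K] (φ δ : List Q.A → K) : Prop where
  rot : ∀ u v a b, Walk Q.src Q.tgt u v a → Walk Q.src Q.tgt v u b → φ (a ++ b) = φ (b ++ a)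
  drot : ∀ u v a b, Walk Q.src Q.tgt u v a → Walk Q.src Q.tgt v u b → δ (a ++ b) = δ (b ++ a)
  sq : ∀ v a, a ≠ [] → Walk Q.src Q.tgt v v a → φ (a ++ a) = - 2 * δ a
  sqm : ∀ v a b, a ≠ [] → b ≠ [] → Walk Q.src Q.tgt v v a → Walk Q.src Q.tgt v v b → φ (a ++ a ++ b) = 0
  sw : ∀ v a b c, a ≠ [] → b ≠ [] → c ≠ [] → Walk Q.src Q.tgt v v a → Walk Q.src Q.tgt v v b → 
    Walk Q.src Q.tgt v v c → φ (a ++ c ++ b) = - φ (a ++ b ++ c)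
  dmul : ∀ v a b, a ≠ [] → b ≠ [] → Walk Q.src Q.tgt v v a → Walk Q.src Q.tgt v v b → δ (a ++ b) = 0

def Main (Q : QuiverData) (K : Type) [Field K] : Prop := ∀ φ δ : List Q.A → K, PD Q K φ δ → ∀ α : Multiset Q.A,
  ∃ ℓ : MvPolynomial Q.Var K →ₗ[K] K, (∀ p ∈ Q.PlusSet K, ∀ q ∈ Q.PlusSet K, ℓ (p * q) = 0) ∧
    (∀ h : List Q.A, h ≠ [] → Cl Q.src Q.tgt h → ℓ (Q.pathTr K h) = if (h : Multiset Q.A) = α then φ h else 0) ∧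
    (∀ h : List Q.A, h ≠ [] → Cl Q.src Q.tgt h → ℓ (Q.pathDet K h) = if 2 • (h : Multiset Q.A) = α then δ h else 0)

theorem AQ_decomp (p : Q.AQ K) : p - MvPolynomial.C (MvPolynomial.constantCoeff p) ∈
    Submodule.span K (Set.range (MvPolynomial.X : Q.SymIdx → Q.AQ K)) ⊔ Q.AQplusSq K := by
  induction p using MvPolynomial.induction_on with
  | C a => simp
  | add p q hp hq =>
    have := add_mem hp hq
    rw [map_add, map_add]
    convert this using 1
    ring
  | mul_X p i hp =>
    rw [map_mul, MvPolynomial.constantCoeff_X, mul_zero, map_zero, sub_zero]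
    have : p * MvPolynomial.X i = (p - MvPolynomial.C (MvPolynomial.constantCoeff p)) * MvPolynomial.X i + 
      (MvPolynomial.constantCoeff p) • MvPolynomial.X i := by
      rw [MvPolynomial.smul_eq_C_mul]; ring
    rw [this]
    apply add_mem
    · apply Submodule.mem_sup_right
      exact Submodule.subset_span ⟨_, _, by simp, by simp, rfl⟩
    · apply Submodule.mem_sup_left
      exact Submodule.smul_mem _ _ (Submodule.subset_span ⟨i, rfl⟩)

theorem hard_dir (HM : Main Q K) (q : Q.AQ K) (hd : Q.Decomposable K (Q.toInv K q)) :
    q ∈ Submodule.span K (Q.RelSet K) ⊔ Q.AQplusSq K := by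
  by_contra hq
  obtain ⟨Φ, hΦq, hΦ⟩ := Submodule.exists_le_ker_of_notMem hq
  have hΦR : ∀ x ∈ Q.RelSet K, Φ x = 0 := fun x hx => hΦ (Submodule.mem_sup_left (Submodule.subset_span hx))
  have hΦS : ∀ p p' : Q.AQ K, MvPolynomial.constantCoeff p = 0 → MvPolynomial.constantCoeff p' = 0 → Φ (p * p') = 0 :=
    fun p p' hp hp' => hΦ (Submodule.mem_sup_right (Submodule.subset_span ⟨p, p', hp, hp', rfl⟩))
  let φ : ℕ → List Q.A → K := fun k l => if h : 1 ≤ k ∧ Q.IsClosed l then Φ (Q.sym K k l h) else 0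
  have φe : ∀ {k l} (h : 1 ≤ k ∧ Q.IsClosed l), φ k l = Φ (Q.sym K k l h) := fun h => dif_pos h
  have clA : ∀ {v a}, a ≠ [] → Walk Q.src Q.tgt v v a → Q.IsClosedAt v a := fun h1 h2 => ⟨h1, (isPathFrom_iff _ _ _ _).2 h2⟩
  have hrot : ∀ k, (k = 1 ∨ k = 2) → ∀ u v a b, Walk Q.src Q.tgt u v a → Walk Q.src Q.tgt v u b → 
      φ k (a ++ b) = φ k (b ++ a) := by
    intro k hk u v a b ha hb
    by_cases ha0 : a = []
    · simp [ha0]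
    by_cases hb0 : b = []
    · simp [hb0]
    have h1 : 1 ≤ k ∧ Q.IsClosed (a ++ b) := ⟨by omega, u, by simp [ha0], (isPathFrom_iff _ _ _ _).2 (walk_append.2 ⟨_, ha, hb⟩)⟩
    have h2 : 1 ≤ k ∧ Q.IsClosed (b ++ a) := ⟨by omega, v, by simp [ha0], (isPathFrom_iff _ _ _ _).2 (walk_append.2 ⟨_, hb, ha⟩)⟩
    rw [φe h1, φe h2]
    have := hΦR (Q.sym K k (a ++ b) h1 - Q.sym K k (b ++ a) h2) (Or.inl ⟨k, u, v, a, b, h1, h2, hk, ha0, hb0, 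
      (isPathFrom_iff _ _ _ _).2 ha, (isPathFrom_iff _ _ _ _).2 hb, rfl⟩)
    rw [map_sub, sub_eq_zero] at this
    exact this
  have hPD : PD Q K (φ 1) (φ 2) := by
    refine ⟨hrot 1 (by simp), hrot 2 (by simp), ?_, ?_, ?_, ?_⟩
    · intro v a ha hw
      have c := clA ha hw
      have h1 : 1 ≤ 1 ∧ Q.IsClosed (a ++ a) := ⟨by omega, v, closed_append c c⟩
      have h2 : 1 ≤ 2 ∧ Q.IsClosed a := ⟨by omega, v, c⟩
      rw [φe h1, φe h2]
      have := hΦR _ (Or.inr (Or.inl ⟨v, a, h1, h2, c, rfl⟩))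
      rw [map_add, show (2 : Q.AQ K) * Q.sym K 2 a h2 = (2:K) • Q.sym K 2 a h2 by
        rw [MvPolynomial.smul_eq_C_mul, map_ofNat], map_smul, smul_eq_mul] at this
      linear_combination this
    · intro v a b ha hb hwa hwb
      have h1 : 1 ≤ 1 ∧ Q.IsClosed (a ++ a ++ b) := 
        ⟨by omega, v, closed_append (closed_append (clA ha hwa) (clA ha hwa)) (clA hb hwb)⟩
      rw [φe h1]
      exact hΦR _ (Or.inr (Or.inr (Or.inl ⟨v, a, b, h1, clA ha hwa, clA hb hwb, rfl⟩)))
    · intro v a b c ha hb hc hwa hwb hwc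
      have h1 : 1 ≤ 1 ∧ Q.IsClosed (a ++ c ++ b) := 
        ⟨by omega, v, closed_append (closed_append (clA ha hwa) (clA hc hwc)) (clA hb hwb)⟩
      have h2 : 1 ≤ 1 ∧ Q.IsClosed (a ++ b ++ c) := 
        ⟨by omega, v, closed_append (closed_append (clA ha hwa) (clA hb hwb)) (clA hc hwc)⟩
      rw [φe h1, φe h2]
      have := hΦR _ (Or.inr (Or.inr (Or.inr (Or.inr (Or.inl ⟨v, a, b, c, h1, h2, clA ha hwa, clA hb hwb, clA hc hwc, rfl⟩)))))
      rw [map_add] at this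
      linear_combination this
    · intro v a b ha hb hwa hwb
      have h1 : 1 ≤ 2 ∧ Q.IsClosed (a ++ b) := ⟨by omega, v, closed_append (clA ha hwa) (clA hb hwb)⟩
      rw [φe h1]
      exact hΦR _ (Or.inr (Or.inr (Or.inr (Or.inr (Or.inr (Or.inl ⟨v, a, b, h1, clA ha hwa, clA hb hwb, rfl⟩))))))
  choose ℓ hℓ1 hℓ2 hℓ3 using HM _ _ hPD
  let P : Q.AQ K → Prop := fun p => ∃ A0 : Finset (Multiset Q.A), ∀ A, A0 ⊆ A → Φ p = ∑ α ∈ A, ℓ α (Q.toInv K p)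
  have Padd : ∀ p p', P p → P p' → P (p + p') := by
    rintro p p' ⟨A, hA⟩ ⟨B, hB⟩
    refine ⟨A ∪ B, fun C hC => ?_⟩
    rw [map_add, hA C (Finset.union_subset_left hC), hB C (Finset.union_subset_right hC), ← Finset.sum_add_distrib]
    simp
  have Psmul : ∀ (c : K) p, P p → P (c • p) := by
    rintro c p ⟨A, hA⟩
    refine ⟨A, fun C hC => ?_⟩
    rw [map_smul, hA C hC, smul_eq_mul, Finset.mul_sum]
    simp
  let PS : Submodule K (Q.AQ K) := { carrier := {p | P p}, add_mem' := fun {a b} ha hb => Padd a b ha hb, 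
                                     zero_mem' := ⟨∅, by simp⟩, smul_mem' := fun c x hx => Psmul c x hx }
  have key : Submodule.span K (Set.range (MvPolynomial.X : Q.SymIdx → Q.AQ K)) ⊔ Q.AQplusSq K ≤ PS := by
    rw [sup_le_iff]
    constructor
    · rw [Submodule.span_le]
      rintro _ ⟨⟨⟨k, h⟩, hk⟩, rfl⟩
      show P (Q.sym K k h hk)
      have hcl : Cl Q.src Q.tgt h := by
        obtain ⟨v, hv⟩ := hk.2
        exact ⟨v, (isPathFrom_iff _ _ _ _).1 hv.2⟩
      have hne : h ≠ [] := by obtain ⟨v, hv⟩ := hk.2; exact hv.1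
      by_cases h1 : k = 1
      · subst h1
        refine ⟨{(h : Multiset Q.A)}, fun A hA => ?_⟩
        rw [toInv_sym, sig1, ← φe hk]
        simp only [hℓ2 _ h hne hcl]
        rw [Finset.sum_ite_eq, if_pos (hA (by simp))]
      by_cases h2 : k = 2
      · subst h2
        refine ⟨{2 • (h : Multiset Q.A)}, fun A hA => ?_⟩
        rw [toInv_sym, sig2, ← φe hk]
        simp only [hℓ3 _ h hne hcl]
        rw [Finset.sum_ite_eq, if_pos (hA (by simp))]
      · refine ⟨∅, fun A _ => ?_⟩
        have hk1 := hk.1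
        rw [toInv_sym, show Q.pathSigma K k h = 0 by
          unfold QuiverData.pathSigma
          rw [if_neg (by omega), if_neg h1, if_neg h2]]
        obtain ⟨v, hv⟩ := hk.2
        rw [hΦR _ (Or.inr (Or.inr (Or.inr (Or.inr (Or.inr (Or.inr ⟨k, v, h, hk, by omega, hv, rfl⟩))))))]
        simp
    · unfold QuiverData.AQplusSq
      rw [Submodule.span_le]
      rintro _ ⟨p, p', hp, hp', rfl⟩
      refine ⟨∅, fun A _ => ?_⟩
      rw [hΦS p p' hp hp', map_mul]
      simp [hℓ1 _ _ (toInv_plus hp) _ (toInv_plus hp')]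
  have hdec : ∀ x ∈ DD K Q, MvPolynomial.constantCoeff x = 0 ∧ ∀ α, ℓ α x = 0 := by
    intro x hx
    induction hx using Submodule.span_induction with
    | mem x hx =>
      obtain ⟨p, hp, p', hp', rfl⟩ := hx
      exact ⟨by rw [map_mul, hp.2, zero_mul], fun α => hℓ1 α p hp p' hp'⟩
    | zero => simp
    | add x y _ _ hx hy => exact ⟨by rw [map_add, hx.1, hy.1, add_zero], fun α => by rw [map_add, hx.2, hy.2, add_zero]⟩
    | smul c x _ hx => exact ⟨by rw [MvPolynomial.smul_eq_C_mul, map_mul, hx.1, mul_zero], fun α => by rw [map_smul, hx.2, smul_zero]⟩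
  obtain ⟨hc0, hl0⟩ := hdec _ hd
  rw [toInv_cc] at hc0
  have := AQ_decomp q
  rw [hc0, map_zero, sub_zero] at this
  obtain ⟨A, hA⟩ := key this
  apply hΦq
  rw [hA A (Finset.Subset.refl _)]
  exact Finset.sum_eq_zero (fun α _ => hl0 α)

theorem reduction (HM : Main Q K) (q : Q.AQ K) : Q.Decomposable K (Q.toInv K q) ↔
        q ∈ Submodule.span K (Q.RelSet K) ⊔ Q.AQplusSq K := ⟨hard_dir HM q, easy_dir q⟩

end red
end QR

set_option linter.all false

namespace QR
section split
variable {K : Type} [Field K] {Q : QuiverData}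

abbrev FT (α : Multiset Q.A) (κ : Q.A → ℕ) : Type := {a : Q.A // a ∈ α.toFinset.filter (fun a => κ a ≠ 0)}
abbrev LT (α : Multiset Q.A) (κ : Q.A → ℕ) : Type := Σ a : {a : Q.A // a ∈ α.toFinset}, Fin (α.count a.1 - κ a.1)

def arrS (α : Multiset Q.A) (κ : Q.A → ℕ) : FT α κ ⊕ LT α κ → Q.A := Sum.elim (fun a => a.1) (fun l => l.1.1)

noncomputable def m0S (α : Multiset Q.A) (κ : Q.A → ℕ) : FT α κ ⊕ LT α κ →₀ ℕ :=
  Finsupp.equivFunOnFinite.symm (Sum.elim (fun a => κ a.1) (fun l => 1))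

variable {α : Multiset Q.A} {κ : Q.A → ℕ}

@[simp] theorem m0S_inl (a : FT α κ) : m0S α κ (Sum.inl a) = κ a.1 := rfl
@[simp] theorem m0S_inr (a : LT α κ) : m0S α κ (Sum.inr a) = 1 := rfl
@[simp] theorem arrS_inl (a : FT α κ) : arrS α κ (Sum.inl a) = a.1 := rfl
@[simp] theorem arrS_inr (a : LT α κ) : arrS α κ (Sum.inr a) = a.1.1 := rfl

theorem arrS_mem (x : FT α κ ⊕ LT α κ) : arrS α κ x ∈ α := by
  rcases x with a | l
  · have := a.2; rw [Finset.mem_filter, Multiset.mem_toFinset] at this; exact this.1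
  · have := l.1.2; rw [Multiset.mem_toFinset] at this; exact this

theorem m0S_tot (hκ : ∀ a, κ a ≤ α.count a) (b : Q.A) :
    ∑ l, (if arrS α κ l = b then m0S α κ l else 0) = α.count b := by
  rw [Fintype.sum_sum_type]
  have e1 : ∑ a : FT α κ, (if a.1 = b then κ a.1 else 0) = κ b := by
    rw [Finset.sum_coe_sort (α.toFinset.filter (fun a => κ a ≠ 0)) (fun a => if a = b then κ a else 0)]
    rw [Finset.sum_ite_eq']
    split_ifs with hb
    · rfl
    · rw [Finset.mem_filter, Multiset.mem_toFinset, ← Multiset.count_pos] at hb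
      have := hκ b
      omega
  have e2 : ∑ l : LT α κ, (if l.1.1 = b then 1 else 0) = α.count b - κ b := by
    rw [Fintype.sum_sigma]
    refine Eq.trans (b := ∑ a : {a : Q.A // a ∈ α.toFinset}, (α.count a.1 - κ a.1) * if a.1 = b then 1 else 0) (by
      apply Finset.sum_congr rfl; intro a _; split_ifs with h <;> simp [h]) ?_
    rw [Finset.sum_coe_sort α.toFinset (fun a => (α.count a - κ a) * if a = b then 1 else 0)]
    simp only [mul_ite, mul_one, mul_zero]
    rw [Finset.sum_ite_eq']
    split_ifs with hb
    · rfl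
    · rw [Multiset.mem_toFinset, ← Multiset.count_pos] at hb
      omega
  have e3 := congrArg₂ (· + ·) e1 e2
  refine Eq.trans e3 ?_
  have := hκ b
  show κ b + (α.count b - κ b) = _
  omega

theorem cont_m0S (hκ : ∀ a, κ a ≤ α.count a) {w : List (FT α κ ⊕ LT α κ)} (hw : cont w = m0S α κ) :
    ((w.map (arrS α κ) : List Q.A) : Multiset Q.A) = α := by
  ext b
  rw [Multiset.coe_count, ← cont_total, hw, m0S_tot hκ]

theorem m0S_fact : ∏ l, (m0S α κ l).factorial = ∏ a ∈ α.toFinset, (κ a).factorial := by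
  rw [Fintype.prod_sum_type]
  simp only [m0S_inl, m0S_inr, Nat.factorial_one, Finset.prod_const_one, mul_one]
  rw [Finset.prod_coe_sort (α.toFinset.filter (fun a => κ a ≠ 0)) (fun a => (κ a).factorial), Finset.prod_filter]
  apply Finset.prod_congr rfl
  intro a _
  by_cases h : κ a = 0 <;> simp [h]

theorem arrS_image (hκ : ∀ a, κ a ≤ α.count a) : Finset.univ.image (arrS α κ) = α.toFinset := by
  ext b
  constructor
  · intro h
    obtain ⟨x, -, rfl⟩ := Finset.mem_image.1 h
    exact Multiset.mem_toFinset.2 (arrS_mem x)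
  · intro h
    rw [Multiset.mem_toFinset, ← Multiset.count_pos, ← m0S_tot hκ] at h
    obtain ⟨x, hx, h⟩ := Finset.exists_ne_zero_of_sum_ne_zero h.ne'
    rw [Finset.mem_image]
    refine ⟨x, hx, ?_⟩
    by_contra hb
    exact h (if_neg hb)

variable {W : Type}

theorem ell_split [Infinite K] (hκ : ∀ a, κ a ≤ α.count a) [Nonempty (LT α κ)] (M : Q.V → W)
    (hM : ∀ a ∈ α, κ a ≠ 0 → M (Q.src a) = M (Q.tgt a))
    (ψ : List (LT α κ) → K)
    (hrot : ∀ w w', FullW (fun l : LT α κ => M (Q.src l.1.1)) (fun l => M (Q.tgt l.1.1)) w →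
      w ~r w' → ψ w = ψ w')
    (hsw : ∀ (z : W) (A B C : List (LT α κ)), A ≠ [] → B ≠ [] → C ≠ [] →
      Walk (fun l : LT α κ => M (Q.src l.1.1)) (fun l => M (Q.tgt l.1.1)) z z A → 
      Walk (fun l : LT α κ => M (Q.src l.1.1)) (fun l => M (Q.tgt l.1.1)) z z B → 
      Walk (fun l : LT α κ => M (Q.src l.1.1)) (fun l => M (Q.tgt l.1.1)) z z C → 
      FullW (fun l : LT α κ => M (Q.src l.1.1)) (fun l => M (Q.tgt l.1.1)) (A ++ B ++ C) →
      ψ (A ++ B ++ C) + ψ (A ++ C ++ B) = 0)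
    (hR3 : ∀ p ∈ Q.PlusSet K, ∀ m1 m2 : FT α κ ⊕ LT α κ →₀ ℕ, m1 + m2 = m0S α κ → m1 ≠ 0 → (∀ l, m1 (Sum.inr l) = 0) →
      cf (arrS α κ) (fun _ => 1) m1 p ≠ 0 → ∃ (W' : Type) (M' : Q.V → W'),
        (∀ a : FT α κ, m2 (Sum.inl a) ≠ 0 → M' (Q.src a.1) = M' (Q.tgt a.1)) ∧
        (∀ u v, M' u = M' v → M u = M v) ∧
        ∀ w, FullW (fun l : LT α κ => M' (Q.src l.1.1)) (fun l => M' (Q.tgt l.1.1)) w → ψ w = 0) :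
    ∃ ℓ : MvPolynomial Q.Var K →ₗ[K] K,
      (∀ p ∈ Q.PlusSet K, ∀ q ∈ Q.PlusSet K, ℓ (p * q) = 0) ∧
      (∀ h, Cl Q.src Q.tgt h → (h : Multiset Q.A) ≠ α → ℓ (Q.pathTr K h) = 0) ∧
      (∀ h, Cl Q.src Q.tgt h → (h : Multiset Q.A) = α → ∀ c : K, (∀ w : List (FT α κ ⊕ LT α κ), w.map (arrS α κ) = h →
        cont w = m0S α κ → ψ (fil w) = c) → 
        ∃ N : ℕ, N * ∏ a ∈ α.toFinset, (κ a).factorial = ∏ a ∈ α.toFinset, (α.count a).factorial ∧ 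
          ℓ (Q.pathTr K h) = N * c) ∧
      (∀ h : List Q.A, 2 • (h : Multiset Q.A) ≠ α → ℓ (Q.pathDet K h) = 0) := by
  obtain ⟨ℓ, h1, h2, h3⟩ := ell_trace (arrS α κ) M (m0S α κ) (fun _ => rfl)
    (fun a ha => hM a.1 (arrS_mem (Sum.inl a)) ha) ψ hrot hsw hR3
  refine ⟨ℓ, h1, ?_, ?_, ?_⟩
  · intro h hh hα
    rw [h2 h hh]
    apply wsum_zero
    intro w hw
    rw [if_neg]
    intro hc
    apply hα
    rw [← hw]; exact cont_m0S hκ hc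
  · intro h hh hα c hc
    refine ⟨wsum (arrS α κ) h (fun w => if cont w = m0S α κ then 1 else 0), ?_, ?_⟩
    · rw [← m0S_fact]
      have hw := wsum_count (arrS α κ) h (m0S α κ) (by
        intro b
        rw [m0S_tot hκ, ← hα, Multiset.coe_count])
      rw [arrS_image hκ] at hw
      refine Eq.trans ?_ (hw.trans ?_)
      · congr!
      · apply Finset.prod_congr rfl
        intro b _
        rw [← hα, Multiset.coe_count]
    · have hw := wsum_const (arrS α κ) h (m0S α κ) c
      rw [h2 h hh]
      refine Eq.trans ?_ (hw.trans ?_)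
      · apply wsum_congr
        intro w hw
        split_ifs with hcw
        · exact hc w hw hcw
        · rfl
      · congr!
  · intro h hα
    apply h3
    intro Y
    by_contra hne
    apply hα
    ext b
    rw [Multiset.count_nsmul, Multiset.coe_count, ← cf_pathDet_deg _ _ _ _ hne b, m0S_tot hκ]

theorem cf_scale {Λ : Type} [Fintype Λ] (arr : Λ → Q.A) (c : Λ → K) (Y : Λ → Matrix (Fin 2) (Fin 2) K) 
    (p : MvPolynomial Q.Var K) : ∀ m : Λ →₀ ℕ,
    cf arr (fun l => c l • Y l) m p = (∏ l, c l ^ m l) * cf arr Y m p := by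
  induction p using MvPolynomial.induction_on with
  | C a =>
    intro m
    rw [cf_C, cf_C]
    split_ifs with h
    · simp [h]
    · simp
  | add p q hp hq => intro m; rw [cf_add, cf_add, hp, hq, mul_add]
  | mul_X p v ih =>
    intro m
    rw [cf_mul_X, cf_mul_X, Finset.mul_sum]
    apply Finset.sum_congr rfl
    intro l _
    split_ifs with h
    · rw [ih]
      have : (∏ x, c x ^ m x) = c l * ∏ x, c x ^ (m - Finsupp.single l 1 : Λ →₀ ℕ) x := by
        rw [← Finset.mul_prod_erase _ _ (Finset.mem_univ l), ← Finset.mul_prod_erase _ (fun x => c x ^ (m - Finsupp.single l 1 : Λ →₀ ℕ) x) (Finset.mem_univ l)]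
        rw [← mul_assoc]
        congr 1
        · rw [← pow_succ']
          congr 1
          simp
          have := h.2
          omega
        · apply Finset.prod_congr rfl
          intro x hx
          simp [Finsupp.single_apply, Ne.symm (Finset.ne_of_mem_erase hx)]
      rw [this]
      simp only [Matrix.smul_apply, smul_eq_mul]
      ring
    · simp

/-- nonzero coefficients are balanced -/
theorem cf_balanced {Λ : Type} [Fintype Λ] [Infinite K] (arr : Λ → Q.A) {p : MvPolynomial Q.Var K} (hp : p ∈ Q.PlusSet K) 
    (m : Λ →₀ ℕ)
    (Y : Λ → Matrix (Fin 2) (Fin 2) K) (hc : cf arr Y m p ≠ 0) (v : Q.V) :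
    ∑ l, (if Q.src (arr l) = v then m l else 0) = ∑ l, (if Q.tgt (arr l) = v then m l else 0) := by
  symm
  apply pow_inj_of_infinite (K := K)
  intro t ht
  have h := cf_inv arr hp.1 (fun u => (if u = v then t else 1) • 1) (by
    intro u
    by_cases hu : u = v <;> simp [hu, ht]) Y m
  have e : (fun l => ((if Q.tgt (arr l) = v then t else 1) • (1 : Matrix (Fin 2) (Fin 2) K)) * Y l * 
      ((if Q.src (arr l) = v then t else 1) • (1 : Matrix (Fin 2) (Fin 2) K))⁻¹) =
      fun l => ((if Q.tgt (arr l) = v then t else 1) * (if Q.src (arr l) = v then t else 1)⁻¹) • Y l := by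
    funext l
    have hi : ∀ s : K, s ≠ 0 → (s • (1 : Matrix (Fin 2) (Fin 2) K))⁻¹ = s⁻¹ • 1 := by
      intro s hs
      apply Matrix.inv_eq_right_inv
      simp [hs]
    rw [hi _ (by split_ifs <;> simp [ht])]
    simp only [Matrix.smul_mul, Matrix.one_mul, Matrix.mul_smul, Matrix.mul_one]
    rw [smul_smul, mul_comm]
  rw [e, cf_scale] at h
  have h2 := mul_right_cancel₀ hc (h.trans (one_mul _).symm)
  simp only [mul_pow, Finset.prod_mul_distrib, inv_pow, Finset.prod_inv_distrib] at h2
  have e2 : ∀ f : Λ → Q.V, ∏ l, (if f l = v then t else 1) ^ m l = t ^ (∑ l, if f l = v then m l else 0) := by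
    intro f
    rw [← Finset.prod_pow_eq_pow_sum]
    apply Finset.prod_congr rfl
    intro l _
    split_ifs <;> simp
  rw [e2, e2] at h2
  field_simp at h2
  exact h2
end split
end QR

set_option linter.all false

namespace QR
section helpers
variable {B V : Type*} {s t : B → V}

theorem rot_first {h : List B} (hc : Cl s t h) {a : B} (ha : a ∈ h) :
    ∃ h', h ~r (a :: h') ∧ Walk s t (s a) (s a) (a :: h') := by
  obtain ⟨l1, l2, rfl⟩ := List.append_of_mem ha
  have hr := rotated_append l1 (a :: l2)
  refine ⟨l2 ++ l1, hr, ?_⟩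
  obtain ⟨u, hu⟩ := hc.rotated hr
  have : u = s a := hu.1.symm
  subst this
  exact hu

theorem tgt_src {h : List B} (hc : Cl s t h) {a : B} (ha : a ∈ h) : ∃ b ∈ h, s b = t a := by
  obtain ⟨h', hr, h1, h2⟩ := rot_first hc ha
  have hm : ∀ x, x ∈ a :: h' → x ∈ h := fun x hx => hr.perm.mem_iff.2 hx
  cases h' with
  | nil => exact ⟨a, ha, (h2 : t a = s a).symm⟩
  | cons b h' => exact ⟨b, hm b (by simp), h2.1⟩

theorem first_visit {u v' v : V} {h : List B} (hw : Walk s t u v' h) (hv : 0 < h.countP (fun a => s a = v)) :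
    ∃ A C, h = A ++ C ∧ Walk s t u v A ∧ Walk s t v v' C ∧ A.countP (fun a => s a = v) = 0 := by
  induction h generalizing u with
  | nil => simp at hv
  | cons a h ih =>
    by_cases ha : s a = v
    · refine ⟨[], a :: h, rfl, ?_, ?_, rfl⟩
      · exact hw.1.symm.trans ha
      · rw [← ha]; exact ⟨rfl, hw.2⟩
    · rw [List.countP_cons_of_neg (by simpa using ha)] at hv
      obtain ⟨A, C, rfl, h1, h2, h3⟩ := ih hw.2 hv
      refine ⟨a :: A, C, rfl, ⟨hw.1, h1⟩, h2, ?_⟩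
      rw [List.countP_cons_of_neg (by simpa using ha), h3]

theorem split_visit {v v' : V} {h : List B} {n : ℕ} (hw : Walk s t v v' h) (hv : h.countP (fun a => s a = v) = n + 2) :
    ∃ A C, h = A ++ C ∧ A ≠ [] ∧ C ≠ [] ∧ Walk s t v v A ∧ Walk s t v v' C ∧ A.countP (fun a => s a = v) = 1 ∧
      C.countP (fun a => s a = v) = n + 1 := by
  cases h with
  | nil => simp at hv
  | cons a h =>
    rw [List.countP_cons_of_pos (by simpa using hw.1)] at hv
    obtain ⟨A, C, rfl, h1, h2, h3⟩ := first_visit (v := v) hw.2 (by omega)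
    rw [List.countP_append] at hv
    have e1 : (a :: A).countP (fun a => s a = v) = 1 := by rw [List.countP_cons_of_pos (by simpa using hw.1), h3]
    refine ⟨a :: A, C, rfl, by simp, ?_, ⟨hw.1, h1⟩, h2, e1, by omega⟩
    rintro rfl; simp at hv; omega

theorem det_pre {S : Set B} (hS : ∀ a ∈ S, ∀ b ∈ S, s a = s b → a = b) {u v v' : V} {X Y : List B}
    (hX : ∀ a ∈ X, a ∈ S) (hY : ∀ a ∈ Y, a ∈ S) (h : Walk s t u v X) (h' : Walk s t u v' Y) :
    (∃ E, Y = X ++ E) ∨ ∃ E, X = Y ++ E := by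
  induction X generalizing u Y with
  | nil => exact Or.inl ⟨Y, rfl⟩
  | cons a X ih =>
    cases Y with
    | nil => exact Or.inr ⟨_, rfl⟩
    | cons b Y =>
      have : a = b := hS a (hX a (by simp)) b (hY b (by simp)) (h.1.trans h'.1.symm)
      subst this
      rcases ih (fun x hx => hX x (by simp [hx])) (fun x hx => hY x (by simp [hx])) h.2 h'.2 with ⟨E, rfl⟩ | ⟨E, rfl⟩
      · exact Or.inl ⟨E, rfl⟩
      · exact Or.inr ⟨E, rfl⟩

end helpers

section pd
variable {K : Type} [Field K] {Q : QuiverData} {φ δ : List Q.A → K}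

theorem PD.rotated (H : PD Q K φ δ) {h h' : List Q.A} (hc : Cl Q.src Q.tgt h) (hr : h ~r h') : φ h = φ h' := by
  obtain ⟨n, rfl⟩ := hr
  rw [← List.rotate_mod]
  by_cases hl : h = []
  · simp [hl]
  have hk : n % h.length < h.length := Nat.mod_lt _ (List.length_pos_of_ne_nil hl)
  rw [List.rotate_eq_drop_append_take hk.le]
  conv_lhs => rw [← List.take_append_drop (n % h.length) h]
  obtain ⟨u, hu⟩ := hc
  rw [← List.take_append_drop (n % h.length) h] at hu
  obtain ⟨x, h1, h2⟩ := walk_append.1 hu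
  exact H.rot u x _ _ h1 h2

theorem PD.four (H : PD Q K φ δ) (h2 : (2 : K) ≠ 0) {v : Q.V} {a b c d : List Q.A} (ha : a ≠ []) (hb : b ≠ []) 
    (hc : c ≠ []) (hd : d ≠ []) (wa : Walk Q.src Q.tgt v v a) (wb : Walk Q.src Q.tgt v v b)
    (wc : Walk Q.src Q.tgt v v c) (wd : Walk Q.src Q.tgt v v d) : φ (a ++ (b ++ (c ++ d))) = 0 := by
  have A : ∀ {x y}, Walk Q.src Q.tgt v v x → Walk Q.src Q.tgt v v y → Walk Q.src Q.tgt v v (x ++ y) :=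
    fun hx hy => walk_append.2 ⟨v, hx, hy⟩
  have e1 := H.sw v a b (c ++ d) ha hb (by simp [hc]) wa wb (A wc wd)
  have e2 := H.sw v (d ++ a) b c (by simp [hd]) hb hc (A wd wa) wb wc
  have e3 := H.sw v (a ++ c) b d (by simp [ha]) hb hd (A wa wc) wb wd
  have r1 := H.rot v v d (a ++ (c ++ b)) wd (A wa (A wc wb))
  have r2 := H.rot v v d (a ++ (b ++ c)) wd (A wa (A wb wc))
  simp only [List.append_assoc] at *
  have : 2 * φ (a ++ (b ++ (c ++ d))) = 0 := by
    linear_combination e1 - e3 + e2 - r1 - r2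
  simpa [h2] using this

theorem PD.visits (H : PD Q K φ δ) (h2 : (2 : K) ≠ 0) {h : List Q.A} (hc : Cl Q.src Q.tgt h) (h0 : φ h ≠ 0) (v : Q.V) :
    h.countP (fun a => Q.src a = v) ≤ 3 := by
  by_contra hn
  have hpos : 0 < h.countP (fun a => Q.src a = v) := by omega
  obtain ⟨a, ha, hav⟩ := List.countP_pos_iff.1 hpos
  simp only [decide_eq_true_eq] at hav
  subst hav
  obtain ⟨h', hr, hw⟩ := rot_first hc ha
  rw [H.rotated hc hr] at h0
  rw [hr.perm.countP_eq] at hn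
  obtain ⟨n, hn⟩ : ∃ n, (a :: h').countP (fun b => Q.src b = Q.src a) = n + 4 := ⟨(a :: h').countP (fun b => Q.src b = Q.src a) - 4, by omega⟩
  obtain ⟨A, R, e, hA, hR, wA, wR, -, hn⟩ := split_visit (n := n + 2) hw hn
  obtain ⟨A2, R2, rfl, hA2, hR2, wA2, wR2, -, hn⟩ := split_visit (n := n + 1) wR hn
  obtain ⟨A3, R3, rfl, hA3, hR3, wA3, wR3, -, hn⟩ := split_visit (n := n) wR2 hn
  rw [e] at h0
  exact h0 (H.four h2 hA hA2 hA3 hR3 wA wA2 wA3 wR3)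

end pd
end QR

set_option linter.all false

namespace QR
section odd
variable {K : Type} [Field K] {Q : QuiverData} {φ δ : List Q.A → K}

/-- `p` is a path of triple arrows from `v` to a vertex with a non triple arrow leaving -/
def EndP (α : Multiset Q.A) (v : Q.V) (p : List Q.A) (z : Q.V) : Prop :=
  (∀ a ∈ p, α.count a = 3) ∧ Walk Q.src Q.tgt v z p ∧ ∃ b ∈ α, α.count b ≠ 3 ∧ Q.src b = z

theorem EndP.uniq {α : Multiset Q.A} (hF : ∀ a b, α.count a = 3 → b ∈ α → Q.src b = Q.src a → b = a)
    {v z z' : Q.V} {p p' : List Q.A} (h : EndP α v p z) (h' : EndP α v p' z') : p = p' ∧ z = z' := by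
  induction p generalizing v p' with
  | nil =>
    obtain ⟨-, h2, b, hb, hb3, hbz⟩ := h
    have h2 : v = z := h2
    cases p' with
    | nil => exact ⟨rfl, h2.symm.trans h'.2.1⟩
    | cons a p' =>
      exfalso
      have := hF a b (h'.1 a (by simp)) hb (by rw [hbz, ← h2, h'.2.1.1])
      rw [this] at hb3
      exact hb3 (h'.1 a (by simp))
  | cons a p ih =>
    have ha := h.1 a (by simp)
    cases p' with
    | nil =>
      exfalso
      obtain ⟨-, h2, b, hb, hb3, hbz⟩ := h'
      have h2 : v = z' := h2
      have := hF a b ha hb (by rw [hbz, ← h2, h.2.1.1])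
      rw [this] at hb3
      exact hb3 ha
    | cons a' p' =>
      have ha' := h'.1 a' (by simp)
      have : a = a' := hF a' a ha' (by rw [← Multiset.count_pos]; omega) (by rw [h.2.1.1, h'.2.1.1])
      subst this
      have := ih (v := Q.tgt a) (p' := p') ⟨fun x hx => h.1 x (by simp [hx]), h.2.1.2, h.2.2⟩ 
        ⟨fun x hx => h'.1 x (by simp [hx]), h'.2.1.2, h'.2.2⟩
      exact ⟨by rw [this.1], this.2⟩

theorem fcount {α : Multiset Q.A} (hv : ∀ v, α.countP (fun a => Q.src a = v) ≤ 3) :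
    ∀ a b, α.count a = 3 → b ∈ α → Q.src b = Q.src a → b = a := by
  intro a b ha hb hs
  by_contra hne
  have h1 : Multiset.replicate 3 a + {b} ≤ α := by
    rw [Multiset.le_iff_count]
    intro x
    rw [Multiset.count_add, Multiset.count_replicate, Multiset.count_singleton]
    by_cases hx : x = a
    · subst hx
      simp [ha, Ne.symm hne]
    · by_cases hxb : x = b
      · subst hxb
        have := Multiset.count_pos.2 hb
        simp [Ne.symm hx]; first | exact Multiset.count_pos.2 hb | exact hb
      · simp [hxb, Ne.symm hx]
  have h2 := Multiset.countP_le_of_le (fun x => Q.src x = Q.src a) h1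
  rw [Multiset.countP_add] at h2
  have h3 : Multiset.countP (fun x => Q.src x = Q.src a) (Multiset.replicate 3 a) = 3 := by
    rw [Multiset.countP_eq_card.2]
    · simp
    · intro x hx; rw [Multiset.eq_of_mem_replicate hx]
  have h4 : Multiset.countP (fun x => Q.src x = Q.src a) {b} = 1 := by
    rw [Multiset.countP_eq_card.2]
    · simp
    · intro x hx; rw [Multiset.mem_singleton.1 hx, hs]
  have := hv (Q.src a)
  omega

theorem PD.exists_nontriple (H : PD Q K φ δ) {h0 : List Q.A} (hne : h0 ≠ []) (hc : Cl Q.src Q.tgt h0) (hφ : φ h0 ≠ 0) 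
    (hv : ∀ v, h0.countP (fun a => Q.src a = v) ≤ 3) : ∃ a ∈ h0, (h0 : Multiset Q.A).count a ≠ 3 := by
  by_contra hall
  push Not at hall
  have hF := fcount (α := (h0 : Multiset Q.A)) hv
  obtain ⟨a, ha⟩ := List.exists_mem_of_ne_nil _ hne
  obtain ⟨h', hr, hw⟩ := rot_first hc ha
  have hS : ∀ x ∈ {x | x ∈ h0}, ∀ y ∈ {x | x ∈ h0}, Q.src x = Q.src y → x = y := by
    intro x hx y hy hxy
    exact hF y x (hall y hy) hx hxy
  have hc3 : (a :: h').countP (fun b => Q.src b = Q.src a) = 3 := by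
    rw [← hr.perm.countP_eq]
    apply le_antisymm (hv _)
    rw [← hall a ha, Multiset.coe_count, List.count_eq_countP]
    apply List.countP_mono_left
    intro x _ hx
    simp only [beq_iff_eq] at hx
    simp [hx]
  have hmem : ∀ x ∈ a :: h', x ∈ h0 := fun x hx => hr.perm.mem_iff.2 hx
  obtain ⟨A, R, e, hA, hR, wA, wR, cA, hn⟩ := split_visit (n := 1) hw hc3
  obtain ⟨A2, A3, rfl, hA2, hA3, wA2, wA3, cA2, hn⟩ := split_visit (n := 0) wR hn
  have hEE : ∀ {X Y E : List Q.A}, Walk Q.src Q.tgt (Q.src a) (Q.src a) X → Walk Q.src Q.tgt (Q.src a) (Q.src a) Y → 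
      Y = X ++ E → X.countP (fun b => Q.src b = Q.src a) = 1 → Y.countP (fun b => Q.src b = Q.src a) = 1 → E = [] := by
    rintro X Y E hX hY rfl h1 h2
    obtain ⟨z, hz1, hz2⟩ := walk_append.1 hY
    obtain rfl := walk_unique hX hz1
    cases E with
    | nil => rfl
    | cons b E =>
      rw [List.countP_append, List.countP_cons_of_pos (by simpa using hz2.1)] at h2
      omega
  have : A = A2 := by
    rcases det_pre hS (X := A) (Y := A2) (fun x hx => hmem x (by rw [e]; simp [hx])) (fun x hx => hmem x (by rw [e]; simp [hx]))
      wA wA2 with ⟨E, hE⟩ | ⟨E, hE⟩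
    · rw [hE, hEE wA wA2 hE cA cA2, List.append_nil]
    · rw [hE, hEE wA2 wA hE cA2 cA, List.append_nil]
  subst this
  rw [H.rotated hc hr, e, ← List.append_assoc] at hφ
  exact hφ (H.sqm _ _ _ hA hA3 wA wA3)

theorem endP_exists {h0 : List Q.A} (hc : Cl Q.src Q.tgt h0) (hnt : ∃ a ∈ h0, (h0 : Multiset Q.A).count a ≠ 3) 
    {v : Q.V} (hv : ∃ a ∈ h0, Q.src a = v) : ∃ p z, EndP (h0 : Multiset Q.A) v p z := by
  obtain ⟨a, ha, rfl⟩ := hv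
  obtain ⟨h', hr, hw⟩ := rot_first hc ha
  have hnt' : ∃ b ∈ a :: h', (h0 : Multiset Q.A).count b ≠ 3 := by
    obtain ⟨b, hb, h⟩ := hnt
    exact ⟨b, hr.perm.mem_iff.1 hb, h⟩
  have hmem : ∀ x ∈ a :: h', x ∈ h0 := fun x hx => hr.perm.mem_iff.2 hx
  generalize hl : a :: h' = l at *
  generalize Q.src a = v at *
  have : ∀ l u, (∃ b ∈ l, (h0 : Multiset Q.A).count b ≠ 3) → (∀ x ∈ l, x ∈ h0) → Walk Q.src Q.tgt u v l →
      ∃ p z, EndP (h0 : Multiset Q.A) u p z := by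
    intro l
    induction l with
    | nil => intro u h; simp at h
    | cons b l ih =>
      intro u h hm hw
      by_cases hb : (h0 : Multiset Q.A).count b = 3
      · obtain ⟨p, z, hp⟩ := ih (Q.tgt b) (by
          obtain ⟨x, hx, hx3⟩ := h
          rcases List.mem_cons.1 hx with rfl | hx
          · exact absurd hb hx3
          · exact ⟨x, hx, hx3⟩) (fun x hx => hm x (by simp [hx])) hw.2
        refine ⟨b :: p, z, ?_, ⟨hw.1, hp.2.1⟩, hp.2.2⟩
        intro x hx
        rcases List.mem_cons.1 hx with rfl | hx
        · exact hb
        · exact hp.1 x hx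
      · exact ⟨[], u, by simp, rfl, b, hm b (by simp), hb, hw.1⟩
  exact this l v hnt' hmem hw

end odd
end QR

set_option linter.all false

namespace QR
section odd2
variable {K : Type} [Field K] {Q : QuiverData} {φ δ : List Q.A → K}

/-- multiplicities of the arrows to be kept together -/
noncomputable def kap (α : Multiset Q.A) (a : Q.A) : ℕ := if α.count a = 3 then 3 else 0

theorem LT_kap {α : Multiset Q.A} (l : LT α (kap α)) : α.count l.1.1 ≠ 3 := by
  intro h
  have := l.2.2
  simp [kap, h] at this

theorem FT_kap {α : Multiset Q.A} (l : FT α (kap α)) : α.count l.1 = 3 := by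
  have := l.2
  rw [Finset.mem_filter] at this
  by_contra h
  exact this.2 (by simp [kap, h])

def lif {α : Multiset Q.A} (path : Q.V → List Q.A) (τ : List (LT α (kap α))) : List Q.A :=
  τ.flatMap (fun l => l.1.1 :: path (Q.tgt l.1.1))

theorem lif_append {α : Multiset Q.A} (path : Q.V → List Q.A) (τ τ' : List (LT α (kap α))) :
    lif path (τ ++ τ') = lif path τ ++ lif path τ' := by simp [lif]

theorem lif_cons {α : Multiset Q.A} (path : Q.V → List Q.A) (l) (τ : List (LT α (kap α))) :
    lif path (l :: τ) = (l.1.1 :: path (Q.tgt l.1.1)) ++ lif path τ := by simp [lif]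

theorem lif_ne {α : Multiset Q.A} (path : Q.V → List Q.A) {τ : List (LT α (kap α))} (h : τ ≠ []) :
    lif path τ ≠ [] := by
  cases τ with
  | nil => exact absurd rfl h
  | cons l τ => rw [lif_cons]; simp

theorem mem_LT {α : Multiset Q.A} {κ} (l : LT α κ) : l.1.1 ∈ α := arrS_mem (Sum.inr l)

theorem odd_core [Infinite K] (H : PD Q K φ δ) {α : Multiset Q.A} (M : Q.V → Q.V) (path : Q.V → List Q.A)
    (hF : ∀ a b, α.count a = 3 → b ∈ α → Q.src b = Q.src a → b = a)
    (h3 : ∀ a, α.count a ≤ 3) (h2 : (2 : K) ≠ 0) (hnt : ∃ b ∈ α, α.count b ≠ 3)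
    (P1 : ∀ b ∈ α, α.count b ≠ 3 → M (Q.src b) = Q.src b ∧ path (Q.src b) = [])
    (P2 : ∀ a, α.count a = 3 → M (Q.src a) = M (Q.tgt a) ∧ path (Q.src a) = a :: path (Q.tgt a))
    (P3 : ∀ a ∈ α, EndP α (Q.tgt a) (path (Q.tgt a)) (M (Q.tgt a))) :
    ∃ ℓ : MvPolynomial Q.Var K →ₗ[K] K, (∀ p ∈ Q.PlusSet K, ∀ q ∈ Q.PlusSet K, ℓ (p * q) = 0) ∧
    (∀ h : List Q.A, h ≠ [] → Cl Q.src Q.tgt h → ℓ (Q.pathTr K h) = if (h : Multiset Q.A) = α then φ h else 0) ∧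
    (∀ h : List Q.A, 2 • (h : Multiset Q.A) ≠ α → ℓ (Q.pathDet K h) = 0) := by
  have hκ : ∀ a, kap α a ≤ α.count a := by
    intro a; unfold kap; split_ifs <;> omega
  have hne : Nonempty (LT α (kap α)) := by
    obtain ⟨b, hb, hb3⟩ := hnt
    refine ⟨⟨⟨b, Multiset.mem_toFinset.2 hb⟩, ⟨0, ?_⟩⟩⟩
    have := Multiset.count_pos.2 hb
    simp [kap, hb3]; exact this
  obtain ⟨N0, hN0⟩ : ∃ N0 : ℕ, N0 = ∏ a ∈ α.toFinset, (if α.count a = 3 then 1 else (α.count a).factorial) := ⟨_, rfl⟩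
  have hN0K : (N0 : K) ≠ 0 := by
    rw [hN0, Nat.cast_prod, Finset.prod_ne_zero_iff]
    intro a _
    have := h3 a
    interval_cases h : α.count a <;> simp [h, h2]
  have lw : ∀ {τ : List (LT α (kap α))} {z z' : Q.V}, Walk (fun l : LT α (kap α) => M (Q.src l.1.1)) (fun l => M (Q.tgt l.1.1)) z z' τ →
      Walk Q.src Q.tgt z z' (lif path τ) := by
    intro τ
    induction τ with
    | nil => intro z z' h; exact h
    | cons l τ ih =>
      intro z z' h
      rw [lif_cons, walk_append]
      refine ⟨M (Q.tgt l.1.1), ⟨?_, (P3 _ (mem_LT l)).2.1⟩, ih h.2⟩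
      exact (P1 _ (mem_LT l) (LT_kap l)).1.symm.trans h.1
  have wp : ∀ {w : List (FT α (kap α) ⊕ LT α (kap α))} {v z : Q.V}, 
      Walk (fun l => Q.src (arrS α (kap α) l)) (fun l => Q.tgt (arrS α (kap α) l)) v z w → path z = [] →
      w.map (arrS α (kap α)) = path v ++ lif path (fil w) := by
    intro w
    induction w with
    | nil => intro v z h hz; have h : v = z := h; subst h; simp [hz, lif]
    | cons x w ih =>
      intro v z h hz
      have hw := ih h.2 hz
      have h1 := h.1
      rcases x with a | l
      · simp only [arrS_inl] at h1 hw
        rw [List.map_cons, hw, fil_inl, ← h1, (P2 _ (FT_kap a)).2]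
        simp
      · simp only [arrS_inr] at h1 hw
        rw [List.map_cons, hw, fil_inr, ← h1, (P1 _ (mem_LT l) (LT_kap l)).2, lif_cons]
        simp
  obtain ⟨ℓ, hl1, hl2, hl3, hl4⟩ := ell_split (K := K) (Q := Q) hκ M (by
      intro a ha hk
      refine (P2 a ?_).1
      by_contra h
      exact hk (by simp [kap, h])) (fun τ => φ (lif path τ) / N0) (by
      intro w w' hw hr
      obtain ⟨u, hu⟩ := hw.2.2.2
      have : lif path w ~r lif path w' := by
        obtain ⟨n, rfl⟩ := hr
        rw [← List.rotate_mod]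
        have hk : n % w.length < w.length := Nat.mod_lt _ (List.length_pos_of_ne_nil hw.2.2.1)
        rw [List.rotate_eq_drop_append_take hk.le]
        conv_lhs => rw [← List.take_append_drop (n % w.length) w]
        rw [lif_append, lif_append]
        exact rotated_append _ _
      show φ (lif path w) / (N0 : K) = φ (lif path w') / N0
      rw [H.rotated ⟨u, lw hu⟩ this]) (by
      intro z A B C hA hB hC wA wB wC _
      show φ (lif path (A ++ B ++ C)) / (N0 : K) + φ (lif path (A ++ C ++ B)) / N0 = 0
      rw [lif_append, lif_append, lif_append, lif_append, H.sw z _ _ _ (lif_ne path hA) (lif_ne path hB) (lif_ne path hC) (lw wA) (lw wB) (lw wC)]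
      ring) (by
      intro p hp m1 m2 hm hm1 hm1r hc
      exfalso
      apply hm1
      have hb := cf_balanced _ hp _ _ hc
      have hout : ∀ (q : List Q.A) (v z : Q.V), EndP α v q z → ∀ a : FT α (kap α), Q.src a.1 = v → m1 (Sum.inl a) = 0 := by
        intro q
        induction q with
        | nil =>
          rintro v z ⟨-, hvz, b, hb, hb3, hbz⟩ a ha
          have hvz : v = z := hvz
          exfalso
          have := hF a.1 b (FT_kap a) hb (by rw [hbz, ha, hvz])
          rw [this] at hb3
          exact hb3 (FT_kap a)
        | cons b q ih =>
          rintro v z hE a ha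
          have hb3 := hE.1 b (by simp)
          have hab : a.1 = b := hF b a.1 hb3 (arrS_mem (Sum.inl a)) (by rw [ha, hE.2.1.1])
          have hih := ih (Q.tgt b) z ⟨fun x hx => hE.1 x (by simp [hx]), hE.2.1.2, hE.2.2⟩
          have h0 : ∑ l, (if Q.src (arrS α (kap α) l) = Q.tgt b then m1 l else 0) = 0 := by
            apply Finset.sum_eq_zero
            rintro (x | x) _
            · split_ifs with hx
              · exact hih x hx
              · rfl
            · simp [hm1r]
          rw [hb (Q.tgt b)] at h0
          have := (Finset.sum_eq_zero_iff.1 h0) (Sum.inl a) (Finset.mem_univ _)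
          rwa [if_pos (by rw [arrS_inl, hab])] at this
      ext l
      rcases l with a | l
      · have ha3 := FT_kap a
        have hE := P3 a.1 (arrS_mem (Sum.inl a))
        refine hout (a.1 :: path (Q.tgt a.1)) (Q.src a.1) (M (Q.tgt a.1)) ⟨?_, ⟨rfl, hE.2.1⟩, hE.2.2⟩ a rfl
        intro x hx
        rcases List.mem_cons.1 hx with rfl | hx
        · exact ha3
        · exact hE.1 x hx
      · simp [hm1r])
  refine ⟨ℓ, hl1, ?_, hl4⟩
  intro h hhne hcl
  split_ifs with hα
  · obtain ⟨N, hN, hN'⟩ := hl3 h hcl hα (φ h / N0) (by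
      intro w hw hcw
      show φ (lif path (fil w)) / (N0 : K) = _
      congr 1
      obtain ⟨l0⟩ := hne
      have hmem : Sum.inr l0 ∈ w := by rw [← mem_of_cont, hcw]; simp
      obtain ⟨w1, w2, rfl⟩ := List.append_of_mem hmem
      have hcl' : Cl Q.src Q.tgt (((Sum.inr l0 :: w2) ++ w1).map (arrS α (kap α))) := by
        rw [List.map_append]; apply Cl.rot; rw [← List.map_append, hw]; exact hcl
      obtain ⟨u, hu⟩ := hcl'
      have hus : u = Q.src l0.1.1 := hu.1.symm
      have hP := P1 _ (mem_LT l0) (LT_kap l0)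
      have e := wp (walk_map _ |>.1 hu) (by rw [hus, hP.2])
      rw [hus, hP.2, List.nil_append] at e
      have r1 : h ~r (((Sum.inr l0 :: w2) ++ w1).map (arrS α (kap α))) := by
        rw [← hw, List.map_append, List.map_append]; exact rotated_append _ _
      have r2 : (lif path (fil ((Sum.inr l0 :: w2) ++ w1))) ~r (lif path (fil (w1 ++ Sum.inr l0 :: w2))) := by
        rw [fil_append, fil_append, lif_append, lif_append]; exact rotated_append _ _
      rw [H.rotated hcl r1, e, H.rotated ⟨u, e ▸ hu⟩ r2])
    rw [hN']
    have : N = N0 := by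
      have hpos : 0 < ∏ a ∈ α.toFinset, (kap α a).factorial := Finset.prod_pos (fun a _ => Nat.factorial_pos _)
      apply Nat.eq_of_mul_eq_mul_right hpos
      rw [hN, hN0, ← Finset.prod_mul_distrib]
      apply Finset.prod_congr rfl
      intro a _
      unfold kap
      split_ifs with h
      · simp [h]
      · simp
    rw [this]
    field_simp
  · exact hl2 h hcl hα

theorem main_odd [Infinite K] (h2 : (2 : K) ≠ 0) : Main Q K := by
  intro φ δ H α
  suffices h : ∃ ℓ : MvPolynomial Q.Var K →ₗ[K] K, (∀ p ∈ Q.PlusSet K, ∀ q ∈ Q.PlusSet K, ℓ (p * q) = 0) ∧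
    (∀ h : List Q.A, h ≠ [] → Cl Q.src Q.tgt h → ℓ (Q.pathTr K h) = if (h : Multiset Q.A) = α then φ h else 0) ∧
    (∀ h : List Q.A, 2 • (h : Multiset Q.A) ≠ α → ℓ (Q.pathDet K h) = 0) by
    obtain ⟨ℓ, e1, e2, e3⟩ := h
    refine ⟨ℓ, e1, e2, ?_⟩
    intro h hne hcl
    split_ifs with hα
    · obtain ⟨u, hu⟩ := hcl
      have hc : Q.IsClosed h := ⟨u, hne, (isPathFrom_iff Q u u h).2 hu⟩
      have hid : Q.pathTr K (h ++ h) = Q.pathTr K h * Q.pathTr K h - (2 : K) • Q.pathDet K h := by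
        simp only [QuiverData.pathTr, QuiverData.pathDet, pathMat_append, Matrix.trace_fin_two, Matrix.det_fin_two,
          Matrix.mul_apply, Fin.sum_univ_two, MvPolynomial.smul_eq_C_mul, map_ofNat]
        ring
      have e4 := e2 (h ++ h) (by simp [hne]) ⟨u, walk_append.2 ⟨u, hu, hu⟩⟩
      rw [hid, map_sub, map_smul, e1 _ (tr_plus hc) _ (tr_plus hc), if_pos (by rw [← hα, two_nsmul]; rfl), H.sq u h hne hu, smul_eq_mul] at e4
      apply mul_left_cancel₀ h2
      linear_combination -e4
    · exact e3 h hα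
  by_cases hA : ∀ h : List Q.A, h ≠ [] → Cl Q.src Q.tgt h → (h : Multiset Q.A) = α → φ h = 0
  · refine ⟨0, by simp, ?_, by simp⟩
    intro h hne hcl
    split_ifs with hα
    · rw [hA h hne hcl hα]; rfl
    · rfl
  push Not at hA
  obtain ⟨h0, hne, hcl, rfl, hφ⟩ := hA
  have hv := H.visits h2 hcl hφ
  have hF := fcount (α := (h0 : Multiset Q.A)) hv
  have hnt := H.exists_nontriple hne hcl hφ hv
  have hEx : ∀ a ∈ h0, ∃ p z, EndP (h0 : Multiset Q.A) (Q.src a) p z := fun a ha => endP_exists hcl hnt ⟨a, ha, rfl⟩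
  have hch : ∃ (path : Q.V → List Q.A) (M : Q.V → Q.V), ∀ a ∈ h0, EndP (h0 : Multiset Q.A) (Q.src a) (path (Q.src a)) (M (Q.src a)) := by
    have : ∀ v : Q.V, ∃ p : List Q.A × Q.V, (∃ a ∈ h0, Q.src a = v) → EndP (h0 : Multiset Q.A) v p.1 p.2 := by
      intro v
      by_cases h : ∃ a ∈ h0, Q.src a = v
      · obtain ⟨p, z, hp⟩ := endP_exists hcl hnt h
        exact ⟨(p, z), fun _ => hp⟩
      · exact ⟨([], v), fun h' => absurd h' h⟩
    choose f hf using this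
    exact ⟨fun v => (f v).1, fun v => (f v).2, fun a ha => hf _ ⟨a, ha, rfl⟩⟩
  obtain ⟨path, M, hPM⟩ := hch
  have P3 : ∀ a ∈ (h0 : Multiset Q.A), EndP (h0 : Multiset Q.A) (Q.tgt a) (path (Q.tgt a)) (M (Q.tgt a)) := by
    intro a ha
    obtain ⟨b, hb, e⟩ := tgt_src hcl (Multiset.mem_coe.1 ha)
    rw [← e]; exact hPM b hb
  refine odd_core H M path hF ?_ h2 hnt ?_ ?_ P3
  · intro a
    refine le_trans ?_ (hv (Q.src a))
    rw [Multiset.coe_count, List.count_eq_countP]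
    apply List.countP_mono_left
    intro x _ hx
    simp only [beq_iff_eq] at hx
    simp [hx]
  · intro b hb hb3
    have := EndP.uniq hF (hPM b hb) (p' := []) (z' := Q.src b) ⟨by simp, rfl, b, hb, hb3, rfl⟩
    exact ⟨this.2, this.1⟩
  · intro a ha3
    have ha : a ∈ (h0 : Multiset Q.A) := by rw [← Multiset.count_pos]; omega
    have hE := P3 a ha
    have := EndP.uniq hF (hPM a ha) (p' := a :: path (Q.tgt a)) (z' := M (Q.tgt a)) ⟨?_, ⟨rfl, hE.2.1⟩, hE.2.2⟩
    · exact ⟨this.2, this.1⟩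
    · intro x hx
      rcases List.mem_cons.1 hx with rfl | hx
      · exact ha3
      · exact hE.1 x hx

end odd2
end QR

set_option linter.all false

namespace QR
section E
variable {B C V W : Type*}

/-- the equivalence generated by rotations and swaps of incident closed factors -/
inductive E (s t : B → V) : List B → List B → Prop
  | refl (l) : E s t l l
  | trans {a b c} : E s t a b → E s t b c → E s t a c
  | rot (X Y) : Cl s t (X ++ Y) → E s t (X ++ Y) (Y ++ X)
  | swap (v X Y Z) : Walk s t v v X → Walk s t v v Y → Walk s t v v Z → E s t (X ++ Y ++ Z) (X ++ Z ++ Y)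

variable {s t : B → V}

theorem E.symm {a b : List B} (h : E s t a b) : E s t b a := by
  induction h with
  | refl l => exact E.refl l
  | trans _ _ h1 h2 => exact h2.trans h1
  | rot X Y h => exact E.rot Y X h.rot
  | swap v X Y Z hX hY hZ => exact E.swap v X Z Y hX hZ hY

theorem E.rotated {a b : List B} (hc : Cl s t a) (h : a ~r b) : E s t a b := by
  obtain ⟨n, rfl⟩ := h
  obtain ⟨k, hk⟩ : ∃ k, k = n % a.length := ⟨_, rfl⟩
  rw [← List.rotate_mod, ← hk]
  by_cases hl : a = []
  · subst hl; simpa using E.refl _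
  have : k ≤ a.length := by
    rw [hk]; exact (Nat.mod_lt _ (List.length_pos_iff.2 hl)).le
  rw [List.rotate_eq_drop_append_take this]
  have := E.rot (s := s) (t := t) (a.take k) (a.drop k) (by rwa [List.take_append_drop])
  rwa [List.take_append_drop] at this

theorem E.perm {a b : List B} (h : E s t a b) : a.Perm b := by
  induction h with
  | refl l => exact List.Perm.refl _
  | trans _ _ h1 h2 => exact h1.trans h2
  | rot X Y h => exact List.perm_append_comm
  | swap v X Y Z hX hY hZ =>
    rw [List.append_assoc, List.append_assoc]
    exact List.Perm.append_left _ List.perm_append_comm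

theorem E.cl {a b : List B} (h : E s t a b) (ha : Cl s t a) : Cl s t b := by
  induction h with
  | refl l => exact ha
  | trans _ _ h1 h2 => exact h2 (h1 ha)
  | rot X Y h => exact h.rot
  | swap v X Y Z hX hY hZ => exact ⟨v, walk_append.2 ⟨v, walk_append.2 ⟨v, hX, hZ⟩, hY⟩⟩

theorem E.map {C : Type*} {f : B → C} {s' t' : C → V} (hs : ∀ b, s' (f b) = s b) (ht : ∀ b, t' (f b) = t b)
    {a b : List B} (h : E s t a b) : E s' t' (a.map f) (b.map f) := by
  have hw : ∀ u v l, Walk s t u v l → Walk s' t' u v (l.map f) := by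
    intro u v l h
    rw [walk_map]
    exact walk_congr (fun b _ => hs b) (fun b _ => ht b) h
  induction h with
  | refl l => exact E.refl _
  | trans _ _ h1 h2 => exact h1.trans h2
  | rot X Y h => 
    simp only [List.map_append]
    apply E.rot
    rw [← List.map_append]
    obtain ⟨u, hu⟩ := h
    exact ⟨u, hw _ _ _ hu⟩
  | swap v X Y Z hX hY hZ => 
    simp only [List.map_append]
    exact E.swap v _ _ _ (hw _ _ _ hX) (hw _ _ _ hY) (hw _ _ _ hZ)

/-- push E along vertex maps -/
theorem E.comp (m : V → W) {a b : List B} (h : E s t a b) : E (fun x => m (s x)) (fun x => m (t x)) a b := by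
  induction h with
  | refl l => exact E.refl _
  | trans _ _ h1 h2 => exact h1.trans h2
  | rot X Y h => exact E.rot X Y (h.comp m)
  | swap v X Y Z hX hY hZ => exact E.swap (m v) _ _ _ (walk_comp m hX) (walk_comp m hY) (walk_comp m hZ)

/-- E-lifting by insertion of a letter before another -/
theorem E.ins {i j : B} (hij : t i = s j) {s' : B → V} (hj : s' j = s i) (hs : ∀ x, x ≠ j → s' x = s x)
    {a b : List B} (h : E s' t a b) : 
    E s t (a.flatMap (fun x => if x = j then [i, j] else [x])) (b.flatMap (fun x => if x = j then [i, j] else [x])) := by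
  have hw : ∀ u v l, Walk s' t u v l → Walk s t u v (l.flatMap (fun x => if x = j then [i, j] else [x])) := by
    intro u v l h
    induction l generalizing u with
    | nil => exact h
    | cons x l ih =>
      rw [List.flatMap_cons, walk_append]
      refine ⟨t x, ?_, ih _ h.2⟩
      split_ifs with hx
      · subst hx; exact ⟨hj.symm.trans h.1, hij.symm, rfl⟩
      · exact ⟨(hs x hx).symm.trans h.1, rfl⟩
  induction h with
  | refl l => exact E.refl _
  | trans _ _ h1 h2 => exact h1.trans h2
  | rot X Y h => 
    simp only [List.flatMap_append]
    apply E.rot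
    rw [← List.flatMap_append]
    obtain ⟨u, hu⟩ := h
    exact ⟨u, hw _ _ _ hu⟩
  | swap v X Y Z hX hY hZ => 
    simp only [List.flatMap_append]
    exact E.swap v _ _ _ (hw _ _ _ hX) (hw _ _ _ hY) (hw _ _ _ hZ)

end E

section sg
variable {B V W : Type*}

noncomputable def restr (p : B → Prop) (π : Equiv.Perm B) : Equiv.Perm B :=
  if h : ∀ x, p (π x) ↔ p x then Equiv.Perm.ofSubtype (Equiv.Perm.subtypePerm π h) else 1

theorem restr_apply {p : B → Prop} {π : Equiv.Perm B} (h : ∀ x, p (π x) ↔ p x) (x : B) :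
    restr p π x = if p x then π x else x := by
  rw [restr, dif_pos h]
  split_ifs with hx
  · rw [Equiv.Perm.ofSubtype_apply_of_mem _ hx]; rfl
  · exact Equiv.Perm.ofSubtype_apply_of_not_mem _ hx

variable [Fintype B]

noncomputable def sg (t : B → V) (v : V) (π : Equiv.Perm B) : ℤˣ := Equiv.Perm.sign (restr (fun x => t x = v) π)

def BP (t : B → V) (π : Equiv.Perm B) : Prop := ∀ x, t (π x) = t x

variable {t : B → V} {v : V} {π π' : Equiv.Perm B}

theorem BP.iff (h : BP t π) (v : V) (x : B) : t (π x) = v ↔ t x = v := by rw [h]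
theorem BP.mul (h : BP t π) (h' : BP t π') : BP t (π * π') := fun x => (h _).trans (h' x)
theorem BP.inv (h : BP t π) : BP t π⁻¹ := fun x => by have := h (π⁻¹ x); simpa using this.symm
theorem BP.swap {i j : B} (h : t i = t j) : BP t (Equiv.swap i j) := bsw_lem i j h
theorem BP.comp (m : V → W) (h : BP t π) : BP (fun x => m (t x)) π := fun x => congrArg m (h x)

theorem sg_one : sg t v 1 = 1 := by
  have : restr (fun x => t x = v) 1 = 1 := by
    ext x; rw [restr_apply (fun x => Iff.rfl)]; simp
  rw [sg, this, Equiv.Perm.sign_one]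

theorem sg_mul (h : BP t π) (h' : BP t π') : sg t v (π * π') = sg t v π * sg t v π' := by
  rw [sg, sg, sg, ← Equiv.Perm.sign_mul]
  congr 1
  ext x
  rw [Equiv.Perm.mul_apply, restr_apply ((h.mul h').iff v), restr_apply (π := π') (h'.iff v), restr_apply (π := π) (h.iff v)]
  by_cases hx : t x = v
  · rw [if_pos hx, if_pos hx, if_pos (by rw [h', hx])]; rfl
  · rw [if_neg hx, if_neg hx, if_neg hx]

theorem sg_inv (h : BP t π) : sg t v π⁻¹ = sg t v π := by
  have := sg_mul (v := v) h h.inv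
  rw [mul_inv_cancel, sg_one] at this
  rcases Int.units_eq_one_or (sg t v π) with h1 | h1 <;> rcases Int.units_eq_one_or (sg t v π⁻¹) with h2 | h2 <;>
    rw [h1, h2] at this ⊢ <;> simp at this

theorem sg_swap {i j : B} (hij : i ≠ j) (h : t i = t j) : sg t v (Equiv.swap i j) = if t i = v then -1 else 1 := by
  have hB : BP t (Equiv.swap i j) := BP.swap h
  split_ifs with hv
  · have : restr (fun x => t x = v) (Equiv.swap i j) = Equiv.swap i j := by
      ext x; rw [restr_apply (hB.iff v)]
      split_ifs with hx
      · rfl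
      · rw [Equiv.swap_apply_of_ne_of_ne]
        · rintro rfl; exact hx hv
        · rintro rfl; exact hx (h.symm.trans hv)
    rw [sg, this, Equiv.Perm.sign_swap hij]
  · have : restr (fun x => t x = v) (Equiv.swap i j) = 1 := by
      ext x; rw [restr_apply (hB.iff v)]
      split_ifs with hx
      · rw [Equiv.swap_apply_of_ne_of_ne]; rfl
        · rintro rfl; exact hv hx
        · rintro rfl; exact hv (h.trans hx)
      · rfl
    rw [sg, this, Equiv.Perm.sign_one]

theorem sg_swap_mul (hπ : BP t π) {i j : B} (hij : i ≠ j) (h : t i = t j) : 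
    sg t v (π * Equiv.swap i j) = sg t v π * if t i = v then -1 else 1 := by
  rw [sg_mul hπ (BP.swap h), sg_swap hij h]

end sg

section fp
variable {B V W : Type*}
noncomputable abbrev fp (l : List B) : Equiv.Perm B := l.formPerm

theorem fp_append (L M : List B) (a : B) : fp (L ++ a :: M) = fp (L ++ [a]) * fp (a :: M) := by
  induction L with
  | nil => simp [fp]
  | cons x L ih =>
    cases L with
    | nil => 
      simp only [List.nil_append, List.cons_append, fp, List.formPerm_cons_cons, List.formPerm_singleton, mul_one]
    | cons y L =>
      simp only [List.cons_append, fp, List.formPerm_cons_cons, mul_assoc] at ih ⊢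
      rw [ih]

theorem fp_join {A C : List B} {a c : B} (h : ((A ++ [a]) ++ (C ++ [c])).Nodup) :
    fp ((A ++ [a]) ++ (C ++ [c])) = fp (A ++ [a]) * fp (C ++ [c]) * Equiv.swap a c := by
  have h2 : (a :: (C ++ [c])).Nodup := by
    have : ((A ++ [a]) ++ (C ++ [c])) = A ++ (a :: (C ++ [c])) := by simp
    rw [this] at h
    exact h.of_append_right
  have h1 : fp (a :: (C ++ [c])) = fp (C ++ [c]) * Equiv.swap a c := by
    have r : (a :: (C ++ [c])) ~r (C ++ [c, a]) := by
      have := rotated_append [a] (C ++ [c])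
      simpa using this
    rw [fp, List.formPerm_eq_of_isRotated h2 r, List.formPerm_append_pair, Equiv.swap_comm]
  rw [show (A ++ [a]) ++ (C ++ [c]) = A ++ a :: (C ++ [c]) by simp, fp_append, h1, mul_assoc]

variable {s t : B → V}

theorem fp_rot {h h' : List B} (hn : h.Nodup) (r : h ~r h') : fp h = fp h' := List.formPerm_eq_of_isRotated hn r

theorem fp_mem {h : List B} {x : B} : fp h x ∈ h ↔ x ∈ h := List.formPerm_mem_iff_mem

theorem fp_notMem {h : List B} {x : B} (hx : x ∉ h) : fp h x = x := List.formPerm_apply_of_notMem hx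

theorem fp_src {h : List B} (hn : h.Nodup) (hc : Cl s t h) {x : B} (hx : x ∈ h) : s (fp h x) = t x := by
  obtain ⟨l, hr, hw⟩ := rot_first hc hx
  rw [fp_rot hn hr]
  have hn' := hr.perm.nodup_iff.1 hn
  cases l with
  | nil => 
    have : t x = s x := hw.2
    simp [fp, this]
  | cons y l => 
    rw [fp, List.formPerm_apply_head _ _ _ hn']
    exact hw.2.1

theorem fp_BP {h h' : List B} (hn : h.Nodup) (hn' : h'.Nodup) (hp : h.Perm h') (hc : Cl s t h) (hc' : Cl s t h') :
    BP t ((fp h)⁻¹ * fp h') := by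
  intro x
  obtain ⟨z, hz⟩ : ∃ z, z = ((fp h)⁻¹ * fp h') x := ⟨_, rfl⟩
  have hz' : fp h z = fp h' x := by rw [hz]; simp
  rw [← hz]
  by_cases hx : x ∈ h'
  · have h1 := fp_src hn' hc' hx
    have : z ∈ h := by rw [← fp_mem, hz', hp.mem_iff, fp_mem]; exact hx
    rw [← fp_src hn hc this, hz', h1]
  · rw [fp_notMem hx] at hz'
    have : z ∉ h := by rw [← fp_mem, hz', hp.mem_iff]; exact hx
    rw [fp_notMem this] at hz'
    rw [hz']

variable [Fintype B]

theorem E_sg {h h' : List B} (hE : E s t h h') (hn : h.Nodup) (hc : Cl s t h) (v : V) : sg t v ((fp h)⁻¹ * fp h') = 1 := by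
  induction hE with
  | refl l => rw [inv_mul_cancel, sg_one]
  | @trans a b c h1 h2 i1 i2 => 
    have e : (fp a)⁻¹ * fp c = ((fp a)⁻¹ * fp b) * ((fp b)⁻¹ * fp c) := by group
    have nb := h1.perm.nodup_iff.1 hn
    have cb := h1.cl hc
    rw [e, sg_mul (fp_BP hn nb h1.perm hc cb) (fp_BP nb (h2.perm.nodup_iff.1 nb) h2.perm cb (h2.cl cb)), i1 hn hc, i2 nb cb, one_mul]
  | rot X Y h => 
    rw [fp_rot hn (rotated_append X Y), inv_mul_cancel, sg_one]
  | swap u X Y Z hX hY hZ => 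
    have nil_or : ∀ L : List B, L = [] ∨ ∃ L' b, L = L' ++ [b] := fun L => by simpa using List.eq_nil_or_concat L
    rcases nil_or Y with rfl | ⟨Y, b, rfl⟩
    · simp [sg_one]
    rcases nil_or Z with rfl | ⟨Z, c, rfl⟩
    · simp [sg_one]
    rcases nil_or X with rfl | ⟨X, a, rfl⟩
    · rw [List.nil_append, List.nil_append, fp_rot (by simpa using hn) (rotated_append (Y ++ [b]) (Z ++ [c])), inv_mul_cancel, sg_one]
    have hab : a ≠ b := by rintro rfl; simp [List.nodup_append] at hn
    have hac : a ≠ c := by rintro rfl; simp [List.nodup_append] at hn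
    have e1 := (walk_snoc.1 hX).2
    have e2 := (walk_snoc.1 hY).2
    have e3 := (walk_snoc.1 hZ).2
    have hn2 : ((X ++ [a]) ++ (Z ++ [c]) ++ (Y ++ [b])).Nodup := by
      rw [List.append_assoc] at hn ⊢
      exact (List.Perm.append_left (X ++ [a]) (List.perm_append_comm (l₁ := Y ++ [b]))).nodup_iff.1 hn
    rw [List.append_assoc] at hn hn2
    rw [List.append_assoc, List.append_assoc (X ++ [a])]
    have j1 : fp (X ++ [a] ++ (Y ++ [b] ++ (Z ++ [c]))) = fp (X ++ [a]) * fp (Y ++ [b] ++ (Z ++ [c])) * Equiv.swap a c := by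
      have := fp_join (A := X) (a := a) (C := (Y ++ [b] ++ Z)) (c := c) (by simpa using hn)
      simpa using this
    have j2 : fp (X ++ [a] ++ (Z ++ [c] ++ (Y ++ [b]))) = fp (X ++ [a]) * fp (Z ++ [c] ++ (Y ++ [b])) * Equiv.swap a b := by
      have := fp_join (A := X) (a := a) (C := (Z ++ [c] ++ Y)) (c := b) (by simpa using hn2)
      simpa using this
    rw [j1, j2, fp_rot hn2.of_append_right (rotated_append (Z ++ [c]) (Y ++ [b]))]
    have e : ∀ (A B : Equiv.Perm B), (A * B * Equiv.swap a c)⁻¹ * (A * B * Equiv.swap a b) = Equiv.swap a c * Equiv.swap a b := by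
      intro A B
      rw [mul_inv_rev, Equiv.swap_inv]; group
    rw [e, sg_swap_mul (BP.swap (e1.trans e3.symm)) hab (e1.trans e2.symm), sg_swap hac (e1.trans e3.symm)]
    split_ifs <;> simp

theorem move2 {h : List B} (hc : Cl s t h) {i : B} (hi : i ∈ h) {j1 j2 : B} (h1 : j1 ∈ h) (h2 : j2 ∈ h) (hj : j1 ≠ j2)
    (s1 : s j1 = t i) (s2 : s j2 = t i) : (∃ Z, E s t h (i :: j1 :: Z)) ∨ (∃ Z, E s t h (i :: j2 :: Z)) := by
  obtain ⟨H, hH⟩ := exists_rot_last hi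
  have hE := E.rotated hc hH
  obtain ⟨u, hu⟩ := hc.rotated hH
  have hui := (walk_snoc.1 hu).2
  subst hui
  have key : ∀ j1 j2, j1 ≠ j2 → s j1 = t i → s j2 = t i → ∀ U A D, H ++ [i] = U ++ (j1 :: A) ++ (j2 :: D) → 
    ∃ Z, E s t h (i :: j1 :: Z) := by
    intro j1 j2 hj s1 s2 U A D e
    obtain ⟨D', hD⟩ : ∃ D', j2 :: D = D' ++ [i] := by
      rcases List.eq_nil_or_concat (j2 :: D) with h0 | ⟨D', b, h0⟩
      · simp at h0
      · rw [List.concat_eq_append] at h0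
        rw [h0, ← List.append_assoc] at e
        have := List.append_inj' e rfl
        simp at this
        exact ⟨D', by rw [h0, this.2]⟩
    rw [e] at hu hE
    obtain ⟨w, hw1, hw2⟩ := walk_append.1 hu
    obtain ⟨w', hw1, hw3⟩ := walk_append.1 hw1
    have e1 : w = t i := hw2.1.symm.trans s2
    have e2 : w' = t i := hw3.1.symm.trans s1
    subst e1; subst e2
    have hE2 := hE.trans (E.swap _ _ _ _ hw1 hw3 hw2)
    have hc2 := hE2.cl hc
    rw [hD] at hE2 hc2
    refine ⟨A ++ (U ++ D'), hE2.trans (E.rotated hc2 ?_)⟩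
    have := rotated_append (U ++ D') (i :: j1 :: A)
    simpa using this
  have h1' := hH.perm.mem_iff.1 h1
  have h2' := hH.perm.mem_iff.1 h2
  obtain ⟨U, R, e⟩ := List.append_of_mem h1'
  rw [e, List.mem_append, List.mem_cons] at h2'
  rcases h2' with h2' | h2' | h2'
  · obtain ⟨U1, U2, rfl⟩ := List.append_of_mem h2'
    exact Or.inr (key j2 j1 (Ne.symm hj) s2 s1 U1 U2 R e)
  · exact absurd h2'.symm hj
  · obtain ⟨R1, R2, rfl⟩ := List.append_of_mem h2'
    exact Or.inl (key j1 j2 hj s1 s2 U R1 R2 (by rw [e]; simp))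

theorem E_of_sg (n : ℕ) : ∀ (s : B → V) (h h' : List B), h.length = n → h.Nodup → h.Perm h' → Cl s t h → Cl s t h' → 
    (∀ v, sg t v ((fp h)⁻¹ * fp h') = 1) → E s t h h' := by
  induction n with
  | zero => 
    intro s h h' hl hn hp hc hc' hs
    rw [List.length_eq_zero_iff] at hl
    subst hl
    rw [List.nil_perm.1 hp]
    exact E.refl _
  | succ n ih =>
    intro s h h' hl hn hp hc hc' hs
    have hn' := hp.nodup_iff.1 hn
    cases h with
    | nil => simp at hl
    | cons i h0 =>
    cases h0 with
    | nil => 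
      rw [List.singleton_perm.1 hp]
      exact E.refl _
    | cons j X =>
    obtain ⟨h, hh⟩ : ∃ h, h = i :: j :: X := ⟨_, rfl⟩
    rw [← hh] at hl hn hp hc hs ⊢
    have hih : i ∈ h := by simp [hh]
    have hjh : j ∈ h := by simp [hh]
    have fij : fp h i = j := by
      rw [hh]; exact List.formPerm_apply_head _ _ _ (hh ▸ hn)
    have sj : s j = t i := by rw [← fij, fp_src hn hc hih]
    have hij : i ≠ j := by rintro rfl; rw [hh] at hn; simp at hn
    have claim : ∃ k Z Z', E s t h (i :: k :: Z) ∧ E s t h' (i :: k :: Z') := by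
      have hih' := hp.mem_iff.1 hih
      obtain ⟨l', hr, hw⟩ := rot_first hc' hih'
      cases l' with
      | nil => 
        have := (hp.trans hr.perm).length_eq
        rw [hh] at this; simp at this
      | cons j' X' =>
      have Ej' := E.rotated hc' hr
      by_cases hjj : j = j'
      · subst hjj
        exact ⟨j, X, X', by rw [hh]; exact E.refl _, Ej'⟩
      have fij' : fp h' i = j' := by
        rw [fp_rot hn' hr]; exact List.formPerm_apply_head _ _ _ (hr.perm.nodup_iff.1 hn')
      have sj' : s j' = t i := hw.2.1
      have hj'h : j' ∈ h := by rw [(hp.trans hr.perm).mem_iff]; simp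
      have hjh' : j ∈ h' := hp.mem_iff.1 hjh
      obtain ⟨p, hpp⟩ : ∃ p, fp h p = j' := ⟨(fp h)⁻¹ j', by simp⟩
      have hph : p ∈ h := by rw [← fp_mem, hpp]; exact hj'h
      have hpi : p ≠ i := by rintro rfl; exact hjj (fij.symm.trans hpp)
      by_cases hq : ∃ q ∈ h, t q = t i ∧ q ≠ i ∧ q ≠ p
      · obtain ⟨q, hqh, tq, qi, qp⟩ := hq
        obtain ⟨k, hk⟩ : ∃ k, k = fp h q := ⟨_, rfl⟩
        have hkh : k ∈ h := by rw [hk, fp_mem]; exact hqh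
        have sk : s k = t i := by rw [hk, fp_src hn hc hqh, tq]
        have kj : k ≠ j := by rintro rfl; exact qi ((fp h).injective (hk.symm.trans fij.symm))
        have kj' : k ≠ j' := by rintro rfl; exact qp ((fp h).injective (hk.symm.trans hpp.symm))
        rcases move2 hc hih hj'h hkh (Ne.symm kj') sj' sk with ⟨Z, hZ⟩ | ⟨Z, hZ⟩
        · exact ⟨j', Z, X', hZ, Ej'⟩
        rcases move2 hc' hih' (hp.mem_iff.1 hjh) (hp.mem_iff.1 hkh) (Ne.symm kj) sj sk with ⟨Z', hZ'⟩ | ⟨Z', hZ'⟩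
        · exact ⟨j, X, Z', by rw [hh]; exact E.refl _, hZ'⟩
        · exact ⟨k, Z, Z', hZ, hZ'⟩
      · exfalso
        push Not at hq
        have hB := fp_BP hn hn' hp hc hc'
        obtain ⟨π, hπ⟩ : ∃ π, π = (fp h)⁻¹ * fp h' := ⟨_, rfl⟩
        have pi : π i = p := by
          rw [hπ, Equiv.Perm.mul_apply, fij', ← hpp]; simp
        have tp : t p = t i := by rw [← pi, hπ, hB]
        have hmem : ∀ x ∈ h, π x ∈ h := by
          intro x hx
          rw [← fp_mem, hπ]
          have e : fp h (((fp h)⁻¹ * fp h') x) = fp h' x := by simp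
          rw [e, hp.mem_iff, fp_mem]; exact hp.mem_iff.1 hx
        have pp : π p = i := by
          by_contra hne
          have := hq (π p) (hmem p hph) (by rw [hπ, hB, tp]) hne
          rw [← pi] at this
          exact hpi (by have := π.injective this; rw [← pi]; exact this)
        have hsw : restr (fun x => t x = t i) π = Equiv.swap i p := by
          ext x
          rw [restr_apply (fun x => by rw [hπ, hB])]
          by_cases xi : x = i
          · subst xi; simp [pi]
          by_cases xp : x = p
          · subst xp; simp [pp, tp]
          rw [Equiv.swap_apply_of_ne_of_ne xi xp]
          split_ifs with htx
          · by_cases hxh : x ∈ h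
            · exact absurd (hq x hxh htx xi) xp
            · rw [hπ, Equiv.Perm.mul_apply, fp_notMem (fun hx => hxh (hp.mem_iff.2 hx))]
              rw [Equiv.Perm.inv_eq_iff_eq, fp_notMem hxh]
          · rfl
        have := hs (t i)
        rw [← hπ, sg, hsw, Equiv.Perm.sign_swap (Ne.symm hpi)] at this
        exact absurd this (by decide)
    obtain ⟨k, Z, Z', hE1, hE2⟩ := claim
    have n1 := hE1.perm.nodup_iff.1 hn
    have n2 := hE2.perm.nodup_iff.1 hn'
    have c1 := hE1.cl hc
    have c2 := hE2.cl hc'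
    refine hE1.trans (E.trans ?_ hE2.symm)
    have hs1 : ∀ v, sg t v ((fp (i :: k :: Z))⁻¹ * fp (i :: k :: Z')) = 1 := by
      intro v
      have e : (fp (i :: k :: Z))⁻¹ * fp (i :: k :: Z') = ((fp (i :: k :: Z))⁻¹ * fp h) * ((fp h)⁻¹ * fp h') * 
        ((fp h')⁻¹ * fp (i :: k :: Z')) := by group
      have b1 := fp_BP n1 hn hE1.perm.symm c1 hc
      have b2 := fp_BP hn hn' hp hc hc'
      have b3 := fp_BP hn' n2 hE2.perm hc' c2
      rw [e, sg_mul (b1.mul b2) b3, sg_mul b1 b2, E_sg hE1.symm n1 c1, hs, E_sg hE2 hn' hc', one_mul, one_mul]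
    have e : (fp (i :: k :: Z))⁻¹ * fp (i :: k :: Z') = (fp (k :: Z))⁻¹ * fp (k :: Z') := by
      simp only [fp, List.formPerm_cons_cons]; group
    rw [e] at hs1
    have hkZ : k ∉ Z := fun h => by simp [h] at n1
    have hkZ' : k ∉ Z' := fun h => by simp [h] at n2
    have cl' : ∀ Z, k ∉ Z → Cl s t (i :: k :: Z) → Cl (Function.update s k (s i)) t (k :: Z) := by
      rintro Z hk ⟨u, hu⟩
      refine ⟨u, by simp [hu.1], walk_congr ?_ (fun _ _ => rfl) hu.2.2⟩
      intro b hb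
      rw [Function.update_of_ne]
      rintro rfl; exact hk hb
    have tik : t i = s k := by obtain ⟨u, hu⟩ := c1; exact hu.2.1.symm
    have := ih (Function.update s k (s i)) (k :: Z) (k :: Z') (by
        have := hE1.perm.length_eq; rw [hl] at this; simpa using this.symm) n1.of_cons
      (by have := hE1.perm.symm.trans (hp.trans hE2.perm); exact (List.perm_cons i).1 this) (cl' Z hkZ c1) (cl' Z' hkZ' c2) hs1
    have := E.ins tik (by simp) (fun x hx => Function.update_of_ne hx _ _) this
    have fm : ∀ Z, k ∉ Z → (k :: Z).flatMap (fun x => if x = k then [i, k] else [x]) = i :: k :: Z := by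
      intro Z hk
      rw [List.flatMap_cons, if_pos rfl]
      have : Z.flatMap (fun x => if x = k then [i, k] else [x]) = Z := by
        induction Z with
        | nil => rfl
        | cons y Z ih => 
          rw [List.flatMap_cons, if_neg (by rintro rfl; simp at hk), ih (fun h => hk (by simp [h]))]; rfl
      rw [this]; rfl
    rwa [fm Z hkZ, fm Z' hkZ'] at this

end fp
end QR

set_option linter.all false

namespace QR
section flt
variable {B V W : Type*} {s t : B → V}

theorem rotated_split {h h' : List B} (r : h ~r h') : ∃ X Y, h = X ++ Y ∧ h' = Y ++ X := by
  obtain ⟨n, rfl⟩ := r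
  obtain ⟨k, hk⟩ : ∃ k, k = n % h.length := ⟨_, rfl⟩
  rw [← List.rotate_mod, ← hk]
  by_cases hl : h = []
  · subst hl; exact ⟨[], [], by simp, by simp⟩
  have : k ≤ h.length := by
    rw [hk]; exact (Nat.mod_lt _ (List.length_pos_iff.2 hl)).le
  rw [List.rotate_eq_drop_append_take this]
  exact ⟨_, _, (List.take_append_drop k h).symm, rfl⟩

theorem rotated_filter (p : B → Bool) {h h' : List B} (r : h ~r h') : h.filter p ~r h'.filter p := by
  obtain ⟨X, Y, rfl, rfl⟩ := rotated_split r
  rw [List.filter_append, List.filter_append]; exact rotated_append _ _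

variable [Fintype B]

theorem sg_filter (p : B → Bool) (hloop : ∀ e, p e = false → s e = t e) (v : V) (n : ℕ) : ∀ w w' : List B, w.length = n → w.Nodup → 
    w.Perm w' → Cl s t w → Cl s t w' → 
    sg t v ((fp w)⁻¹ * fp w') = sg t v ((fp (w.filter p))⁻¹ * fp (w'.filter p)) := by
  induction n with
  | zero => 
    intro w w' hl hn hp hc hc'
    rw [List.length_eq_zero_iff] at hl
    subst hl
    rw [List.nil_perm.1 hp]
    simp
  | succ n ih =>
    intro w w' hl hn hp hc hc'
    by_cases hall : ∀ e ∈ w, p e = true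
    · rw [List.filter_eq_self.2 hall, List.filter_eq_self.2 (fun e he => hall e (hp.mem_iff.2 he))]
    push Not at hall
    obtain ⟨e, hew, hpe⟩ := hall
    have hpe : p e = false := by simpa using hpe
    have hn' := hp.nodup_iff.1 hn
    obtain ⟨X, hX⟩ := exists_rot_last hew
    obtain ⟨X', hX'⟩ := exists_rot_last (hp.mem_iff.1 hew)
    have nX := hX.perm.nodup_iff.1 hn
    have nX' := hX'.perm.nodup_iff.1 hn'
    have pX : X.Perm X' := by
      have := hX.perm.symm.trans (hp.trans hX'.perm)
      exact (List.perm_append_right_iff [e]).1 this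
    have clX : ∀ X, Cl s t (X ++ [e]) → Cl s t X := by
      rintro X ⟨u, hu⟩
      obtain ⟨h1, h2⟩ := walk_snoc.1 hu
      rw [hloop e hpe, h2] at h1
      exact ⟨u, h1⟩
    have cX := hc.rotated hX
    have cX' := hc'.rotated hX'
    have fX : ∀ X, (X ++ [e]).filter p = X.filter p := by intro X; simp [hpe]
    rw [fp_rot hn hX, fp_rot hn' hX', fp_rot (hn.filter p) (rotated_filter p hX), fp_rot (hn'.filter p) (rotated_filter p hX'), fX, fX]
    rw [← ih X X' (by have := hX.perm.length_eq; simp at this; omega) nX.of_append_left pX (clX X cX) (clX X' cX')]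
    rcases List.eq_nil_or_concat' X with rfl | ⟨Y, b, rfl⟩
    · rw [List.nil_perm.1 pX]; simp
    rcases List.eq_nil_or_concat' X' with rfl | ⟨Y', b', rfl⟩
    · simp at pX
    have j1 : fp (Y ++ [b] ++ [e]) = fp (Y ++ [b]) * Equiv.swap b e := by
      have := fp_join (A := Y) (a := b) (C := []) (c := e) (by simpa using nX)
      simpa [fp] using this
    have j2 : fp (Y' ++ [b'] ++ [e]) = fp (Y' ++ [b']) * Equiv.swap b' e := by
      have := fp_join (A := Y') (a := b') (C := []) (c := e) (by simpa using nX')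
      simpa [fp] using this
    have tb : ∀ Y b, Cl s t (Y ++ [b] ++ [e]) → t b = t e := by
      rintro Y b ⟨u, hu⟩
      have h1 := (walk_snoc.1 hu).1
      rw [(walk_snoc.1 h1).2, hloop e hpe]
    have hb := tb _ _ cX
    have hb' := tb _ _ cX'
    have be : b ≠ e := by rintro rfl; simp [List.nodup_append] at nX
    have be' : b' ≠ e := by rintro rfl; simp [List.nodup_append] at nX'
    have e1 : (fp (Y ++ [b] ++ [e]))⁻¹ * fp (Y' ++ [b'] ++ [e]) = 
      (Equiv.swap b e * ((fp (Y ++ [b]))⁻¹ * fp (Y' ++ [b']))) * Equiv.swap b' e := by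
      rw [j1, j2, mul_inv_rev, Equiv.swap_inv]; group
    have bp := fp_BP nX.of_append_left nX'.of_append_left pX (clX _ cX) (clX _ cX')
    rw [e1, sg_swap_mul ((BP.swap hb).mul bp) be' hb', sg_mul (BP.swap hb) bp, sg_swap be hb, hb, hb']
    split_ifs <;> simp

end flt

section mg
variable {V : Type*}

/-- vertex identification map -/
noncomputable def mg : List (V × V) → V → V
  | [], v => v
  | f :: fs, v => if mg fs v = mg fs f.1 then mg fs f.2 else mg fs v

theorem mg_mem {fs : List (V × V)} {f : V × V} (hf : f ∈ fs) : mg fs f.1 = mg fs f.2 := by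
  induction fs with
  | nil => simp at hf
  | cons g fs ih =>
    rcases List.mem_cons.1 hf with rfl | hf
    · simp only [mg]; simp
    · simp only [mg, ih hf]

theorem mg_min {W : Type*} (m : V → W) {fs : List (V × V)} (h : ∀ f ∈ fs, m f.1 = m f.2) (v : V) : m (mg fs v) = m v := by
  induction fs generalizing v with
  | nil => rfl
  | cons g fs ih =>
    have ih' := ih (fun f hf => h f (by simp [hf]))
    simp only [mg]
    split_ifs with hv
    · have := ih' v
      rw [hv, ih' g.1] at this
      rw [ih' g.2, ← h g (by simp), this]
    · exact ih' v

theorem mg_le {W : Type*} (m : V → W) {fs : List (V × V)} (h : ∀ f ∈ fs, m f.1 = m f.2) {u v : V} (huv : mg fs u = mg fs v) :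
    m u = m v := by rw [← mg_min m h u, huv, mg_min m h]

end mg

section rel
variable {B V A : Type*} [Fintype B] {s t : B → V}

theorem fp_map (ρ : Equiv.Perm B) (l : List B) : fp (l.map ρ) = ρ * fp l * ρ⁻¹ := by
  induction l with
  | nil => simp [fp]
  | cons x l ih =>
    cases l with
    | nil => simp [fp]
    | cons y l =>
      simp only [List.map_cons, fp, List.formPerm_cons_cons] at ih ⊢
      rw [ih, Equiv.swap_apply_apply]; group

theorem sg_congr {W W' : Type*} {T : B → W} {T' : B → W'} {z : W} {z' : W'} (π : Equiv.Perm B) (h : ∀ x, T x = z ↔ T' x = z') :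
    sg T z π = sg T' z' π := by
  have : (fun x => T x = z) = (fun x => T' x = z') := by ext x; exact h x
  rw [sg, sg, this]

theorem sg_union {W W' : Type*} {T : B → W} {T' : B → W'} {z : W'} {x y : W} {π : Equiv.Perm B} (hB : BP T π) (hxy : x ≠ y) 
    (h : ∀ b, T' b = z ↔ T b = x ∨ T b = y) :
    sg T' z π = sg T x π * sg T y π := by
  rw [sg, sg, sg, ← Equiv.Perm.sign_mul]
  congr 1
  ext b
  rw [Equiv.Perm.mul_apply, restr_apply (fun b => by rw [h, h, hB]), restr_apply (p := fun b => T b = y) (hB.iff y), restr_apply (p := fun b => T b = x) (hB.iff x)]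
  by_cases hx : T b = x
  · have : T b ≠ y := by rw [hx]; exact hxy
    rw [if_neg this, if_pos hx, if_pos ((h b).2 (Or.inl hx))]
  · by_cases hy : T b = y
    · rw [if_pos hy, if_pos ((h b).2 (Or.inr hy)), if_neg]
      rw [hB, hy]; exact Ne.symm hxy
    · rw [if_neg hy, if_neg hx, if_neg]
      rw [h]; tauto

theorem retag (arr : B → A) {h : List B} (hn : h.Nodup) (hfull : ∀ b, b ∈ h) (hc : Cl s t h) 
    (harr : ∀ b b', arr b = arr b' → s b = s b' ∧ t b = t b') (fs : List (V × V)) 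
    (hfs : ∀ f ∈ fs, ∃ e e', e ≠ e' ∧ arr e = arr e' ∧ s e = f.1 ∧ t e = f.2) : 
    ∀ h' : List B, h'.Nodup → (∀ b, b ∈ h') → Cl s t h' → (∀ z, sg (fun b => mg fs (t b)) z ((fp h)⁻¹ * fp h') = 1) →
    ∃ h'' : List B, h''.map arr = h'.map arr ∧ h''.Nodup ∧ (∀ b, b ∈ h'') ∧ Cl s t h'' ∧ 
      ∀ v, sg t v ((fp h)⁻¹ * fp h'') = 1 := by
  induction fs with
  | nil => 
    intro h' hn' hf' hc' hs
    exact ⟨h', rfl, hn', hf', hc', hs⟩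
  | cons f fs ih =>
    intro h' hn' hf' hc' hs
    have ih' := ih (fun f hf => hfs f (by simp [hf]))
    obtain ⟨e, e', hee, hae, hse, hte⟩ := hfs f (by simp)
    obtain ⟨hse', hte'⟩ := harr e e' hae
    obtain ⟨x, hx⟩ : ∃ x, x = mg fs f.1 := ⟨_, rfl⟩
    obtain ⟨y, hy⟩ : ∃ y, y = mg fs f.2 := ⟨_, rfl⟩
    simp only [mg, ← hx, ← hy] at hs
    have bp0 := fp_BP hn hn' (perm_of_full hn hn' hfull hf') hc hc'
    have bp : BP (fun b => mg fs (t b)) ((fp h)⁻¹ * fp h') := bp0.comp (mg fs)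
    by_cases hxy : x = y
    · refine ih' h' hn' hf' hc' ?_
      intro z
      rw [← hs z]
      apply sg_congr
      intro b
      rw [← hxy]
      by_cases hb : mg fs (t b) = x <;> simp [hb]
    have hother : ∀ z, z ≠ x → z ≠ y → sg (fun b => mg fs (t b)) z ((fp h)⁻¹ * fp h') = 1 := by
      intro z zx zy
      rw [← hs z]
      apply sg_congr
      intro b
      by_cases hb : mg fs (t b) = x
      · simp [hb, zx, zy, Ne.symm zx, Ne.symm zy]
      · simp [hb]
    have hu := hs y
    rw [sg_union bp hxy (by
      intro b
      by_cases hb : mg fs (t b) = x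
      · simp [hb]
      · simp [hb])] at hu
    by_cases hX : sg (fun b => mg fs (t b)) x ((fp h)⁻¹ * fp h') = 1
    · refine ih' h' hn' hf' hc' ?_
      intro z
      by_cases zx : z = x
      · rw [zx]; exact hX
      by_cases zy : z = y
      · rw [zy]; rw [hX, one_mul] at hu; exact hu
      exact hother z zx zy
    · have hX' := (Int.units_eq_one_or _).resolve_left hX
      rw [hX'] at hu
      have hY' : sg (fun b => mg fs (t b)) y ((fp h)⁻¹ * fp h') = -1 := by
        rcases Int.units_eq_one_or (sg (fun b => mg fs (t b)) y ((fp h)⁻¹ * fp h')) with h1 | h1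
        · rw [h1] at hu; exact absurd hu (by decide)
        · exact h1
      have harρ : ∀ b, arr (Equiv.swap e e' b) = arr b := fun b => bsw_lem e e' hae b
      have hsρ : ∀ b, s (Equiv.swap e e' b) = s b := fun b => (harr _ _ (harρ b)).1
      have htρ : ∀ b, t (Equiv.swap e e' b) = t b := fun b => (harr _ _ (harρ b)).2
      have hfull'' : ∀ b, b ∈ h'.map (Equiv.swap e e') := fun b => 
        List.mem_map.2 ⟨Equiv.swap e e' b, hf' _, by simp⟩
      have cl'' : Cl s t (h'.map (Equiv.swap e e')) := by
        obtain ⟨u, hu⟩ := hc'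
        exact ⟨u, walk_map _ |>.2 (walk_congr (fun b _ => hsρ b) (fun b _ => htρ b) hu)⟩
      have key : ∀ z, sg (fun b => mg fs (t b)) z ((fp h)⁻¹ * fp (h'.map (Equiv.swap e e'))) = 1 := by
        intro z
        obtain ⟨d, hd⟩ : ∃ d, fp h' d = e := ⟨(fp h')⁻¹ e, by simp⟩
        obtain ⟨d', hd'⟩ : ∃ d', fp h' d' = e' := ⟨(fp h')⁻¹ e', by simp⟩
        have hdd : d ≠ d' := by rintro rfl; exact hee (hd.symm.trans hd')
        have td : t d = f.1 := by rw [← fp_src hn' hc' (hf' d), hd, hse]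
        have td' : t d' = f.1 := by rw [← fp_src hn' hc' (hf' d'), hd', ← hse', hse]
        have e1 : (fp h)⁻¹ * fp (h'.map (Equiv.swap e e')) = ((fp h)⁻¹ * fp h') * Equiv.swap d d' * Equiv.swap e e' := by
          rw [fp_map, ← hd, ← hd', Equiv.swap_apply_apply]
          simp only [mul_inv_rev, Equiv.swap_inv, inv_inv]
          group
        rw [e1, sg_swap_mul (bp.mul (BP.swap (by rw [td, td']))) hee (by rw [hte']), 
          sg_swap_mul bp hdd (by rw [td, td']), td, hte, ← hx, ← hy]
        by_cases zx : z = x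
        · rw [zx, hX', if_pos rfl, if_neg (Ne.symm hxy)]; rfl
        by_cases zy : z = y
        · rw [zy, hY', if_pos rfl, if_neg hxy]; rfl
        rw [hother z zx zy, if_neg (Ne.symm zx), if_neg (Ne.symm zy)]; rfl
      obtain ⟨h'', a1, a2⟩ := ih' (h'.map (Equiv.swap e e')) (hn'.map (Equiv.injective _)) hfull'' cl'' key
      refine ⟨h'', ?_, a2⟩
      rw [a1, List.map_map]
      apply List.map_congr_left
      intro b _; exact harρ b

end rel

section label
theorem perm_lift {B C : Type*} (f : B → C) (l : List C) : ∀ base : List B, l.Perm (base.map f) → ∃ l' : List B, l'.Perm base ∧ l'.map f = l := by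
  induction l with
  | nil => 
    intro base h
    exact ⟨[], by have := List.nil_perm.1 h; simp at this; rw [this], rfl⟩
  | cons x l ih =>
    intro base h
    have hx : x ∈ base.map f := h.mem_iff.1 (by simp)
    obtain ⟨y, hy, rfl⟩ := List.mem_map.1 hx
    obtain ⟨b1, b2, rfl⟩ := List.append_of_mem hy
    have : l.Perm ((b1 ++ b2).map f) := by
      rw [List.map_append, List.map_cons] at h
      have := h.trans List.perm_middle
      rw [List.map_append]
      exact (List.perm_cons _).1 this
    obtain ⟨l', h1, h2⟩ := ih _ this
    refine ⟨y :: l', ?_, by rw [List.map_cons, h2]⟩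
    exact ((List.perm_cons y).2 h1).trans List.perm_middle.symm

variable {B : Type} [Fintype B]

theorem exists_label (m0 : B →₀ ℕ) {w : List B} (hw : cont w = m0) : ∃ l : List (Σ b : B, Fin (m0 b)), l.Nodup ∧ (∀ x, x ∈ l) ∧ 
    l.map Sigma.fst = w := by
  have : w.Perm ((Finset.univ : Finset (Σ b : B, Fin (m0 b))).toList.map Sigma.fst) := by
    rw [List.perm_iff_count]
    intro b
    rw [← cont_apply, hw, ← Multiset.coe_count, ← Multiset.map_coe, Finset.coe_toList, Multiset.count_map]
    have e : (Multiset.filter (fun a : (Σ b : B, Fin (m0 b)) => b = a.1) Finset.univ.val).card = 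
      (Finset.univ.filter (fun a : (Σ b : B, Fin (m0 b)) => b = a.1)).card := rfl
    rw [e, Finset.card_filter, Fintype.sum_sigma, Finset.sum_eq_single b]
    · simp
    · intro c _ hc
      simp [Ne.symm hc]
    · simp
  obtain ⟨l, h1, h2⟩ := perm_lift _ _ _ this
  exact ⟨l, h1.nodup_iff.2 (Finset.nodup_toList _), fun x => h1.mem_iff.2 (by simp), h2⟩

variable {F L : Type} [Fintype F] [Fintype L] {V : Type*}

theorem E_of_fil (s t : F ⊕ L → V) (m0 : F ⊕ L →₀ ℕ) (hr : ∀ l, m0 (Sum.inr l) = 1) (fs : List (V × V))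
    (hfs : ∀ f ∈ fs, ∃ a : F, 2 ≤ m0 (Sum.inl a) ∧ f = (s (Sum.inl a), t (Sum.inl a)))
    (hloop : ∀ a : F, mg fs (s (Sum.inl a)) = mg fs (t (Sum.inl a)))
    {w w' : List (F ⊕ L)} (hw : cont w = m0) (hw' : cont w' = m0) (hc : Cl s t w) (hc' : Cl s t w')
    (hE : E (fun l => mg fs (s (Sum.inr l))) (fun l => mg fs (t (Sum.inr l))) (fil w) (fil w')) : E s t w w' := by
  obtain ⟨h, hn, hfull, rfl⟩ := exists_label m0 hw
  obtain ⟨h', hn', hfull', rfl⟩ := exists_label m0 hw'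
  obtain ⟨S, hS⟩ : ∃ S : (Σ b, Fin (m0 b)) → V, S = fun x => s x.1 := ⟨_, rfl⟩
  obtain ⟨T, hT⟩ : ∃ T : (Σ b, Fin (m0 b)) → V, T = fun x => t x.1 := ⟨_, rfl⟩
  have c1 : Cl S T h := by
    obtain ⟨u, hu⟩ := hc
    rw [hS, hT]
    exact ⟨u, walk_map _ |>.1 hu⟩
  have c1' : Cl S T h' := by
    obtain ⟨u, hu⟩ := hc'
    rw [hS, hT]
    exact ⟨u, walk_map _ |>.1 hu⟩
  let ι : L → (Σ b : F ⊕ L, Fin (m0 b)) := fun l => ⟨Sum.inr l, ⟨0, by rw [hr]; exact Nat.one_pos⟩⟩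
  have hfil : ∀ h : List (Σ b : F ⊕ L, Fin (m0 b)), h.filter (fun x => x.1.isRight) = (fil (h.map Sigma.fst)).map ι := by
    intro h
    induction h with
    | nil => rfl
    | cons x h ih =>
      obtain ⟨x, i⟩ := x
      rcases x with a | l
      · simp [ih]
      · have : (⟨Sum.inr l, i⟩ : (Σ b : F ⊕ L, Fin (m0 b))) = ι l := by
          simp only [ι]
          congr 1
          have := i.2
          apply Fin.ext
          have h1 := hr l
          show (i : ℕ) = 0
          omega
        simp only [List.map_cons, fil_inr, ← ih, ← this]
        rw [List.filter_cons_of_pos rfl]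
  have cM : Cl (fun x => mg fs (S x)) (fun x => mg fs (T x)) h := c1.comp _
  have cM' : Cl (fun x => mg fs (S x)) (fun x => mg fs (T x)) h' := c1'.comp _
  have hp := perm_of_full hn hn' hfull hfull'
  have hsg : ∀ z, sg (fun x => mg fs (T x)) z ((fp h)⁻¹ * fp h') = 1 := by
    intro z
    have hl : ∀ e : (Σ b : F ⊕ L, Fin (m0 b)), e.1.isRight = false → mg fs (S e) = mg fs (T e) := by
      rintro ⟨x, i⟩ he
      rcases x with a | l
      · rw [hS, hT]; exact hloop a
      · simp at he
    rw [sg_filter (s := fun x => mg fs (S x)) (fun x => x.1.isRight) hl z _ h h' rfl hn hp cM cM', hfil, hfil]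
    have hE' := hE.map (f := ι) (s' := fun x => mg fs (S x)) (t' := fun x => mg fs (T x)) (by intro b; rw [hS]) (by intro b; rw [hT])
    apply E_sg hE'
    · rw [← hfil]; exact hn.filter _
    · obtain ⟨u, hu⟩ := hc.comp (mg fs)
      have := fil_walk hu (fun a _ => hloop a)
      refine ⟨u, walk_map _ |>.2 ?_⟩
      rw [hS, hT]
      exact this
  obtain ⟨h'', a1, a2, a3, a4, a5⟩ := retag (Sigma.fst) hn hfull c1 (by
    rintro b b' e; rw [hS, hT]; simp [e]) fs (by
    intro f hf
    obtain ⟨a, ha, rfl⟩ := hfs f hf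
    refine ⟨⟨Sum.inl a, ⟨0, by omega⟩⟩, ⟨Sum.inl a, ⟨1, by omega⟩⟩, ?_, rfl, ?_, ?_⟩
    · intro h; simp at h
    · rw [hS]
    · rw [hT]) h' hn' hfull' c1' hsg
  have hE := E_of_sg (t := T) _ S h h'' rfl hn (perm_of_full hn a2 hfull a3) c1 a4 a5
  have := hE.map (f := Sigma.fst) (s' := s) (t' := t) (by intro b; rw [hS]) (by intro b; rw [hT])
  rwa [a1] at this

end label

section phi
variable {K : Type} [Field K] {Q : QuiverData} {φ δ : List Q.A → K}

theorem PD.E (H : PD Q K φ δ) (h2 : (2 : K) = 0) {a b : List Q.A} (h : QR.E Q.src Q.tgt a b) : φ a = φ b := by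
  induction h with
  | refl l => rfl
  | trans _ _ h1 h2 => exact h1.trans h2
  | rot X Y h => exact H.rotated h (rotated_append X Y)
  | swap v X Y Z hX hY hZ => 
    have hc : Cl Q.src Q.tgt (X ++ Y ++ Z) := ⟨v, walk_append.2 ⟨v, walk_append.2 ⟨v, hX, hY⟩, hZ⟩⟩
    by_cases h1 : X = []
    · subst h1; exact H.rotated hc (rotated_append Y Z)
    by_cases h3 : Y = []
    · subst h3; simp
    by_cases h4 : Z = []
    · subst h4; simp
    rw [H.sw v X Y Z h1 h3 h4 hX hY hZ]
    linear_combination (φ (X ++ Y ++ Z)) * h2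

end phi
end QR

set_option linter.all false

namespace QR
section bal
variable {B V W : Type*} {s t : B → V}

/-- balanced multiset of letters -/
def Bal (s t : B → V) (l : List B) : Prop := (l.map s).Perm (l.map t)

theorem Bal.of_perm {l l' : List B} (h : Bal s t l) (hp : l.Perm l') : Bal s t l' :=
  (hp.map s).symm.trans (h.trans (hp.map t))

theorem Bal.append {l l' : List B} (h : Bal s t l) (h' : Bal s t l') : Bal s t (l ++ l') := by
  unfold Bal at *
  rw [List.map_append, List.map_append]; exact h.append h'

theorem Bal.cancel {l l' : List B} (h : Bal s t (l ++ l')) (h' : Bal s t l) : Bal s t l' := by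
  unfold Bal at *
  rw [List.map_append, List.map_append] at h
  have := h.trans ((h'.symm).append_right _)
  exact (List.perm_append_left_iff _).1 this

theorem Bal.comp {l : List B} (h : Bal s t l) (m : V → W) : Bal (fun b => m (s b)) (fun b => m (t b)) l := by
  have := List.Perm.map m h
  unfold Bal
  simpa [List.map_map, Function.comp_def] using this

theorem bal_loops {l : List B} (h : ∀ b ∈ l, s b = t b) : Bal s t l := by
  unfold Bal
  rw [List.map_congr_left h]

theorem walk_st {u v : V} {l : List B} (h : Walk s t u v l) : l.map s ++ [v] = u :: l.map t := by
  induction l generalizing u with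
  | nil => simp only [Walk] at h; simp [h]
  | cons b l ih => 
    obtain ⟨h1, h2⟩ := h
    simp [ih h2, h1]

theorem walk_bal {u : V} {l : List B} (h : Walk s t u u l) : Bal s t l := by
  have := walk_st h
  have h2 : (u :: l.map s).Perm (u :: l.map t) := by
    rw [← this]; exact (List.perm_append_singleton u _).symm
  exact (List.perm_cons _).1 h2

theorem Cl.bal {l : List B} (h : Cl s t l) : Bal s t l := by
  obtain ⟨u, hu⟩ := h; exact walk_bal hu

theorem bal_double {l : List B} (h : Bal s t (l ++ l)) : Bal s t l := by
  unfold Bal at *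
  rw [List.perm_iff_count] at *
  intro v
  have := h v
  simp only [List.map_append, List.count_append] at this
  omega

theorem trail_aux (n : ℕ) : ∀ (u v : V) (C g : List B), g.length = n → Walk s t u v C → Bal s t (C ++ g) →
    ∃ D g' : List B, g.Perm (D ++ g') ∧ Walk s t u u (C ++ D) := by
  induction n with
  | zero => 
    intro u v C g hl hC hb
    have : g = [] := List.eq_nil_of_length_eq_zero hl
    subst this
    refine ⟨[], [], by simp, ?_⟩
    have h1 := walk_st hC
    rw [List.append_nil] at *
    have h2 : (v :: C.map s).Perm (u :: C.map t) := by
      rw [← h1]; exact (List.perm_append_singleton v _).symm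
    have h3 := (((List.perm_cons v).2 hb).symm.trans h2)
    have h4 : v = u := by
      rw [List.perm_iff_count] at h3
      have := h3 v
      simp only [List.count_cons] at this
      by_contra hne
      simp [Ne.symm hne] at this
    rw [← h4] at hC ⊢; exact hC
  | succ n ih =>
    intro u v C g hl hC hb
    by_cases huv : v = u
    · subst huv
      exact ⟨[], g, by simp, by simpa using hC⟩
    have h1 := walk_st hC
    have : ∃ b ∈ g, s b = v := by
      have c1 := congrArg (List.count v) h1
      simp only [List.count_append, List.count_cons, List.count_nil] at c1
      simp only [beq_self_eq_true, if_true, beq_iff_eq, if_neg (Ne.symm huv)] at c1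
      have c2 := List.perm_iff_count.1 hb v
      simp only [List.map_append, List.count_append] at c2
      have c3 : 0 < (g.map s).count v := by omega
      rw [List.count_pos_iff] at c3
      simpa using c3
    obtain ⟨b, hb', hbv⟩ := this
    obtain ⟨g1, g2, rfl⟩ := List.append_of_mem hb'
    obtain ⟨D, g', p1, p2⟩ := ih u (t b) (C ++ [b]) (g1 ++ g2) (by simp at hl ⊢; omega) 
      (walk_snoc.2 ⟨by rw [hbv]; exact hC, rfl⟩) (hb.of_perm (by 
        simp only [List.append_assoc]
        exact List.Perm.append_left _ List.perm_middle))
    refine ⟨b :: D, g', ?_, by simpa using p2⟩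
    exact List.perm_middle.trans ((List.perm_cons b).2 p1)

theorem closed_trail {g : List B} (hb : Bal s t g) {a : B} (ha : a ∈ g) : 
    ∃ D g' : List B, g.Perm ((a :: D) ++ g') ∧ Walk s t (s a) (s a) (a :: D) ∧ Bal s t g' := by
  obtain ⟨g1, g2, rfl⟩ := List.append_of_mem ha
  obtain ⟨D, g', p1, p2⟩ := trail_aux (s := s) (t := t) _ (s a) (t a) [a] (g1 ++ g2) rfl ⟨rfl, rfl⟩ (hb.of_perm List.perm_middle)
  have hp : (g1 ++ a :: g2).Perm ((a :: D) ++ g') := List.perm_middle.trans ((List.perm_cons a).2 p1)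
  exact ⟨D, g', hp, p2, (hb.of_perm hp).cancel (walk_bal p2)⟩

theorem euler (n : ℕ) : ∀ (C g : List B), g.length = n → Cl s t C → Bal s t g → (∀ b ∈ g, ∃ c ∈ C, s c = s b) → 
    ∃ w, Cl s t w ∧ w.Perm (C ++ g) := by
  induction n using Nat.strong_induction_on with
  | _ n ih =>
    intro C g hl hC hb hv
    rcases g with _ | ⟨b, g⟩
    · exact ⟨C, hC, by simp⟩
    obtain ⟨D, g', p1, p2, p3⟩ := closed_trail hb (List.mem_cons_self)
    obtain ⟨c, hc, hcb⟩ := hv b (by simp)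
    obtain ⟨h', r1, r2⟩ := rot_first hC hc
    have hlen := p1.length_eq
    obtain ⟨w, w1, w2⟩ := ih g'.length (by simp at hlen hl; omega) ((b :: D) ++ (c :: h')) g' rfl 
      ⟨s b, walk_append.2 ⟨s b, p2, by rw [← hcb]; exact r2⟩⟩ p3 (by
        intro b' hb'
        obtain ⟨c', h1, h2⟩ := hv b' (p1.mem_iff.2 (by simp [hb']))
        exact ⟨c', by rw [List.mem_append]; exact Or.inr (r1.perm.mem_iff.1 h1), h2⟩)
    refine ⟨w, w1, w2.trans ?_⟩
    have : (C ++ b :: g).Perm ((c :: h') ++ ((b :: D) ++ g')) := r1.perm.append p1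
    refine List.Perm.trans ?_ this.symm
    rw [← List.append_assoc]
    exact List.perm_append_comm.append_right _

theorem walk_inv {P : V → Prop} {u v : V} {l : List B} (h : Walk s t u v l) (hu : P u) (hP : ∀ b ∈ l, P (s b) → P (t b)) : 
    ∀ b ∈ l, P (s b) := by
  induction l generalizing u with
  | nil => simp
  | cons b l ih =>
    obtain ⟨h1, h2⟩ := h
    intro c hc
    have hb : P (s b) := by rw [h1]; exact hu
    rcases List.mem_cons.1 hc with rfl | hc
    · exact hb
    · exact ih h2 (hP b (by simp) hb) (fun b hb => hP b (by simp [hb])) c hc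

theorem connect {w0 X g : List B} (h0 : Cl s t w0) (hX : Cl s t X) (hX0 : X ≠ []) (hg : g ≠ []) (hp : w0.Perm (X ++ (g ++ g))) :
    ∃ b ∈ g, ∃ c ∈ X, s c = s b := by
  by_contra hno
  push Not at hno
  obtain ⟨x, hx⟩ := List.exists_mem_of_ne_nil X hX0
  obtain ⟨b, hb⟩ := List.exists_mem_of_ne_nil g hg
  obtain ⟨h', r1, r2⟩ := rot_first h0 (hp.mem_iff.2 (by simp [hx]) : x ∈ w0)
  have := walk_inv (P := fun v => ∃ c ∈ X, s c = v) r2 ⟨x, hx, rfl⟩ (by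
    rintro y hy ⟨c, hc, hcy⟩
    have hy' := hp.mem_iff.1 (r1.perm.mem_iff.2 hy)
    simp only [List.mem_append, or_self] at hy'
    rcases hy' with hy' | hy'
    · exact tgt_src hX hy'
    · exact absurd hcy (hno y hy' c hc)) b (r1.perm.mem_iff.1 (hp.mem_iff.2 (by simp [hb])))
  obtain ⟨c, hc, hcb⟩ := this
  exact hno b hb c hc hcb

end bal

section ins
variable {F L : Type} [Fintype F] [Fintype L] {V W : Type*} {s t : F ⊕ L → V}

theorem fil_eq_nil {l : List (F ⊕ L)} (h : ∀ x ∈ l, x.isLeft) : fil l = [] := by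
  induction l with
  | nil => rfl
  | cons x l ih =>
    rcases x with a | b
    · rw [fil_inl]; exact ih (fun x hx => h x (by simp [hx]))
    · have := h (Sum.inr b) (by simp); simp at this

theorem fil_rot {l l' : List (F ⊕ L)} (h : l ~r l') : fil l ~r fil l' := by
  obtain ⟨X, Y, rfl, rfl⟩ := rotated_split h
  rw [fil_append, fil_append]; exact rotated_append _ _

theorem insert_double (n : ℕ) : ∀ (w0 X g : List (F ⊕ L)), g.length = n → Cl s t w0 → Cl s t X → g ≠ [] → Bal s t g → 
    (∀ x ∈ g, x.isLeft) → w0.Perm (X ++ (g ++ g)) → 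
    ∃ C R v, C ≠ [] ∧ Walk s t v v C ∧ Walk s t v v R ∧ (C ++ C ++ R).Perm w0 ∧ fil X ~r fil (C ++ C ++ R) := by
  induction n using Nat.strong_induction_on with
  | _ n ih =>
    intro w0 X g hl h0 hX hg hb hinl hp
    have key : ∃ b ∈ g, ∃ X', X ~r X' ∧ Walk s t (s b) (s b) X' := by
      by_cases hX0 : X = []
      · subst hX0
        obtain ⟨b, hb⟩ := List.exists_mem_of_ne_nil g hg
        exact ⟨b, hb, [], List.IsRotated.refl _, rfl⟩
      · obtain ⟨b, hb, c, hc, e⟩ := connect h0 hX hX0 hg hp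
        obtain ⟨h', r1, r2⟩ := rot_first hX hc
        exact ⟨b, hb, _, r1, by rw [← e]; exact r2⟩
    obtain ⟨b, hb', X', r, hX'⟩ := key
    obtain ⟨D, g', p1, p2, p3⟩ := closed_trail hb hb'
    have hpp : w0.Perm (((b :: D) ++ (b :: D) ++ X') ++ (g' ++ g')) := by
      refine hp.trans ((r.perm.append (p1.append p1)).trans ?_)
      rw [← Multiset.coe_eq_coe]
      simp only [← Multiset.coe_add]
      abel
    have hf : fil ((b :: D) ++ (b :: D) ++ X') = fil X' := by
      rw [fil_append, fil_append, fil_eq_nil (l := b :: D)]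
      · rfl
      · intro x hx; exact hinl x (p1.mem_iff.2 (by rw [List.mem_append]; exact Or.inl hx))
    by_cases hg' : g' = []
    · subst hg'
      refine ⟨b :: D, X', s b, by simp, p2, hX', ?_, ?_⟩
      · simpa using hpp.symm
      · rw [hf]; exact fil_rot r
    · have hlen := p1.length_eq
      obtain ⟨C, R, v, c1, c2, c3, c4, c5⟩ := ih g'.length (by simp at hlen hl; omega) w0 ((b :: D) ++ (b :: D) ++ X') g' rfl h0 
        ⟨s b, walk_append.2 ⟨s b, walk_append.2 ⟨s b, p2, p2⟩, hX'⟩⟩ hg' p3 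
        (fun x hx => hinl x (p1.mem_iff.2 (by rw [List.mem_append]; exact Or.inr hx))) hpp
      refine ⟨C, R, v, c1, c2, c3, c4, ?_⟩
      rw [hf] at c5
      exact (fil_rot r).trans c5

end ins
end QR

set_option linter.all false

namespace QR
section seg
variable {B V W : Type*} {s t : B → V}

theorem E_loops {z : V} {Ls Ls' : List (List B)} (hp : Ls.Perm Ls') : (∀ σ ∈ Ls, Walk s t z z σ) → 
    ∀ D, Walk s t z z D → E s t (D ++ Ls.flatten) (D ++ Ls'.flatten) := by
  have fl : ∀ Ls : List (List B), (∀ σ ∈ Ls, Walk s t z z σ) → Walk s t z z Ls.flatten := by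
    intro Ls
    induction Ls with
    | nil => intro _; rfl
    | cons a l ih => 
      intro h
      rw [List.flatten_cons]
      exact walk_append.2 ⟨z, h a (by simp), ih (fun σ hσ => h σ (by simp [hσ]))⟩
  induction hp with
  | nil => intro _ D _; exact E.refl _
  | cons σ _ ih =>
    intro h D hD
    have := ih (fun σ hσ => h σ (by simp [hσ])) (D ++ σ) (walk_append.2 ⟨z, hD, h σ (by simp)⟩)
    simpa [List.append_assoc] using this
  | swap a b l =>
    intro h D hD
    have ha := h a (by simp)
    have hb := h b (by simp)
    have hR := fl l (fun σ hσ => h σ (by simp [hσ]))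
    have w1 := walk_append.2 ⟨z, walk_append.2 ⟨z, hD, hb⟩, ha⟩
    have w2 := walk_append.2 ⟨z, walk_append.2 ⟨z, hD, ha⟩, hb⟩
    have e1 := E.rot (s := s) (t := t) (D ++ b ++ a) l.flatten ⟨z, walk_append.2 ⟨z, w1, hR⟩⟩
    have e2 := E.swap z (l.flatten ++ D) b a (walk_append.2 ⟨z, hR, hD⟩) hb ha
    have e3 := E.rot (s := s) (t := t) l.flatten (D ++ a ++ b) ⟨z, walk_append.2 ⟨z, hR, w2⟩⟩
    simp only [List.append_assoc, List.flatten_cons] at e1 e2 e3 ⊢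
    exact (e1.trans e2).trans e3
  | trans p1 p2 h1 h2 =>
    intro h D hD
    exact (h1 h D hD).trans (h2 (fun σ hσ => h σ (p1.mem_iff.2 hσ)) D hD)

theorem cut (n : V → W) (z : W) (hn : ∀ p q, n p = n q → p = q ∨ n p = z) (τ : List B) : 
    ∀ v0, Walk (fun b => n (s b)) (fun b => n (t b)) (n v0) z τ → 
    ∃ (σ0 : List B) (Ls : List (List B)), τ = σ0 ++ Ls.flatten ∧ (∃ q, n q = z ∧ Walk s t v0 q σ0) ∧ 
      ∀ σ ∈ Ls, ∃ p q, n p = z ∧ n q = z ∧ Walk s t p q σ := by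
  induction τ with
  | nil => 
    intro v0 h
    exact ⟨[], [], rfl, ⟨v0, h, rfl⟩, by simp⟩
  | cons b τ ih =>
    rintro v0 ⟨h1, h2⟩
    obtain ⟨σ0, Ls, rfl, ⟨q, hq, hw⟩, hL⟩ := ih (t b) h2
    by_cases hb : s b = v0
    · exact ⟨b :: σ0, Ls, rfl, ⟨q, hq, hb, hw⟩, hL⟩
    · have h1' : n (s b) = n v0 := h1
      have hz := (hn _ _ h1').resolve_left hb
      refine ⟨[], (b :: σ0) :: Ls, by simp, ⟨v0, by rw [← h1', hz], rfl⟩, ?_⟩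
      intro σ hσ
      rcases List.mem_cons.1 hσ with rfl | hσ
      · exact ⟨s b, q, hz, hq, rfl, hw⟩
      · exact hL σ hσ

theorem seg_flat {S T : List B → V} (Ω : List (List B)) (h : ∀ σ ∈ Ω, Walk s t (S σ) (T σ) σ) : ∀ p q, Walk S T p q Ω → 
    Walk s t p q Ω.flatten := by
  induction Ω with
  | nil => intro p q h; exact h
  | cons σ Ω ih =>
    rintro p q ⟨h1, h2⟩
    rw [List.flatten_cons]
    exact walk_append.2 ⟨T σ, by rw [← h1]; exact h σ (by simp), ih (fun σ hσ => h σ (by simp [hσ])) _ _ h2⟩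

theorem seg_bal {S T : List B → V} (Ω : List (List B)) (h : ∀ σ ∈ Ω, Walk s t (S σ) (T σ) σ) : 
    (Ω.flatten.map s ++ Ω.map T).Perm (Ω.map S ++ Ω.flatten.map t) := by
  induction Ω with
  | nil => simp
  | cons σ Ω ih =>
    have h1 := walk_st (h σ (by simp))
    have h2 := ih (fun σ hσ => h σ (by simp [hσ]))
    rw [← Multiset.coe_eq_coe] at h2 ⊢
    have h1' : ((σ.map s : List V) : Multiset V) + {T σ} = {S σ} + (σ.map t : List V) := by
      rw [Multiset.singleton_add, Multiset.cons_coe, ← h1]; rfl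
    simp only [List.flatten_cons, List.map_append, List.map_cons, ← Multiset.coe_add, ← Multiset.cons_coe, 
      ← Multiset.singleton_add] at h2 ⊢
    calc _ = (((σ.map s : List V) : Multiset V) + {T σ}) + ((Ω.flatten.map s : List V) + (Ω.map T : List V)) := by abel
      _ = _ := by rw [h1', h2]; abel

/-- one letter insertion -/
theorem step (n : V → W) (f : B) (hnf : n (s f) = n (t f)) (hn : ∀ p q, n p = n q → p = q ∨ n p = n (s f))
    (hn2 : ∀ p, n p = n (s f) → p = s f ∨ p = t f) {τ : List B} 
    (hc : Cl (fun b => n (s b)) (fun b => n (t b)) τ) (hb : Bal s t (f :: τ)) (hto : ∃ b ∈ τ, n (s b) = n (s f)) :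
    ∃ w τ', Cl s t w ∧ w.Perm (f :: τ) ∧ τ ~r τ' ∧ E (fun b => n (s b)) (fun b => n (t b)) w (f :: τ') := by
  obtain ⟨b, hbτ, hbz⟩ := hto
  obtain ⟨τ1, r1, r2⟩ := rot_first hc hbτ
  have r2' : Walk (fun b => n (s b)) (fun b => n (t b)) (n (s f)) (n (s f)) (b :: τ1) := by
    rw [← hbz]; exact r2
  obtain ⟨σ0, Ls, hτ, ⟨q, hq, hw⟩, hL⟩ := cut n (n (s f)) hn _ (s f) r2'
  have hΩ : ∀ σ ∈ [f] :: σ0 :: Ls, ∃ p q, n p = n (s f) ∧ n q = n (s f) ∧ Walk s t p q σ := by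
    intro σ hσ
    simp only [List.mem_cons] at hσ
    rcases hσ with rfl | rfl | hσ
    · exact ⟨s f, t f, rfl, hnf.symm, rfl, rfl⟩
    · exact ⟨s f, q, rfl, hq, hw⟩
    · exact hL σ hσ
  have hch : ∀ σ : List B, ∃ pq : V × V, σ ∈ [f] :: σ0 :: Ls → n pq.1 = n (s f) ∧ n pq.2 = n (s f) ∧ Walk s t pq.1 pq.2 σ := by
    intro σ
    by_cases h : σ ∈ [f] :: σ0 :: Ls
    · obtain ⟨p, q, h1⟩ := hΩ σ h
      exact ⟨(p, q), fun _ => h1⟩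
    · exact ⟨(s f, s f), fun h' => absurd h' h⟩
  choose g hg using hch
  have gf : (g [f]).1 = s f ∧ (g [f]).2 = t f := by
    have := (hg [f] (by simp)).2.2
    exact ⟨this.1.symm, this.2.symm⟩
  have hflat : ([f] :: σ0 :: Ls).flatten = f :: (b :: τ1) := by rw [hτ]; simp
  have hpf : (f :: (b :: τ1)).Perm (f :: τ) := (List.perm_cons _).2 r1.perm.symm
  have balΩ : Bal (fun σ => (g σ).1) (fun σ => (g σ).2) ([f] :: σ0 :: Ls) := by
    have h1 := seg_bal (s := s) (t := t) (S := fun σ => (g σ).1) (T := fun σ => (g σ).2) ([f] :: σ0 :: Ls) (fun σ hσ => (hg σ hσ).2.2)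
    rw [hflat] at h1
    have h2 : Bal s t (f :: (b :: τ1)) := hb.of_perm hpf.symm
    have h3 := h1.trans (List.Perm.append_left _ h2.symm)
    have h4 := List.perm_append_comm.trans h3
    exact ((List.perm_append_right_iff _).1 h4).symm
  obtain ⟨D, g', p1, p2, p3⟩ := closed_trail balΩ (List.mem_cons_self)
  have c1 : Cl (fun σ => (g σ).1) (fun σ => (g σ).2) ([f] :: D) := ⟨_, p2⟩
  obtain ⟨Ω, w1, w2⟩ := euler _ ([f] :: D) g' rfl c1 p3 (by
    intro σ hσ
    have hm := hg σ (p1.mem_iff.2 (by rw [List.mem_append]; exact Or.inr hσ))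
    rcases hn2 _ hm.1 with h | h
    · exact ⟨[f], by simp, by rw [gf.1, h]⟩
    · obtain ⟨σ', h1, h2⟩ := tgt_src c1 (List.mem_cons_self)
      exact ⟨σ', h1, by rw [h2, gf.2, h]⟩)
  have hpΩ : Ω.Perm ([f] :: σ0 :: Ls) := w2.trans p1.symm
  refine ⟨Ω.flatten, b :: τ1, ?_, ?_, r1, ?_⟩
  · obtain ⟨u, hu⟩ := w1
    exact ⟨u, seg_flat Ω (fun σ hσ => (hg σ (hpΩ.mem_iff.1 hσ)).2.2) _ _ hu⟩
  · refine List.Perm.trans ?_ hpf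
    rw [← hflat]
    exact hpΩ.flatten
  · have := E_loops (s := fun b => n (s b)) (t := fun b => n (t b)) (z := n (s f)) hpΩ (by
      intro σ hσ
      obtain ⟨h1, h2, h3⟩ := hg σ (hpΩ.mem_iff.1 hσ)
      have := walk_comp n h3
      rw [h1, h2] at this; exact this) [] rfl
    rw [hflat] at this
    exact this

end seg

section surj
variable {F L : Type} [Fintype F] [Fintype L] {V W : Type*}

theorem E.fil {s t : F ⊕ L → V} (hl : ∀ a, s (Sum.inl a) = t (Sum.inl a)) {w w' : List (F ⊕ L)} (h : E s t w w') :
    E (fun l => s (Sum.inr l)) (fun l => t (Sum.inr l)) (QR.fil w) (QR.fil w') := by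
  induction h with
  | refl l => exact E.refl _
  | trans _ _ h1 h2 => exact h1.trans h2
  | rot X Y h => 
    rw [fil_append, fil_append]
    apply E.rot
    obtain ⟨u, hu⟩ := h
    rw [← fil_append]
    exact ⟨u, fil_walk hu (fun a _ => hl a)⟩
  | swap v X Y Z hX hY hZ => 
    simp only [fil_append]
    exact E.swap v _ _ _ (fil_walk hX (fun a _ => hl a)) (fil_walk hY (fun a _ => hl a)) (fil_walk hZ (fun a _ => hl a))

/-- arrow pairs of flagged letters -/
def pr (s t : F ⊕ L → V) (fs : List F) : List (V × V) := fs.map (fun a => (s (Sum.inl a), t (Sum.inl a)))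

theorem surj (s t : F ⊕ L → V) (M : V → W) (hM : ∀ a, M (s (Sum.inl a)) = M (t (Sum.inl a))) (fs : List F) : 
    ∀ τ : List (F ⊕ L), Cl (fun b => mg (pr s t fs) (s b)) (fun b => mg (pr s t fs) (t b)) τ → 
    Bal s t (fs.map Sum.inl ++ τ) → (∀ a ∈ fs, ∃ b ∈ τ, mg (pr s t fs) (s b) = mg (pr s t fs) (s (Sum.inl a))) →
    ∃ w, Cl s t w ∧ w.Perm (fs.map Sum.inl ++ τ) ∧ 
      E (fun l => M (s (Sum.inr l))) (fun l => M (t (Sum.inr l))) (QR.fil w) (QR.fil τ) := by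
  induction fs with
  | nil => 
    intro τ hc hb _
    exact ⟨τ, hc, by simp, E.refl _⟩
  | cons f fs ih =>
    intro τ hc hb hto
    obtain ⟨m, hm⟩ : ∃ m, m = mg (pr s t fs) := ⟨_, rfl⟩
    obtain ⟨k, hk⟩ : ∃ k : V → V, k = fun u => if u = m (s (Sum.inl f)) then m (t (Sum.inl f)) else u := ⟨_, rfl⟩
    have hmg : ∀ v, mg (pr s t (f :: fs)) v = k (m v) := by
      intro v; rw [hk, hm]; rfl
    have hkx : k (m (s (Sum.inl f))) = m (t (Sum.inl f)) := by rw [hk]; simp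
    have hky : k (m (t (Sum.inl f))) = m (t (Sum.inl f)) := by
      rw [hk]; dsimp only; split_ifs <;> rfl
    have hkn : ∀ u, u ≠ m (s (Sum.inl f)) → k u = u := by
      intro u hu; rw [hk]; dsimp only; rw [if_neg hu]
    simp only [hmg] at hc hto
    have hloop : ∀ b ∈ fs.map (Sum.inl : F → F ⊕ L), m (s b) = m (t b) := by
      intro b hb
      obtain ⟨a, ha, rfl⟩ := List.mem_map.1 hb
      rw [hm]
      exact mg_mem (f := (s (Sum.inl a), t (Sum.inl a))) (List.mem_map.2 ⟨a, ha, rfl⟩)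
    have hb1 : Bal (fun b => m (s b)) (fun b => m (t b)) (Sum.inl f :: τ) := by
      have h1 := (hb.of_perm (l' := fs.map Sum.inl ++ (Sum.inl f :: τ)) List.perm_middle.symm).comp m
      exact h1.cancel (bal_loops hloop)
    obtain ⟨w1, τ', a1, a2, a3, a4⟩ := step (s := fun b => m (s b)) (t := fun b => m (t b)) k (Sum.inl f) 
      (by rw [hkx, hky]) (by
        intro p q hpq
        rw [hkx]
        by_cases hp : p = m (s (Sum.inl f))
        · right; rw [hp, hkx]
        by_cases hq : q = m (s (Sum.inl f))
        · right; rw [hpq, hq, hkx]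
        left; rw [← hkn p hp, hpq, hkn q hq]) (by
        intro p hp
        rw [hkx] at hp
        by_cases hpx : p = m (s (Sum.inl f))
        · exact Or.inl hpx
        · right; rw [← hkn p hpx, hp]) hc hb1 (hto f (by simp))
    have hfw : (Sum.inl f : F ⊕ L) ∈ w1 := a2.mem_iff.2 (by simp)
    have hpw : (fs.map Sum.inl ++ w1).Perm ((f :: fs).map Sum.inl ++ τ) := 
      (List.Perm.append_left _ a2).trans List.perm_middle
    obtain ⟨w, b1, b2, b3⟩ := ih w1 (by rw [← hm]; exact a1) (hb.of_perm hpw.symm) (by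
      intro a ha
      rw [← hm]
      obtain ⟨b, hb, hba⟩ := hto a (by simp [ha])
      by_cases hax : m (s (Sum.inl a)) = m (s (Sum.inl f))
      · exact ⟨_, hfw, hax.symm⟩
      by_cases hay : m (s (Sum.inl a)) = m (t (Sum.inl f))
      · obtain ⟨c, hc1, hc2⟩ := tgt_src a1 hfw
        exact ⟨c, hc1, hc2.trans hay.symm⟩
      refine ⟨b, a2.mem_iff.2 (by simp [hb]), ?_⟩
      rw [hkn _ hax] at hba
      by_cases hbx : m (s b) = m (s (Sum.inl f))
      · rw [hbx, hkx] at hba; exact absurd hba.symm hay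
      · rwa [hkn _ hbx] at hba)
    refine ⟨w, b1, b2.trans hpw, b3.trans ?_⟩
    have hMm : ∀ v, M (k (m v)) = M v := by
      intro v
      rw [← hmg]
      apply mg_min
      intro g hg
      obtain ⟨a, ha, rfl⟩ := List.mem_map.1 hg
      exact hM a
    have e1 := a4.comp M
    simp only [hMm] at e1
    have e2 := e1.fil hM
    rw [fil_inl] at e2
    refine e2.trans (E.symm ?_)
    have hcM : Cl (fun b => M (s b)) (fun b => M (t b)) τ := by
      have := hc.comp M
      simp only [hMm] at this; exact this
    exact (E.rotated hcM a3).fil hM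

/-- the touched part -/
theorem touched (s t : F ⊕ L → V) (fs : List F) {τ : List (F ⊕ L)} (hτ : τ ≠ [])
    (hc : Cl (fun b => mg (pr s t fs) (s b)) (fun b => mg (pr s t fs) (t b)) τ)
    (hb : Bal s t (fs.map Sum.inl ++ τ)) : 
    ∃ P : F → Prop, 
      Cl (fun b => mg (pr s t (fs.filter (fun a => P a))) (s b)) (fun b => mg (pr s t (fs.filter (fun a => P a))) (t b)) τ ∧
      Bal s t ((fs.filter (fun a => P a)).map Sum.inl ++ τ) ∧ 
      (∀ a ∈ fs.filter (fun a => P a), ∃ b ∈ τ, mg (pr s t (fs.filter (fun a => P a))) (s b) = mg (pr s t (fs.filter (fun a => P a))) (s (Sum.inl a))) := by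
  obtain ⟨tv, htv⟩ : ∃ tv : V → Prop, tv = fun v => ∃ b ∈ τ, mg (pr s t fs) (s b) = mg (pr s t fs) v := ⟨_, rfl⟩
  have hfst : ∀ a ∈ fs, mg (pr s t fs) (s (Sum.inl a)) = mg (pr s t fs) (t (Sum.inl a)) := by
    intro a ha
    exact mg_mem (f := (s (Sum.inl a), t (Sum.inl a))) (List.mem_map.2 ⟨a, ha, rfl⟩)
  have htst : ∀ a ∈ fs, (tv (s (Sum.inl a)) ↔ tv (t (Sum.inl a))) := by
    intro a ha; rw [htv]; simp only [hfst a ha]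
  have hs : ∀ b ∈ τ, tv (s b) := by
    intro b hb; rw [htv]; exact ⟨b, hb, rfl⟩
  have ht : ∀ b ∈ τ, tv (t b) := by
    intro b hb; rw [htv]; exact tgt_src hc hb
  obtain ⟨T, hT⟩ : ∃ T, T = fs.filter (fun a => tv (s (Sum.inl a))) := ⟨_, rfl⟩
  refine ⟨fun a => tv (s (Sum.inl a)), ?_⟩
  rw [← hT]
  obtain ⟨v0, hv0⟩ : ∃ v0 : V, True := by
    obtain ⟨b, hb⟩ := List.exists_mem_of_ne_nil τ hτ
    exact ⟨s b, trivial⟩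
  obtain ⟨m, hm⟩ : ∃ m : V → V, m = fun v => if tv v then mg (pr s t T) v else v0 := ⟨_, rfl⟩
  have hmt : ∀ v, tv v → m v = mg (pr s t T) v := by
    intro v hv; rw [hm]; dsimp only; rw [if_pos hv]
  have hmf : ∀ f ∈ pr s t fs, m f.1 = m f.2 := by
    intro f hf
    obtain ⟨a, ha, rfl⟩ := List.mem_map.1 hf
    by_cases h : tv (s (Sum.inl a))
    · dsimp only
      rw [hmt _ h, hmt _ ((htst a ha).1 h)]
      exact mg_mem (f := (s (Sum.inl a), t (Sum.inl a))) (List.mem_map.2 ⟨a, by rw [hT, List.mem_filter]; exact ⟨ha, by simpa using h⟩, rfl⟩)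
    · have h' := fun h' => h ((htst a ha).2 h')
      rw [hm]; dsimp only; rw [if_neg h, if_neg h']
  refine ⟨?_, ?_, ?_⟩
  · obtain ⟨u, hu⟩ := hc
    have := walk_comp m hu
    refine ⟨m u, walk_congr ?_ ?_ this⟩
    · intro b hb
      rw [mg_min m hmf, hmt _ (hs b hb)]
    · intro b hb
      rw [mg_min m hmf, hmt _ (ht b hb)]
  · have h1 := List.Perm.filter (fun v => decide (tv v)) hb
    rw [List.filter_map, List.filter_map] at h1
    have e1 : (fs.map Sum.inl ++ τ).filter ((fun v => decide (tv v)) ∘ s) = T.map Sum.inl ++ τ := by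
      rw [List.filter_append, List.filter_map, hT, List.filter_eq_self (l := τ) |>.2 (fun b hb => by simpa using hs b hb)]
      rfl
    have e2 : (fs.map Sum.inl ++ τ).filter ((fun v => decide (tv v)) ∘ t) = T.map Sum.inl ++ τ := by
      rw [List.filter_append, List.filter_map, hT, List.filter_eq_self (l := τ) |>.2 (fun b hb => by simpa using ht b hb)]
      congr 2
      apply List.filter_congr
      intro a ha
      simp only [Function.comp, htst a ha]
    rw [e1, e2] at h1
    exact h1
  · intro a ha
    rw [hT, List.mem_filter] at ha
    have ha2 : tv (s (Sum.inl a)) := by simpa using ha.2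
    have ha3 := ha2
    rw [htv] at ha3
    obtain ⟨b, hb, hba⟩ := ha3
    refine ⟨b, hb, ?_⟩
    rw [← hmt _ (hs b hb), ← hmt _ ha2]
    exact mg_le m hmf hba

end surj
end QR

set_option linter.all false

namespace QR
section sq
variable {F L : Type} [Fintype F] [Fintype L] {V W : Type*}

theorem fil_map_inr (τ : List L) : fil (τ.map (Sum.inr : L → F ⊕ L)) = τ := by
  induction τ with
  | nil => rfl
  | cons a τ ih => rw [List.map_cons, fil_inr, ih]

theorem exists_square (s t : F ⊕ L → V) (M : V → W) (hM : ∀ a, M (s (Sum.inl a)) = M (t (Sum.inl a))) 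
    {w0 : List (F ⊕ L)} (h0 : Cl s t w0) {τ : List L} (hτ : τ ≠ []) {γ fs : List F} (hγ : γ ≠ [])
    (hp : w0.Perm ((γ ++ γ).map Sum.inl ++ ((fs ++ fs).map Sum.inl ++ τ.map Sum.inr))) 
    (hb : Bal s t (γ.map Sum.inl))
    (hc : Cl (fun l => mg (pr s t (fs ++ fs)) (s (Sum.inr l))) (fun l => mg (pr s t (fs ++ fs)) (t (Sum.inr l))) τ) : 
    ∃ C R v, C ≠ [] ∧ Walk s t v v C ∧ Walk s t v v R ∧ (C ++ C ++ R).Perm w0 ∧ 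
      E (fun l => M (s (Sum.inr l))) (fun l => M (t (Sum.inr l))) (fil (C ++ C ++ R)) τ := by
  have hc' : Cl (fun l => mg (pr s t (fs ++ fs)) (s l)) (fun l => mg (pr s t (fs ++ fs)) (t l)) (τ.map Sum.inr) := by
    obtain ⟨u, hu⟩ := hc
    exact ⟨u, walk_map _ |>.2 hu⟩
  have hb0 : Bal s t ((fs ++ fs).map Sum.inl ++ τ.map Sum.inr) := by
    refine (h0.bal.of_perm hp).cancel ?_
    rw [List.map_append]; exact hb.append hb
  obtain ⟨P, c1, c2, c3⟩ := touched s t (fs ++ fs) (by simpa using hτ) hc' hb0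
  obtain ⟨w, w1, w2, w3⟩ := surj s t M hM _ _ c1 c2 c3
  rw [fil_map_inr] at w3
  obtain ⟨g, hg⟩ : ∃ g : List (F ⊕ L), g = (γ ++ fs.filter (fun a => ¬ P a)).map Sum.inl := ⟨_, rfl⟩
  have hpw : w0.Perm (w ++ (g ++ g)) := by
    refine hp.trans (List.Perm.trans ?_ (w2.symm.append_right _))
    have hf : ((fs.filter (fun a => P a)) ++ (fs.filter (fun a => ¬ P a))).Perm fs := by
      have := List.filter_append_perm (fun a => decide (P a)) fs
      simpa using this
    have hf' := (hf.map (Sum.inl : F → F ⊕ L)).symm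
    rw [← Multiset.coe_eq_coe] at hf' ⊢
    rw [hg]
    simp only [List.filter_append, List.map_append, ← Multiset.coe_add] at hf' ⊢
    rw [hf']
    abel
  have hbg : Bal s t g := by
    apply bal_double
    exact (h0.bal.of_perm hpw).cancel w1.bal
  obtain ⟨C, R, v, e1, e2, e3, e4, e5⟩ := insert_double _ w0 w g rfl h0 w1 (by rw [hg]; simp [hγ]) hbg (by
    intro x hx; rw [hg] at hx; obtain ⟨a, _, rfl⟩ := List.mem_map.1 hx; rfl) hpw
  refine ⟨C, R, v, e1, e2, e3, e4, E.trans (E.symm (E.rotated ?_ e5)) w3⟩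
  obtain ⟨u, hu⟩ := w1.comp M
  exact ⟨u, fil_walk hu (fun a _ => hM a)⟩

end sq
end QR

set_option linter.all false

namespace QR
section weyl
variable {K : Type} [Field K] {Q : QuiverData} {Λ : Type} [Fintype Λ]

/-- diagonal matrix units -/
def Ed (K : Type) [Field K] (Λ : Type) (x : Λ × Fin 2) : Matrix (Fin 2) (Fin 2) K := Matrix.diagonal (fun i => if i = x.2 then 1 else 0)

def wσ (Λ : Type) : Λ × Fin 2 ≃ Λ × Fin 2 := Equiv.prodCongr (Equiv.refl Λ) (Equiv.swap 0 1)

theorem theta_X {Λ : Type} [Fintype Λ] (arr : Λ → Q.A) (Y : Λ → Matrix (Fin 2) (Fin 2) K) (a : Q.A) (i j : Fin 2) :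
    theta arr Y (MvPolynomial.X (σ := Q.Var) (R := K) (a, i, j)) =
      ∑ l : Λ, if arr l = a then MvPolynomial.C (Y l i j) * MvPolynomial.X l else 0 := MvPolynomial.aeval_X _ _

theorem theta_equiv {Λ : Type} [Fintype Λ] (arr : Λ → Q.A) (e : Λ ≃ Λ) (he : ∀ l, arr (e l) = arr l) (Y : Λ → Matrix (Fin 2) (Fin 2) K) (p : MvPolynomial Q.Var K) : 
    MvPolynomial.rename e (theta arr (fun l => Y (e l)) p) = theta arr Y p := by
  have : ((MvPolynomial.rename e).comp (theta arr (fun l => Y (e l)))) = theta (K := K) arr Y := by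
    apply MvPolynomial.algHom_ext
    rintro ⟨a, i, j⟩
    rw [AlgHom.comp_apply]
    refine Eq.trans (congrArg _ (theta_X arr _ a i j)) (Eq.trans ?_ (theta_X arr Y a i j).symm)
    rw [map_sum]
    refine Eq.trans ?_ (Equiv.sum_comp e _)
    apply Finset.sum_congr rfl
    intro l _
    rw [he]
    split_ifs
    · simp
    · simp
  rw [← this]; rfl

theorem cf_weyl (arr : Λ → Q.A) {p : MvPolynomial Q.Var K} (hp : Q.IsInvariant K p) (m : Λ × Fin 2 →₀ ℕ) : 
    cf (fun x : Λ × Fin 2 => arr x.1) (Ed K Λ) (m.mapDomain (wσ Λ)) p = cf (fun x : Λ × Fin 2 => arr x.1) (Ed K Λ) m p := by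
  have hg : IsUnit (!![0, 1; 1, 0] : Matrix (Fin 2) (Fin 2) K).det := by simp [Matrix.det_fin_two]
  have hinv : (!![0, 1; 1, 0] : Matrix (Fin 2) (Fin 2) K)⁻¹ = !![0, 1; 1, 0] := by
    apply Matrix.inv_eq_right_inv
    ext i j; fin_cases i <;> fin_cases j <;> simp [Matrix.mul_apply]
  have h1 := cf_inv (fun x : Λ × Fin 2 => arr x.1) hp (fun _ => !![0, 1; 1, 0]) (fun _ => hg) (Ed K Λ) m
  have h2 : (fun l : Λ × Fin 2 => (!![0, 1; 1, 0] : Matrix (Fin 2) (Fin 2) K) * Ed K Λ l * (!![0, 1; 1, 0])⁻¹) = fun l => Ed K Λ (wσ Λ l) := by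
    funext ⟨l, k⟩
    rw [hinv]
    have h0 : Ed K Λ (l, 0) = !![1, 0; 0, 0] := by
      ext i j; fin_cases i <;> fin_cases j <;> simp [Ed, Matrix.diagonal]
    have h1 : Ed K Λ (l, 1) = !![0, 0; 0, 1] := by
      ext i j; fin_cases i <;> fin_cases j <;> simp [Ed, Matrix.diagonal]
    have hk0 : wσ Λ (l, 0) = (l, 1) := by simp [wσ]
    have hk1 : wσ Λ (l, 1) = (l, 0) := by simp [wσ]
    fin_cases k
    · show _ * Ed K Λ (l, 0) * _ = Ed K Λ (wσ Λ (l, 0))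
      rw [hk0, h0, h1]; ext i j; fin_cases i <;> fin_cases j <;> simp
    · show _ * Ed K Λ (l, 1) * _ = Ed K Λ (wσ Λ (l, 1))
      rw [hk1, h0, h1]; ext i j; fin_cases i <;> fin_cases j <;> simp
  rw [h2] at h1
  rw [← h1]
  unfold cf
  rw [← theta_equiv (fun x : Λ × Fin 2 => arr x.1) (wσ Λ) (fun l => rfl) (Ed K Λ) p, MvPolynomial.coeff_rename_mapDomain _ (wσ Λ).injective]

theorem theta_fst (arr : Λ → Q.A) (p : MvPolynomial Q.Var K) : 
    MvPolynomial.rename Prod.fst (theta (fun x : Λ × Fin 2 => arr x.1) (Ed K Λ) p) = theta arr (fun _ => 1) p := by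
  have : ((MvPolynomial.rename Prod.fst).comp (theta (fun x : Λ × Fin 2 => arr x.1) (Ed K Λ))) = theta (K := K) arr (fun _ => 1) := by
    apply MvPolynomial.algHom_ext
    rintro ⟨a, i, j⟩
    rw [AlgHom.comp_apply]
    refine Eq.trans (congrArg _ (theta_X _ _ a i j)) (Eq.trans ?_ (theta_X arr _ a i j).symm)
    rw [map_sum, Fintype.sum_prod_type]
    apply Finset.sum_congr rfl
    intro l _
    rw [Fin.sum_univ_two]
    dsimp only
    split_ifs
    · fin_cases i <;> fin_cases j <;> simp [Ed, Matrix.diagonal]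
    · simp
  rw [← this]; rfl

theorem wσ_invol (m : Λ × Fin 2 →₀ ℕ) : (m.mapDomain (wσ Λ)).mapDomain (wσ Λ) = m := by
  rw [← Finsupp.mapDomain_comp]
  have : (wσ Λ ∘ wσ Λ) = id := by
    funext ⟨l, k⟩; simp [wσ]
  rw [this, Finsupp.mapDomain_id]

theorem wσ_fst (m : Λ × Fin 2 →₀ ℕ) : (m.mapDomain (wσ Λ)).mapDomain Prod.fst = m.mapDomain Prod.fst := by
  rw [← Finsupp.mapDomain_comp]; rfl

theorem wσ_fix {m : Λ × Fin 2 →₀ ℕ} (h : m.mapDomain (wσ Λ) = m) (l : Λ) : m (l, 0) = m (l, 1) := by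
  have := Finsupp.mapDomain_apply (wσ Λ).injective m (l, 0)
  rw [h] at this
  rw [← this]; rfl

theorem mapDomain_fst (m : Λ × Fin 2 →₀ ℕ) (l : Λ) : m.mapDomain Prod.fst l = m (l, 0) + m (l, 1) := by
  rw [Finsupp.mapDomain, Finsupp.sum_fintype _ _ (by simp), Finsupp.finset_sum_apply, Fintype.sum_prod_type, Finset.sum_eq_single l]
  · simp [Fin.sum_univ_two]
  · intro b _ hb; simp [hb]
  · simp

theorem cf_even (h2 : (2 : K) = 0) (arr : Λ → Q.A) {p : MvPolynomial Q.Var K} (hp : Q.IsInvariant K p) (m : Λ →₀ ℕ) 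
    (hc : cf arr (fun _ => 1) m p ≠ 0) (l : Λ) : Even (m l) := by
  by_contra hodd
  apply hc
  obtain ⟨P, hP⟩ : ∃ P, P = theta (fun x : Λ × Fin 2 => arr x.1) (Ed K Λ) p := ⟨_, rfl⟩
  have hw : ∀ m, MvPolynomial.coeff (m.mapDomain (wσ Λ)) P = MvPolynomial.coeff m P := by
    intro m; rw [hP]; exact cf_weyl arr hp m
  unfold cf
  rw [← theta_fst, ← hP, MvPolynomial.as_sum P, map_sum, MvPolynomial.coeff_sum]
  simp only [MvPolynomial.rename_monomial, MvPolynomial.coeff_monomial]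
  apply Finset.sum_involution (fun m _ => m.mapDomain (wσ Λ))
  · intro m' _
    rw [wσ_fst, hw]
    split_ifs
    · linear_combination (MvPolynomial.coeff m' P) * h2
    · simp
  · intro m' _ hne heq
    apply hodd
    have hm : m'.mapDomain Prod.fst = m := by
      by_contra h; rw [if_neg h] at hne; exact hne rfl
    rw [← hm, mapDomain_fst, wσ_fix heq]
    exact ⟨_, rfl⟩
  · intro m' _; exact wσ_invol m'
  · intro m' hm'
    rw [MvPolynomial.mem_support_iff, hw]
    exact MvPolynomial.mem_support_iff.1 hm'

end weyl
end QR

set_option linter.all false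

namespace QR
section contx
variable {Λ : Type} [Fintype Λ]

theorem cont_append (a b : List Λ) : cont (a ++ b) = cont a + cont b := by
  unfold cont; rw [← Multiset.coe_add, map_add]

theorem perm_of_cont {a b : List Λ} (h : cont a = cont b) : a.Perm b := by
  unfold cont at h
  exact Multiset.coe_eq_coe.1 (Multiset.toFinsupp.injective h)

theorem cont_perm {a b : List Λ} (h : a.Perm b) : cont a = cont b := by
  unfold cont; rw [Multiset.coe_eq_coe.2 h]

theorem cont_cons' (x y : Λ) (w : List Λ) : cont (x :: w) y = (if x = y then 1 else 0) + cont w y := by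
  rw [cont_cons, Finsupp.add_apply, Finsupp.single_apply]

theorem cont_map_inj {Λ' : Type} [Fintype Λ'] {f : Λ → Λ'} (hf : Function.Injective f) (w : List Λ) (x : Λ) : cont (w.map f) (f x) = cont w x := by
  induction w with
  | nil => simp [cont_nil]
  | cons y w ih => rw [List.map_cons, cont_cons', cont_cons', ih]; simp [hf.eq_iff]

theorem cont_map_ne {Λ' : Type} [Fintype Λ'] {f : Λ → Λ'} (w : List Λ) {x : Λ'} (hx : ∀ y, f y ≠ x) : cont (w.map f) x = 0 := by
  induction w with
  | nil => simp [cont_nil]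
  | cons y w ih => rw [List.map_cons, cont_cons', ih, if_neg (hx y)]

theorem exists_cont (m : Λ →₀ ℕ) : ∃ w : List Λ, cont w = m := by
  refine ⟨(Finsupp.toMultiset m).toList, ?_⟩
  unfold cont; simp

theorem count_map_cont {V : Type} (s : Λ → V) (w : List Λ) (v : V) : 
    (w.map s).count v = ∑ l, if s l = v then cont w l else 0 := by
  induction w with
  | nil => simp [cont_nil]
  | cons y w ih =>
    rw [List.map_cons, List.count_cons, ih]
    have : ∀ l, (if s l = v then cont (y :: w) l else 0) = (if s l = v then cont w l else 0) + (if l = y then (if s y = v then 1 else 0) else 0) := by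
      intro l
      rw [cont_cons']
      by_cases h : y = l
      · subst h; by_cases h2 : s y = v <;> simp [h2, add_comm]
      · by_cases h2 : s l = v <;> simp [h2, h, Ne.symm h]
    simp only [this, Finset.sum_add_distrib, Finset.sum_ite_eq', Finset.mem_univ, if_true]
    simp

theorem bal_of_cf {K : Type} [Field K] {Q : QuiverData} [Infinite K] (arr : Λ → Q.A) {p : MvPolynomial Q.Var K} (hp : p ∈ Q.PlusSet K) 
    (m : Λ →₀ ℕ) (Y : Λ → Matrix (Fin 2) (Fin 2) K) (hc : cf arr Y m p ≠ 0) (w : List Λ) (hw : ∀ l, m l = 2 * cont w l) :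
    Bal (fun x => Q.src (arr x)) (fun x => Q.tgt (arr x)) w := by
  unfold Bal
  rw [List.perm_iff_count]
  intro v
  rw [count_map_cont, count_map_cont]
  have := cf_balanced arr hp m Y hc v
  simp only [hw] at this
  have e : ∀ f : Λ → Q.V, (∑ l, if f l = v then 2 * cont w l else 0) = 2 * ∑ l, if f l = v then cont w l else 0 := by
    intro f
    rw [Finset.mul_sum]; apply Finset.sum_congr rfl; intro l _; split_ifs <;> simp
  rw [e (fun l => Q.src (arr l)), e (fun l => Q.tgt (arr l))] at this
  omega

end contx

section even
variable {K : Type} [Field K] {Q : QuiverData} {φ δ : List Q.A → K}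

/-- even part of the multiplicities -/
noncomputable def kev (α : Multiset Q.A) (a : Q.A) : ℕ := 2 * (α.count a / 2)

theorem kev_le (α : Multiset Q.A) (a : Q.A) : kev α a ≤ α.count a := by unfold kev; omega

noncomputable def sE (α : Multiset Q.A) : FT α (kev α) ⊕ LT α (kev α) → Q.V := fun x => Q.src (arrS α (kev α) x)
noncomputable def tE (α : Multiset Q.A) : FT α (kev α) ⊕ LT α (kev α) → Q.V := fun x => Q.tgt (arrS α (kev α) x)

noncomputable def ME (α : Multiset Q.A) : Q.V → Q.V := mg (pr (sE α) (tE α) (Finset.univ : Finset (FT α (kev α))).toList)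

theorem ME_loop (α : Multiset Q.A) (a : FT α (kev α)) : ME α (sE α (Sum.inl a)) = ME α (tE α (Sum.inl a)) := by
  unfold ME
  refine mg_mem (f := (sE α (Sum.inl a), tE α (Sum.inl a))) ?_
  unfold pr
  exact List.mem_map.2 ⟨a, by simp, rfl⟩

theorem FT_kev (α : Multiset Q.A) (a : FT α (kev α)) : 2 ≤ kev α a.1 := by
  have := (Finset.mem_filter.1 a.2).2
  unfold kev at *; omega

theorem WD (H : PD Q K φ δ) (h2 : (2 : K) = 0) {α : Multiset Q.A} {w w' : List (FT α (kev α) ⊕ LT α (kev α))}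
    (hw : cont w = m0S α (kev α)) (hw' : cont w' = m0S α (kev α)) (hc : Cl (sE α) (tE α) w) (hc' : Cl (sE α) (tE α) w')
    (hE : E (fun l => ME α (sE α (Sum.inr l))) (fun l => ME α (tE α (Sum.inr l))) (fil w) (fil w')) :
    φ (w.map (arrS α (kev α))) = φ (w'.map (arrS α (kev α))) := by
  have := E_of_fil (sE α) (tE α) (m0S α (kev α)) (fun l => rfl) _ (by
    intro f hf
    unfold pr at hf
    obtain ⟨a, _, rfl⟩ := List.mem_map.1 hf
    exact ⟨a, FT_kev α a, rfl⟩) (ME_loop α) hw hw' hc hc' hE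
  exact H.E h2 (this.map (f := arrS α (kev α)) (fun _ => rfl) (fun _ => rfl))

def Pg (α : Multiset Q.A) (τ : List (LT α (kev α))) (w : List (FT α (kev α) ⊕ LT α (kev α))) : Prop :=
  cont w = m0S α (kev α) ∧ Cl (sE α) (tE α) w ∧ E (fun l => ME α (sE α (Sum.inr l))) (fun l => ME α (tE α (Sum.inr l))) (fil w) τ

noncomputable def psi (φ : List Q.A → K) (α : Multiset Q.A) (τ : List (LT α (kev α))) : K :=
  if h : ∃ w, Pg α τ w then φ (h.choose.map (arrS α (kev α))) else 0

theorem psi_eq (H : PD Q K φ δ) (h2 : (2 : K) = 0) {α : Multiset Q.A} {τ : List (LT α (kev α))} {w} (hw : Pg α τ w) :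
    psi φ α τ = φ (w.map (arrS α (kev α))) := by
  have h : ∃ w, Pg α τ w := ⟨w, hw⟩
  unfold psi
  rw [dif_pos h]
  have hs := h.choose_spec
  exact WD H h2 hs.1 hw.1 hs.2.1 hw.2.1 (hs.2.2.trans hw.2.2.symm)

theorem psi_E (H : PD Q K φ δ) (h2 : (2 : K) = 0) {α : Multiset Q.A} {τ τ' : List (LT α (kev α))} 
    (hE : E (fun l => ME α (sE α (Sum.inr l))) (fun l => ME α (tE α (Sum.inr l))) τ τ') : psi φ α τ = psi φ α τ' := by
  have : Pg α τ = Pg α τ' := by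
    funext w
    apply propext
    exact ⟨fun h => ⟨h.1, h.2.1, h.2.2.trans hE⟩, fun h => ⟨h.1, h.2.1, h.2.2.trans hE.symm⟩⟩
  unfold psi
  rw [this]

theorem phi_sq (H : PD Q K φ δ) (h2 : (2 : K) = 0) {v} {C R : List Q.A} (hC : C ≠ []) (h1 : Walk Q.src Q.tgt v v C) (hR : Walk Q.src Q.tgt v v R) :
    φ (C ++ C ++ R) = 0 := by
  by_cases hR0 : R = []
  · subst hR0
    rw [List.append_nil, H.sq v C hC h1, h2]; simp
  · exact H.sqm v C R hC hR0 h1 hR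

theorem odd_alpha [Infinite K] (H : PD Q K φ δ) (h2 : (2 : K) = 0) (α : Multiset Q.A) (hα : ∃ b, ¬ Even (α.count b)) :
    ∃ ℓ : MvPolynomial Q.Var K →ₗ[K] K, (∀ p ∈ Q.PlusSet K, ∀ q ∈ Q.PlusSet K, ℓ (p * q) = 0) ∧
    (∀ h : List Q.A, h ≠ [] → Cl Q.src Q.tgt h → ℓ (Q.pathTr K h) = if (h : Multiset Q.A) = α then φ h else 0) ∧
    (∀ h : List Q.A, h ≠ [] → Cl Q.src Q.tgt h → ℓ (Q.pathDet K h) = if 2 • (h : Multiset Q.A) = α then δ h else 0) := by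
  have hne : Nonempty (LT α (kev α)) := by
    obtain ⟨b, hb⟩ := hα
    have hb1 : α.count b % 2 = 1 := Nat.odd_iff.1 (Nat.not_even_iff_odd.1 hb)
    refine ⟨⟨⟨b, Multiset.mem_toFinset.2 (Multiset.count_pos.1 (by omega))⟩, ⟨0, ?_⟩⟩⟩
    unfold kev; dsimp only; omega
  obtain ⟨ℓ, l1, l2, l3, l4⟩ := ell_split (K := K) (kev_le α) (ME α) (by
      intro a ha hk
      exact ME_loop α ⟨a, Finset.mem_filter.2 ⟨Multiset.mem_toFinset.2 ha, hk⟩⟩) (psi φ α)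
    (by
      intro w w' hw hr
      exact psi_E H h2 (E.rotated hw.2.2.2 hr))
    (by
      intro z A B C _ _ _ hA hB hC _
      have : psi φ α (A ++ B ++ C) = psi φ α (A ++ C ++ B) := psi_E H h2 (E.swap z A B C hA hB hC)
      rw [this]
      linear_combination (psi φ α (A ++ C ++ B)) * h2)
    (by
      intro p hp m1 m2 hm hm1 hm1r hcf
      have hev := cf_even h2 (arrS α (kev α)) hp.1 m1 hcf
      obtain ⟨γ, hγ⟩ := exists_cont (Finsupp.equivFunOnFinite.symm (fun a : FT α (kev α) => m1 (Sum.inl a) / 2))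
      obtain ⟨fs, hfs⟩ := exists_cont (Finsupp.equivFunOnFinite.symm (fun a : FT α (kev α) => m2 (Sum.inl a) / 2))
      have hγ1 : ∀ a, m1 (Sum.inl a) = 2 * cont γ a := by
        intro a
        rw [hγ]
        obtain ⟨k, hk⟩ := hev (Sum.inl a)
        show _ = 2 * (m1 (Sum.inl a) / 2)
        omega
      have hfs1 : ∀ a, m2 (Sum.inl a) = 2 * cont fs a := by
        intro a
        rw [hfs]
        obtain ⟨k, hk⟩ := hev (Sum.inl a)
        have h3 : m1 (Sum.inl a) + m2 (Sum.inl a) = kev α a.1 := by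
          exact (DFunLike.congr_fun hm (Sum.inl a) : _)
        have key : ∀ x y c k : ℕ, x + y = 2 * c → x = k + k → y = 2 * (y / 2) := by intros; omega
        exact key _ _ _ _ h3 hk
      refine ⟨Q.V, mg (pr (sE α) (tE α) (fs ++ fs)), ?_, ?_, ?_⟩
      · intro a ha
        refine mg_mem (f := (sE α (Sum.inl a), tE α (Sum.inl a))) ?_
        unfold pr
        refine List.mem_map.2 ⟨a, ?_, rfl⟩
        rw [hfs1] at ha
        have : a ∈ fs := mem_of_cont.1 (by omega)
        simp [this]
      · intro u v huv
        refine mg_le (ME α) ?_ huv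
        intro f hf
        unfold pr at hf
        obtain ⟨a, _, rfl⟩ := List.mem_map.1 hf
        exact ME_loop α a
      · intro τ hτ
        by_cases hex : ∃ w, Pg α τ w
        swap
        · unfold psi; rw [dif_neg hex]
        obtain ⟨w0, hw0⟩ := hex
        have hτc : ∀ l, cont τ l = 1 := by
          intro l
          rw [cont_apply]
          have := List.count_eq_one_of_mem hτ.1 (hτ.2.1 l)
          convert this
        have hperm : w0.Perm ((γ ++ γ).map Sum.inl ++ ((fs ++ fs).map Sum.inl ++ τ.map Sum.inr)) := by
          apply perm_of_cont
          rw [hw0.1]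
          ext x
          rcases x with a | l
          · rw [cont_append, cont_append, Finsupp.add_apply, Finsupp.add_apply, cont_map_inj Sum.inl_injective, cont_map_inj Sum.inl_injective, cont_map_ne _ (by simp),
              cont_append, cont_append, Finsupp.add_apply, Finsupp.add_apply, ← hm, Finsupp.add_apply, hγ1, hfs1]
            omega
          · rw [cont_append, cont_append, Finsupp.add_apply, Finsupp.add_apply, cont_map_inj Sum.inr_injective, cont_map_ne _ (by simp), cont_map_ne _ (by simp), hτc, m0S_inr, zero_add, zero_add]
        have hγ0 : γ ≠ [] := by
          rintro rfl
          apply hm1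
          ext x
          rcases x with a | l
          · rw [hγ1]; simp [cont_nil]
          · rw [hm1r]; rfl
        have hbal : Bal (sE α) (tE α) (γ.map Sum.inl) := by
          refine bal_of_cf (arrS α (kev α)) hp m1 _ hcf (γ.map Sum.inl) ?_
          intro x
          rcases x with a | l
          · rw [cont_map_inj Sum.inl_injective, hγ1]
          · rw [cont_map_ne _ (by simp), hm1r]
        obtain ⟨C, R, v, c1, c2, c3, c4, c5⟩ := exists_square (sE α) (tE α) (ME α) (ME_loop α) hw0.2.1 hτ.2.2.1 hγ0 hperm hbal hτ.2.2.2
        have hg : Pg α τ (C ++ C ++ R) := ⟨(cont_perm c4).trans hw0.1, ⟨v, walk_append.2 ⟨v, walk_append.2 ⟨v, c2, c2⟩, c3⟩⟩, c5⟩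
        rw [psi_eq H h2 hg, List.map_append, List.map_append]
        exact phi_sq H h2 (by simpa using c1) (walk_map _ |>.2 c2) (walk_map _ |>.2 c3))
  have hdet : ∀ h : List Q.A, 2 • (h : Multiset Q.A) ≠ α := by
    rintro h rfl
    obtain ⟨b, hb⟩ := hα
    apply hb
    rw [Multiset.count_nsmul]; exact even_two_mul _
  refine ⟨ℓ, l1, ?_, ?_⟩
  · intro h hn hc
    by_cases hh : (h : Multiset Q.A) = α
    · rw [if_pos hh]
      obtain ⟨N, hN, hN'⟩ := l3 h hc hh (φ h) (by
        intro w hw hcw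
        have : Pg α (fil w) w := ⟨hcw, by
          rw [← hw] at hc
          obtain ⟨u, hu⟩ := hc
          exact ⟨u, walk_map (arrS α (kev α)) |>.1 hu⟩, E.refl _⟩
        rw [psi_eq H h2 this, hw])
      rw [hN']
      have hN1 : N = ∏ a ∈ α.toFinset, (if Even (α.count a) then 1 else α.count a) := by
        have e : ∏ a ∈ α.toFinset, (α.count a).factorial = (∏ a ∈ α.toFinset, (if Even (α.count a) then 1 else α.count a)) * ∏ a ∈ α.toFinset, (kev α a).factorial := by
          rw [← Finset.prod_mul_distrib]
          apply Finset.prod_congr rfl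
          intro a _
          split_ifs with h
          · rw [one_mul]; congr 1; unfold kev; obtain ⟨k, hk⟩ := h; omega
          · have hb1 : α.count a % 2 = 1 := Nat.odd_iff.1 (Nat.not_even_iff_odd.1 h)
            have e1 : α.count a = kev α a + 1 := by unfold kev; omega
            rw [e1, Nat.factorial_succ]
        rw [e] at hN
        exact Nat.eq_of_mul_eq_mul_right (Finset.prod_pos (fun a _ => Nat.factorial_pos _)) hN
      have : (N : K) = 1 := by
        rw [hN1, Nat.cast_prod]
        apply Finset.prod_eq_one
        intro a _
        split_ifs with h
        · simp
        · obtain ⟨k, hk⟩ := Nat.not_even_iff_odd.1 h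
          rw [hk]; push_cast; rw [h2]; ring
      rw [this, one_mul]
    · rw [if_neg hh]; exact l2 h hc hh
  · intro h _ _
    rw [if_neg (hdet h)]; exact l4 h (hdet h)

end even
end QR

set_option linter.all false

namespace QR
section evena
variable {K : Type} [Field K] {Q : QuiverData} {φ δ : List Q.A → K}

theorem phi_even (H : PD Q K φ δ) (h2 : (2 : K) = 0) (α : Multiset Q.A) (hα : ∀ b, Even (α.count b)) {h : List Q.A} (hn : h ≠ [])
    (hc : Cl Q.src Q.tgt h) (hh : (h : Multiset Q.A) = α) : φ h = 0 := by
  have hL : ∀ l : LT α (kev α), False := by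
    rintro ⟨a, l⟩
    have := l.2
    obtain ⟨k, hk⟩ := hα a.1
    unfold kev at this
    omega
  obtain ⟨base, hbase⟩ := exists_cont (m0S α (kev α))
  have hb1 := cont_m0S (kev_le α) hbase
  obtain ⟨w, hw, hwh⟩ := perm_lift (arrS α (kev α)) h base (Multiset.coe_eq_coe.1 (hh.trans hb1.symm))
  have hwc : cont w = m0S α (kev α) := (cont_perm hw).trans hbase
  obtain ⟨g, hg⟩ := exists_cont (Finsupp.equivFunOnFinite.symm (fun x => m0S α (kev α) x / 2))
  have hg' : ∀ x, cont g x = m0S α (kev α) x / 2 := fun x => by rw [hg]; rfl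
  have hp : w.Perm ([] ++ (g ++ g)) := by
    apply perm_of_cont
    rw [List.nil_append, cont_append, hwc]
    ext x
    rw [Finsupp.add_apply, hg']
    rcases x with a | l
    · rw [m0S_inl]; unfold kev; omega
    · exact (hL l).elim
  have hcl : Cl (sE α) (tE α) w := by
    rw [← hwh] at hc
    obtain ⟨u, hu⟩ := hc
    exact ⟨u, walk_map (arrS α (kev α)) |>.1 hu⟩
  have hg0 : g ≠ [] := by
    rintro rfl
    have : w = [] := List.perm_nil.1 hp
    subst this
    exact hn hwh.symm
  obtain ⟨u, hu⟩ := hc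
  obtain ⟨C, R, v, c1, c2, c3, c4, c5⟩ := insert_double (s := sE α) (t := tE α) g.length w [] g rfl hcl ⟨u, rfl⟩ hg0 (bal_double (hcl.bal.of_perm hp)) (by
    intro x _
    rcases x with a | l
    · rfl
    · exact (hL l).elim) hp
  have hnil : ∀ l : List (LT α (kev α)), l = [] := by
    intro l
    cases l with
    | nil => rfl
    | cons a _ => exact (hL a).elim
  have := WD H h2 hwc ((cont_perm c4).trans hwc) hcl ⟨v, walk_append.2 ⟨v, walk_append.2 ⟨v, c2, c2⟩, c3⟩⟩ (by
    rw [hnil (fil w), hnil (fil (C ++ C ++ R))]; exact E.refl _)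
  rw [hwh, List.map_append, List.map_append] at this
  rw [this]
  exact phi_sq H h2 (by simpa using c1) (walk_map _ |>.2 c2) (walk_map _ |>.2 c3)

theorem PD.drotated (H : PD Q K φ δ) {h h' : List Q.A} (hc : Cl Q.src Q.tgt h) (hr : h ~r h') : δ h = δ h' := by
  obtain ⟨X, Y, rfl, rfl⟩ := rotated_split hr
  obtain ⟨u, hu⟩ := hc
  obtain ⟨v, h1, h2⟩ := walk_append.1 hu
  exact H.drot u v X Y h1 h2

theorem simple_of_delta (H : PD Q K φ δ) {C : List Q.A} (hc : Cl Q.src Q.tgt C) (hd : δ C ≠ 0) : (C.map Q.src).Nodup := by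
  rw [List.nodup_iff_count_le_one]
  intro v
  by_contra hv
  have hv' : 2 ≤ C.countP (fun a => Q.src a = v) := by
    have e : (C.map Q.src).count v = C.countP (fun a => Q.src a = v) := by
      rw [List.count, List.countP_map]; congr!
    omega
  have : ∃ a ∈ C, Q.src a = v := by
    have := List.countP_pos_iff.1 (lt_of_lt_of_le (by norm_num) hv')
    simpa using this
  obtain ⟨a, ha, rfl⟩ := this
  obtain ⟨h', r, hw⟩ := rot_first hc ha
  obtain ⟨n, hn⟩ := Nat.exists_eq_add_of_le' hv'
  have e2 := r.perm.countP_eq (fun x => decide (Q.src x = Q.src a))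
  obtain ⟨A, D, e, hA, hD, wA, wD, _, _⟩ := split_visit hw (e2.symm.trans hn)
  apply hd
  rw [H.drotated hc r, e]
  exact H.dmul _ A D hA hD wA wD

theorem rot_of_simple {C h : List Q.A} (hs : (C.map Q.src).Nodup) (hc : Cl Q.src Q.tgt C) (hh : Cl Q.src Q.tgt h) (hp : h.Perm C) : C ~r h := by
  cases h with
  | nil => rw [List.nil_perm.1 hp]
  | cons a h =>
    have ha : a ∈ C := hp.mem_iff.1 (by simp)
    obtain ⟨h', r, hw⟩ := rot_first hc ha
    obtain ⟨u, hu⟩ := hh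
    have : Q.src a = u := hu.1
    subst this
    have hinj := List.inj_on_of_nodup_map hs
    have hpre := det_pre (S := {x | x ∈ C}) (fun x hx y hy hxy => hinj hx hy hxy) (fun x hx => hp.mem_iff.1 hx) (fun x hx => r.perm.mem_iff.2 hx) hu hw
    have hlen : (a :: h).length = (a :: h').length := (hp.trans r.perm).length_eq
    rcases hpre with ⟨E, e⟩ | ⟨E, e⟩
    · have : E = [] := by
        rw [e, List.length_append] at hlen; exact List.length_eq_zero_iff.1 (by omega)
      rw [this, List.append_nil] at e
      rw [← e]; exact r
    · have : E = [] := by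
        rw [e, List.length_append] at hlen; exact List.length_eq_zero_iff.1 (by omega)
      rw [this, List.append_nil] at e
      rw [e]; exact r

end evena

section cyc
variable {K : Type} [Field K] {Q : QuiverData}

abbrev CT (C : List Q.A) : Type := {a : Q.A // a ∈ C.toFinset}

noncomputable def ones (Λ : Type) [Fintype Λ] : Λ →₀ ℕ := Finsupp.equivFunOnFinite.symm (fun _ => 1)
theorem ones_apply {Λ : Type} [Fintype Λ] (x : Λ) : ones Λ x = 1 := rfl

theorem ones_wσ (Λ : Type) [Fintype Λ] : (ones (Λ × Fin 2)).mapDomain (wσ Λ) = ones (Λ × Fin 2) := by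
  ext x
  obtain ⟨y, rfl⟩ := (wσ Λ).surjective x
  rw [Finsupp.mapDomain_apply (wσ Λ).injective]; rfl

theorem Ed_prod (Λ : Type) (w : List (Λ × Fin 2)) : (w.map (Ed K Λ)).reverse.prod = 
    Matrix.diagonal (fun i => if ∀ x ∈ w, i = x.2 then (1 : K) else 0) := by
  induction w with
  | nil => simp
  | cons x w ih =>
    rw [List.map_cons, List.reverse_cons, List.prod_append, ih, List.prod_singleton, Ed, Matrix.diagonal_mul_diagonal]
    congr 1
    funext i
    by_cases h : i = x.2 <;> simp [h]

theorem cyc_tr (C : List Q.A) (hC : C ≠ []) (h : List Q.A) : 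
    cf (fun x : CT C × Fin 2 => x.1.1) (Ed K (CT C)) (ones _) (Q.pathTr K h) = 0 := by
  obtain ⟨a, ha⟩ := List.exists_mem_of_ne_nil C hC
  rw [cf_pathTr]
  apply wsum_zero
  intro w _
  split_ifs with hc
  · have hm : ∀ x, x ∈ w := by
      intro x
      rw [← mem_of_cont, hc, ones_apply]; simp
    have h0 := hm (⟨a, List.mem_toFinset.2 ha⟩, 0)
    have h1 := hm (⟨a, List.mem_toFinset.2 ha⟩, 1)
    rw [Ed_prod, Matrix.trace_diagonal]
    apply Finset.sum_eq_zero
    intro i _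
    rw [if_neg]
    intro hi
    have := (hi _ h0).symm.trans (hi _ h1)
    simp at this
  · rfl

noncomputable def yv (K : Type) [Field K] (C : List Q.A) (i : Fin 2) (a : Q.A) : MvPolynomial (CT C × Fin 2) K :=
  if h : a ∈ C.toFinset then MvPolynomial.X (⟨a, h⟩, i) else 0

theorem theta_gen (C : List Q.A) (a : Q.A) : 
    (Q.genMat K a).map (theta (fun x : CT C × Fin 2 => x.1.1) (Ed K (CT C))) = Matrix.diagonal (fun i => yv K C i a) := by
  ext i j : 1
  refine Eq.trans (theta_X _ _ a i j) ?_
  rw [Fintype.sum_prod_type]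
  simp only [Fin.sum_univ_two]
  unfold yv
  by_cases h : a ∈ C.toFinset
  · rw [Finset.sum_eq_single (⟨a, h⟩ : CT C)]
    · simp only [if_true, dif_pos h]
      fin_cases i <;> fin_cases j <;> simp [Ed, Matrix.diagonal]
    · intro b _ hb
      have : ¬ b.1 = a := fun e => hb (Subtype.ext e)
      simp [this]
    · simp
  · rw [Finset.sum_eq_zero]
    · simp [h]
    · intro b _
      have : ¬ b.1 = a := fun e => h (e ▸ b.2)
      simp [this]

theorem theta_path (C : List Q.A) (h : List Q.A) : 
    (Q.pathMat K h).map (theta (fun x : CT C × Fin 2 => x.1.1) (Ed K (CT C))) = Matrix.diagonal (fun i => (h.map (yv K C i)).prod) := by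
  induction h with
  | nil => simp [QuiverData.pathMat]
  | cons a h ih =>
    rw [pathMat_cons, Matrix.map_mul, ih, theta_gen, Matrix.diagonal_mul_diagonal]
    congr 1
    funext i
    rw [List.map_cons, List.prod_cons, mul_comm]

theorem prod_yv {C h : List Q.A} (hs : C.Nodup) (hp : h.Perm C) (i : Fin 2) : 
    (h.map (yv K C i)).prod = ∏ l : CT C, MvPolynomial.X (l, i) := by
  rw [(hp.map _).prod_eq, ← List.prod_toFinset _ hs]
  refine (Finset.prod_coe_sort C.toFinset (yv K C i)).symm.trans ?_
  apply Finset.prod_congr rfl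
  intro l _
  unfold yv
  rw [dif_pos l.2]

theorem cyc_det {C h : List Q.A} (hs : C.Nodup) (hp : h.Perm C) : 
    cf (fun x : CT C × Fin 2 => x.1.1) (Ed K (CT C)) (ones _) (Q.pathDet K h) = 1 := by
  unfold cf
  have e : theta (fun x : CT C × Fin 2 => x.1.1) (Ed K (CT C)) (Q.pathDet K h) = MvPolynomial.monomial (ones _) 1 := by
    rw [QuiverData.pathDet, AlgHom.map_det]
    have := theta_path (K := K) C h
    refine Eq.trans (congrArg _ this) ?_
    rw [Matrix.det_diagonal, Fin.prod_univ_two, prod_yv hs hp, prod_yv hs hp, MvPolynomial.monomial_eq, Finsupp.prod_fintype _ _ (by simp), 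
      Fintype.prod_prod_type_right, Fin.prod_univ_two]
    simp [ones_apply]
  rw [e, MvPolynomial.coeff_monomial, if_pos rfl]

theorem cyc_det0 {C h : List Q.A} (hs : C.Nodup) (hp : ¬ h.Perm C) : 
    cf (fun x : CT C × Fin 2 => x.1.1) (Ed K (CT C)) (ones _) (Q.pathDet K h) = 0 := by
  by_contra hne
  apply hp
  rw [List.perm_iff_count]
  intro b
  have := cf_pathDet_deg _ _ _ _ hne b
  rw [Fintype.sum_prod_type] at this
  simp only [Fin.sum_univ_two, ones_apply] at this
  by_cases hb : b ∈ C
  · rw [Finset.sum_eq_single (⟨b, List.mem_toFinset.2 hb⟩ : CT C)] at this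
    · rw [List.count_eq_one_of_mem hs hb]; simp at this; omega
    · intro x _ hx
      have : ¬ x.1 = b := fun e => hx (Subtype.ext e)
      simp [this]
    · simp
  · rw [Finset.sum_eq_zero] at this
    · rw [List.count_eq_zero_of_not_mem hb]; omega
    · intro x _
      have : ¬ x.1 = b := fun e => hb (e ▸ List.mem_toFinset.1 x.2)
      simp [this]

theorem mem_anti {Λ : Type} {m : Λ →₀ ℕ} {x : (Λ →₀ ℕ) × (Λ →₀ ℕ)} : 
    x ∈ Finset.HasAntidiagonal.antidiagonal m ↔ x.1 + x.2 = m := Finset.HasAntidiagonal.mem_antidiagonal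

theorem cyc_kill [Infinite K] (h2 : (2 : K) = 0) {C : List Q.A} (hc : Cl Q.src Q.tgt C) (hs : (C.map Q.src).Nodup) 
    {p q : MvPolynomial Q.Var K} (hp : p ∈ Q.PlusSet K) (hq : q ∈ Q.PlusSet K) :
    cf (fun x : CT C × Fin 2 => x.1.1) (Ed K (CT C)) (ones _) (p * q) = 0 := by
  have hw := fun (p : MvPolynomial Q.Var K) (hp : p ∈ Q.PlusSet K) m => cf_weyl (Subtype.val : CT C → Q.A) hp.1 m
  rw [cf_mul]
  apply Finset.sum_involution (fun x _ => (x.1.mapDomain (wσ (CT C)), x.2.mapDomain (wσ (CT C))))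
  · rintro ⟨m1, m2⟩ _
    dsimp only
    rw [hw p hp, hw q hq]
    linear_combination (cf (fun x : CT C × Fin 2 => x.1.1) (Ed K (CT C)) m1 p * cf (fun x : CT C × Fin 2 => x.1.1) (Ed K (CT C)) m2 q) * h2
  · rintro ⟨m1, m2⟩ hm hne heq
    replace hm := mem_anti.1 hm
    dsimp only at hm hne heq
    rw [Prod.mk.injEq] at heq
    have hf := wσ_fix heq.1
    have hf2 := wσ_fix heq.2
    have hb := cf_balanced _ hp m1 _ (left_ne_zero_of_mul hne)
    have hti : (C.map Q.tgt).Nodup := (List.Perm.nodup_iff hc.bal).1 hs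
    have hsi := List.inj_on_of_nodup_map hs
    have htj := List.inj_on_of_nodup_map hti
    have hsum : ∀ (f : Q.A → Q.V), (∀ ⦃x⦄, x ∈ C → ∀ ⦃y⦄, y ∈ C → f x = f y → x = y) → ∀ b : CT C, 
        (∑ l : CT C × Fin 2, if f l.1.1 = f b.1 then m1 l else 0) = 2 * m1 (b, 0) := by
      intro f hf' b
      rw [Fintype.sum_prod_type, Finset.sum_eq_single b]
      · simp [Fin.sum_univ_two, ← hf]; omega
      · intro x _ hx
        have : ¬ f x.1 = f b.1 := fun e => hx (Subtype.ext (hf' (List.mem_toFinset.1 x.2) (List.mem_toFinset.1 b.2) e))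
        simp [this]
      · simp
    obtain ⟨u, hu⟩ := hc
    have hinv := walk_inv (P := fun v => (∑ l : CT C × Fin 2, if Q.src l.1.1 = v then m1 l else 0) = ∑ l : CT C × Fin 2, if Q.src l.1.1 = u then m1 l else 0) hu rfl (by
      intro b hb' hP
      rw [← hP, hb (Q.tgt b)]
      have e1 := hsum Q.src hsi ⟨b, List.mem_toFinset.2 hb'⟩
      have e2 := hsum Q.tgt htj ⟨b, List.mem_toFinset.2 hb'⟩
      exact e2.trans e1.symm)
    have hval : ∀ b : CT C, 2 * m1 (b, 0) = ∑ l : CT C × Fin 2, if Q.src l.1.1 = u then m1 l else 0 := by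
      intro b
      rw [← hinv b.1 (List.mem_toFinset.1 b.2)]
      exact (hsum Q.src hsi b).symm
    by_cases h0 : (∑ l : CT C × Fin 2, if Q.src l.1.1 = u then m1 l else 0) = 0
    · have : m1 = 0 := by
        ext ⟨b, i⟩
        have h3 := hval b
        rw [h0] at h3
        have h4 := hf b
        fin_cases i
        · show m1 (b, 0) = 0
          omega
        · show m1 (b, 1) = 0
          omega
      apply hne
      rw [this, cf_zero, hp.2, zero_mul]
    · have : m2 = 0 := by
        ext ⟨b, i⟩
        have h3 := hval b
        have h4 := hf2 b
        have h5 : m1 (b, 0) + m2 (b, 0) = 1 := DFunLike.congr_fun hm (b, 0)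
        fin_cases i
        · show m2 (b, 0) = 0
          omega
        · show m2 (b, 1) = 0
          omega
      apply hne
      rw [this, cf_zero, hq.2, mul_zero]
  · rintro ⟨m1, m2⟩ _
    dsimp only
    rw [wσ_invol, wσ_invol]
  · rintro ⟨m1, m2⟩ hm
    replace hm := mem_anti.1 hm
    refine mem_anti.2 ?_
    dsimp only at *
    rw [← Finsupp.mapDomain_add, hm, ones_wσ]

noncomputable def cfL {Λ : Type} [Fintype Λ] (arr : Λ → Q.A) (Y : Λ → Matrix (Fin 2) (Fin 2) K) (m : Λ →₀ ℕ) : MvPolynomial Q.Var K →ₗ[K] K where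
  toFun := cf arr Y m
  map_add' := cf_add arr Y m
  map_smul' := fun c p => by rw [cf_smul]; rfl

theorem main_even [Infinite K] (h2 : (2 : K) = 0) : Main Q K := by
  intro φ δ H α
  by_cases hα : ∃ b, ¬ Even (α.count b)
  · exact odd_alpha H h2 α hα
  push Not at hα
  have hφ : ∀ h : List Q.A, h ≠ [] → Cl Q.src Q.tgt h → (if (h : Multiset Q.A) = α then φ h else 0) = 0 := by
    intro h hn hc
    split_ifs with hh
    · exact phi_even H h2 α hα hn hc hh
    · rfl
  by_cases hδ : ∃ C : List Q.A, C ≠ [] ∧ Cl Q.src Q.tgt C ∧ 2 • (C : Multiset Q.A) = α ∧ δ C ≠ 0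
  swap
  · refine ⟨0, by simp, ?_, ?_⟩
    · intro h hn hc
      rw [hφ h hn hc]; rfl
    · intro h hn hc
      split_ifs with hh
      · by_contra hne
        exact hδ ⟨h, hn, hc, hh, fun e => hne (by rw [e]; rfl)⟩
      · rfl
  obtain ⟨C, hn, hc, hCα, hd⟩ := hδ
  have hs := simple_of_delta H hc hd
  have hnd : C.Nodup := List.Nodup.of_map _ hs
  refine ⟨δ C • cfL (fun x : CT C × Fin 2 => x.1.1) (Ed K (CT C)) (ones _), ?_, ?_, ?_⟩
  · intro p hp q hq
    have := cyc_kill h2 hc hs hp hq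
    show δ C * cf _ _ _ _ = 0
    rw [this, mul_zero]
  · intro h hn' hc'
    rw [hφ h hn' hc']
    have := cyc_tr (K := K) C hn h
    show δ C * cf _ _ _ _ = 0
    rw [this, mul_zero]
  · intro h hn' hc'
    by_cases hp : h.Perm C
    · rw [if_pos (by rw [← hCα, Multiset.coe_eq_coe.2 hp]), ← H.drotated hc (rot_of_simple hs hc hc' hp)]
      have := cyc_det (K := K) hnd hp
      show δ C * cf _ _ _ _ = δ C
      rw [this, mul_one]
    · rw [if_neg]
      · have := cyc_det0 (K := K) hnd hp
        show δ C * cf _ _ _ _ = 0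
        rw [this, mul_zero]
      · intro e
        apply hp
        rw [← hCα] at e
        rw [← Multiset.coe_eq_coe]
        ext b
        have := congrArg (Multiset.count b) e
        rw [Multiset.count_nsmul, Multiset.count_nsmul] at this
        omega

end cyc
end QR

/-- **Lemma (relations between indecomposable invariants).** The ideal of relations
`L(Q)` for `Inv(Q)/((Inv(Q)⁺)²)`, i.e. the kernel of the natural surjection
`A(Q)/((A(Q)⁺)²) → Inv(Q)/((Inv(Q)⁺)²)`, is equal to the `K`-span of the relations
(a)–(f).  Equivalently, for every `q ∈ A(Q)`: the image of `q` in `Inv(Q,(2,…,2))` is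
decomposable iff `q` lies in the span of the relations (a)–(f) together
with `(A(Q)⁺)²`. -/
theorem relations_span
    (K : Type) [Field K] [Infinite K]
    (Q : QuiverData) (hsc : Q.StronglyConnected) :
    ∀ q : Q.AQ K,
      Q.Decomposable K (Q.toInv K q) ↔
        q ∈ Submodule.span K (Q.RelSet K) ⊔ Q.AQplusSq K := by
  intro q
  by_cases h2 : (2 : K) = 0
  · exact QR.reduction (QR.main_even h2) q
  · exact QR.reduction (QR.main_odd h2) q
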